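/- For every real number k ≥ 4 and every ε > 0 there exists a constant C = C(k, ε) such that for all real X ≥ 2, the sum of h_3(-d)^k over squarefree integers d with 0 < d < X is at most C · X^{(2k+3)/6 + ε}. -/

import Mathlib

/-- The imaginary quadratic field `ℚ(√-d)`, realized as the subfield of `ℂ`
generated over `ℚ` by `√d · i`. -/
noncomputable def Kneg (d : ℕ) : IntermediateField ℚ ℂ :=
  IntermediateField.adjoin ℚ {(Real.sqrt d : ℂ) * Complex.I}

/-- `hneg g d` is the `g`-part of the class number of `ℚ(√-d)`: the number of
ideal classes `c` of the ring of integers of `ℚ(√-d)` with `c ^ g = 1`. -/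
noncomputable def hneg (g d : ℕ) : ℕ :=
  Nat.card {c : ClassGroup (NumberField.RingOfIntegers (Kneg d)) // c ^ g = 1}

lemma succ_le_mul_rpow {ε : ℝ} (hε : 0 < ε) {p : ℕ} (hp : 2 ≤ p) (a : ℕ) :
    ((a : ℝ) + 1) ≤ (1 + 1 / (ε * Real.log 2)) * ((p : ℝ) ^ a) ^ ε := by
  have hl : 0 < Real.log 2 := Real.log_pos one_lt_two
  have hel : 0 < ε * Real.log 2 := mul_pos hε hl
  have h1 : (a : ℝ) * (ε * Real.log 2) + 1 ≤ ((p : ℝ) ^ a) ^ ε := by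
    have hp0 : (0 : ℝ) < p := by positivity
    rw [Real.rpow_def_of_pos (by positivity), Real.log_pow]
    refine le_trans (Real.add_one_le_exp _) (Real.exp_le_exp.2 ?_)
    have : Real.log 2 ≤ Real.log p := Real.log_le_log (by norm_num) (by exact_mod_cast hp)
    have : (a : ℝ) * (ε * Real.log 2) ≤ a * (ε * Real.log p) := by gcongr
    linarith
  have h2 : (0 : ℝ) ≤ a * (ε * Real.log 2) := by positivity
  calc (a : ℝ) + 1 ≤ (1 + 1 / (ε * Real.log 2)) * (a * (ε * Real.log 2) + 1) := by
        have : (1 + 1 / (ε * Real.log 2)) * (a * (ε * Real.log 2) + 1)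
          = a * (ε * Real.log 2) + 1 + a + 1 / (ε * Real.log 2) := by field_simp; ring
        rw [this]; have : 0 < 1 / (ε * Real.log 2) := by positivity
        linarith
    _ ≤ _ := by gcongr

/-- The divisor bound. -/
theorem exists_card_divisors_le {ε : ℝ} (hε : 0 < ε) :
    ∃ C : ℝ, 1 ≤ C ∧ ∀ n : ℕ, n ≠ 0 → (n.divisors.card : ℝ) ≤ C * (n : ℝ) ^ ε := by
  set K : ℝ := 1 + 1 / (ε * Real.log 2) with hK
  have hl : 0 < Real.log 2 := Real.log_pos one_lt_two
  have hK1 : 1 ≤ K := by rw [hK]; have : 0 < 1 / (ε * Real.log 2) := by positivity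
                         linarith
  obtain ⟨B, hB⟩ := exists_nat_ge ((2 : ℝ) ^ (1 / ε))
  refine ⟨K ^ B, one_le_pow₀ hK1, fun n hn => ?_⟩
  rw [Nat.card_divisors hn]
  push_cast
  have hlarge : ∀ p a : ℕ, B ≤ p → ((a : ℝ) + 1) ≤ ((p : ℝ) ^ a) ^ ε := by
    intro p a hp
    have h2 : (2 : ℝ) ≤ (p : ℝ) ^ ε := by
      have : ((2 : ℝ) ^ (1 / ε)) ^ ε ≤ (p : ℝ) ^ ε := by
        gcongr; exact hB.trans (by exact_mod_cast hp)
      rwa [← Real.rpow_mul (by norm_num), one_div_mul_cancel hε.ne', Real.rpow_one] at this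
    rw [← Real.rpow_natCast, ← Real.rpow_mul (by positivity), mul_comm, Real.rpow_mul (by positivity),
      Real.rpow_natCast]
    calc ((a : ℝ) + 1) ≤ 2 ^ a := by exact_mod_cast Nat.lt_two_pow_self
      _ ≤ _ := by gcongr
  calc ∏ p ∈ n.primeFactors, ((n.factorization p : ℝ) + 1)
      ≤ ∏ p ∈ n.primeFactors, ((if p < B then K else 1) * ((p : ℝ) ^ n.factorization p) ^ ε) := by
        refine Finset.prod_le_prod (fun _ _ => by positivity) fun p hp => ?_
        split_ifs with h
        · exact succ_le_mul_rpow hε (Nat.prime_of_mem_primeFactors hp).two_le _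
        · rw [one_mul]; exact hlarge p _ (not_lt.1 h)
    _ = (∏ p ∈ n.primeFactors, (if p < B then K else 1)) * (n : ℝ) ^ ε := by
        rw [Finset.prod_mul_distrib]
        congr 1
        rw [Real.finsetProd_rpow _ _ (fun _ _ => by positivity)]
        congr 1
        conv_rhs => rw [← Nat.prod_factorization_pow_eq_self hn]
        rw [Finsupp.prod]; push_cast; rfl
    _ ≤ K ^ B * (n : ℝ) ^ ε := by
        gcongr
        rw [Finset.prod_ite]
        simp only [Finset.prod_const, one_pow, mul_one]
        refine pow_le_pow_right₀ hK1 ?_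
        calc _ ≤ (Finset.range B).card := Finset.card_le_card (by
              intro p hp; simp at hp ⊢; exact hp.2)
          _ = B := by simp

/-- The nontrivial Dirichlet character modulo `3`, as a real-valued function on `ℕ`. -/
noncomputable def chiThree (n : ℕ) : ℝ :=
  if n % 3 = 1 then 1 else if n % 3 = 2 then -1 else 0

lemma chiThree_mul (m n : ℕ) : chiThree (m * n) = chiThree m * chiThree n := by
  unfold chiThree
  have hm : m % 3 < 3 := Nat.mod_lt _ (by norm_num)
  have hn : n % 3 < 3 := Nat.mod_lt _ (by norm_num)
  rw [Nat.mul_mod]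
  interval_cases m % 3 <;> interval_cases n % 3 <;> norm_num

lemma abs_chiThree_le (n : ℕ) : |chiThree n| ≤ 1 := by
  unfold chiThree; split_ifs <;> norm_num

lemma sum_chiThree_mul_bounds (M : ℕ) (f : ℕ → ℝ) (hf0 : ∀ n, M < n → 0 ≤ f n)
    (hf : ∀ n, M < n → f (n + 1) ≤ f n) (N : ℕ) (hN : M < N) :
    (if N % 3 = 1 then 1 else 0) * f N - f (M + 1) ≤ ∑ n ∈ Finset.Ioc M N, chiThree n * f n ∧
    ∑ n ∈ Finset.Ioc M N, chiThree n * f n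
      ≤ (if N % 3 = 1 then 1 else 0) * f N + f (M + 1) - f N := by
  induction N, hN using Nat.le_induction with
  | base =>
    have := hf0 (M + 1) (by omega)
    simp only [Nat.Ioc_succ_singleton, Finset.sum_singleton, chiThree, Nat.succ_eq_add_one]
    split_ifs <;> constructor <;> linarith
  | succ N hN ih =>
    rw [Finset.sum_Ioc_succ_top (by omega)]
    have h1 := hf N hN
    have h2 := hf0 (N + 1) (by omega)
    have h3 := hf0 N hN
    obtain ⟨ih1, ih2⟩ := ih
    have hN3 : N % 3 < 3 := Nat.mod_lt _ (by norm_num)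
    have hN1 : (N + 1) % 3 = (N % 3 + 1) % 3 := by omega
    unfold chiThree at *
    rw [hN1]
    interval_cases hh : N % 3 <;> norm_num at ih1 ih2 ⊢ <;> constructor <;> linarith

lemma abs_sum_chiThree_mul_le (M : ℕ) (f : ℕ → ℝ) (hf0 : ∀ n, M < n → 0 ≤ f n)
    (hf : ∀ n, M < n → f (n + 1) ≤ f n) (N : ℕ) :
    |∑ n ∈ Finset.Ioc M N, chiThree n * f n| ≤ f (M + 1) := by
  rcases le_or_gt N M with h | h
  · rw [Finset.Ioc_eq_empty (by omega)]
    simpa using hf0 (M + 1) (by omega)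
  · obtain ⟨h1, h2⟩ := sum_chiThree_mul_bounds M f hf0 hf N h
    have h3 := hf0 N h
    rw [abs_le]
    split_ifs at h1 h2 <;> constructor <;> linarith

open ArithmeticFunction in
lemma sum_vonMangoldt_div_bounds : ∃ C : ℝ, ∀ N : ℕ, 1 ≤ N →
    |∑ n ∈ Finset.Ioc 0 N, Λ n / n - Real.log N| ≤ C := by
  refine ⟨Real.log 4 + 4 + 1, fun N hN => ?_⟩
  have hN0 : (0 : ℝ) < N := by exact_mod_cast hN
  have hlog : ∑ n ∈ Finset.Ioc 0 N, Λ n * ((N / n : ℕ) : ℝ) = Real.log N.factorial := by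
    rw [← sum_Ioc_mul_zeta_eq_sum, vonMangoldt_mul_zeta]
    clear hN hN0
    induction N with
    | zero => simp
    | succ N ih =>
      rw [Finset.sum_Ioc_succ_top (by omega), ih, Nat.factorial_succ, Nat.cast_mul,
        Real.log_mul (by positivity) (by positivity)]
      simp [add_comm]
  have hup : Real.log N.factorial ≤ N * Real.log N := by
    rw [← Real.log_pow]
    exact Real.log_le_log (by positivity) (by exact_mod_cast Nat.factorial_le_pow N)
  have hlow : N * Real.log N - N ≤ Real.log N.factorial := by
    have h : (N : ℝ) ^ N / N.factorial ≤ Real.exp N :=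
      Real.pow_div_factorial_le_exp _ hN0.le _
    have h2 := Real.log_le_log (by positivity) h
    rw [Real.log_exp, Real.log_div (by positivity) (by positivity), Real.log_pow] at h2
    linarith
  have hpsi : ∑ n ∈ Finset.Ioc 0 N, Λ n ≤ (Real.log 4 + 4) * N := by
    have := Chebyshev.psi_le_const_mul_self hN0.le
    rwa [Chebyshev.psi, Nat.floor_natCast] at this
  have h1 : Real.log N.factorial ≤ N * ∑ n ∈ Finset.Ioc 0 N, Λ n / n := by
    rw [← hlog, Finset.mul_sum]
    refine Finset.sum_le_sum fun n hn => ?_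
    calc Λ n * ((N / n : ℕ) : ℝ) ≤ Λ n * ((N : ℝ) / n) :=
          mul_le_mul_of_nonneg_left Nat.cast_div_le vonMangoldt_nonneg
      _ = _ := by ring
  have h2 : N * ∑ n ∈ Finset.Ioc 0 N, Λ n / n
      ≤ Real.log N.factorial + ∑ n ∈ Finset.Ioc 0 N, Λ n := by
    rw [← hlog, Finset.mul_sum, ← Finset.sum_add_distrib]
    refine Finset.sum_le_sum fun n hn => ?_
    have h : (N : ℝ) / n ≤ ((N / n : ℕ) : ℝ) + 1 := by
      have hn' : 0 < n := (Finset.mem_Ioc.1 hn).1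
      rw [← Nat.floor_div_eq_div (K := ℝ)]
      exact (Nat.lt_floor_add_one _).le
    calc N * (Λ n / n) = Λ n * ((N : ℝ) / n) := by ring
      _ ≤ Λ n * (((N / n : ℕ) : ℝ) + 1) := mul_le_mul_of_nonneg_left h vonMangoldt_nonneg
      _ = _ := by ring
  have e1 : N * (Real.log N - 1) ≤ N * ∑ n ∈ Finset.Ioc 0 N, Λ n / n := by linarith
  have e2 : N * ∑ n ∈ Finset.Ioc 0 N, Λ n / n ≤ N * (Real.log N + (Real.log 4 + 4)) := by linarith
  have f1 := le_of_mul_le_mul_left e1 hN0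
  have f2 := le_of_mul_le_mul_left e2 hN0
  have : 0 ≤ Real.log 4 := Real.log_nonneg (by norm_num)
  rw [abs_le]; constructor <;> linarith

lemma chiThree_sum_tail (M N : ℕ) :
    |∑ n ∈ Finset.Ioc M N, chiThree n / n| ≤ 1 / (M + 1) := by
  have := abs_sum_chiThree_mul_le M (fun n => 1 / (n : ℝ)) (fun n _ => by positivity)
    (fun n hn => by
      have : (0 : ℝ) < n := by exact_mod_cast (by omega : 0 < n)
      push_cast; gcongr; linarith) N
  simpa [div_eq_mul_inv] using this

lemma half_le_sum_chiThree (N : ℕ) (hN : 1 ≤ N) :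
    1 / 2 ≤ ∑ n ∈ Finset.Ioc 0 N, chiThree n / n := by
  have h := chiThree_sum_tail 1 N
  have h2 : ∑ n ∈ Finset.Ioc 0 N, chiThree n / n
      = chiThree 1 + ∑ n ∈ Finset.Ioc 1 N, chiThree n / n := by
    rw [← Finset.sum_Ioc_consecutive _ (Nat.zero_le 1) hN]; simp
  rw [h2]
  have h3 : chiThree 1 = 1 := by simp [chiThree]
  rw [h3]
  have := (abs_le.1 h).1
  norm_num at this; linarith

open ArithmeticFunction in
lemma sum_chiThree_vonMangoldt_bounded : ∃ C : ℝ, ∀ N : ℕ, 1 ≤ N →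
    |∑ n ∈ Finset.Ioc 0 N, chiThree n * Λ n / n| ≤ C := by
  -- the logarithmic sum is bounded
  have hlogsum : ∃ C : ℝ, ∀ N : ℕ, |∑ n ∈ Finset.Ioc 0 N, chiThree n * Real.log n / n| ≤ C := by
    have key := abs_sum_chiThree_mul_le 2 (fun n => Real.log n / n) (fun n _ => by positivity)
      (fun n hn => by
        refine Real.log_div_self_antitoneOn ?_ ?_ (by push_cast; linarith)
        · have : (3 : ℝ) ≤ n := by exact_mod_cast hn
          exact (Real.exp_one_lt_d9.le.trans (by norm_num)).trans this
        · have : (3 : ℝ) ≤ n := by exact_mod_cast hn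
          push_cast
          exact (Real.exp_one_lt_d9.le.trans (by norm_num)).trans (this.trans (by linarith)))
    refine ⟨Real.log 2 + Real.log 3, fun N => ?_⟩
    have hl2 : 0 ≤ Real.log 2 := Real.log_nonneg (by norm_num)
    have hl3 : 0 ≤ Real.log 3 := Real.log_nonneg (by norm_num)
    rcases le_or_gt N 1 with h | h
    · interval_cases N <;> simp <;> positivity
    · rw [← Finset.sum_Ioc_consecutive _ (Nat.zero_le 2) h]
      refine (abs_add_le _ _).trans (add_le_add ?_ ?_)
      · rw [Finset.sum_Ioc_succ_top (by omega), Finset.sum_Ioc_succ_top (by omega)]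
        simp [chiThree, abs_div]
        rw [abs_of_nonneg hl2]; linarith
      · have := key N
        simp only [mul_div_assoc]
        refine this.trans ?_
        push_cast
        rw [div_le_iff₀ (by norm_num)]
        linarith
  obtain ⟨C, hC⟩ := hlogsum
  refine ⟨2 * (C + (Real.log 4 + 4)), fun N hN => ?_⟩
  have hN0 : (0 : ℝ) < N := by exact_mod_cast hN
  let F : ArithmeticFunction ℝ := ⟨fun n => chiThree n * Λ n / n, by simp⟩
  let G : ArithmeticFunction ℝ := ⟨fun n => chiThree n / n, by simp⟩
  have hF : ∀ n, F n = chiThree n * Λ n / n := fun _ => rfl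
  have hG : ∀ n, G n = chiThree n / n := fun _ => rfl
  have hFG : ∀ n : ℕ, (F * G) n = chiThree n * Real.log n / n := by
    intro n
    rw [mul_apply, ← vonMangoldt_sum, Finset.mul_sum, Finset.sum_div,
      Nat.sum_divisorsAntidiagonal (f := fun a b => F a * G b)]
    refine Finset.sum_congr rfl fun d hd => ?_
    have hd0 : d ≠ 0 := (Nat.pos_of_mem_divisors hd).ne'
    obtain ⟨k, rfl⟩ := Nat.dvd_of_mem_divisors hd
    rw [Nat.mul_div_cancel_left _ (Nat.pos_of_ne_zero hd0), hF, hG, chiThree_mul]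
    push_cast
    ring
  have hsum := sum_Ioc_mul_eq_sum_sum F G N
  simp only [hFG] at hsum
  set T := ∑ n ∈ Finset.Ioc 0 N, chiThree n / n with hT
  have hT2 : 1 / 2 ≤ T := half_le_sum_chiThree N hN
  set B := ∑ n ∈ Finset.Ioc 0 N, chiThree n * Λ n / n with hB
  have hpsi : ∑ n ∈ Finset.Ioc 0 N, Λ n ≤ (Real.log 4 + 4) * N := by
    have := Chebyshev.psi_le_const_mul_self hN0.le
    rwa [Chebyshev.psi, Nat.floor_natCast] at this
  have hdiff : |B * T - ∑ n ∈ Finset.Ioc 0 N, chiThree n * Real.log n / n| ≤ Real.log 4 + 4 := by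
    rw [hsum, hB, Finset.sum_mul, ← Finset.sum_sub_distrib]
    refine (Finset.abs_sum_le_sum_abs _ _).trans ?_
    have : ∀ n ∈ Finset.Ioc 0 N, |chiThree n * Λ n / n * T
        - F n * ∑ m ∈ Finset.Ioc 0 (N / n), G m| ≤ Λ n / N := by
      intro n hn
      have hn0 : (0 : ℝ) < n := by exact_mod_cast (Finset.mem_Ioc.1 hn).1
      have ht : T - ∑ m ∈ Finset.Ioc 0 (N / n), G m
          = ∑ m ∈ Finset.Ioc (N / n) N, chiThree m / m := by
        rw [hT, ← Finset.sum_Ioc_consecutive _ (Nat.zero_le (N / n)) (Nat.div_le_self _ _)]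
        simp [hG]
      rw [hF, ← mul_sub, ht, abs_mul, abs_div, abs_mul, abs_of_nonneg vonMangoldt_nonneg,
        abs_of_pos hn0]
      have h1 : ((N / n : ℕ) : ℝ) + 1 ≥ N / n := by
        rw [← Nat.floor_div_eq_div (K := ℝ)]
        exact (Nat.lt_floor_add_one _).le
      calc |chiThree n| * Λ n / n * |∑ m ∈ Finset.Ioc (N / n) N, chiThree m / m|
          ≤ 1 * Λ n / n * (1 / (((N / n : ℕ) : ℝ) + 1)) := by
            have := vonMangoldt_nonneg (n := n)
            gcongr
            · exact abs_chiThree_le n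
            · exact chiThree_sum_tail _ _
        _ ≤ 1 * Λ n / n * (1 / ((N : ℝ) / n)) := by
            have := vonMangoldt_nonneg (n := n)
            gcongr
        _ = Λ n / N := by field_simp
    refine (Finset.sum_le_sum this).trans ?_
    rw [← Finset.sum_div, div_le_iff₀ hN0]
    exact hpsi
  have h2 : |B * T| ≤ C + (Real.log 4 + 4) := by
    have e : B * T = (∑ n ∈ Finset.Ioc 0 N, chiThree n * Real.log n / n)
      + (B * T - ∑ n ∈ Finset.Ioc 0 N, chiThree n * Real.log n / n) := by ring
    rw [e]
    exact (abs_add_le _ _).trans (add_le_add (hC N) hdiff)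
  rw [abs_mul, abs_of_nonneg (by linarith : 0 ≤ T)] at h2
  nlinarith [abs_nonneg B]

open ArithmeticFunction in
lemma sum_vonMangoldt_not_prime_bounded : ∃ C : ℝ, ∀ N : ℕ,
    ∑ n ∈ Finset.Ioc 0 N, (if n.Prime then 0 else Λ n) / n ≤ C := by
  have h := vonMangoldt.summable_residueClass_non_primes_div (q := 1) 0
  have e : ∀ n : ℕ, vonMangoldt.residueClass (0 : ZMod 1) n = Λ n := fun n => by
    simp [vonMangoldt.residueClass, Set.indicator, Subsingleton.elim (n : ZMod 1) 0]
  simp only [e] at h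
  refine ⟨_, fun N => h.sum_le_tsum _ fun n _ => ?_⟩
  split_ifs
  · simp
  · exact div_nonneg vonMangoldt_nonneg (by positivity)

/-- Mertens' first theorem for the primes congruent to `2` modulo `3`. -/
lemma sum_log_div_primes_two_mod_three : ∃ C : ℝ, ∀ N : ℕ, 1 ≤ N →
    |∑ p ∈ (Finset.Ioc 0 N).filter (fun p => p.Prime ∧ p % 3 = 2), Real.log p / p
      - Real.log N / 2| ≤ C := by
  open ArithmeticFunction in
  obtain ⟨C1, h1⟩ := sum_vonMangoldt_div_bounds
  obtain ⟨C2, h2⟩ := sum_chiThree_vonMangoldt_bounded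
  obtain ⟨C3, h3⟩ := sum_vonMangoldt_not_prime_bounded
  refine ⟨C1 + C2 + C3 + Real.log 3, fun N hN => ?_⟩
  specialize h1 N hN; specialize h2 N hN; specialize h3 N
  set A := ∑ n ∈ Finset.Ioc 0 N, Λ n / n
  set B := ∑ n ∈ Finset.Ioc 0 N, chiThree n * Λ n / n
  set R := ∑ n ∈ Finset.Ioc 0 N, (if n.Prime then 0 else Λ n) / n
  set S := ∑ p ∈ (Finset.Ioc 0 N).filter (fun p => p.Prime ∧ p % 3 = 2), Real.log p / p with hS
  have hl3 : 0 ≤ Real.log 3 := Real.log_nonneg (by norm_num)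
  have lo : 2 * S ≤ A - B := by
    rw [hS, Finset.mul_sum, ← Finset.sum_sub_distrib, Finset.sum_filter]
    refine Finset.sum_le_sum fun n hn => ?_
    have hL := vonMangoldt_nonneg (n := n)
    have hchi := (abs_le.1 (abs_chiThree_le n)).2
    split_ifs with h
    · rw [vonMangoldt_apply_prime h.1, chiThree]
      simp only [h.2]; norm_num; ring_nf; rfl
    · have : Λ n / n - chiThree n * Λ n / n = (1 - chiThree n) * Λ n / n := by ring
      rw [this]
      exact div_nonneg (mul_nonneg (by linarith) hL) (by positivity)
  have hi : A - B ≤ 2 * S + 2 * R + Real.log 3 := by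
    have : Real.log 3 ≥ ∑ n ∈ Finset.Ioc 0 N, if n = 3 then Real.log 3 / 3 else 0 := by
      rw [Finset.sum_ite_eq']
      split_ifs
      · linarith
      · exact hl3
    refine le_trans ?_ (add_le_add_right this _)
    rw [hS, Finset.mul_sum, Finset.mul_sum, ← Finset.sum_sub_distrib, Finset.sum_filter,
      ← Finset.sum_add_distrib, ← Finset.sum_add_distrib]
    refine Finset.sum_le_sum fun n hn => ?_
    have hL := vonMangoldt_nonneg (n := n)
    have hchi := (abs_le.1 (abs_chiThree_le n)).1
    have e : Λ n / n - chiThree n * Λ n / n = (1 - chiThree n) * (Λ n / n) := by ring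
    have hLn : 0 ≤ Λ n / n := by positivity
    rw [e]
    by_cases hp : n.Prime
    · rw [if_pos hp]
      by_cases h3 : n = 3
      · subst h3
        rw [vonMangoldt_apply_prime hp]
        simp [chiThree]
      · have hn3 : n % 3 ≠ 0 := fun h =>
          h3 ((Nat.prime_dvd_prime_iff_eq Nat.prime_three hp).1 (Nat.dvd_of_mod_eq_zero h)).symm
        have : n % 3 = 1 ∨ n % 3 = 2 := by omega
        rcases this with h | h
        · simp [chiThree, h, h3]
        · rw [vonMangoldt_apply_prime hp]
          simp [chiThree, h, hp, h3]
          norm_num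
    · simp only [hp, false_and, if_false]
      have h3 : n ≠ 3 := fun h => hp (h ▸ Nat.prime_three)
      rw [if_neg h3]
      have : (1 - chiThree n) * (Λ n / n) ≤ 2 * (Λ n / n) := by gcongr; linarith
      linarith
  have hR : 0 ≤ R := Finset.sum_nonneg fun n _ => by
    have := vonMangoldt_nonneg (n := n)
    split_ifs <;> positivity
  rw [abs_le] at *
  constructor <;> linarith

/-- There are at least `c N / log N` primes `p ≤ N` congruent to `2` modulo `3`. -/
lemma exists_primes_two_mod_three : ∃ c : ℝ, 0 < c ∧ ∃ N₀ : ℕ, ∀ N : ℕ, N₀ ≤ N →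
    c * N / Real.log N ≤ ((Finset.Ioc 0 N).filter (fun p => p.Prime ∧ p % 3 = 2)).card := by
  obtain ⟨C, hC⟩ := sum_log_div_primes_two_mod_three
  obtain ⟨K, hK⟩ := exists_nat_ge (Real.exp (4 * C + 2))
  have hK0 : (0 : ℝ) < K := (Real.exp_pos _).trans_le hK
  have hKn : 0 < K := by exact_mod_cast hK0
  have hlogK : 4 * C + 2 ≤ Real.log K := (Real.le_log_iff_exp_le hK0).2 hK
  refine ⟨1 / K, by positivity, max K 2, fun N hN => ?_⟩
  have hNK : K ≤ N := (le_max_left _ _).trans hN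
  have hN2 : 2 ≤ N := (le_max_right _ _).trans hN
  have hN0 : (0 : ℝ) < N := by positivity
  have hlogN : 0 < Real.log N := Real.log_pos (by exact_mod_cast hN2)
  set N' := N / K with hN'
  have hN'1 : 1 ≤ N' := (Nat.one_le_div_iff hKn).2 hNK
  have hle : N' ≤ N := Nat.div_le_self _ _
  have hd1 := (abs_le.1 (hC N (by omega))).1
  have hd2 := (abs_le.1 (hC N' hN'1)).2
  set p : ℕ → Prop := fun p => p.Prime ∧ p % 3 = 2
  have hsplit : ∑ p ∈ (Finset.Ioc 0 N).filter p, Real.log p / p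
      = ∑ p ∈ (Finset.Ioc 0 N').filter p, Real.log p / p
        + ∑ p ∈ (Finset.Ioc N' N).filter p, Real.log p / p := by
    simp only [Finset.sum_filter]
    rw [Finset.sum_Ioc_consecutive _ (Nat.zero_le _) hle]
  have hlogN' : Real.log N' ≤ Real.log N - Real.log K := by
    rw [← Real.log_div (by positivity) (by positivity)]
    exact Real.log_le_log (by positivity) Nat.cast_div_le
  have h1 : 1 ≤ ∑ p ∈ (Finset.Ioc N' N).filter p, Real.log p / p := by linarith
  have hN'K : (N : ℝ) / K ≤ N' + 1 := by
    rw [hN', ← Nat.floor_div_eq_div (K := ℝ)]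
    exact (Nat.lt_floor_add_one _).le
  have h2 : ∑ p ∈ (Finset.Ioc N' N).filter p, Real.log p / p
      ≤ ((Finset.Ioc N' N).filter p).card * (Real.log N / (N / K)) := by
    rw [← nsmul_eq_mul]
    refine Finset.sum_le_card_nsmul _ _ _ fun n hn => ?_
    have hn' := Finset.mem_Ioc.1 (Finset.mem_filter.1 hn).1
    have hn1 : (N' : ℝ) + 1 ≤ n := by exact_mod_cast hn'.1
    have : 0 < n := by omega
    have hnN : (n : ℝ) ≤ N := by exact_mod_cast hn'.2
    gcongr
    exact hN'K.trans hn1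
  have h3 : ((Finset.Ioc N' N).filter p).card ≤ ((Finset.Ioc 0 N).filter p).card :=
    Finset.card_le_card (Finset.filter_subset_filter _ (Finset.Ioc_subset_Ioc_left (Nat.zero_le _)))
  have h4 : (1 : ℝ) ≤ ((Finset.Ioc 0 N).filter p).card * (Real.log N / (N / K)) :=
    (h1.trans h2).trans (by gcongr)
  rw [div_le_iff₀ hlogN]
  have h5 : ((Finset.Ioc 0 N).filter p).card * (Real.log N / (N / K))
    = ((((Finset.Ioc 0 N).filter p).card : ℝ) * Real.log N) / (N / K) := by ring
  rw [h5, le_div_iff₀ (by positivity)] at h4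
  linarith [h4, (by ring : 1 / (K : ℝ) * N = 1 * (N / K))]

lemma exists_rpow_le_card_primes_two_mod_three {η : ℝ} (hη : 0 < η) : ∃ c : ℝ, 0 < c ∧
    ∀ N : ℕ, 2 ≤ N → c * (N : ℝ) ^ (1 - η)
      ≤ ((Finset.Ioc 0 N).filter (fun p => p.Prime ∧ p % 3 = 2)).card := by
  obtain ⟨c, hc, N₀, h⟩ := exists_primes_two_mod_three
  refine ⟨min (c * η) (1 / ((N₀ : ℝ) + 1)), by positivity, fun N hN => ?_⟩
  have hN0 : (1 : ℝ) < N := by exact_mod_cast hN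
  rcases le_or_gt N₀ N with hle | hlt
  · refine le_trans ?_ (h N hle)
    have hlog : Real.log N ≤ (N : ℝ) ^ η / η := Real.log_le_rpow_div (by positivity) hη
    rw [le_div_iff₀ (Real.log_pos hN0)]
    calc min (c * η) (1 / ((N₀ : ℝ) + 1)) * (N : ℝ) ^ (1 - η) * Real.log N
        ≤ (c * η) * (N : ℝ) ^ (1 - η) * ((N : ℝ) ^ η / η) := by
          have := (Real.log_pos hN0).le
          gcongr; exact min_le_left _ _
      _ = c * ((N : ℝ) ^ (1 - η) * (N : ℝ) ^ η) := by field_simp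
      _ = c * N := by rw [← Real.rpow_add (by positivity)]; simp
  · have h1 : (1 : ℝ) ≤ ((Finset.Ioc 0 N).filter (fun p => p.Prime ∧ p % 3 = 2)).card := by
      exact_mod_cast Finset.card_pos.2 ⟨2, by simp [Nat.prime_two, hN]⟩
    refine le_trans ?_ h1
    have : (N : ℝ) ^ (1 - η) ≤ (N₀ : ℝ) + 1 := by
      calc (N : ℝ) ^ (1 - η) ≤ (N : ℝ) ^ (1 : ℝ) :=
            Real.rpow_le_rpow_of_exponent_le hN0.le (by linarith)
        _ = N := Real.rpow_one _
        _ ≤ (N₀ : ℝ) + 1 := by exact_mod_cast (by omega : N ≤ N₀ + 1)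
    calc _ ≤ 1 / ((N₀ : ℝ) + 1) * ((N₀ : ℝ) + 1) := by
          gcongr; exact min_le_right _ _
      _ = 1 := by field_simp

/-- `κ a³ = u² + δ d v²` has a solution in coprime integers `u`, `v` with `v ≠ 0` of the
size that arises from ideals of norm `a ^ 3`. -/
def CubeSol (κ δ : ℤ) (d a : ℕ) : Prop :=
  ∃ u v : ℤ, v ≠ 0 ∧ IsCoprime u v ∧ κ * a ^ 3 = u ^ 2 + δ * d * v ^ 2 ∧ v ^ 2 * d ≤ 4 * a ^ 3

lemma CubeSol.exists_nat {κ δ : ℤ} {d a : ℕ} (h : CubeSol κ δ d a) :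
    ∃ u v : ℕ, 1 ≤ v ∧ u.Coprime v ∧ κ * a ^ 3 = (u : ℤ) ^ 2 + δ * d * v ^ 2 ∧
      v ^ 2 * d ≤ 4 * a ^ 3 := by
  obtain ⟨u, v, hv, huv, h1, h2⟩ := h
  refine ⟨u.natAbs, v.natAbs, Int.natAbs_pos.2 hv, Int.isCoprime_iff_gcd_eq_one.1 huv, ?_, ?_⟩
  · simpa using h1
  · zify; simpa using h2

/-- Integers with the same square modulo `v²`, coprime to `v` and lying in a short range,
are few. -/
lemma card_le_of_sq_congr {v : ℕ} (hv : 1 ≤ v) (U : Finset ℕ) {H : ℝ} (hH0 : 0 ≤ H)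
    (hcop : ∀ u ∈ U, u.Coprime v)
    (hdvd : ∀ u ∈ U, ∀ w ∈ U, ((v : ℤ) ^ 2) ∣ (u : ℤ) ^ 2 - (w : ℤ) ^ 2)
    (hH : ∀ u ∈ U, ∀ w ∈ U, w ≤ u → (u : ℝ) - w ≤ H) :
    (U.card : ℝ) ≤ ((v ^ 2).divisors.card : ℝ) ^ 2 * (2 * H / v ^ 2 + 1) := by
  rcases U.eq_empty_or_nonempty with rfl | ⟨u₀, hu₀⟩
  · simp; positivity
  have hv0 : (v ^ 2) ≠ 0 := by positivity
  let f : ℕ → ℕ × ℕ := fun u =>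
    (Int.gcd ((u : ℤ) - u₀) ((v : ℤ) ^ 2), Int.gcd ((u : ℤ) + u₀) ((v : ℤ) ^ 2))
  have hmaps : ∀ u ∈ U, f u ∈ (v ^ 2).divisors ×ˢ (v ^ 2).divisors := by
    intro u _
    simp only [f, Finset.mem_product, Nat.mem_divisors]
    refine ⟨⟨?_, hv0⟩, ?_, hv0⟩
    · exact Int.natCast_dvd_natCast.1 (by push_cast; exact Int.gcd_dvd_right _ _)
    · exact Int.natCast_dvd_natCast.1 (by push_cast; exact Int.gcd_dvd_right _ _)
  have hfib : ∀ y ∈ (v ^ 2).divisors ×ˢ (v ^ 2).divisors,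
      ((U.filter (fun u => f u = y)).card : ℝ) ≤ 2 * H / v ^ 2 + 1 := by
    intro y _
    rcases (U.filter (fun u => f u = y)).eq_empty_or_nonempty with he | hne
    · rw [he]; simp; positivity
    obtain ⟨m, hm, hmin⟩ := Finset.exists_min_image _ id hne
    simp only [id, Finset.mem_filter] at hmin hm
    have key : ∀ u ∈ U, f u = y → ((v : ℤ) ^ 2) ∣ 2 * ((u : ℤ) - m) := by
      intro u hu huy
      have hgm : f u = f m := huy.trans hm.2.symm
      set g : ℤ := ((Int.gcd ((u : ℤ) - u₀) ((v : ℤ) ^ 2) : ℕ) : ℤ) with hg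
      set h : ℤ := ((Int.gcd ((u : ℤ) + u₀) ((v : ℤ) ^ 2) : ℕ) : ℤ) with hh
      have hg' : g = ((Int.gcd ((m : ℤ) - u₀) ((v : ℤ) ^ 2) : ℕ) : ℤ) := by
        rw [hg]; exact congrArg (fun x : ℕ × ℕ => (x.1 : ℤ)) hgm
      have hh' : h = ((Int.gcd ((m : ℤ) + u₀) ((v : ℤ) ^ 2) : ℕ) : ℤ) := by
        rw [hh]; exact congrArg (fun x : ℕ × ℕ => (x.2 : ℤ)) hgm
      have d1 : g ∣ (u : ℤ) - m := by
        have a1 : g ∣ (u : ℤ) - u₀ := Int.gcd_dvd_left _ _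
        have a2 : g ∣ (m : ℤ) - u₀ := hg' ▸ Int.gcd_dvd_left _ _
        simpa using dvd_sub a1 a2
      have d2 : h ∣ (u : ℤ) - m := by
        have a1 : h ∣ (u : ℤ) + u₀ := Int.gcd_dvd_left _ _
        have a2 : h ∣ (m : ℤ) + u₀ := hh' ▸ Int.gcd_dvd_left _ _
        simpa using dvd_sub a1 a2
      have d3 : (v : ℤ) ^ 2 ∣ g * h := by
        have : (v : ℤ) ^ 2 ∣ ((u : ℤ) - u₀) * ((u : ℤ) + u₀) := by
          have := hdvd u hu u₀ hu₀
          convert this using 1; ring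
        rw [hg, hh, ← Int.natCast_mul, ← Int.natAbs_dvd_natAbs]
        rw [← Int.natAbs_dvd_natAbs, Int.natAbs_mul] at this
        rw [Int.natAbs_natCast, Int.gcd_comm _ ((v : ℤ) ^ 2), Int.gcd_comm _ ((v : ℤ) ^ 2)]
        exact Nat.dvd_gcd_mul_gcd_iff_dvd_mul.2 this
      have d4 : (Int.gcd g h : ℤ) ∣ 2 := by
        have a1 : (Int.gcd g h : ℤ) ∣ 2 * u₀ := by
          have b1 : (Int.gcd g h : ℤ) ∣ (u : ℤ) - u₀ :=
            (Int.gcd_dvd_left g h).trans (Int.gcd_dvd_left _ _)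
          have b2 : (Int.gcd g h : ℤ) ∣ (u : ℤ) + u₀ :=
            (Int.gcd_dvd_right g h).trans (Int.gcd_dvd_left _ _)
          have := dvd_sub b2 b1
          rwa [show (u : ℤ) + u₀ - (u - u₀) = 2 * u₀ by ring] at this
        have a2 : (Int.gcd g h : ℤ) ∣ (v : ℤ) ^ 2 :=
          (Int.gcd_dvd_left g h).trans (Int.gcd_dvd_right _ _)
        have c : IsCoprime ((v : ℤ) ^ 2) (u₀ : ℤ) :=
          (Nat.isCoprime_iff_coprime.2 (hcop u₀ hu₀)).symm.pow_left
        exact (c.of_isCoprime_of_dvd_left a2).dvd_of_dvd_mul_right a1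
      have d5 : g * h ∣ 2 * ((u : ℤ) - m) := by
        have e : (Int.gcd g h : ℤ) * (Int.lcm g h : ℤ) = g * h := by
          have := Int.gcd_mul_lcm g h
          rw [← Int.natCast_mul, this, Int.natCast_mul, Int.natAbs_of_nonneg (by positivity),
            Int.natAbs_of_nonneg (by positivity)]
        rw [← e]
        exact mul_dvd_mul d4 (Int.coe_lcm_dvd d1 d2)
      exact d3.trans d5
    have hcard : (U.filter (fun u => f u = y)).card ≤ ⌊2 * H / v ^ 2⌋₊ + 1 := by
      rw [← Finset.card_range (⌊2 * H / v ^ 2⌋₊ + 1)]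
      refine Finset.card_le_card_of_injOn (fun u => 2 * (u - m) / v ^ 2) ?_ ?_
      · intro u hu
        simp only [Finset.coe_filter, Set.mem_ofPred_eq] at hu
        have hmu := hmin u hu
        have h1 := hH u hu.1 m hm.1 hmu
        simp only [Finset.coe_range, Set.mem_Iio, Nat.lt_succ_iff]
        refine Nat.le_floor ?_
        refine Nat.cast_div_le.trans ?_
        push_cast [Nat.cast_sub hmu]
        gcongr
      · intro u hu w hw huw
        simp only [Finset.coe_filter, Set.mem_ofPred_eq] at hu hw
        have hmu := hmin u hu
        have hmw := hmin w hw
        have ku := key u hu.1 hu.2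
        have kw := key w hw.1 hw.2
        rw [← Nat.cast_sub hmu] at ku
        rw [← Nat.cast_sub hmw] at kw
        have ku' : v ^ 2 ∣ 2 * (u - m) := by exact_mod_cast ku
        have kw' : v ^ 2 ∣ 2 * (w - m) := by exact_mod_cast kw
        have := (Nat.div_left_inj ku' kw').1 huw
        omega
    calc ((U.filter (fun u => f u = y)).card : ℝ) ≤ (⌊2 * H / v ^ 2⌋₊ : ℝ) + 1 := by
          exact_mod_cast hcard
      _ ≤ _ := by gcongr; exact Nat.floor_le (by positivity)
  rw [Finset.card_eq_sum_card_fiberwise hmaps]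
  push_cast
  refine (Finset.sum_le_card_nsmul _ _ _ hfib).trans (le_of_eq ?_)
  rw [Finset.card_product, nsmul_eq_mul]
  push_cast; ring

/-- The relation counted by `CubeSol`, with the solution made explicit. -/
def CubeRel (κ δ : ℤ) (d v a u : ℕ) : Prop :=
  κ * a ^ 3 = (u : ℤ) ^ 2 + δ * d * v ^ 2 ∧ u.Coprime v

section Count

variable {κ δ : ℤ}

lemma CubeRel.eq_of_eq (hδ : δ ≠ 0) {d d' v a u : ℕ} (hv : 1 ≤ v) (h : CubeRel κ δ d v a u)
    (h' : CubeRel κ δ d' v a u) : d = d' := by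
  have hv0 : (v : ℤ) ≠ 0 := by positivity
  have e : δ * v ^ 2 * ((d : ℤ) - d') = 0 := by linear_combination h'.1 - h.1
  have := (mul_eq_zero.1 e).resolve_left (by positivity)
  omega

open Classical in
lemma card_cubeRel_le (hδ : δ ≠ 0) {Y v a : ℕ} (hv : 1 ≤ v) (U : Finset ℕ) :
    ((((Finset.Ico Y (2 * Y)) ×ˢ U).filter (fun x => CubeRel κ δ x.1 v a x.2)).card : ℝ)
      ≤ ((v ^ 2).divisors.card : ℝ) ^ 2 * (2 * √(|δ| * Y) / v + 1) := by
  set T := ((Finset.Ico Y (2 * Y)) ×ˢ U).filter (fun x => CubeRel κ δ x.1 v a x.2) with hT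
  have hmem : ∀ x ∈ T, x.1 ∈ Finset.Ico Y (2 * Y) ∧ CubeRel κ δ x.1 v a x.2 := by
    intro x hx
    rw [hT, Finset.mem_filter, Finset.mem_product] at hx
    exact ⟨hx.1.1, hx.2⟩
  have hinj : Set.InjOn Prod.snd (T : Set (ℕ × ℕ)) := by
    rintro ⟨d, u⟩ hx ⟨d', u'⟩ hy (rfl : u = u')
    exact Prod.ext ((hmem _ hx).2.eq_of_eq hδ hv (hmem _ hy).2) rfl
  rw [← Finset.card_image_of_injOn hinj]
  have hv0 : (0 : ℝ) < v := by exact_mod_cast hv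
  have := card_le_of_sq_congr hv (T.image Prod.snd) (H := √(|δ| * Y) * v) (by positivity) ?_ ?_ ?_
  · refine this.trans (le_of_eq ?_)
    congr 2
    field_simp
  · intro u hu
    obtain ⟨x, hx, rfl⟩ := Finset.mem_image.1 hu
    exact (hmem x hx).2.2
  · intro u hu w hw
    obtain ⟨x, hx, rfl⟩ := Finset.mem_image.1 hu
    obtain ⟨y, hy, rfl⟩ := Finset.mem_image.1 hw
    refine ⟨δ * (y.1 - x.1), ?_⟩
    linear_combination (hmem y hy).2.1 - (hmem x hx).2.1
  · intro u hu w hw hwu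
    obtain ⟨x, hx, rfl⟩ := Finset.mem_image.1 hu
    obtain ⟨y, hy, rfl⟩ := Finset.mem_image.1 hw
    have hx1 := Finset.mem_Ico.1 (hmem x hx).1
    have hy1 := Finset.mem_Ico.1 (hmem y hy).1
    have e : (x.2 : ℤ) ^ 2 - (y.2 : ℤ) ^ 2 = δ * v ^ 2 * ((y.1 : ℤ) - x.1) := by
      linear_combination (hmem y hy).2.1 - (hmem x hx).2.1
    have e' : (x.2 : ℝ) ^ 2 - (y.2 : ℝ) ^ 2 = δ * v ^ 2 * ((y.1 : ℝ) - x.1) := by exact_mod_cast e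
    have hYd : |(y.1 : ℝ) - x.1| ≤ Y := by
      have a1 : (Y : ℝ) ≤ x.1 := by exact_mod_cast hx1.1
      have a2 : (x.1 : ℝ) ≤ 2 * Y := by exact_mod_cast hx1.2.le
      have a3 : (Y : ℝ) ≤ y.1 := by exact_mod_cast hy1.1
      have a4 : (y.1 : ℝ) ≤ 2 * Y := by exact_mod_cast hy1.2.le
      rw [abs_le]; constructor <;> linarith
    have hwu' : (y.2 : ℝ) ≤ x.2 := by exact_mod_cast hwu
    have hy0 : (0 : ℝ) ≤ y.2 := by positivity
    refine abs_le_of_sq_le_sq' ?_ (by positivity) |>.2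
    calc ((x.2 : ℝ) - y.2) ^ 2 ≤ (x.2 : ℝ) ^ 2 - (y.2 : ℝ) ^ 2 := by nlinarith
      _ ≤ |δ * v ^ 2 * ((y.1 : ℝ) - x.1)| := e' ▸ le_abs_self _
      _ = |(δ : ℝ)| * v ^ 2 * |(y.1 : ℝ) - x.1| := by
          rw [abs_mul, abs_mul, abs_of_nonneg (by positivity : (0 : ℝ) ≤ (v : ℝ) ^ 2)]
      _ ≤ |(δ : ℝ)| * v ^ 2 * Y := by gcongr
      _ = (√(|δ| * Y) * v) ^ 2 := by
          rw [mul_pow, Real.sq_sqrt (by positivity)]; push_cast; ring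

open Classical in
lemma card_offDiag_cubeRel_le (hκ : 0 < κ) (hδ : δ ≠ 0) {t W Q : ℕ} (A D Vs U : Finset ℕ)
    (hA : A ⊆ Finset.Icc 1 Q) (hV : ∀ v ∈ Vs, 1 ≤ v)
    (ht : ∀ n, n ≠ 0 → n ≤ W → n.divisors.card ≤ t) (hD : ∀ d ∈ D, 1 ≤ d)
    (hW1 : κ.natAbs * Q ^ 3 ≤ W) (hW2 : ∀ d ∈ D, ∀ v ∈ Vs, δ.natAbs * d * v ^ 2 ≤ W) :
    (((D ×ˢ Vs) ×ˢ ((A ×ˢ U) ×ˢ (A ×ˢ U))).filter (fun x : (ℕ × ℕ) × ((ℕ × ℕ) × (ℕ × ℕ)) =>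
      CubeRel κ δ x.1.1 x.1.2 x.2.1.1 x.2.1.2 ∧ CubeRel κ δ x.1.1 x.1.2 x.2.2.1 x.2.2.2 ∧
        x.2.1.1 ≠ x.2.2.1)).card ≤ Q ^ 2 * t ^ 2 := by
  set O := ((D ×ˢ Vs) ×ˢ ((A ×ˢ U) ×ˢ (A ×ˢ U))).filter
    (fun x : (ℕ × ℕ) × ((ℕ × ℕ) × (ℕ × ℕ)) =>
      CubeRel κ δ x.1.1 x.1.2 x.2.1.1 x.2.1.2 ∧ CubeRel κ δ x.1.1 x.1.2 x.2.2.1 x.2.2.2 ∧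
        x.2.1.1 ≠ x.2.2.1) with hO
  have hmem : ∀ x ∈ O, (x.1.1 ∈ D ∧ x.1.2 ∈ Vs ∧ x.2.1.1 ∈ A ∧ x.2.2.1 ∈ A) ∧
      CubeRel κ δ x.1.1 x.1.2 x.2.1.1 x.2.1.2 ∧ CubeRel κ δ x.1.1 x.1.2 x.2.2.1 x.2.2.2 ∧
        x.2.1.1 ≠ x.2.2.1 := by
    intro x hx
    rw [hO, Finset.mem_filter] at hx
    simp only [Finset.mem_product] at hx
    exact ⟨⟨hx.1.1.1, hx.1.1.2, hx.1.2.1.1, hx.1.2.2.1⟩, hx.2⟩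
  have step1 : O.card ≤ t * (O.image Prod.snd).card := by
    refine Finset.card_le_mul_card_image _ _ fun y hy => ?_
    obtain ⟨x₀, hx₀, rfl⟩ := Finset.mem_image.1 hy
    obtain ⟨⟨hd, hv, -, -⟩, hr, -⟩ := hmem x₀ hx₀
    have hn : ((κ * x₀.2.1.1 ^ 3 - (x₀.2.1.2 : ℤ) ^ 2).natAbs) = δ.natAbs * x₀.1.1 * x₀.1.2 ^ 2 := by
      rw [hr.1, add_sub_cancel_left]
      simp [Int.natAbs_mul, Int.natAbs_pow]
    refine le_trans ?_ (ht (κ * x₀.2.1.1 ^ 3 - (x₀.2.1.2 : ℤ) ^ 2).natAbs ?_ ?_)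
    · refine Finset.card_le_card_of_injOn (fun x => x.1.2) ?_ ?_
      · intro x hx
        obtain ⟨hx, hxe⟩ := Finset.mem_filter.1 hx
        have h := (hmem x hx).2.1
        rw [hxe] at h
        refine Nat.mem_divisors.2 ⟨?_, ?_⟩
        · rw [← Int.natCast_dvd]
          exact ⟨δ * x.1.1 * x.1.2, by linear_combination h.1⟩
        · rw [hn]
          have := hD _ hd; have := hV _ hv
          positivity
      · intro x hx y hy hxy
        obtain ⟨hx, hxe⟩ := Finset.mem_filter.1 hx
        obtain ⟨hy, hye⟩ := Finset.mem_filter.1 hy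
        have h1 := (hmem x hx).2.1
        have h2 := (hmem y hy).2.1
        have hxy' : x.1.2 = y.1.2 := hxy
        rw [hye.trans hxe.symm, ← hxy'] at h2
        exact Prod.ext (Prod.ext (h1.eq_of_eq hδ (hV _ (hmem x hx).1.2.1) h2) hxy)
          (hxe.trans hye.symm)
    · rw [hn]
      have := hD _ hd; have := hV _ hv
      positivity
    · rw [hn]; exact hW2 _ hd _ hv
  have step2 : (O.image Prod.snd).card
      ≤ t * ((O.image Prod.snd).image (fun y => (y.1.1, y.2.1))).card := by
    refine Finset.card_le_mul_card_image _ _ fun z hz => ?_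
    obtain ⟨y₀, hy₀, rfl⟩ := Finset.mem_image.1 hz
    obtain ⟨x₀, hx₀, rfl⟩ := Finset.mem_image.1 hy₀
    obtain ⟨⟨-, -, ha, hb⟩, -, -, hne⟩ := hmem x₀ hx₀
    have ha' := Finset.mem_Icc.1 (hA ha)
    have hb' := Finset.mem_Icc.1 (hA hb)
    have hcube : (x₀.2.1.1 : ℤ) ^ 3 - (x₀.2.2.1 : ℤ) ^ 3 ≠ 0 := by
      intro h
      have : x₀.2.1.1 ^ 3 = x₀.2.2.1 ^ 3 := by zify; linarith
      exact hne (Nat.pow_left_injective (by norm_num : (3 : ℕ) ≠ 0) this)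
    have hn0 : κ * ((x₀.2.1.1 : ℤ) ^ 3 - (x₀.2.2.1 : ℤ) ^ 3) ≠ 0 := mul_ne_zero hκ.ne' hcube
    have hyr : ∀ y ∈ (O.image Prod.snd).filter (fun y => (y.1.1, y.2.1) = (x₀.2.1.1, x₀.2.2.1)),
        y.1.1 = x₀.2.1.1 ∧ y.2.1 = x₀.2.2.1 ∧ κ * ((x₀.2.1.1 : ℤ) ^ 3 - (x₀.2.2.1 : ℤ) ^ 3)
          = ((y.1.2 : ℤ) - y.2.2) * (y.1.2 + y.2.2) := by
      intro y hy
      obtain ⟨hy, hye⟩ := Finset.mem_filter.1 hy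
      obtain ⟨x, hx, rfl⟩ := Finset.mem_image.1 hy
      obtain ⟨-, h1, h2, -⟩ := hmem x hx
      obtain ⟨e1, e2⟩ := Prod.mk.inj hye
      refine ⟨e1, e2, ?_⟩
      rw [← e1, ← e2]
      linear_combination h1.1 - h2.1
    refine le_trans ?_ (ht (κ * ((x₀.2.1.1 : ℤ) ^ 3 - (x₀.2.2.1 : ℤ) ^ 3)).natAbs
      (Int.natAbs_ne_zero.2 hn0) ?_)
    · refine Finset.card_le_card_of_injOn (fun y => y.1.2 + y.2.2) ?_ ?_
      · intro y hy
        refine Nat.mem_divisors.2 ⟨?_, Int.natAbs_ne_zero.2 hn0⟩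
        rw [← Int.natCast_dvd]
        exact ⟨(y.1.2 : ℤ) - y.2.2, by rw [(hyr y hy).2.2]; push_cast; ring⟩
      · intro y hy z hz hyz
        obtain ⟨y1, y2, y3⟩ := hyr y hy
        obtain ⟨z1, z2, z3⟩ := hyr z hz
        have hs : (y.1.2 : ℤ) + y.2.2 = z.1.2 + z.2.2 := by exact_mod_cast hyz
        have hs0 : (y.1.2 : ℤ) + y.2.2 ≠ 0 := by
          intro h; rw [h, mul_zero] at y3; exact hn0 y3
        have hd : (y.1.2 : ℤ) - y.2.2 = z.1.2 - z.2.2 := by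
          refine mul_right_cancel₀ hs0 ?_
          rw [← y3, hs, ← z3]
        refine Prod.ext (Prod.ext (y1.trans z1.symm) (by omega))
          (Prod.ext (y2.trans z2.symm) (by omega))
    · rw [Int.natAbs_mul]
      refine le_trans (Nat.mul_le_mul_left _ ?_) hW1
      have h1 : x₀.2.1.1 ^ 3 ≤ Q ^ 3 := Nat.pow_le_pow_left ha'.2 3
      have h2 : x₀.2.2.1 ^ 3 ≤ Q ^ 3 := Nat.pow_le_pow_left hb'.2 3
      have : ((x₀.2.1.1 : ℤ) ^ 3 - (x₀.2.2.1 : ℤ) ^ 3)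
        = ((x₀.2.1.1 ^ 3 : ℕ) : ℤ) - ((x₀.2.2.1 ^ 3 : ℕ) : ℤ) := by push_cast; ring
      rw [this]; omega
  have step3 : ((O.image Prod.snd).image (fun y => (y.1.1, y.2.1))).card ≤ Q ^ 2 := by
    calc _ ≤ ((Finset.Icc 1 Q) ×ˢ (Finset.Icc 1 Q)).card := by
          refine Finset.card_le_card fun z hz => ?_
          obtain ⟨y₀, hy₀, rfl⟩ := Finset.mem_image.1 hz
          obtain ⟨x₀, hx₀, rfl⟩ := Finset.mem_image.1 hy₀
          obtain ⟨⟨-, -, ha, hb⟩, -⟩ := hmem x₀ hx₀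
          exact Finset.mem_product.2 ⟨hA ha, hA hb⟩
      _ = Q ^ 2 := by simp [sq]
  calc O.card ≤ t * (t * Q ^ 2) := step1.trans (Nat.mul_le_mul_left _ (step2.trans
        (Nat.mul_le_mul_left _ step3)))
    _ = Q ^ 2 * t ^ 2 := by ring

open Classical in
lemma sum_sq_card_cubeSol_le (hκ : 0 < κ) (hδ : δ ≠ 0) {t Y Q : ℕ} (hY : 1 ≤ Y)
    (ht : ∀ n, n ≠ 0 → n ≤ (κ.natAbs + 8 * δ.natAbs + 4) * Q ^ 3 → n.divisors.card ≤ t) :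
    ∑ d ∈ Finset.Ico Y (2 * Y), (((Finset.Icc 1 Q).filter (CubeSol κ δ d)).card : ℝ) ^ 2
      ≤ (Nat.sqrt (4 * Q ^ 3 / Y)) * (t : ℝ) ^ 2 * (Q ^ 2 + Q * (2 * √(|δ| * Y) *
        (1 + Real.log (Nat.sqrt (4 * Q ^ 3 / Y))) + Nat.sqrt (4 * Q ^ 3 / Y))) := by
  set V := Nat.sqrt (4 * Q ^ 3 / Y) with hVdef
  set A := Finset.Icc 1 Q with hA
  set D := Finset.Ico Y (2 * Y) with hD
  set U := Finset.range ((κ.natAbs + 8 * δ.natAbs) * Q ^ 3 + 1) with hU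
  set R : ℕ → ℕ → Finset (ℕ × ℕ) := fun d v => (A ×ˢ U).filter (fun x => CubeRel κ δ d v x.1 x.2)
    with hR
  have hVY : V ^ 2 * Y ≤ 4 * Q ^ 3 := by
    have := Nat.sqrt_le' (4 * Q ^ 3 / Y)
    exact (Nat.mul_le_mul_right _ this).trans (Nat.div_mul_le_self _ _)
  have hD2 : ∀ d ∈ D, ∀ v ∈ Finset.Icc 1 V, δ.natAbs * d * v ^ 2 ≤ 8 * δ.natAbs * Q ^ 3 := by
    intro d hd v hv
    have h1 := (Finset.mem_Ico.1 hd).2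
    have h2 := (Finset.mem_Icc.1 hv).2
    calc δ.natAbs * d * v ^ 2 ≤ δ.natAbs * (2 * Y) * V ^ 2 := by gcongr
      _ = 2 * δ.natAbs * (V ^ 2 * Y) := by ring
      _ ≤ 2 * δ.natAbs * (4 * Q ^ 3) := by gcongr
      _ = _ := by ring
  -- pointwise bound
  have hpt : ∀ d ∈ D, ((A.filter (CubeSol κ δ d)).card : ℝ) ^ 2
      ≤ V * ∑ v ∈ Finset.Icc 1 V, ((R d v).card : ℝ) ^ 2 := by
    intro d hd
    have h1 : (A.filter (CubeSol κ δ d)).card ≤ ∑ v ∈ Finset.Icc 1 V, (R d v).card := by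
      have hsub : A.filter (CubeSol κ δ d)
          ⊆ (Finset.Icc 1 V).biUnion (fun v => (R d v).image Prod.fst) := by
        intro a ha
        obtain ⟨ha, hs⟩ := Finset.mem_filter.1 ha
        obtain ⟨u, v, hv, huv, e, hb⟩ := hs.exists_nat
        have ha' := Finset.mem_Icc.1 ha
        have hdY := (Finset.mem_Ico.1 hd)
        have haQ : a ^ 3 ≤ Q ^ 3 := Nat.pow_le_pow_left ha'.2 3
        have hvV : v ≤ V := by
          refine Nat.le_sqrt'.2 ((Nat.le_div_iff_mul_le hY).2 ?_)
          calc v ^ 2 * Y ≤ v ^ 2 * d := by gcongr; exact hdY.1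
            _ ≤ 4 * a ^ 3 := hb
            _ ≤ 4 * Q ^ 3 := by omega
        have hvm : v ∈ Finset.Icc 1 V := Finset.mem_Icc.2 ⟨hv, hvV⟩
        refine Finset.mem_biUnion.2 ⟨v, hvm, Finset.mem_image.2 ⟨(a, u), ?_, rfl⟩⟩
        refine Finset.mem_filter.2 ⟨Finset.mem_product.2 ⟨ha, ?_⟩, e, huv⟩
        refine Finset.mem_range.2 (Nat.lt_succ_of_le ?_)
        have h3 := hD2 d hd v hvm
        have e1 : u ^ 2 ≤ κ.natAbs * a ^ 3 + δ.natAbs * d * v ^ 2 := by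
          have : ((u ^ 2 : ℕ) : ℤ) = κ * a ^ 3 - δ * d * v ^ 2 := by push_cast; linarith
          have e2 := congrArg Int.natAbs this
          rw [Int.natAbs_natCast] at e2
          rw [e2]
          refine (Int.natAbs_sub_le _ _).trans (le_of_eq ?_)
          simp [Int.natAbs_mul, Int.natAbs_pow]
        calc u ≤ u ^ 2 := Nat.le_self_pow (by norm_num) u
          _ ≤ κ.natAbs * Q ^ 3 + 8 * δ.natAbs * Q ^ 3 :=
            e1.trans (add_le_add (Nat.mul_le_mul_left _ haQ) h3)
          _ = _ := by ring
      refine (Finset.card_le_card hsub).trans (Finset.card_biUnion_le.trans ?_)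
      exact Finset.sum_le_sum fun v _ => Finset.card_image_le
    calc ((A.filter (CubeSol κ δ d)).card : ℝ) ^ 2
        ≤ (∑ v ∈ Finset.Icc 1 V, ((R d v).card : ℝ)) ^ 2 := by
          gcongr; exact_mod_cast h1
      _ ≤ (Finset.Icc 1 V).card * ∑ v ∈ Finset.Icc 1 V, ((R d v).card : ℝ) ^ 2 :=
          sq_sum_le_card_mul_sum_sq
      _ = _ := by simp
  -- second moment splits into diagonal and off-diagonal terms
  set O := ((D ×ˢ Finset.Icc 1 V) ×ˢ ((A ×ˢ U) ×ˢ (A ×ˢ U))).filter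
    (fun x : (ℕ × ℕ) × ((ℕ × ℕ) × (ℕ × ℕ)) =>
      CubeRel κ δ x.1.1 x.1.2 x.2.1.1 x.2.1.2 ∧ CubeRel κ δ x.1.1 x.1.2 x.2.2.1 x.2.2.2 ∧
        x.2.1.1 ≠ x.2.2.1) with hO
  have hOcard : O.card ≤ Q ^ 2 * t ^ 2 :=
    card_offDiag_cubeRel_le hκ hδ A D (Finset.Icc 1 V) U (Finset.Subset.refl _)
      (fun v hv => (Finset.mem_Icc.1 hv).1) ht
      (fun d hd => hY.trans (Finset.mem_Ico.1 hd).1) (by gcongr; omega)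
      (fun d hd v hv => (hD2 d hd v hv).trans (by gcongr; omega))
  have hOfib : O.card = ∑ y ∈ D ×ˢ Finset.Icc 1 V, (O.filter (fun x => x.1 = y)).card :=
    Finset.card_eq_sum_card_fiberwise fun x hx => (Finset.mem_product.1 (Finset.mem_filter.1 hx).1).1
  have hsq : ∀ d ∈ D, ∀ v ∈ Finset.Icc 1 V,
      (R d v).card ^ 2 ≤ (R d v).card + (O.filter (fun x => x.1 = (d, v))).card := by
    intro d hd v hv
    have hdiag : ∀ x ∈ R d v, ∀ y ∈ R d v, x.1 = y.1 → x = y := by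
      intro x hx y hy hxy
      have h1 := (Finset.mem_filter.1 hx).2.1
      have h2 := (Finset.mem_filter.1 hy).2.1
      rw [hxy] at h1
      have : (x.2 : ℤ) ^ 2 = (y.2 : ℤ) ^ 2 := by linarith
      have : x.2 ^ 2 = y.2 ^ 2 := by exact_mod_cast this
      exact Prod.ext hxy (Nat.pow_left_injective (by norm_num : (2 : ℕ) ≠ 0) this)
    have : (R d v ×ˢ R d v) ⊆ (R d v).diag ∪ (O.filter (fun x => x.1 = (d, v))).image Prod.snd := by
      rintro ⟨x, y⟩ hxy
      obtain ⟨hx, hy⟩ := Finset.mem_product.1 hxy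
      rw [Finset.mem_union]
      by_cases h : x.1 = y.1
      · left
        exact Finset.mem_diag.2 ⟨hx, hdiag x hx y hy h⟩
      · right
        refine Finset.mem_image.2 ⟨((d, v), (x, y)), Finset.mem_filter.2 ⟨?_, rfl⟩, rfl⟩
        obtain ⟨hx1, hx2⟩ := Finset.mem_filter.1 hx
        obtain ⟨hy1, hy2⟩ := Finset.mem_filter.1 hy
        exact Finset.mem_filter.2 ⟨Finset.mem_product.2 ⟨Finset.mem_product.2 ⟨hd, hv⟩,
          Finset.mem_product.2 ⟨hx1, hy1⟩⟩, hx2, hy2, h⟩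
    calc (R d v).card ^ 2 = (R d v ×ˢ R d v).card := by rw [Finset.card_product, sq]
      _ ≤ _ := (Finset.card_le_card this).trans ((Finset.card_union_le _ _).trans
          (add_le_add (by rw [Finset.diag_card]) Finset.card_image_le))
  -- the diagonal
  have hdiag : ∑ v ∈ Finset.Icc 1 V, ∑ d ∈ D, ((R d v).card : ℝ)
      ≤ Q * ((t : ℝ) ^ 2 * (2 * √(|δ| * Y) * (1 + Real.log V) + V)) := by
    have h1 : ∀ v ∈ Finset.Icc 1 V, ∑ d ∈ D, ((R d v).card : ℝ)
        ≤ Q * ((t : ℝ) ^ 2 * (2 * √(|δ| * Y) * (v : ℝ)⁻¹ + 1)) := by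
      intro v hv
      have hv' := Finset.mem_Icc.1 hv
      have e : ∑ d ∈ D, ((R d v).card : ℝ)
          = ∑ a ∈ A, (((D ×ˢ U).filter (fun x => CubeRel κ δ x.1 v a x.2)).card : ℝ) := by
        simp only [hR, Finset.card_filter, Finset.sum_product]
        push_cast
        rw [Finset.sum_comm]
      rw [e]
      have htv : (((v ^ 2).divisors.card : ℕ) : ℝ) ≤ t := by
        have : v ^ 2 ≤ V ^ 2 * Y := by nlinarith [Nat.pow_le_pow_left hv'.2 2]
        exact_mod_cast ht _ (pow_ne_zero _ (by omega)) (by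
          calc v ^ 2 ≤ 4 * Q ^ 3 := this.trans hVY
            _ ≤ _ := by gcongr; omega)
      calc _ ≤ ∑ a ∈ A, ((t : ℝ) ^ 2 * (2 * √(|δ| * Y) * (v : ℝ)⁻¹ + 1)) := by
            refine Finset.sum_le_sum fun a _ => (card_cubeRel_le hδ hv'.1 U).trans ?_
            rw [div_eq_mul_inv]
            gcongr
        _ = _ := by simp [hA]
    refine (Finset.sum_le_sum h1).trans ?_
    rw [← Finset.mul_sum, ← Finset.mul_sum, Finset.sum_add_distrib, ← Finset.mul_sum]
    have hh : ∑ v ∈ Finset.Icc 1 V, (v : ℝ)⁻¹ ≤ 1 + Real.log V := by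
      have := harmonic_le_one_add_log V
      rw [harmonic_eq_sum_Icc] at this
      push_cast at this
      exact this
    have hc : ∑ v ∈ Finset.Icc 1 V, (1 : ℝ) = V := by simp
    rw [hc]
    gcongr
  have hS : ∑ d ∈ D, ∑ v ∈ Finset.Icc 1 V, ((R d v).card : ℝ) ^ 2
      ≤ Q * ((t : ℝ) ^ 2 * (2 * √(|δ| * Y) * (1 + Real.log V) + V)) + Q ^ 2 * t ^ 2 := by
    have h1 : ∑ d ∈ D, ∑ v ∈ Finset.Icc 1 V, ((R d v).card : ℝ) ^ 2
        ≤ ∑ d ∈ D, ∑ v ∈ Finset.Icc 1 V, (((R d v).card : ℝ)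
          + ((O.filter (fun x => x.1 = (d, v))).card : ℝ)) :=
      Finset.sum_le_sum fun d hd => Finset.sum_le_sum fun v hv => by exact_mod_cast hsq d hd v hv
    refine h1.trans ?_
    simp only [Finset.sum_add_distrib]
    refine add_le_add ?_ ?_
    · rw [Finset.sum_comm]; exact hdiag
    · rw [← Finset.sum_product' (f := fun d v => ((O.filter (fun x => x.1 = (d, v))).card : ℝ))]
      have : (O.card : ℝ) ≤ Q ^ 2 * t ^ 2 := by exact_mod_cast hOcard
      refine le_trans (le_of_eq ?_) this
      rw [hOfib]; push_cast; rfl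
  calc _ ≤ ∑ d ∈ D, V * ∑ v ∈ Finset.Icc 1 V, ((R d v).card : ℝ) ^ 2 := Finset.sum_le_sum hpt
    _ = V * ∑ d ∈ D, ∑ v ∈ Finset.Icc 1 V, ((R d v).card : ℝ) ^ 2 := by rw [Finset.mul_sum]
    _ ≤ V * (Q * ((t : ℝ) ^ 2 * (2 * √(|δ| * Y) * (1 + Real.log V) + V)) + Q ^ 2 * t ^ 2) := by
        gcongr
    _ = _ := by ring

end Count

open Classical in
theorem exists_sum_sq_card_cubeSol_le {κ δ : ℤ} (hκ : 0 < κ) (hδ : δ ≠ 0) {ε : ℝ} (hε : 0 < ε) :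
    ∃ C : ℝ, 0 < C ∧ ∀ Y Q : ℕ, 1 ≤ Y → 1 ≤ Q →
      ∑ d ∈ Finset.Ico Y (2 * Y), (((Finset.Icc 1 Q).filter (CubeSol κ δ d)).card : ℝ) ^ 2
        ≤ C * (Q : ℝ) ^ ε * ((√Q ^ 3 / √Y) * (Q ^ 2 + Q * √Y + Q * (√Q ^ 3 / √Y))) := by
  set K : ℕ := κ.natAbs + 8 * δ.natAbs + 4 with hK
  obtain ⟨C, hC, h⟩ := exists_card_divisors_le (ε := ε / 12) (by positivity)
  have hK0 : (0 : ℝ) < K := by rw [hK]; positivity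
  set C1 : ℝ := C * (K : ℝ) ^ (ε / 12) + 1 with hC1
  have hC10 : 0 < C1 := by positivity
  refine ⟨2 * C1 ^ 2 * (1 + 2 * √|δ| * (1 + Real.log 2 + 3 / ε) + 2), ?_, fun Y Q hY hQ => ?_⟩
  · have : 0 < Real.log 2 := Real.log_pos (by norm_num)
    positivity
  set V := Nat.sqrt (4 * Q ^ 3 / Y) with hVdef
  have hQ0 : (1 : ℝ) ≤ Q := by exact_mod_cast hQ
  have hY0 : (1 : ℝ) ≤ Y := by exact_mod_cast hY
  set B : ℝ := √Q ^ 3 / √Y with hB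
  have hsY : 0 < √(Y : ℝ) := by positivity
  have hB0 : 0 < B := by positivity
  have hVB : (V : ℝ) ≤ 2 * B := by
    have h1 : V ^ 2 * Y ≤ 4 * Q ^ 3 :=
      (Nat.mul_le_mul_right _ (Nat.sqrt_le' (4 * Q ^ 3 / Y))).trans (Nat.div_mul_le_self _ _)
    have h2 : (V : ℝ) ^ 2 * Y ≤ 4 * Q ^ 3 := by exact_mod_cast h1
    refine le_of_sq_le_sq ?_ (by positivity)
    have e : (2 * B) ^ 2 = 4 * Q ^ 3 / Y := by
      rw [hB, mul_pow, div_pow, ← pow_mul, mul_comm 3 2, pow_mul, Real.sq_sqrt (by positivity),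
        Real.sq_sqrt (by positivity)]
      ring
    rw [e, le_div_iff₀ (by positivity)]; exact h2
  have hVQ : Real.log V ≤ Real.log 2 + 3 / ε * (Q : ℝ) ^ (ε / 2) := by
    rcases Nat.eq_zero_or_pos V with h0 | h0
    · rw [h0]; simp only [Nat.cast_zero, Real.log_zero]
      have : 0 < Real.log 2 := Real.log_pos (by norm_num)
      positivity
    have hB2 : B ≤ √Q ^ 3 := by
      rw [hB]; exact div_le_self (by positivity) (Real.one_le_sqrt.2 hY0)
    have h3 : (V : ℝ) ≤ 2 * √Q ^ 3 := by linarith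
    have := Real.log_le_log (by positivity) h3
    rw [Real.log_mul (by norm_num) (by positivity), Real.log_pow, Real.log_sqrt (by positivity)] at this
    have hl : Real.log Q ≤ (Q : ℝ) ^ (ε / 2) / (ε / 2) :=
      Real.log_le_rpow_div (by positivity) (by positivity)
    have e : 3 / ε * (Q : ℝ) ^ (ε / 2) = (3 : ℕ) * ((Q : ℝ) ^ (ε / 2) / (ε / 2) / 2) := by
      push_cast; field_simp
    rw [e]
    have : ((3 : ℕ) : ℝ) * (Real.log Q / 2) ≤ (3 : ℕ) * ((Q : ℝ) ^ (ε / 2) / (ε / 2) / 2) := by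
      gcongr
    linarith
  -- the divisor bound
  set t : ℕ := ⌊C1 * (Q : ℝ) ^ (ε / 4)⌋₊ with ht
  have htle : (t : ℝ) ≤ C1 * (Q : ℝ) ^ (ε / 4) := Nat.floor_le (by positivity)
  have hmain := sum_sq_card_cubeSol_le hκ hδ (t := t) (Y := Y) (Q := Q) hY (by
    intro n hn hnK
    refine Nat.le_floor ((h n hn).trans ?_)
    have hn' : (n : ℝ) ≤ K * (Q : ℝ) ^ 3 := by exact_mod_cast hnK
    calc C * (n : ℝ) ^ (ε / 12) ≤ C * (K * (Q : ℝ) ^ 3) ^ (ε / 12) := by gcongr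
      _ = C * (K : ℝ) ^ (ε / 12) * (Q : ℝ) ^ (ε / 4) := by
        rw [Real.mul_rpow (by positivity) (by positivity), ← Real.rpow_natCast (Q : ℝ) 3,
          ← Real.rpow_mul (by positivity)]
        rw [show ((3 : ℕ) : ℝ) * (ε / 12) = ε / 4 by push_cast; ring]
        ring
      _ ≤ C1 * (Q : ℝ) ^ (ε / 4) := by gcongr; linarith)
  refine hmain.trans ?_
  rw [← hVdef]
  have hl2 : 0 < Real.log 2 := Real.log_pos (by norm_num)
  have hQe : (1 : ℝ) ≤ (Q : ℝ) ^ (ε / 2) := Real.one_le_rpow hQ0 (by positivity)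
  have ht2 : (t : ℝ) ^ 2 ≤ C1 ^ 2 * (Q : ℝ) ^ (ε / 2) := by
    calc (t : ℝ) ^ 2 ≤ (C1 * (Q : ℝ) ^ (ε / 4)) ^ 2 := by gcongr
      _ = C1 ^ 2 * (Q : ℝ) ^ (ε / 2) := by
        rw [mul_pow, ← Real.rpow_natCast ((Q : ℝ) ^ (ε / 4)) 2, ← Real.rpow_mul (by positivity)]
        congr 2; push_cast; ring
  have hlogV : 1 + Real.log V ≤ (1 + Real.log 2 + 3 / ε) * (Q : ℝ) ^ (ε / 2) := by
    nlinarith [hVQ, hQe, hl2]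
  have hlogV0 : 0 ≤ 1 + Real.log V := by
    have : 0 ≤ Real.log V := Real.log_natCast_nonneg V
    linarith
  have hsq : √(|δ| * Y : ℝ) = √|(δ : ℝ)| * √Y := by
    push_cast; exact Real.sqrt_mul (abs_nonneg _) _
  set E : ℝ := (Q : ℝ) ^ (ε / 2) with hE
  have hEE : (Q : ℝ) ^ ε = E * E := by
    rw [hE, ← Real.rpow_add (by positivity)]; congr 1; ring
  calc (V : ℝ) * (t : ℝ) ^ 2 * (Q ^ 2 + Q * (2 * √(|δ| * Y) * (1 + Real.log V) + V))
      ≤ (2 * B) * (C1 ^ 2 * E) * (Q ^ 2 * E + Q * (2 * (√|(δ : ℝ)| * √Y)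
          * ((1 + Real.log 2 + 3 / ε) * E) + (2 * B) * E)) := by
        have a1 : (Q : ℝ) ^ 2 ≤ Q ^ 2 * E := le_mul_of_one_le_right (by positivity) hQe
        have a2 : (V : ℝ) ≤ (2 * B) * E := hVB.trans (le_mul_of_one_le_right (by positivity) hQe)
        have a3 : √(|δ| * Y : ℝ) * (1 + Real.log V)
            ≤ √|(δ : ℝ)| * √Y * ((1 + Real.log 2 + 3 / ε) * E) := by
          rw [hsq]; gcongr
        push_cast at a3 ⊢
        have a4 : (Q : ℝ) * (2 * √(|(δ : ℝ)| * Y) * (1 + Real.log V) + V)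
            ≤ Q * (2 * (√|(δ : ℝ)| * √Y) * ((1 + Real.log 2 + 3 / ε) * E) + (2 * B) * E) := by
          gcongr (Q : ℝ) * ?_
          linarith
        have a5 : 0 ≤ (Q : ℝ) * (2 * √(|(δ : ℝ)| * Y) * (1 + Real.log V) + V) := by positivity
        gcongr
    _ = 2 * C1 ^ 2 * (E * E) * (B * (1 * Q ^ 2 + (2 * √|(δ : ℝ)| * (1 + Real.log 2 + 3 / ε)) * (Q * √Y)
          + 2 * (Q * B))) := by ring
    _ ≤ 2 * C1 ^ 2 * (E * E) * (B * ((1 + 2 * √|(δ : ℝ)| * (1 + Real.log 2 + 3 / ε) + 2) *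
          (Q ^ 2 + Q * √Y + Q * B))) := by
        have b1 : 0 ≤ (Q : ℝ) ^ 2 := by positivity
        have b2 : 0 ≤ (Q : ℝ) * √Y := by positivity
        have b3 : 0 ≤ (Q : ℝ) * B := by positivity
        have b4 : 0 ≤ 2 * √|(δ : ℝ)| * (1 + Real.log 2 + 3 / ε) := by positivity
        gcongr
        nlinarith [mul_nonneg b4 b1, mul_nonneg b4 b3]
    _ = _ := by rw [hEE]; ring

open Classical in
lemma card_cubeSol_eq_zero {κ δ : ℤ} {d Q Y : ℕ} (hd : Y ≤ d) (h : 4 * Q ^ 3 < Y) :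
    ((Finset.Icc 1 Q).filter (CubeSol κ δ d)).card = 0 := by
  rw [Finset.card_eq_zero, Finset.filter_eq_empty_iff]
  intro a ha hs
  obtain ⟨u, v, hv, -, -, hb⟩ := hs.exists_nat
  have haQ : a ^ 3 ≤ Q ^ 3 := Nat.pow_le_pow_left (Finset.mem_Icc.1 ha).2 3
  have : 1 * Y ≤ v ^ 2 * d := Nat.mul_le_mul (Nat.one_le_pow _ _ hv) hd
  omega

open Classical in
/-- The number of `a ≤ Q` for which one of the three relevant equations is soluble. -/
noncomputable def solCount (d Q : ℕ) : ℝ :=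
  ((Finset.Icc 1 Q).filter (CubeSol 1 1 d)).card + ((Finset.Icc 1 Q).filter (CubeSol 4 1 d)).card
    + ((Finset.Icc 1 Q).filter (CubeSol 1 (-8748) d)).card

lemma solCount_nonneg (d Q : ℕ) : 0 ≤ solCount d Q := by unfold solCount; positivity

lemma solCount_eq_zero {d Q Y : ℕ} (hd : Y ≤ d) (h : 4 * Q ^ 3 < Y) : solCount d Q = 0 := by
  unfold solCount
  rw [card_cubeSol_eq_zero hd h, card_cubeSol_eq_zero hd h, card_cubeSol_eq_zero hd h]; simp

lemma exists_sum_sq_solCount_le {ε : ℝ} (hε : 0 < ε) :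
    ∃ C : ℝ, 0 < C ∧ ∀ Y Q : ℕ, 1 ≤ Y → 1 ≤ Q →
      ∑ d ∈ Finset.Ico Y (2 * Y), solCount d Q ^ 2
        ≤ C * (Q : ℝ) ^ ε * ((√Q ^ 3 / √Y) * (Q ^ 2 + Q * √Y + Q * (√Q ^ 3 / √Y))) := by
  obtain ⟨C1, h1, H1⟩ := exists_sum_sq_card_cubeSol_le (κ := 1) (δ := 1) (by norm_num) (by norm_num) hε
  obtain ⟨C2, h2, H2⟩ := exists_sum_sq_card_cubeSol_le (κ := 4) (δ := 1) (by norm_num) (by norm_num) hε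
  obtain ⟨C3, h3, H3⟩ := exists_sum_sq_card_cubeSol_le (κ := 1) (δ := -8748) (by norm_num) (by norm_num) hε
  refine ⟨3 * (C1 + C2 + C3), by positivity, fun Y Q hY hQ => ?_⟩
  have e : ∀ a b c : ℝ, (a + b + c) ^ 2 ≤ 3 * (a ^ 2 + b ^ 2 + c ^ 2) := fun a b c => by
    nlinarith [sq_nonneg (a - b), sq_nonneg (b - c), sq_nonneg (a - c)]
  refine (Finset.sum_le_sum fun d _ => e _ _ _).trans ?_
  rw [← Finset.mul_sum, Finset.sum_add_distrib, Finset.sum_add_distrib]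
  have := H1 Y Q hY hQ; have := H2 Y Q hY hQ; have := H3 Y Q hY hQ
  linarith

section Levels

variable {k : ℝ}

lemma level_exponent_le (hk : 4 ≤ k) {x : ℝ} (hx : 1 / 6 ≤ x) (hx' : x ≤ 1 / 3) :
    k * (1 / 2 - x) + (5 * x - 1 / 2) ≤ (2 * k + 3) / 6 ∧
    k * (1 / 2 - x) + 3 * x ≤ (2 * k + 3) / 6 ∧
    k * (1 / 2 - x) + (6 * x - 1) ≤ (2 * k + 3) / 6 := by
  refine ⟨?_, ?_, ?_⟩ <;> nlinarith

/-- Level sets: few `d` have many small solutions. -/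
lemma exists_card_level_le {ε : ℝ} (hε : 0 < ε) : ∃ C : ℝ, 0 < C ∧ ∀ Y p : ℕ, ∀ x : ℝ, 1 ≤ Y →
    1 ≤ p → 1 / 6 ≤ x → x ≤ 1 / 3 → (Y : ℝ) ^ x / 4 ≤ p → (p : ℝ) ≤ (Y : ℝ) ^ x →
    (((Finset.Ico Y (2 * Y)).filter (fun d => (p : ℝ) < solCount d (p ^ 2))).card : ℝ)
      ≤ C * (Y : ℝ) ^ ε * ((Y : ℝ) ^ (5 * x - 1 / 2) + (Y : ℝ) ^ (3 * x) + (Y : ℝ) ^ (6 * x - 1)) := by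
  obtain ⟨C, hC, H⟩ := exists_sum_sq_solCount_le hε
  refine ⟨C, hC, fun Y p x hY hp hx hx' hp1 hp2 => ?_⟩
  have hY1 : (1 : ℝ) ≤ Y := by exact_mod_cast hY
  have hY0 : (0 : ℝ) < Y := by positivity
  have hp0 : (0 : ℝ) < p := by exact_mod_cast hp
  set S := (Finset.Ico Y (2 * Y)).filter (fun d => (p : ℝ) < solCount d (p ^ 2)) with hS
  have h1 : (S.card : ℝ) * (p : ℝ) ^ 2 ≤ ∑ d ∈ Finset.Ico Y (2 * Y), solCount d (p ^ 2) ^ 2 := by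
    calc (S.card : ℝ) * (p : ℝ) ^ 2 = ∑ d ∈ S, (p : ℝ) ^ 2 := by simp
      _ ≤ ∑ d ∈ S, solCount d (p ^ 2) ^ 2 := by
          refine Finset.sum_le_sum fun d hd => ?_
          have := (Finset.mem_filter.1 hd).2
          gcongr
      _ ≤ _ := Finset.sum_le_sum_of_subset_of_nonneg (Finset.filter_subset _ _)
          fun _ _ _ => by positivity
  have h2 := h1.trans (H Y (p ^ 2) hY (Nat.one_le_pow _ _ hp))
  push_cast at h2
  rw [Real.sqrt_sq hp0.le] at h2
  have hpe : ((p : ℝ) ^ 2) ^ ε ≤ (Y : ℝ) ^ ε := by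
    have : (p : ℝ) ^ 2 ≤ Y := by
      calc (p : ℝ) ^ 2 ≤ ((Y : ℝ) ^ x) ^ 2 := by gcongr
        _ = (Y : ℝ) ^ (x * 2) := by rw [← Real.rpow_natCast, ← Real.rpow_mul hY0.le]; norm_num
        _ ≤ (Y : ℝ) ^ (1 : ℝ) := Real.rpow_le_rpow_of_exponent_le hY1 (by linarith)
        _ = Y := Real.rpow_one _
    gcongr
  have hsY : √(Y : ℝ) = (Y : ℝ) ^ (1 / 2 : ℝ) := Real.sqrt_eq_rpow _
  have h3 : (S.card : ℝ) ≤ C * (Y : ℝ) ^ ε * ((p : ℝ) ^ 5 / √Y + (p : ℝ) ^ 3 + (p : ℝ) ^ 6 / Y) := by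
    refine le_of_mul_le_mul_right (h2.trans ?_) (by positivity : (0 : ℝ) < (p : ℝ) ^ 2)
    have hs0 : 0 < √(Y : ℝ) := by positivity
    have e : (p : ℝ) ^ 3 / √Y * (((p : ℝ) ^ 2) ^ 2 + (p : ℝ) ^ 2 * √Y + (p : ℝ) ^ 2 * ((p : ℝ) ^ 3 / √Y))
        = ((p : ℝ) ^ 5 / √Y + (p : ℝ) ^ 3 + (p : ℝ) ^ 6 / Y) * (p : ℝ) ^ 2 := by
      have : (Y : ℝ) = √Y * √Y := (Real.mul_self_sqrt hY0.le).symm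
      conv_rhs => rw [this]
      rw [Real.sqrt_mul_self hs0.le]
      field_simp
    rw [e]
    calc _ ≤ C * (Y : ℝ) ^ ε * (((p : ℝ) ^ 5 / √Y + (p : ℝ) ^ 3 + (p : ℝ) ^ 6 / Y) * (p : ℝ) ^ 2) := by
          gcongr
      _ = _ := by ring
  refine h3.trans ?_
  have hpow : ∀ n : ℕ, (p : ℝ) ^ n ≤ (Y : ℝ) ^ (n * x) := by
    intro n
    calc (p : ℝ) ^ n ≤ ((Y : ℝ) ^ x) ^ n := by gcongr
      _ = _ := by rw [← Real.rpow_natCast, ← Real.rpow_mul hY0.le, mul_comm]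
  have h5 := hpow 5; have h3' := hpow 3; have h6 := hpow 6
  push_cast at h5 h3' h6
  have hY1' : (Y : ℝ) = (Y : ℝ) ^ (1 : ℝ) := (Real.rpow_one _).symm
  gcongr ?_ * (?_ + ?_ + ?_)
  · rw [Real.rpow_sub hY0, hsY]; gcongr
  · rw [Real.rpow_sub hY0, Real.rpow_one]; gcongr

end Levels

section Moments

variable {k : ℝ}

/-- The `j`-th of the exponents interpolating between `1/6` and `1/3`. -/
noncomputable def levelExp (J j : ℕ) : ℝ := 1 / 6 + j / (6 * J)

lemma levelExp_mem {J j : ℕ} (hJ : 0 < J) (hj : j ≤ J) :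
    1 / 6 ≤ levelExp J j ∧ levelExp J j ≤ 1 / 3 := by
  have h0 : (0 : ℝ) < J := by exact_mod_cast hJ
  have h1 : (j : ℝ) ≤ J := by exact_mod_cast hj
  have h2 : (j : ℝ) / (6 * J) ≤ 1 / 6 := by rw [div_le_div_iff₀ (by positivity) (by norm_num)]; linarith
  have h3 : 0 ≤ (j : ℝ) / (6 * J) := by positivity
  unfold levelExp
  constructor <;> linarith

/-- The length attached to an exponent. -/
noncomputable def levelLen (Y : ℕ) (x : ℝ) : ℕ := ⌊(Y : ℝ) ^ x / 2⌋₊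

lemma levelLen_bounds {Y : ℕ} (hY : 4096 ≤ Y) {x : ℝ} (hx : 1 / 6 ≤ x) (hx' : x ≤ 1 / 3) :
    2 ≤ levelLen Y x ∧ levelLen Y x ≤ Y ∧ (Y : ℝ) ^ x / 4 ≤ levelLen Y x ∧
      (levelLen Y x : ℝ) ≤ (Y : ℝ) ^ x / 2 := by
  have hY' : (4096 : ℝ) ≤ Y := by exact_mod_cast hY
  have h4 : (4 : ℝ) ≤ (Y : ℝ) ^ x := by
    calc (4 : ℝ) = (4096 : ℝ) ^ (1 / 6 : ℝ) := by
          rw [show (4096 : ℝ) = 4 ^ (6 : ℝ) by norm_num, ← Real.rpow_mul (by norm_num)]; norm_num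
      _ ≤ (Y : ℝ) ^ (1 / 6 : ℝ) := by gcongr
      _ ≤ _ := Real.rpow_le_rpow_of_exponent_le (by linarith) hx
  have hle : (levelLen Y x : ℝ) ≤ (Y : ℝ) ^ x / 2 := Nat.floor_le (by positivity)
  have hYx : (Y : ℝ) ^ x ≤ Y := by
    calc (Y : ℝ) ^ x ≤ (Y : ℝ) ^ (1 : ℝ) := Real.rpow_le_rpow_of_exponent_le (by linarith) (by linarith)
      _ = Y := Real.rpow_one _
  refine ⟨Nat.le_floor (by push_cast; linarith), ?_, ?_, hle⟩
  · exact_mod_cast (show (levelLen Y x : ℝ) ≤ Y by linarith)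
  · have := Nat.lt_floor_add_one ((Y : ℝ) ^ x / 2)
    change (Y : ℝ) ^ x / 2 < (levelLen Y x : ℝ) + 1 at this
    linarith

lemma solCount_level_zero {Y d : ℕ} (hY : 4096 ≤ Y) (hd : Y ≤ d) :
    solCount d (levelLen Y (1 / 6) ^ 2) = 0 := by
  refine solCount_eq_zero hd ?_
  obtain ⟨-, -, -, h⟩ := levelLen_bounds hY (le_refl (1 / 6 : ℝ)) (by norm_num)
  have hY' : (4096 : ℝ) ≤ Y := by exact_mod_cast hY
  have : (4 * (levelLen Y (1 / 6) ^ 2) ^ 3 : ℝ) < Y := by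
    calc (4 * ((levelLen Y (1 / 6) : ℝ) ^ 2) ^ 3 : ℝ) ≤ 4 * (((Y : ℝ) ^ (1 / 6 : ℝ) / 2) ^ 2) ^ 3 := by
          gcongr
      _ = Y / 16 := by
          have : ((Y : ℝ) ^ (1 / 6 : ℝ)) ^ 6 = Y := by
            rw [← Real.rpow_natCast, ← Real.rpow_mul (by positivity)]; norm_num
          ring_nf; ring_nf at this; rw [this]
      _ < Y := by linarith
  exact_mod_cast this

open Classical in
/-- The moment over a dyadic block, from the pointwise bound in terms of `solCount`. -/
lemma exists_sum_block_le {h : ℕ → ℝ} (h0 : ∀ d, 0 ≤ h d)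
    (hA : ∀ ε : ℝ, 0 < ε → ∃ C : ℝ, 0 < C ∧ ∀ d P : ℕ, Squarefree d → 3 < d → 2 ≤ P → P ≤ d →
      h d * P ^ 2 ≤ C * (d : ℝ) ^ (1 / 2 + ε) * (P + solCount d (P ^ 2)))
    (hk : 4 ≤ k) {ε : ℝ} (hε : 0 < ε) : ∃ C : ℝ, 0 < C ∧ ∀ Y : ℕ, 4096 ≤ Y →
      ∑ d ∈ (Finset.Ico Y (2 * Y)).filter Squarefree, h d ^ k ≤ C * (Y : ℝ) ^ ((2 * k + 3) / 6 + ε) := by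
  have hk0 : 0 < k := by linarith
  set ε₁ : ℝ := min (1 / 2) (ε / (3 * k)) with hε₁
  have hε₁0 : 0 < ε₁ := by positivity
  have hε₁h : ε₁ ≤ 1 / 2 := min_le_left _ _
  have hε₁k : k * ε₁ ≤ ε / 3 := by
    calc k * ε₁ ≤ k * (ε / (3 * k)) := by gcongr; exact min_le_right _ _
      _ = ε / 3 := by field_simp
  obtain ⟨J, hJ⟩ := exists_nat_gt (k / (2 * ε))
  have hJ0' : (0 : ℝ) < J := lt_trans (by positivity) hJ
  have hJ0 : 0 < J := by exact_mod_cast hJ0'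
  have hJk : k * (1 / (6 * J)) ≤ ε / 3 := by
    rw [div_lt_iff₀ (by positivity)] at hJ
    rw [mul_one_div, div_le_div_iff₀ (by positivity) (by norm_num)]; linarith
  obtain ⟨C, hC, HA⟩ := hA ε₁ hε₁0
  obtain ⟨C2, hC2, HL⟩ := exists_card_level_le (ε := ε / 3) (by positivity)
  refine ⟨(16 * C) ^ k * (1 + J * (3 * C2)), by positivity, fun Y hY => ?_⟩
  have hY4 : (4096 : ℝ) ≤ Y := by exact_mod_cast hY
  have hY0 : (0 : ℝ) < Y := by linarith
  have hY1 : (1 : ℝ) ≤ Y := by linarith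
  set lev : ℕ → ℕ := fun j => levelLen Y (levelExp J j) with hlev
  set bad : ℕ → Finset ℕ :=
    fun j => (Finset.Ico Y (2 * Y)).filter (fun d => (lev j : ℝ) < solCount d (lev j ^ 2)) with hbad
  set W : ℕ → ℝ := fun j => (16 * C) ^ k * (Y : ℝ) ^ (k * (1 / 2 + ε₁ - levelExp J (j - 1))) with hW
  -- good levels
  have hgood : ∀ d ∈ (Finset.Ico Y (2 * Y)).filter Squarefree, ∀ j ≤ J, d ∉ bad j →
      h d ^ k ≤ (16 * C) ^ k * (Y : ℝ) ^ (k * (1 / 2 + ε₁ - levelExp J j)) := by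
    intro d hd j hj hdj
    obtain ⟨hd1, hdsq⟩ := Finset.mem_filter.1 hd
    have hd2 := Finset.mem_Ico.1 hd1
    obtain ⟨hx, hx'⟩ := levelExp_mem hJ0 hj
    obtain ⟨b1, b2, b3, b4⟩ := levelLen_bounds hY hx hx'
    have hs : solCount d (lev j ^ 2) ≤ lev j := by
      by_contra hcon
      exact hdj (Finset.mem_filter.2 ⟨hd1, not_le.1 hcon⟩)
    have hm := HA d (lev j) hdsq (by omega) b1 (b2.trans hd2.1)
    have hp0 : (0 : ℝ) < lev j := by
      have : 0 < lev j := by change 2 ≤ lev j at b1; omega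
      exact_mod_cast this
    have hd2Y : (d : ℝ) ≤ 2 * Y := by exact_mod_cast hd2.2.le
    have hdpow : (d : ℝ) ^ (1 / 2 + ε₁) ≤ 2 * (Y : ℝ) ^ (1 / 2 + ε₁) := by
      calc (d : ℝ) ^ (1 / 2 + ε₁) ≤ (2 * Y : ℝ) ^ (1 / 2 + ε₁) := by gcongr
        _ = 2 ^ (1 / 2 + ε₁) * (Y : ℝ) ^ (1 / 2 + ε₁) := Real.mul_rpow (by norm_num) hY0.le
        _ ≤ 2 ^ (1 : ℝ) * (Y : ℝ) ^ (1 / 2 + ε₁) := by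
            gcongr
            · norm_num
            · linarith
        _ = _ := by rw [Real.rpow_one]
    have h1 : h d * (lev j : ℝ) ≤ 4 * C * (Y : ℝ) ^ (1 / 2 + ε₁) := by
      refine le_of_mul_le_mul_right ?_ hp0
      calc h d * (lev j : ℝ) * lev j = h d * (lev j : ℝ) ^ 2 := by ring
        _ ≤ _ := hm
        _ ≤ C * (2 * (Y : ℝ) ^ (1 / 2 + ε₁)) * (lev j + lev j) := by
            have := solCount_nonneg d (lev j ^ 2)
            gcongr
        _ = _ := by ring
    have h2 : h d ≤ 16 * C * (Y : ℝ) ^ (1 / 2 + ε₁ - levelExp J j) := by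
      have hyx : (0 : ℝ) < (Y : ℝ) ^ levelExp J j := by positivity
      rw [Real.rpow_sub hY0, mul_div_assoc', le_div_iff₀ hyx]
      have : h d * ((Y : ℝ) ^ levelExp J j / 4) ≤ h d * (lev j : ℝ) :=
        mul_le_mul_of_nonneg_left b3 (h0 d)
      linarith
    calc h d ^ k ≤ (16 * C * (Y : ℝ) ^ (1 / 2 + ε₁ - levelExp J j)) ^ k :=
          Real.rpow_le_rpow (h0 d) h2 hk0.le
      _ = _ := by
          rw [Real.mul_rpow (by positivity) (by positivity), ← Real.rpow_mul hY0.le, mul_comm k]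
  -- pointwise bound
  have hpt : ∀ d ∈ (Finset.Ico Y (2 * Y)).filter Squarefree,
      h d ^ k ≤ (16 * C) ^ k * (Y : ℝ) ^ (k * (1 / 6 + ε₁))
        + ∑ j ∈ Finset.Icc 1 J, if d ∈ bad j then W j else 0 := by
    intro d hd
    have hd1 := Finset.mem_Ico.1 (Finset.mem_filter.1 hd).1
    have hnn : ∀ j ∈ Finset.Icc 1 J, 0 ≤ (if d ∈ bad j then W j else 0) := fun j _ => by
      split_ifs
      · positivity
      · exact le_rfl
    by_cases hex : ∃ j, j ≤ J ∧ d ∈ bad j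
    · set j := Nat.find hex
      obtain ⟨hjJ, hjb⟩ := Nat.find_spec hex
      have hj0 : j ≠ 0 := by
        intro hj
        have hjb' : d ∈ bad j := hjb
        rw [hj] at hjb'
        have := (Finset.mem_filter.1 hjb').2
        have e : lev 0 = levelLen Y (1 / 6) := by simp [hlev, levelExp]
        rw [e, solCount_level_zero hY hd1.1] at this
        exact absurd this (not_lt.2 (Nat.cast_nonneg _))
      have hprev : d ∉ bad (j - 1) := fun hc =>
        Nat.find_min hex (m := j - 1) (by omega) ⟨by omega, hc⟩
      have hb := hgood d hd (j - 1) (by omega) hprev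
      have hmem : j ∈ Finset.Icc 1 J := Finset.mem_Icc.2 ⟨by omega, hjJ⟩
      have h1 := Finset.single_le_sum hnn hmem
      rw [if_pos hjb] at h1
      have : 0 ≤ (16 * C) ^ k * (Y : ℝ) ^ (k * (1 / 6 + ε₁)) := by positivity
      linarith
    · push Not at hex
      have hb := hgood d hd J le_rfl (hex J le_rfl)
      have e : 1 / 2 + ε₁ - levelExp J J = 1 / 6 + ε₁ := by
        unfold levelExp; field_simp; ring
      rw [e] at hb
      exact hb.trans (le_add_of_nonneg_right (Finset.sum_nonneg hnn))
  have hB0 : ((Finset.Ico Y (2 * Y)).filter Squarefree).card ≤ (Y : ℝ) := by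
    have := Finset.card_filter_le (Finset.Ico Y (2 * Y)) Squarefree
    rw [Nat.card_Ico] at this
    exact_mod_cast this.trans (by omega)
  have hbadsum : ∀ j ∈ Finset.Icc 1 J, ((bad j).card : ℝ) * W j
      ≤ (16 * C) ^ k * (3 * C2) * (Y : ℝ) ^ ((2 * k + 3) / 6 + ε) := by
    intro j hj
    obtain ⟨hj1, hjJ⟩ := Finset.mem_Icc.1 hj
    obtain ⟨hx, hx'⟩ := levelExp_mem hJ0 hjJ
    obtain ⟨b1, b2, b3, b4⟩ := levelLen_bounds hY hx hx'
    have hc := HL Y (lev j) (levelExp J j) (by omega) (by change 2 ≤ lev j at b1; omega) hx hx' b3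
      (b4.trans (half_le_self (by positivity)))
    obtain ⟨e1, e2, e3⟩ := level_exponent_le hk hx hx'
    have hprev : levelExp J (j - 1) = levelExp J j - 1 / (6 * J) := by
      unfold levelExp; rw [Nat.cast_sub hj1]; push_cast; field_simp; ring
    have hterm : ∀ t : ℝ, k * (1 / 2 - levelExp J j) + t ≤ (2 * k + 3) / 6 →
        (Y : ℝ) ^ (ε / 3) * (Y : ℝ) ^ t * (Y : ℝ) ^ (k * (1 / 2 + ε₁ - levelExp J (j - 1)))
          ≤ (Y : ℝ) ^ ((2 * k + 3) / 6 + ε) := by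
      intro t ht
      rw [← Real.rpow_add hY0, ← Real.rpow_add hY0]
      refine Real.rpow_le_rpow_of_exponent_le hY1 ?_
      rw [hprev]; linarith
    calc ((bad j).card : ℝ) * W j ≤ (C2 * (Y : ℝ) ^ (ε / 3) * ((Y : ℝ) ^ (5 * levelExp J j - 1 / 2)
          + (Y : ℝ) ^ (3 * levelExp J j) + (Y : ℝ) ^ (6 * levelExp J j - 1))) * W j := by gcongr
      _ = (16 * C) ^ k * C2 * ((Y : ℝ) ^ (ε / 3) * (Y : ℝ) ^ (5 * levelExp J j - 1 / 2) *
            (Y : ℝ) ^ (k * (1 / 2 + ε₁ - levelExp J (j - 1)))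
          + (Y : ℝ) ^ (ε / 3) * (Y : ℝ) ^ (3 * levelExp J j) *
            (Y : ℝ) ^ (k * (1 / 2 + ε₁ - levelExp J (j - 1)))
          + (Y : ℝ) ^ (ε / 3) * (Y : ℝ) ^ (6 * levelExp J j - 1) *
            (Y : ℝ) ^ (k * (1 / 2 + ε₁ - levelExp J (j - 1)))) := by simp only [hW]; ring
      _ ≤ (16 * C) ^ k * C2 * ((Y : ℝ) ^ ((2 * k + 3) / 6 + ε) + (Y : ℝ) ^ ((2 * k + 3) / 6 + ε)
          + (Y : ℝ) ^ ((2 * k + 3) / 6 + ε)) := by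
          gcongr ?_ * (?_ + ?_ + ?_)
          · exact hterm _ e1
          · exact hterm _ e2
          · exact hterm _ e3
      _ = _ := by ring
  calc ∑ d ∈ (Finset.Ico Y (2 * Y)).filter Squarefree, h d ^ k
      ≤ ∑ d ∈ (Finset.Ico Y (2 * Y)).filter Squarefree, ((16 * C) ^ k * (Y : ℝ) ^ (k * (1 / 6 + ε₁))
        + ∑ j ∈ Finset.Icc 1 J, if d ∈ bad j then W j else 0) := Finset.sum_le_sum hpt
    _ = ((Finset.Ico Y (2 * Y)).filter Squarefree).card * ((16 * C) ^ k * (Y : ℝ) ^ (k * (1 / 6 + ε₁)))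
        + ∑ j ∈ Finset.Icc 1 J, ∑ d ∈ (Finset.Ico Y (2 * Y)).filter Squarefree,
          (if d ∈ bad j then W j else 0) := by
        rw [Finset.sum_add_distrib, Finset.sum_const, nsmul_eq_mul, Finset.sum_comm]
    _ ≤ Y * ((16 * C) ^ k * (Y : ℝ) ^ (k * (1 / 6 + ε₁)))
        + ∑ j ∈ Finset.Icc 1 J, (16 * C) ^ k * (3 * C2) * (Y : ℝ) ^ ((2 * k + 3) / 6 + ε) := by
        gcongr with j hj
        refine le_trans ?_ (hbadsum j hj)
        rw [← Finset.sum_filter, Finset.sum_const, nsmul_eq_mul]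
        have : 0 ≤ W j := by positivity
        gcongr
        intro d hd
        exact (Finset.mem_filter.1 hd).2
    _ ≤ (16 * C) ^ k * (Y : ℝ) ^ ((2 * k + 3) / 6 + ε)
        + J * ((16 * C) ^ k * (3 * C2) * (Y : ℝ) ^ ((2 * k + 3) / 6 + ε)) := by
        rw [Finset.sum_const, nsmul_eq_mul, Nat.card_Icc]
        simp only [add_tsub_cancel_right]
        gcongr ?_ + _
        have : (Y : ℝ) * ((16 * C) ^ k * (Y : ℝ) ^ (k * (1 / 6 + ε₁)))
            = (16 * C) ^ k * (Y : ℝ) ^ (1 + k * (1 / 6 + ε₁)) := by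
          rw [Real.rpow_add hY0, Real.rpow_one]; ring
        rw [this]
        refine mul_le_mul_of_nonneg_left (Real.rpow_le_rpow_of_exponent_le hY1 ?_) (by positivity)
        linarith
    _ = _ := by ring

/-- Passage from dyadic blocks to all `d < X`. -/
lemma exists_sum_le_of_block {f : ℕ → ℝ} (hf : ∀ d, 0 ≤ f d) {s : ℝ} (hs : 0 < s) {Y₀ : ℕ}
    {C : ℝ} (hC : 0 < C)
    (H : ∀ Y : ℕ, Y₀ ≤ Y → ∑ d ∈ Finset.Ico Y (2 * Y), f d ≤ C * (Y : ℝ) ^ s) :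
    ∃ C' : ℝ, 0 < C' ∧ ∀ X : ℝ, 2 ≤ X →
      ∑ d ∈ (Finset.range (⌈X⌉₊ + 1)).filter (fun d : ℕ => (d : ℝ) < X), f d ≤ C' * X ^ s := by
  have h2s : (1 : ℝ) < 2 ^ s := Real.one_lt_rpow (by norm_num) hs
  set D := C / (2 ^ s - 1) with hD
  have hD0 : 0 < D := div_pos hC (by linarith)
  set T := ∑ d ∈ Finset.range (2 ^ Y₀), f d with hT
  have hT0 : 0 ≤ T := Finset.sum_nonneg fun d _ => hf d
  have hp : ∀ n : ℕ, ((2 ^ n : ℕ) : ℝ) ^ s = (2 ^ s) ^ n := by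
    intro n
    push_cast
    rw [← Real.rpow_natCast, ← Real.rpow_natCast, ← Real.rpow_mul (by norm_num),
      ← Real.rpow_mul (by norm_num), mul_comm]
  have key : ∀ n : ℕ, ∑ d ∈ Finset.range (2 ^ n), f d ≤ T + D * (2 ^ s) ^ n := by
    intro n
    rcases le_total n Y₀ with hn | hn
    · have : ∑ d ∈ Finset.range (2 ^ n), f d ≤ T :=
        Finset.sum_le_sum_of_subset_of_nonneg
          (Finset.range_mono (Nat.pow_le_pow_right (by norm_num) hn)) fun d _ _ => hf d
      have : 0 ≤ D * (2 ^ s) ^ n := by positivity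
      linarith
    · induction n, hn using Nat.le_induction with
      | base =>
        have : 0 ≤ D * (2 ^ s) ^ Y₀ := by positivity
        linarith
      | succ n hn ih =>
        have hle : Y₀ ≤ 2 ^ n := hn.trans Nat.lt_two_pow_self.le
        have hb := H (2 ^ n) hle
        rw [hp] at hb
        have e : ∑ d ∈ Finset.range (2 ^ (n + 1)), f d
            = ∑ d ∈ Finset.range (2 ^ n), f d + ∑ d ∈ Finset.Ico (2 ^ n) (2 * 2 ^ n), f d := by
          rw [pow_succ', Finset.sum_range_add_sum_Ico f (by omega)]
        rw [e]
        have e2 : D * (2 ^ s) ^ (n + 1) = D * (2 ^ s) ^ n + C * (2 ^ s) ^ n := by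
          rw [hD, pow_succ]; field_simp [(by linarith : (2 : ℝ) ^ s - 1 ≠ 0)]; ring
        linarith
  refine ⟨T + D * 2 ^ s, by positivity, fun X hX => ?_⟩
  have hX0 : (0 : ℝ) < X := by linarith
  obtain ⟨n, hn1, hn2⟩ := exists_nat_pow_near (by linarith : (1 : ℝ) ≤ X) (by norm_num : (1 : ℝ) < 2)
  have hsub : (Finset.range (⌈X⌉₊ + 1)).filter (fun d : ℕ => (d : ℝ) < X) ⊆ Finset.range (2 ^ (n + 1)) := by
    intro d hd
    have := (Finset.mem_filter.1 hd).2.trans hn2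
    rw [Finset.mem_range]
    exact_mod_cast this
  have hXs : 1 ≤ X ^ s := Real.one_le_rpow (by linarith) hs.le
  have hns : ((2 : ℝ) ^ s) ^ n ≤ X ^ s := by
    rw [← hp]; push_cast; gcongr
  calc _ ≤ ∑ d ∈ Finset.range (2 ^ (n + 1)), f d :=
        Finset.sum_le_sum_of_subset_of_nonneg hsub fun d _ _ => hf d
    _ ≤ T + D * (2 ^ s) ^ (n + 1) := key _
    _ = T * 1 + D * 2 ^ s * (2 ^ s) ^ n := by rw [pow_succ]; ring
    _ ≤ T * X ^ s + D * 2 ^ s * X ^ s := by gcongr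
    _ = _ := by ring

/-- The moment bound, from the pointwise bound in terms of `solCount`. -/
theorem exists_moment_le {h : ℕ → ℝ} (h0 : ∀ d, 0 ≤ h d)
    (hA : ∀ ε : ℝ, 0 < ε → ∃ C : ℝ, 0 < C ∧ ∀ d P : ℕ, Squarefree d → 3 < d → 2 ≤ P → P ≤ d →
      h d * P ^ 2 ≤ C * (d : ℝ) ^ (1 / 2 + ε) * (P + solCount d (P ^ 2)))
    (hk : 4 ≤ k) {ε : ℝ} (hε : 0 < ε) :
    ∃ C : ℝ, 0 < C ∧ ∀ X : ℝ, 2 ≤ X →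
      ∑ d ∈ (Finset.range (⌈X⌉₊ + 1)).filter (fun d : ℕ => Squarefree d ∧ 0 < d ∧ (d : ℝ) < X), h d ^ k
      ≤ C * X ^ ((2 * k + 3) / 6 + ε) := by
  classical
  obtain ⟨C, hC, H⟩ := exists_sum_block_le h0 hA hk hε
  obtain ⟨C', hC', H'⟩ := exists_sum_le_of_block (f := fun d => if Squarefree d then h d ^ k else 0)
    (fun d => by split_ifs; exacts [Real.rpow_nonneg (h0 d) _, le_rfl])
    (s := (2 * k + 3) / 6 + ε) (by positivity) (Y₀ := 4096) hC
    (fun Y hY => by rw [← Finset.sum_filter]; exact H Y hY)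
  refine ⟨C', hC', fun X hX => le_trans ?_ (H' X hX)⟩
  rw [← Finset.sum_filter, Finset.filter_filter]
  refine Finset.sum_le_sum_of_subset_of_nonneg ?_ fun d _ _ => Real.rpow_nonneg (h0 d) _
  intro d hd
  obtain ⟨h1, h2, -, h3⟩ := Finset.mem_filter.1 hd
  exact Finset.mem_filter.2 ⟨h1, h3, h2⟩

end Moments

/-- For a prime `q ≡ 2 mod 3` not dividing `6d`, one of `-d`, `3d` is a square modulo `q`. -/
lemma exists_sq_add_or_exists_sq_sub {q d : ℕ} (hq : q.Prime) (hq3 : q % 3 = 2) (hqd : ¬ q ∣ 6 * d) :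
    (∃ b : ℤ, (q : ℤ) ∣ b ^ 2 + d) ∨ ∃ b : ℤ, (q : ℤ) ∣ b ^ 2 - 3 * d := by
  have := Fact.mk hq
  have hq2 : q ≠ 2 := by rintro rfl; exact hqd ⟨3 * d, by ring⟩
  have hd0 : ((d : ℤ) : ZMod q) ≠ 0 := by
    rw [Ne, ZMod.intCast_zmod_eq_zero_iff_dvd]
    intro h
    exact hqd (dvd_mul_of_dvd_right (Int.natCast_dvd_natCast.1 h) _)
  have h3 : ¬ IsSquare (-3 : ZMod q) := by
    rintro ⟨s, hs⟩
    have hF : Fintype.card (ZMod q) = q := ZMod.card q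
    have h2 : (2 : ZMod q) ≠ 0 := by
      have := (ZMod.natCast_eq_zero_iff 2 q).not.2 (fun h => hq2 ((Nat.prime_dvd_prime_iff_eq hq Nat.prime_two).1 h))
      exact_mod_cast this
    have h3' : (3 : ZMod q) ≠ 0 := by
      have := (ZMod.natCast_eq_zero_iff 3 q).not.2 (fun h => by
        have := (Nat.prime_dvd_prime_iff_eq hq Nat.prime_three).1 h
        omega)
      exact_mod_cast this
    set w : ZMod q := (s - 1) / 2 with hw
    have hw1 : w ^ 2 + w + 1 = 0 := by
      have hs' : s ^ 2 = -3 := by rw [hs]; ring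
      rw [hw]; field_simp; linear_combination hs'
    have hw3 : w ^ 3 = 1 := by linear_combination (w - 1) * hw1
    have hwne : w ≠ 1 := by
      intro h
      rw [h] at hw1
      exact h3' (by linear_combination hw1)
    have hw0 : w ≠ 0 := by rintro h; rw [h] at hw3; norm_num at hw3
    have hord : orderOf w = 3 := orderOf_eq_prime hw3 hwne
    have hdvd : 3 ∣ q - 1 := by
      rw [← hord]; exact orderOf_dvd_of_pow_eq_one (ZMod.pow_card_sub_one_eq_one hw0)
    have := hq.two_le
    omega
  by_cases h1 : IsSquare (-(d : ℤ) : ZMod q)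
  · left
    obtain ⟨s, hs⟩ := h1
    obtain ⟨b, rfl⟩ := ZMod.intCast_surjective s
    refine ⟨b, (ZMod.intCast_zmod_eq_zero_iff_dvd _ _).1 ?_⟩
    push_cast
    push_cast at hs
    linear_combination -hs
  · right
    have h2 : IsSquare (3 * (d : ℤ) : ZMod q) := by
      by_contra h2
      apply h3
      have hχ : quadraticChar (ZMod q) (-3) * quadraticChar (ZMod q) ((d : ℤ) : ZMod q) ^ 2
          = quadraticChar (ZMod q) (-(d : ℤ)) * quadraticChar (ZMod q) (3 * (d : ℤ)) := by
        rw [← map_pow, ← map_mul, ← map_mul]; congr 1; ring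
      have hχd : quadraticChar (ZMod q) ((d : ℤ) : ZMod q) ^ 2 = 1 := by
        rw [← map_pow]; exact quadraticChar_sq_one' hd0
      rw [hχd] at hχ
      rw [quadraticChar_neg_one_iff_not_isSquare.2 h1, quadraticChar_neg_one_iff_not_isSquare.2 h2] at hχ
      by_contra h3c
      rw [quadraticChar_neg_one_iff_not_isSquare.2 h3c] at hχ
      norm_num at hχ
    obtain ⟨s, hs⟩ := h2
    obtain ⟨b, rfl⟩ := ZMod.intCast_surjective s
    refine ⟨b, (ZMod.intCast_zmod_eq_zero_iff_dvd _ _).1 ?_⟩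
    push_cast
    push_cast at hs
    linear_combination -hs

open Classical in
/-- Pairs of primes `≤ P` whose product satisfies a predicate, in terms of the products. -/
lemma card_offDiag_filter_le {P : ℕ} (S : Finset ℕ) (hS : ∀ q ∈ S, 1 ≤ q ∧ q ≤ P) (p : ℕ → Prop)
    {T : ℝ} (hT : ∀ a : ℕ, 1 ≤ a → a ≤ P ^ 2 → (a.divisors.card : ℝ) ≤ T) :
    ((S.offDiag.filter (fun x => p (x.1 * x.2))).card : ℝ)
      ≤ T * ((Finset.Icc 1 (P ^ 2)).filter p).card := by
  set F := S.offDiag.filter (fun x => p (x.1 * x.2)) with hF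
  set I := (Finset.Icc 1 (P ^ 2)).filter p with hI
  have hmem : ∀ x ∈ F, x.1 ∈ S ∧ x.2 ∈ S ∧ p (x.1 * x.2) := fun x hx => by
    obtain ⟨h1, h2⟩ := Finset.mem_filter.1 hx
    exact ⟨(Finset.mem_offDiag.1 h1).1, (Finset.mem_offDiag.1 h1).2.1, h2⟩
  have hmaps : ∀ x ∈ F, x.1 * x.2 ∈ I := by
    intro x hx
    obtain ⟨h1, h2, h3⟩ := hmem x hx
    refine Finset.mem_filter.2 ⟨Finset.mem_Icc.2 ⟨Nat.mul_pos (hS _ h1).1 (hS _ h2).1, ?_⟩, h3⟩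
    rw [sq]; exact Nat.mul_le_mul (hS _ h1).2 (hS _ h2).2
  have hfib : ∀ a ∈ I, ((F.filter (fun x => x.1 * x.2 = a)).card : ℝ) ≤ T := by
    intro a ha
    obtain ⟨ha1, -⟩ := Finset.mem_filter.1 ha
    obtain ⟨ha1, ha2⟩ := Finset.mem_Icc.1 ha1
    refine le_trans ?_ (hT a ha1 ha2)
    have : (F.filter (fun x => x.1 * x.2 = a)).card ≤ a.divisors.card := by
      refine Finset.card_le_card_of_injOn (fun x => x.1) ?_ ?_
      · intro x hx
        have := (Finset.mem_filter.1 hx).2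
        exact Finset.mem_coe.2 (Nat.mem_divisors.2 ⟨⟨x.2, this.symm⟩, by omega⟩)
      · intro x hx y hy hxy
        have h1 := (Finset.mem_filter.1 hx).2
        have h2 := (Finset.mem_filter.1 hy).2
        have hx1 : 0 < x.1 := (hS _ (hmem x (Finset.mem_filter.1 hx).1).1).1
        have hxy' : x.1 = y.1 := hxy
        refine Prod.ext hxy' (Nat.eq_of_mul_eq_mul_left hx1 ?_)
        rw [h1, hxy', h2]
    exact_mod_cast this
  rw [Finset.card_eq_sum_card_fiberwise hmaps]
  push_cast
  calc _ ≤ ∑ a ∈ I, T := Finset.sum_le_sum hfib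
    _ = _ := by rw [Finset.sum_const, nsmul_eq_mul, mul_comm]

set_option maxHeartbeats 1000000 in
open Classical in
/-- The two counting inequalities, for primes `q` modulo which `-d`, respectively `3d`, is a
square, give a bound in terms of `solCount`. -/
theorem exists_mul_sq_le_solCount {h : ℕ → ℝ} (h0 : ∀ d, 0 ≤ h d)
    (H0 : ∀ ε : ℝ, 0 < ε → ∃ C : ℝ, 0 < C ∧ ∀ d : ℕ, Squarefree d → 3 < d →
      h d ≤ C * (d : ℝ) ^ (1 / 2 + ε))
    (H1 : ∀ ε : ℝ, 0 < ε → ∃ C : ℝ, 0 < C ∧ ∀ (d : ℕ) (Q : Finset ℕ), Squarefree d → 3 < d →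
      (∀ q ∈ Q, q.Prime ∧ ¬ q ∣ 6 * d ∧ q ≤ d ∧ ∃ b : ℤ, (q : ℤ) ∣ b ^ 2 + d) →
      h d * (Q.card : ℝ) ^ 2 ≤ C * (d : ℝ) ^ (1 / 2 + ε) * (Q.card +
        (Q.offDiag.filter (fun x => CubeSol 1 1 d (x.1 * x.2) ∨ CubeSol 4 1 d (x.1 * x.2))).card))
    (H2 : ∀ ε : ℝ, 0 < ε → ∃ C : ℝ, 0 < C ∧ ∀ (d : ℕ) (Q : Finset ℕ), Squarefree d → 3 < d →
      (∀ q ∈ Q, q.Prime ∧ ¬ q ∣ 6 * d ∧ q ≤ d ∧ ∃ b : ℤ, (q : ℤ) ∣ b ^ 2 - 3 * d) →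
      h d * (Q.card : ℝ) ^ 2 ≤ C * (d : ℝ) ^ (1 / 2 + ε) * (Q.card +
        (Q.offDiag.filter (fun x => CubeSol 1 (-8748) d (x.1 * x.2))).card))
    {ε : ℝ} (hε : 0 < ε) : ∃ C : ℝ, 0 < C ∧ ∀ d P : ℕ, Squarefree d → 3 < d → 2 ≤ P → P ≤ d →
      h d * P ^ 2 ≤ C * (d : ℝ) ^ (1 / 2 + ε) * (P + solCount d (P ^ 2)) := by
  set η : ℝ := min (1 / 2) (ε / 5) with hη
  have hη0 : 0 < η := by positivity
  have hηh : η ≤ 1 / 2 := min_le_left _ _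
  have hηε : 5 * η ≤ ε := by have : η ≤ ε / 5 := min_le_right _ _; linarith
  obtain ⟨C0, hC0, H0⟩ := H0 η hη0
  obtain ⟨C1, hC1, H1⟩ := H1 η hη0
  obtain ⟨C2, hC2, H2⟩ := H2 η hη0
  obtain ⟨D, hD1, HD⟩ := exists_card_divisors_le hη0
  obtain ⟨c, hc, HP⟩ := exists_rpow_le_card_primes_two_mod_three hη0
  have hD0 : 0 < D := by linarith
  set M : ℝ := 2 * D * 6 ^ η / c with hM
  have hM0 : 0 < M := by positivity
  refine ⟨max (C0 * M ^ 2) ((C1 + C2) * D * (16 / c ^ 2)), by positivity,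
    fun d P hsq hd3 hP2 hPd => ?_⟩
  have hd0 : (0 : ℝ) < d := by exact_mod_cast (by omega : 0 < d)
  have hd1 : (1 : ℝ) ≤ d := by exact_mod_cast (by omega : 1 ≤ d)
  have hP0 : (0 : ℝ) < P := by exact_mod_cast (by omega : 0 < P)
  have hP1 : (1 : ℝ) ≤ P := by exact_mod_cast (by omega : 1 ≤ P)
  have hPd' : (P : ℝ) ≤ d := by exact_mod_cast hPd
  have hsc := solCount_nonneg d (P ^ 2)
  have hmono : ∀ s : ℝ, s ≤ 1 / 2 + ε → (d : ℝ) ^ s ≤ (d : ℝ) ^ (1 / 2 + ε) := fun s hs =>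
    Real.rpow_le_rpow_of_exponent_le hd1 hs
  by_cases hsmall : (P : ℝ) ^ (1 - η) < M * (d : ℝ) ^ η
  · have hP' : (P : ℝ) ≤ M ^ 2 * (d : ℝ) ^ (2 * η) := by
      calc (P : ℝ) = ((P : ℝ) ^ (1 / 2 : ℝ)) ^ 2 := by
            rw [← Real.rpow_natCast, ← Real.rpow_mul hP0.le]; norm_num
        _ ≤ ((P : ℝ) ^ (1 - η)) ^ 2 := by
            have := Real.rpow_le_rpow_of_exponent_le hP1 (by linarith : (1 / 2 : ℝ) ≤ 1 - η)
            gcongr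
        _ ≤ (M * (d : ℝ) ^ η) ^ 2 := by gcongr
        _ = _ := by
            rw [mul_pow, ← Real.rpow_natCast ((d : ℝ) ^ η), ← Real.rpow_mul hd0.le, mul_comm η]
            norm_num
    calc h d * (P : ℝ) ^ 2 ≤ C0 * (d : ℝ) ^ (1 / 2 + η) * (M ^ 2 * (d : ℝ) ^ (2 * η) * P) := by
          rw [sq]
          have := H0 d hsq hd3
          gcongr
      _ = C0 * M ^ 2 * (d : ℝ) ^ (1 / 2 + η + 2 * η) * P := by rw [Real.rpow_add hd0 (1 / 2 + η)]; ring
      _ ≤ C0 * M ^ 2 * (d : ℝ) ^ (1 / 2 + ε) * (P + solCount d (P ^ 2)) := by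
          have := hmono (1 / 2 + η + 2 * η) (by linarith)
          gcongr
          linarith
      _ ≤ _ := by
          gcongr
          exact le_max_left _ _
  · rw [not_lt] at hsmall
    set R := (Finset.Ioc 0 P).filter (fun p => p.Prime ∧ p % 3 = 2) with hR
    set S := R.filter (fun p => ¬ p ∣ 6 * d) with hS
    set A := S.filter (fun q : ℕ => ∃ b : ℤ, (q : ℤ) ∣ b ^ 2 + d) with hA
    set B := S.filter (fun q : ℕ => ∃ b : ℤ, (q : ℤ) ∣ b ^ 2 - 3 * d) with hB
    have hSmem : ∀ q ∈ S, q.Prime ∧ q % 3 = 2 ∧ ¬ q ∣ 6 * d ∧ q ≤ P := by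
      intro q hq
      obtain ⟨h1, h2⟩ := Finset.mem_filter.1 hq
      obtain ⟨h3, h4, h5⟩ := Finset.mem_filter.1 h1
      exact ⟨h4, h5, h2, (Finset.mem_Ioc.1 h3).2⟩
    have hcard : c / 2 * (P : ℝ) ^ (1 - η) ≤ S.card := by
      have e1 : (R.card : ℝ) = (R.filter (fun p => p ∣ 6 * d)).card + S.card := by
        exact_mod_cast (Finset.card_filter_add_card_filter_not (s := R) (fun p => p ∣ 6 * d)).symm
      have e2 : ((R.filter (fun p => p ∣ 6 * d)).card : ℝ) ≤ D * (6 * d : ℝ) ^ η := by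
        have h1 := HD (6 * d) (by omega)
        push_cast at h1
        refine le_trans ?_ h1
        have : R.filter (fun p => p ∣ 6 * d) ⊆ (6 * d).divisors := fun p hp =>
          Nat.mem_divisors.2 ⟨(Finset.mem_filter.1 hp).2, by omega⟩
        exact_mod_cast Finset.card_le_card this
      have e3 : D * (6 * d : ℝ) ^ η ≤ c / 2 * (P : ℝ) ^ (1 - η) := by
        rw [Real.mul_rpow (by norm_num) hd0.le]
        calc D * (6 ^ η * (d : ℝ) ^ η) = c / 2 * (M * (d : ℝ) ^ η) := by rw [hM]; field_simp
          _ ≤ _ := by gcongr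
      have e4 := HP P hP2
      linarith
    have hAB : S.card ≤ A.card + B.card := by
      refine le_trans (Finset.card_le_card ?_) (Finset.card_union_le A B)
      intro q hq
      obtain ⟨h1, h2, h3, -⟩ := hSmem q hq
      rcases exists_sq_add_or_exists_sq_sub h1 h2 h3 with hb | hb
      · exact Finset.mem_union_left _ (Finset.mem_filter.2 ⟨hq, hb⟩)
      · exact Finset.mem_union_right _ (Finset.mem_filter.2 ⟨hq, hb⟩)
    have hAB' : (S.card : ℝ) ≤ A.card + B.card := by exact_mod_cast hAB
    set T : ℝ := D * (d : ℝ) ^ (2 * η) with hT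
    have hT1 : 1 ≤ T := by
      have : 1 ≤ (d : ℝ) ^ (2 * η) := Real.one_le_rpow hd1 (by positivity)
      nlinarith
    have hTdiv : ∀ a : ℕ, 1 ≤ a → a ≤ P ^ 2 → (a.divisors.card : ℝ) ≤ T := by
      intro a ha ha2
      refine (HD a (by omega)).trans ?_
      have : (a : ℝ) ≤ (d : ℝ) ^ 2 := by
        have : (a : ℝ) ≤ (P : ℝ) ^ 2 := by exact_mod_cast ha2
        exact this.trans (by gcongr)
      have e : (d : ℝ) ^ (2 * η) = ((d : ℝ) ^ 2) ^ η := by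
        rw [← Real.rpow_natCast, ← Real.rpow_mul hd0.le]; norm_num
      rw [hT, e]
      gcongr
    -- each half
    have hleS : ∀ q ∈ S, 1 ≤ q ∧ q ≤ P := fun q hq => ⟨(hSmem q hq).1.one_le, (hSmem q hq).2.2.2⟩
    have hSP : (S.card : ℝ) ≤ P := by
      have : S.card ≤ (Finset.Icc 1 P).card := Finset.card_le_card fun q hq =>
        Finset.mem_Icc.2 (hleS q hq)
      rw [Nat.card_Icc] at this
      exact_mod_cast this.trans (by omega)
    have hAineq : h d * (A.card : ℝ) ^ 2 ≤ C1 * (d : ℝ) ^ (1 / 2 + η) * (T * (P + solCount d (P ^ 2))) := by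
      refine (H1 d A hsq hd3 fun q hq => ?_).trans ?_
      · obtain ⟨h1, h2⟩ := Finset.mem_filter.1 hq
        obtain ⟨h3, -, h4, h5⟩ := hSmem q h1
        exact ⟨h3, h4, h5.trans hPd, h2⟩
      · have hsA : ∀ q ∈ A, 1 ≤ q ∧ q ≤ P := fun q hq => hleS q (Finset.mem_filter.1 hq).1
        have b1 : ((A.offDiag.filter
            (fun x => CubeSol 1 1 d (x.1 * x.2) ∨ CubeSol 4 1 d (x.1 * x.2))).card : ℝ)
            ≤ T * ((Finset.Icc 1 (P ^ 2)).filter (fun a => CubeSol 1 1 d a ∨ CubeSol 4 1 d a)).card := by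
          convert card_offDiag_filter_le A hsA (fun a => CubeSol 1 1 d a ∨ CubeSol 4 1 d a) hTdiv
        have b2 : (((Finset.Icc 1 (P ^ 2)).filter (fun a => CubeSol 1 1 d a ∨ CubeSol 4 1 d a)).card : ℝ)
            ≤ solCount d (P ^ 2) := by
          have h1 : ((Finset.Icc 1 (P ^ 2)).filter (fun a => CubeSol 1 1 d a ∨ CubeSol 4 1 d a)).card
              ≤ ((Finset.Icc 1 (P ^ 2)).filter (CubeSol 1 1 d)).card
                + ((Finset.Icc 1 (P ^ 2)).filter (CubeSol 4 1 d)).card := by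
            rw [Finset.filter_or]; exact Finset.card_union_le _ _
          unfold solCount
          have h1' : (((Finset.Icc 1 (P ^ 2)).filter (fun a => CubeSol 1 1 d a ∨ CubeSol 4 1 d a)).card : ℝ)
              ≤ ((Finset.Icc 1 (P ^ 2)).filter (CubeSol 1 1 d)).card
                + ((Finset.Icc 1 (P ^ 2)).filter (CubeSol 4 1 d)).card := by exact_mod_cast h1
          have h2 : (0 : ℝ) ≤ ((Finset.Icc 1 (P ^ 2)).filter (CubeSol 1 (-8748) d)).card := Nat.cast_nonneg _
          linarith
        have b3 : (A.card : ℝ) ≤ P :=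
          le_trans (by exact_mod_cast Finset.card_le_card (Finset.filter_subset _ _)) hSP
        have b4 : (A.card : ℝ) ≤ T * P := by nlinarith
        have b5 := mul_le_mul_of_nonneg_left b2 (by linarith : 0 ≤ T)
        gcongr
        linarith
    have hBineq : h d * (B.card : ℝ) ^ 2 ≤ C2 * (d : ℝ) ^ (1 / 2 + η) * (T * (P + solCount d (P ^ 2))) := by
      refine (H2 d B hsq hd3 fun q hq => ?_).trans ?_
      · obtain ⟨h1, h2⟩ := Finset.mem_filter.1 hq
        obtain ⟨h3, -, h4, h5⟩ := hSmem q h1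
        exact ⟨h3, h4, h5.trans hPd, h2⟩
      · have hsB : ∀ q ∈ B, 1 ≤ q ∧ q ≤ P := fun q hq => hleS q (Finset.mem_filter.1 hq).1
        have b1 := card_offDiag_filter_le B hsB (CubeSol 1 (-8748) d) hTdiv
        have b2 : (((Finset.Icc 1 (P ^ 2)).filter (CubeSol 1 (-8748) d)).card : ℝ)
            ≤ solCount d (P ^ 2) := by
          unfold solCount
          have h1 : (0 : ℝ) ≤ ((Finset.Icc 1 (P ^ 2)).filter (CubeSol 1 1 d)).card := Nat.cast_nonneg _
          have h2 : (0 : ℝ) ≤ ((Finset.Icc 1 (P ^ 2)).filter (CubeSol 4 1 d)).card := Nat.cast_nonneg _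
          linarith
        have b3 : (B.card : ℝ) ≤ P :=
          le_trans (by exact_mod_cast Finset.card_le_card (Finset.filter_subset _ _)) hSP
        have b4 : (B.card : ℝ) ≤ T * P := by nlinarith
        have b5 := mul_le_mul_of_nonneg_left b2 (by linarith : 0 ≤ T)
        gcongr
        linarith
    have hPη : (P : ℝ) ^ 2 = ((P : ℝ) ^ (1 - η)) ^ 2 * (P : ℝ) ^ (2 * η) := by
      rw [← Real.rpow_natCast ((P : ℝ) ^ (1 - η)), ← Real.rpow_mul hP0.le, ← Real.rpow_add hP0,
        ← Real.rpow_natCast]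
      congr 1; push_cast; ring
    have hcard2 : (c / 2) ^ 2 * ((P : ℝ) ^ (1 - η)) ^ 2 ≤ 2 * ((A.card : ℝ) ^ 2 + (B.card : ℝ) ^ 2) := by
      have h1 : c / 2 * (P : ℝ) ^ (1 - η) ≤ A.card + B.card := hcard.trans hAB'
      have h2 : (c / 2 * (P : ℝ) ^ (1 - η)) ^ 2 ≤ ((A.card : ℝ) + B.card) ^ 2 := by gcongr
      nlinarith [sq_nonneg ((A.card : ℝ) - B.card)]
    have hPd2 : (P : ℝ) ^ (2 * η) ≤ (d : ℝ) ^ (2 * η) := by gcongr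
    calc h d * (P : ℝ) ^ 2 = (4 / c ^ 2) * (h d * ((c / 2) ^ 2 * ((P : ℝ) ^ (1 - η)) ^ 2)) * (P : ℝ) ^ (2 * η) := by
          rw [hPη]; field_simp; ring
      _ ≤ (4 / c ^ 2) * (h d * (2 * ((A.card : ℝ) ^ 2 + (B.card : ℝ) ^ 2))) * (d : ℝ) ^ (2 * η) := by
          have := h0 d
          gcongr
      _ = (8 / c ^ 2) * (h d * (A.card : ℝ) ^ 2 + h d * (B.card : ℝ) ^ 2) * (d : ℝ) ^ (2 * η) := by ring
      _ ≤ (8 / c ^ 2) * (C1 * (d : ℝ) ^ (1 / 2 + η) * (T * (P + solCount d (P ^ 2)))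
            + C2 * (d : ℝ) ^ (1 / 2 + η) * (T * (P + solCount d (P ^ 2)))) * (d : ℝ) ^ (2 * η) := by gcongr
      _ = ((C1 + C2) * D * (8 / c ^ 2)) * (d : ℝ) ^ (1 / 2 + η + 2 * η + 2 * η) * (P + solCount d (P ^ 2)) := by
          rw [Real.rpow_add hd0 (1 / 2 + η + 2 * η), Real.rpow_add hd0 (1 / 2 + η), hT]; ring
      _ ≤ ((C1 + C2) * D * (16 / c ^ 2)) * (d : ℝ) ^ (1 / 2 + ε) * (P + solCount d (P ^ 2)) := by
          have := hmono (1 / 2 + η + 2 * η + 2 * η) (by linarith)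
          gcongr
          norm_num
      _ ≤ _ := by
          gcongr
          exact le_max_right _ _

/-- `R` behaves like the ring of integers of `ℚ(√-d)`, with `s` a square root of `-d` and `σ`
the conjugation. -/
structure IsImagQuad (R : Type*) [CommRing R] (d : ℕ) (s : R) (σ : R ≃+* R) : Prop where
  squarefree : Squarefree d
  three_lt : 3 < d
  sq : s ^ 2 = -(d : R)
  conj : σ s = -s
  rep : ∀ x : R, ∃ u v : ℤ, 2 * x = u + v * s
  finrank : Module.finrank ℤ R = 2

namespace IsImagQuad

set_option linter.unusedSectionVars false

variable {R : Type*} [CommRing R] [IsDedekindDomain R] [CharZero R] [Module.Free ℤ R]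
  [Module.Finite ℤ R] {d : ℕ} {s : R} {σ : R ≃+* R}

lemma eq_zero (h : IsImagQuad R d s σ) {u v : ℤ} (huv : (u : R) + v * s = 0) : u = 0 ∧ v = 0 := by
  have h1 : (u : R) ^ 2 + d * v ^ 2 = 0 := by
    linear_combination (u - v * s) * huv + v ^ 2 * h.sq
  have h2 : u ^ 2 + d * v ^ 2 = 0 := by exact_mod_cast h1
  have hd : (0 : ℤ) < d := by have := h.three_lt; omega
  have hv : v = 0 := by
    by_contra hv
    have : 0 < v ^ 2 := by positivity
    nlinarith [sq_nonneg u]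
  subst hv
  exact ⟨by simpa using h2, rfl⟩

lemma inj (h : IsImagQuad R d s σ) {u v u' v' : ℤ} (huv : (u : R) + v * s = u' + v' * s) :
    u = u' ∧ v = v' := by
  have := h.eq_zero (u := u - u') (v := v - v') (by push_cast; linear_combination huv)
  omega

lemma int_dvd (h : IsImagQuad R d s σ) {m a : ℤ} (hma : (m : R) ∣ a) : m ∣ a := by
  obtain ⟨y, hy⟩ := hma
  have h1 := congrArg (Algebra.norm ℤ) hy
  rw [map_mul, ← eq_intCast (algebraMap ℤ R) a, ← eq_intCast (algebraMap ℤ R) m,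
    Algebra.norm_algebraMap, Algebra.norm_algebraMap, h.finrank] at h1
  exact (Int.pow_dvd_pow_iff two_ne_zero).1 ⟨_, h1⟩

lemma two_mul_conj (h : IsImagQuad R d s σ) {x : R} {u v : ℤ} (hx : 2 * x = u + v * s) :
    2 * σ x = u - v * s := by
  have := congrArg σ hx
  simp only [map_mul, map_add, map_intCast, map_ofNat, h.conj] at this
  rw [this]; ring

lemma norm_eq (h : IsImagQuad R d s σ) {x : R} {u v : ℤ} (hx : 2 * x = u + v * s) :
    ∃ m : ℤ, x * σ x = m ∧ 4 * m = u ^ 2 + d * v ^ 2 := by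
  have h4 : 4 * (x * σ x) = ((u ^ 2 + d * v ^ 2 : ℤ) : R) := by
    have := h.two_mul_conj hx
    push_cast
    linear_combination 2 * σ x * hx + (u + v * s) * this - v ^ 2 * h.sq
  obtain ⟨m, hm⟩ := h.int_dvd (m := 4) (a := u ^ 2 + d * v ^ 2) ⟨x * σ x, by rw [← h4]; norm_num⟩
  refine ⟨m, ?_, hm.symm⟩
  rw [hm] at h4
  push_cast at h4
  exact mul_left_cancel₀ (by norm_num) h4

/-- Common odd factors of the coordinates divide. -/
lemma dvd_of_odd {x : R} {u v p : ℤ} (hx : 2 * x = u + v * s)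
    (hp : Odd p) (hu : p ∣ u) (hv : p ∣ v) : (p : R) ∣ x := by
  obtain ⟨u', rfl⟩ := hu
  obtain ⟨v', rfl⟩ := hv
  obtain ⟨k, rfl⟩ := hp
  refine ⟨x - k * (u' + v' * s), ?_⟩
  push_cast
  push_cast at hx
  linear_combination (-k : R) * hx

lemma two_dvd_of_four {x : R} {u v : ℤ}
    (hx : 2 * x = u + v * s) (hu : 4 ∣ u) (hv : 4 ∣ v) : (2 : R) ∣ x := by
  obtain ⟨u', rfl⟩ := hu
  obtain ⟨v', rfl⟩ := hv
  refine ⟨u' + v' * s, mul_left_cancel₀ two_ne_zero ?_⟩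
  rw [hx]; push_cast; ring

lemma absNorm_map (I : Ideal R) : Ideal.absNorm (I.map (σ : R →+* R)) = Ideal.absNorm I := by
  rw [Ideal.absNorm_apply, Ideal.absNorm_apply, Submodule.cardQuot_apply, Submodule.cardQuot_apply]
  exact (Nat.card_congr (Ideal.quotientEquiv I (I.map (σ : R →+* R)) σ rfl).toEquiv).symm

lemma absNorm_span (h : IsImagQuad R d s σ) {x : R} {m : ℤ} (hm : x * σ x = m) :
    Ideal.absNorm (Ideal.span {x}) = m.natAbs := by
  have h1 : Ideal.span {x} * (Ideal.span {x}).map (σ : R →+* R) = Ideal.span {(m.natAbs : R)} := by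
    rw [Ideal.map_span, Set.image_singleton, Ideal.span_singleton_mul_span_singleton]
    change Ideal.span {x * σ x} = _
    rw [hm]
    rcases Int.natAbs_eq m with h | h
    · conv_lhs => rw [h]
      rw [Int.cast_natCast]
    · conv_lhs => rw [h]
      rw [Int.cast_neg, Int.cast_natCast, Ideal.span_singleton_neg]
  have h2 := congrArg Ideal.absNorm h1
  rw [map_mul, absNorm_map, Ideal.absNorm_span_natCast, h.finrank] at h2
  refine Nat.pow_left_injective two_ne_zero ?_
  change _ ^ 2 = _ ^ 2
  rw [pow_two, h2]

/-- An element of small norm in a nonzero ideal. -/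
lemma exists_small (h : IsImagQuad R d s σ) {J : Ideal R} (hJ : J ≠ ⊥) :
    ∃ z ∈ J, z ≠ 0 ∧ (Ideal.absNorm (Ideal.span {z}) : ℝ) ≤ 2 * √d * Ideal.absNorm J := by
  set n := Ideal.absNorm J with hn
  have hn0 : 0 < n := Nat.pos_of_ne_zero (fun h0 => hJ (Ideal.absNorm_eq_zero_iff.1 h0))
  have hd0 : (0 : ℝ) < d := by have := h.three_lt; exact_mod_cast (by omega : 0 < d)
  have hsd : 0 < √(d : ℝ) := Real.sqrt_pos.2 hd0
  have hn0' : (0 : ℝ) < n := by exact_mod_cast hn0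
  set α : ℝ := √(n * √d) with hα
  set β : ℝ := √(n / √d) with hβ
  have hα2 : α ^ 2 = n * √d := Real.sq_sqrt (by positivity)
  have hβ2 : β ^ 2 = n / √d := Real.sq_sqrt (by positivity)
  have hαβ : α * β = n := by
    rw [hα, hβ, ← Real.sqrt_mul (by positivity),
      show (n * √d) * (n / √d) = (n : ℝ) ^ 2 by field_simp, Real.sqrt_sq hn0'.le]
  set A := ⌊α⌋₊
  set B := ⌊β⌋₊
  have hA := Nat.lt_floor_add_one α
  have hB := Nat.lt_floor_add_one β
  have hAB : n < (A + 1) * (B + 1) := by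
    have : (n : ℝ) < (A + 1) * (B + 1) := by
      rw [← hαβ]; exact mul_lt_mul'' hA hB (Real.sqrt_nonneg _) (Real.sqrt_nonneg _)
    exact_mod_cast this
  have hfin : Finite (R ⧸ J) := (Ideal.absNorm_ne_zero_iff J).1 hn0.ne'
  have := Fintype.ofFinite (R ⧸ J)
  have hcard : Fintype.card (R ⧸ J) < (Finset.range (A + 1) ×ˢ Finset.range (B + 1)).card := by
    rw [Finset.card_product, Finset.card_range, Finset.card_range, ← Nat.card_eq_fintype_card]
    exact hAB
  obtain ⟨x, hx, y, hy, hne, hxy⟩ := Finset.exists_ne_map_eq_of_card_lt_of_maps_to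
    (s := Finset.range (A + 1) ×ˢ Finset.range (B + 1)) (t := Finset.univ) hcard
    (f := fun x : ℕ × ℕ => Ideal.Quotient.mk J ((x.1 : R) + x.2 * s)) (fun _ _ => Finset.mem_univ _)
  rw [Finset.mem_product, Finset.mem_range, Finset.mem_range] at hx hy
  set a : ℤ := (x.1 : ℤ) - y.1 with ha
  set b : ℤ := (x.2 : ℤ) - y.2 with hb
  set z : R := a + b * s with hz
  have hzJ : z ∈ J := by
    have := Ideal.Quotient.eq.1 hxy
    convert this using 1
    rw [hz, ha, hb]; push_cast; ring
  have hz0 : z ≠ 0 := by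
    intro h0
    obtain ⟨h1, h2⟩ := h.eq_zero h0
    exact hne (Prod.ext (by omega) (by omega))
  obtain ⟨m, hm, hm4⟩ := h.norm_eq (x := z) (u := 2 * a) (v := 2 * b) (by rw [hz]; push_cast; ring)
  refine ⟨z, hzJ, hz0, ?_⟩
  rw [h.absNorm_span hm]
  have hm' : m = a ^ 2 + d * b ^ 2 := by linarith
  have hmnn : 0 ≤ m := by rw [hm']; positivity
  have e1 : ((m.natAbs : ℕ) : ℝ) = (m : ℝ) := by
    rw [← Int.cast_natCast, Int.natAbs_of_nonneg hmnn]
  have hsqd : √(d : ℝ) * √(d : ℝ) = d := Real.mul_self_sqrt hd0.le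
  have ha' : |(a : ℝ)| ≤ α := by
    have hAα : (A : ℝ) ≤ α := Nat.floor_le (Real.sqrt_nonneg _)
    have : |a| ≤ A := by rw [abs_le]; omega
    have : |(a : ℝ)| ≤ A := by exact_mod_cast this
    linarith
  have hb' : |(b : ℝ)| ≤ β := by
    have hBβ : (B : ℝ) ≤ β := Nat.floor_le (Real.sqrt_nonneg _)
    have : |b| ≤ B := by rw [abs_le]; omega
    have : |(b : ℝ)| ≤ B := by exact_mod_cast this
    linarith
  have ha2 : (a : ℝ) ^ 2 ≤ n * √d := by
    rw [← hα2, ← sq_abs]; gcongr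
  have hb2 : (b : ℝ) ^ 2 ≤ n / √d := by
    rw [← hβ2, ← sq_abs]; gcongr
  rw [e1, hm']
  push_cast
  calc (a : ℝ) ^ 2 + d * (b : ℝ) ^ 2 ≤ n * √d + d * (n / √d) := by gcongr
    _ = n * √d + n * (√d * √d / √d) := by rw [hsqd]; ring
    _ = 2 * √d * n := by field_simp; ring

/-- Every ideal class contains an ideal of small norm which is not divisible by an integer
greater than `1`. -/
lemma exists_primitive (h : IsImagQuad R d s σ) (c : ClassGroup R) :
    ∃ I : Ideal R, ∃ hI : I ∈ nonZeroDivisors (Ideal R), ClassGroup.mk0 ⟨I, hI⟩ = c ∧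
      (Ideal.absNorm I : ℝ) ≤ 2 * √d ∧ ∀ p : ℕ, p.Prime → ¬ I ≤ Ideal.span {(p : R)} := by
  have hex : ∃ n : ℕ, ∃ I : Ideal R, ∃ hI : I ∈ nonZeroDivisors (Ideal R),
      ClassGroup.mk0 ⟨I, hI⟩ = c ∧ Ideal.absNorm I = n := by
    obtain ⟨⟨I, hI⟩, hc⟩ := ClassGroup.mk0_surjective c
    exact ⟨_, I, hI, hc, rfl⟩
  classical
  obtain ⟨I, hI, hIc, hIn⟩ := Nat.find_spec hex
  have hmin : ∀ I' : Ideal R, ∀ hI' : I' ∈ nonZeroDivisors (Ideal R), ClassGroup.mk0 ⟨I', hI'⟩ = c →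
      Ideal.absNorm I ≤ Ideal.absNorm I' := fun I' hI' hc' => by
    rw [hIn]; exact Nat.find_min' hex ⟨I', hI', hc', rfl⟩
  have hI0 : I ≠ ⊥ := mem_nonZeroDivisors_iff_ne_zero.1 hI
  refine ⟨I, hI, hIc, ?_, ?_⟩
  · obtain ⟨⟨J, hJ⟩, hJc⟩ := ClassGroup.mk0_surjective c⁻¹
    have hJ0 : J ≠ ⊥ := mem_nonZeroDivisors_iff_ne_zero.1 hJ
    obtain ⟨z, hzJ, hz0, hzn⟩ := h.exists_small hJ0
    obtain ⟨I', hI'⟩ := Ideal.dvd_iff_le.2 ((Ideal.span_singleton_le_iff_mem J).2 hzJ)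
    have hzspan : Ideal.span {z} ≠ 0 := by
      rw [Ne, Ideal.zero_eq_bot, Ideal.span_singleton_eq_bot]; exact hz0
    have hI'0 : I' ∈ nonZeroDivisors (Ideal R) := by
      rw [mem_nonZeroDivisors_iff_ne_zero]
      rintro rfl
      rw [mul_zero] at hI'
      exact hzspan hI'
    have hc' : ClassGroup.mk0 ⟨I', hI'0⟩ = c := by
      have h1 : ClassGroup.mk0 ⟨J, hJ⟩ * ClassGroup.mk0 ⟨I', hI'0⟩ = 1 := by
        rw [← map_mul]
        have : (⟨J, hJ⟩ * ⟨I', hI'0⟩ : nonZeroDivisors (Ideal R)) =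
            ⟨Ideal.span {z}, mem_nonZeroDivisors_iff_ne_zero.2 hzspan⟩ := Subtype.ext hI'.symm
        rw [this, ClassGroup.mk0_eq_one_iff]
        exact ⟨⟨z, rfl⟩⟩
      rw [hJc, inv_mul_eq_one] at h1
      exact h1.symm
    have hle := hmin I' hI'0 hc'
    rw [hI', map_mul] at hzn
    push_cast at hzn
    have hJpos : (0 : ℝ) < Ideal.absNorm J := by
      have := Nat.pos_of_ne_zero (fun h0 => hJ0 (Ideal.absNorm_eq_zero_iff.1 h0))
      exact_mod_cast this
    have hle' : (Ideal.absNorm I : ℝ) ≤ Ideal.absNorm I' := by exact_mod_cast hle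
    refine hle'.trans (le_of_mul_le_mul_left ?_ hJpos)
    linarith
  · intro p hp hle
    obtain ⟨I', hI'⟩ := Ideal.dvd_iff_le.2 hle
    have hpspan : Ideal.span {(p : R)} ≠ 0 := by
      rw [Ne, Ideal.zero_eq_bot, Ideal.span_singleton_eq_bot]; exact_mod_cast hp.ne_zero
    have hI'ne : I' ≠ 0 := by rintro rfl; rw [mul_zero] at hI'; exact hI0 hI'
    have hI'0 : I' ∈ nonZeroDivisors (Ideal R) := mem_nonZeroDivisors_iff_ne_zero.2 hI'ne
    have hc' : ClassGroup.mk0 ⟨I', hI'0⟩ = c := by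
      rw [← hIc]
      have : (⟨I, hI⟩ : nonZeroDivisors (Ideal R)) =
          ⟨Ideal.span {(p : R)}, mem_nonZeroDivisors_iff_ne_zero.2 hpspan⟩ * ⟨I', hI'0⟩ :=
        Subtype.ext hI'
      rw [this, map_mul, (ClassGroup.mk0_eq_one_iff _).2 ⟨⟨(p : R), rfl⟩⟩, one_mul]
    have hle := hmin I' hI'0 hc'
    rw [hI', map_mul, Ideal.absNorm_span_natCast, h.finrank] at hle
    have hpos : 0 < Ideal.absNorm I' :=
      Nat.pos_of_ne_zero (fun h0 => hI'ne (Ideal.absNorm_eq_zero_iff.1 h0))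
    have h4 : 2 ^ 2 ≤ p ^ 2 := Nat.pow_le_pow_left hp.two_le 2
    have := Nat.mul_le_mul_right (Ideal.absNorm I') h4
    omega

/-- Ideals not divisible by an integer are described by few parameters. -/
lemma exists_params (h : IsImagQuad R d s σ) {I : Ideal R} (hI : I ≠ ⊥)
    (hprim : ∀ p : ℕ, p.Prime → ¬ I ≤ Ideal.span {(p : R)}) :
    ∃ e g r : ℕ, ∃ z : R, 2 * z = r + g * s ∧ (g = 1 ∨ g = 2) ∧ 0 < e ∧ e ≤ Ideal.absNorm I ∧
      r < 2 * e ∧ e ∣ r ^ 2 + g ^ 2 * d ∧ I = Ideal.span {(e : R), z} := by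
  -- the integers in `I`
  obtain ⟨e', he'⟩ := IsPrincipalIdealRing.principal (I.comap (Int.castRingHom R))
  have hmemZ : ∀ m : ℤ, (m : R) ∈ I ↔ e' ∣ m := fun m => by
    rw [← Ideal.mem_span_singleton, Ideal.span, ← he', Ideal.mem_comap]; rfl
  set e := e'.natAbs with he
  have hmem : ∀ m : ℤ, (m : R) ∈ I ↔ (e : ℤ) ∣ m := fun m => by
    rw [hmemZ, he, Int.natAbs_dvd]
  have hNpos : 0 < Ideal.absNorm I :=
    Nat.pos_of_ne_zero (fun h0 => hI (Ideal.absNorm_eq_zero_iff.1 h0))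
  have heN : e ∣ Ideal.absNorm I := by
    have := (hmem (Ideal.absNorm I)).1 (by rw [Int.cast_natCast]; exact Ideal.absNorm_mem I)
    exact_mod_cast this
  have he0 : 0 < e := Nat.pos_of_dvd_of_pos heN hNpos
  -- the coefficients of `s`
  let V : Ideal ℤ :=
    { carrier := {v | ∃ z ∈ I, ∃ u : ℤ, 2 * z = u + v * s}
      add_mem' := by
        rintro v w ⟨z, hz, u, hu⟩ ⟨z', hz', u', hu'⟩
        exact ⟨z + z', I.add_mem hz hz', u + u', by push_cast; linear_combination hu + hu'⟩
      zero_mem' := ⟨0, I.zero_mem, 0, by simp⟩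
      smul_mem' := by
        rintro c v ⟨z, hz, u, hu⟩
        exact ⟨c * z, I.mul_mem_left _ hz, c * u, by
          rw [smul_eq_mul]; push_cast; linear_combination (c : R) * hu⟩ }
  have hVmem : ∀ v : ℤ, v ∈ V ↔ ∃ z ∈ I, ∃ u : ℤ, 2 * z = u + v * s := fun v => Iff.rfl
  obtain ⟨g', hg'⟩ := IsPrincipalIdealRing.principal V
  set g := g'.natAbs with hg
  have hV : ∀ v : ℤ, (∃ z ∈ I, ∃ u : ℤ, 2 * z = u + v * s) ↔ (g : ℤ) ∣ v := fun v => by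
    rw [← hVmem, hg, Int.natAbs_dvd, hg']; exact Ideal.mem_span_singleton
  have hgv : ∀ z ∈ I, ∀ u v : ℤ, 2 * z = u + v * s → (g : ℤ) ∣ u ∧ (g : ℤ) ∣ v := by
    intro z hz u v huv
    refine ⟨(hV u).1 ⟨s * z, I.mul_mem_left _ hz, -d * v, ?_⟩, (hV v).1 ⟨z, hz, u, huv⟩⟩
    push_cast
    linear_combination s * huv + v * h.sq
  have hg0 : g ≠ 0 := by
    intro h0
    have h1 := (hgv (e : R) (by have := (hmem e).2 dvd_rfl; simpa using this) (2 * e) 0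
      (by push_cast; ring)).1
    rw [h0] at h1
    simp at h1; omega
  have hg2 : g = 1 ∨ g = 2 := by
    have hp : ∀ p : ℕ, p.Prime → p ≠ 2 → ¬ p ∣ g := by
      intro p hp hp2 hpg
      refine hprim p hp fun z hz => ?_
      obtain ⟨u, v, huv⟩ := h.rep z
      obtain ⟨h1, h2⟩ := hgv z hz u v huv
      have hpg' : (p : ℤ) ∣ g := by exact_mod_cast hpg
      rw [Ideal.mem_span_singleton, ← Int.cast_natCast]
      exact dvd_of_odd huv (by exact_mod_cast hp.odd_of_ne_two hp2) (hpg'.trans h1) (hpg'.trans h2)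
    have h4 : ¬ 4 ∣ g := by
      intro h4
      refine hprim 2 Nat.prime_two fun z hz => ?_
      obtain ⟨u, v, huv⟩ := h.rep z
      obtain ⟨h1, h2⟩ := hgv z hz u v huv
      have hpg' : (4 : ℤ) ∣ g := by exact_mod_cast h4
      rw [Ideal.mem_span_singleton, Nat.cast_ofNat]
      exact two_dvd_of_four huv (hpg'.trans h1) (hpg'.trans h2)
    have hpow : g = 2 ^ g.primeFactorsList.length :=
      Nat.eq_prime_pow_of_unique_prime_dvd hg0 fun {p} hp' hpg => by
        by_contra hne; exact hp p hp' hne hpg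
    rcases hl : g.primeFactorsList.length with _ | _ | n
    · left; rw [hl] at hpow; simpa using hpow
    · right; rw [hl] at hpow; simpa using hpow
    · exfalso; apply h4; rw [hpow, hl]; exact ⟨2 ^ n, by ring⟩
  obtain ⟨z₁, hz₁, u₁, hu₁⟩ := (hV g).2 dvd_rfl
  -- reduce the first coordinate
  set r : ℕ := (u₁ % (2 * e : ℤ)).toNat with hr
  have h2e : (0 : ℤ) < 2 * e := by omega
  have hrZ : (r : ℤ) = u₁ % (2 * e) := Int.toNat_of_nonneg (Int.emod_nonneg _ h2e.ne')
  have hrlt : r < 2 * e := by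
    have := Int.emod_lt_of_pos u₁ h2e
    omega
  set t : ℤ := u₁ / (2 * e) with ht
  have hut : u₁ = r + 2 * e * t := by rw [hrZ]; exact (Int.emod_add_mul_ediv _ _).symm
  set z : R := z₁ - e * t with hz
  have heI : (e : R) ∈ I := by have := (hmem e).2 dvd_rfl; simpa using this
  have hzI : z ∈ I := I.sub_mem hz₁ (I.mul_mem_right _ heI)
  have h2z : 2 * z = ((r : ℤ) : R) + ((g : ℤ) : R) * s := by
    rw [hz, mul_sub, hu₁, hut]; push_cast; ring
  refine ⟨e, g, r, z, by simpa using h2z, hg2, he0, Nat.le_of_dvd hNpos heN, hrlt, ?_, ?_⟩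
  · obtain ⟨m, hm, hm4⟩ := h.norm_eq h2z
    have h1 : (e : ℤ) ∣ m := (hmem m).1 (by rw [← hm]; exact I.mul_mem_right _ hzI)
    have h2 : (e : ℤ) ∣ (r : ℤ) ^ 2 + (g : ℤ) ^ 2 * d := by
      rw [show (r : ℤ) ^ 2 + (g : ℤ) ^ 2 * d = 4 * m by rw [hm4]; ring]
      exact dvd_mul_of_dvd_right h1 _
    exact_mod_cast h2
  · refine le_antisymm (fun y hy => ?_) ?_
    · obtain ⟨u, v, huv⟩ := h.rep y
      obtain ⟨k, hk⟩ := (hgv y hy u v huv).2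
      have h2y : 2 * (y - k * z) = ((u - k * r : ℤ) : R) := by
        rw [mul_sub, huv, hk]
        push_cast
        push_cast at h2z
        linear_combination (-k : R) * h2z
      obtain ⟨w, hw⟩ := h.int_dvd (m := 2) (a := u - k * r) ⟨y - k * z, by rw [← h2y]; norm_num⟩
      have hyw : y - k * z = w := by
        rw [hw] at h2y
        push_cast at h2y
        exact mul_left_cancel₀ two_ne_zero h2y
      obtain ⟨f, hf⟩ := (hmem w).1 (by rw [← hyw]; exact I.sub_mem hy (I.mul_mem_left _ hzI))
      rw [Ideal.mem_span_pair]
      refine ⟨f, k, ?_⟩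
      rw [hf] at hyw
      push_cast at hyw
      linear_combination -hyw
    · rw [Ideal.span_le]
      rintro x (rfl | rfl)
      · exact heI
      · exact hzI

end IsImagQuad

/-- A bound for the class number. -/
theorem exists_card_classGroup_le {ε : ℝ} (hε : 0 < ε) : ∃ C : ℝ, 0 < C ∧
    ∀ {R : Type} [CommRing R] [IsDedekindDomain R] [CharZero R] [Module.Free ℤ R]
      [Module.Finite ℤ R] {d : ℕ} {s : R} {σ : R ≃+* R}, IsImagQuad R d s σ →
      (Nat.card (ClassGroup R) : ℝ) ≤ C * (d : ℝ) ^ (1 / 2 + ε) := by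
  obtain ⟨D, hD1, hD⟩ := exists_card_divisors_le hε
  refine ⟨2 * 5 * (D * 20 ^ ε), by positivity, ?_⟩
  intro R _ _ _ _ _ d s σ h
  have hd0 : (0 : ℝ) < d := by have := h.three_lt; exact_mod_cast (by omega : 0 < d)
  have hd1 : (1 : ℝ) ≤ √(d : ℝ) := by
    have := h.three_lt
    rw [Real.one_le_sqrt]; exact_mod_cast (by omega : 1 ≤ d)
  have hparam : ∀ c : ClassGroup R, ∃ e g r : ℕ, ∃ z : R, ∃ I : Ideal R,
      ∃ hI : I ∈ nonZeroDivisors (Ideal R), ClassGroup.mk0 ⟨I, hI⟩ = c ∧ 2 * z = r + g * s ∧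
      (g = 1 ∨ g = 2) ∧ 0 < e ∧ (e : ℝ) ≤ 2 * √d ∧ r < 2 * e ∧ e ∣ r ^ 2 + g ^ 2 * d ∧
      I = Ideal.span {(e : R), z} := by
    intro c
    obtain ⟨I, hI, hc, hn, hp⟩ := h.exists_primitive c
    obtain ⟨e, g, r, z, h1, h2, h3, h4, h5, h6, h7⟩ :=
      h.exists_params (mem_nonZeroDivisors_iff_ne_zero.1 hI) hp
    exact ⟨e, g, r, z, I, hI, hc, h1, h2, h3, le_trans (by exact_mod_cast h4) hn, h5, h6, h7⟩
  choose e g r z I hI hc hz hg he0 he hr hdvd hIe using hparam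
  set N := ⌊4 * √(d : ℝ)⌋₊ with hN
  set T := ({1, 2} ×ˢ Finset.range (N + 1) : Finset (ℕ × ℕ)).sigma
    (fun x => (x.2 ^ 2 + x.1 ^ 2 * d).divisors) with hT
  have hrN : ∀ c, r c ≤ N := fun c => by
    refine Nat.le_floor ?_
    have h1 : (r c : ℝ) < 2 * e c := by exact_mod_cast hr c
    have := he c
    linarith
  have hmaps : ∀ c : ClassGroup R, (⟨(g c, r c), e c⟩ : Σ _ : ℕ × ℕ, ℕ) ∈ T := by
    intro c
    rw [hT, Finset.mem_sigma, Finset.mem_product, Finset.mem_range]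
    refine ⟨⟨by rcases hg c with h | h <;> simp [h], Nat.lt_succ_of_le (hrN c)⟩,
      Nat.mem_divisors.2 ⟨hdvd c, ?_⟩⟩
    have := h.three_lt
    rcases hg c with h | h <;> simp only [h] <;> positivity
  have hinj : Function.Injective
      (fun c : ClassGroup R => (⟨⟨(g c, r c), e c⟩, hmaps c⟩ : T)) := by
    intro c c' hcc
    have h1 : (⟨(g c, r c), e c⟩ : Σ _ : ℕ × ℕ, ℕ) = ⟨(g c', r c'), e c'⟩ := congrArg Subtype.val hcc
    obtain ⟨h2, h3⟩ := Sigma.mk.inj h1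
    obtain ⟨h4, h5⟩ := Prod.mk.inj h2
    have h6 : e c = e c' := eq_of_heq h3
    have hzz : z c = z c' := by
      refine mul_left_cancel₀ (two_ne_zero (α := R)) ?_
      rw [hz, hz, h4, h5]
    rw [← hc c, ← hc c']
    congr 1
    refine Subtype.ext ?_
    change I c = I c'
    rw [hIe, hIe, h6, hzz]
  have hcard : Nat.card (ClassGroup R) ≤ T.card := by
    have := Nat.card_le_card_of_injective _ hinj
    simpa using this
  have hNle : (N : ℝ) ≤ 4 * √d := Nat.floor_le (by positivity)
  have hdiv : ∀ x ∈ ({1, 2} ×ˢ Finset.range (N + 1) : Finset (ℕ × ℕ)),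
      ((x.2 ^ 2 + x.1 ^ 2 * d).divisors.card : ℝ) ≤ D * 20 ^ ε * (d : ℝ) ^ ε := by
    intro x hx
    rw [Finset.mem_product, Finset.mem_range] at hx
    have hx1 : x.1 = 1 ∨ x.1 = 2 := by simpa using hx.1
    have hx2 : (x.2 : ℝ) ≤ 4 * √d := le_trans (by exact_mod_cast Nat.lt_succ_iff.1 hx.2) hNle
    have hne : x.2 ^ 2 + x.1 ^ 2 * d ≠ 0 := by
      have := h.three_lt
      rcases hx1 with h | h <;> rw [h] <;> positivity
    refine (hD _ hne).trans ?_
    rw [mul_assoc, ← Real.mul_rpow (by norm_num) hd0.le]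
    gcongr
    push_cast
    have h1 : (x.2 : ℝ) ^ 2 ≤ 16 * (d : ℝ) := by
      have h0 : (x.2 : ℝ) ^ 2 ≤ (4 * √(d : ℝ)) ^ 2 := by gcongr
      rw [mul_pow, Real.sq_sqrt hd0.le] at h0
      linarith
    have h2 : (x.1 : ℝ) ^ 2 ≤ 4 := by rcases hx1 with h | h <;> rw [h] <;> norm_num
    nlinarith
  calc (Nat.card (ClassGroup R) : ℝ) ≤ T.card := by exact_mod_cast hcard
    _ = ∑ x ∈ ({1, 2} ×ˢ Finset.range (N + 1) : Finset (ℕ × ℕ)),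
        ((x.2 ^ 2 + x.1 ^ 2 * d).divisors.card : ℝ) := by
        rw [hT, Finset.card_sigma]; push_cast; rfl
    _ ≤ ∑ x ∈ ({1, 2} ×ˢ Finset.range (N + 1) : Finset (ℕ × ℕ)), D * 20 ^ ε * (d : ℝ) ^ ε :=
        Finset.sum_le_sum hdiv
    _ = 2 * (N + 1) * (D * 20 ^ ε * (d : ℝ) ^ ε) := by
        rw [Finset.sum_const, Finset.card_product, Finset.card_range, nsmul_eq_mul]
        simp
    _ ≤ 2 * (5 * √d) * (D * 20 ^ ε * (d : ℝ) ^ ε) := by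
        gcongr
        linarith
    _ = _ := by rw [Real.rpow_add hd0, ← Real.sqrt_eq_rpow]; ring

lemma sq_card_le_card_mul {α β : Type*} [DecidableEq α] [DecidableEq β] (s : Finset α)
    (t : Finset β) (f : α → β) (hf : ∀ x ∈ s, f x ∈ t) :
    s.card ^ 2 ≤ t.card * ((s ×ˢ s).filter (fun x => f x.1 = f x.2)).card := by
  have h1 : s.card = ∑ b ∈ t, (s.filter (fun x => f x = b)).card :=
    Finset.card_eq_sum_card_fiberwise hf
  have h2 : ((s ×ˢ s).filter (fun x => f x.1 = f x.2)).card =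
      ∑ b ∈ t, (s.filter (fun x => f x = b)).card ^ 2 := by
    rw [Finset.card_eq_sum_card_fiberwise (f := fun x => f x.1) (t := t)
      (fun x hx => hf _ (Finset.mem_product.1 (Finset.mem_filter.1 hx).1).1)]
    refine Finset.sum_congr rfl fun b _ => ?_
    rw [pow_two, ← Finset.card_product]
    congr 1
    ext x
    simp only [Finset.mem_filter, Finset.mem_product]
    constructor
    · rintro ⟨⟨⟨h1, h2⟩, h3⟩, h4⟩; exact ⟨⟨h1, h4⟩, h2, h3 ▸ h4⟩
    · rintro ⟨⟨h1, h4⟩, h2, h3⟩; exact ⟨⟨⟨h1, h2⟩, h4.trans h3.symm⟩, h4⟩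
  rw [h1, h2]
  exact sq_sum_le_card_mul_sum_sq

/-- Elements with few coincidences among their `n`-th powers force `n`-torsion to be small. -/
lemma card_torsion_mul_sq_le {G α : Type*} [CommGroup G] [Finite G] [DecidableEq G] [DecidableEq α]
    (n : ℕ) (s : Finset α) (f : α → G) :
    Nat.card {c : G // c ^ n = 1} * s.card ^ 2 ≤
      Nat.card G * ((s ×ˢ s).filter (fun x => f x.1 ^ n = f x.2 ^ n)).card := by
  have := Fintype.ofFinite G
  set φ : G →* G := powMonoidHom n
  have h1 : Nat.card {c : G // c ^ n = 1} * (Finset.univ.image φ).card = Nat.card G := by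
    have e1 : Nat.card {c : G // c ^ n = 1} = Nat.card φ.ker :=
      Nat.card_congr (Equiv.subtypeEquivRight fun c => by rw [MonoidHom.mem_ker]; rfl)
    have e2 : (Finset.univ.image φ).card = Nat.card φ.range := by
      rw [← Set.ncard_coe_finset, Finset.coe_image, Finset.coe_univ, Set.image_univ,
        ← MonoidHom.coe_range]
      rfl
    rw [e1, e2, Subgroup.card_eq_card_quotient_mul_card_subgroup φ.ker, mul_comm]
    congr 1
    exact Nat.card_congr (QuotientGroup.quotientKerEquivRange φ).symm.toEquiv
  have h2 := sq_card_le_card_mul s (Finset.univ.image φ) (fun x => φ (f x))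
    (fun x _ => Finset.mem_image_of_mem _ (Finset.mem_univ _))
  rw [← h1, mul_assoc]
  exact Nat.mul_le_mul_left _ h2

namespace IsImagQuad

set_option linter.unusedSectionVars false

variable {R : Type*} [CommRing R] [IsDedekindDomain R] [CharZero R] [Module.Free ℤ R]
  [Module.Finite ℤ R] {d : ℕ} {s : R} {σ : R ≃+* R}

/-- The ideal above a prime `q` given by a square root `b` of `-d` modulo `q`. -/
abbrev primeAbove (s : R) (q : ℕ) (b : ℤ) : Ideal R := Ideal.span {(q : R), (b : R) + s}

lemma isCoprime_two_mul {q : ℕ} {b : ℤ} (hq : q.Prime) (hqd : ¬ q ∣ 6 * d)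
    (hb : (q : ℤ) ∣ b ^ 2 + d) : IsCoprime (q : ℤ) (2 * b) := by
  rw [(Nat.prime_iff_prime_int.1 hq).coprime_iff_not_dvd]
  intro h
  rcases (Nat.prime_iff_prime_int.1 hq).dvd_or_dvd h with h | h
  · have : q ∣ 2 := by exact_mod_cast h
    exact hqd (this.trans ⟨3 * d, by ring⟩)
  · have h2 : (q : ℤ) ∣ d := (dvd_add_right (h.pow two_ne_zero)).1 hb
    exact hqd (Dvd.dvd.mul_left (by exact_mod_cast h2) 6)

lemma map_primeAbove (h : IsImagQuad R d s σ) (q : ℕ) (b : ℤ) :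
    (primeAbove s q b).map (σ : R →+* R) = Ideal.span {(q : R), (b : R) - s} := by
  rw [Ideal.map_span, Set.image_pair]
  simp [h.conj, sub_eq_add_neg]

lemma primeAbove_mul_map (h : IsImagQuad R d s σ) {q : ℕ} {b : ℤ} (hq : q.Prime)
    (hqd : ¬ q ∣ 6 * d) (hb : (q : ℤ) ∣ b ^ 2 + d) :
    primeAbove s q b * (primeAbove s q b).map (σ : R →+* R) = Ideal.span {(q : R)} := by
  rw [h.map_primeAbove, Ideal.span_pair_mul_span_pair]
  obtain ⟨k, hk⟩ := hb
  have hk' : ((b : R) + s) * (b - s) = q * k := by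
    have : ((b : R)) ^ 2 + d = q * k := by exact_mod_cast congrArg (Int.cast (R := R)) hk
    linear_combination this - h.sq
  refine le_antisymm ?_ ?_
  · rw [Ideal.span_le]
    rintro x (rfl | rfl | rfl | rfl) <;> rw [SetLike.mem_coe, Ideal.mem_span_singleton]
    · exact dvd_mul_right _ _
    · exact dvd_mul_right _ _
    · exact dvd_mul_left _ _
    · exact ⟨k, hk'⟩
  · rw [Ideal.span_singleton_le_iff_mem]
    obtain ⟨x, y, hxy⟩ := isCoprime_two_mul hq hqd ⟨k, hk⟩
    have hxy' : (x : R) * q + y * (2 * b) = 1 := by exact_mod_cast congrArg (Int.cast (R := R)) hxy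
    have : (q : R) = x * (q * q) + y * (q * (b - s)) + y * ((b + s) * q) := by
      linear_combination (-q : R) * hxy'
    have hmem : (x * (q * q) + y * (q * (b - s)) + y * ((b + s) * q) : R) ∈ Ideal.span
        {(q : R) * q, q * (b - s), (b + s) * q, (b + s) * (b - s)} :=
      Ideal.add_mem _ (Ideal.add_mem _ (Ideal.mul_mem_left _ _ (Ideal.subset_span (by simp)))
      (Ideal.mul_mem_left _ _ (Ideal.subset_span (by simp))))
      (Ideal.mul_mem_left _ _ (Ideal.subset_span (by simp)))
    rwa [← this] at hmem

lemma isCoprime_primeAbove_map (h : IsImagQuad R d s σ) {q : ℕ} {b : ℤ} (hq : q.Prime)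
    (hqd : ¬ q ∣ 6 * d) (hb : (q : ℤ) ∣ b ^ 2 + d) :
    IsCoprime (primeAbove s q b) ((primeAbove s q b).map (σ : R →+* R)) := by
  rw [Ideal.isCoprime_iff_exists, h.map_primeAbove]
  obtain ⟨x, y, hxy⟩ := isCoprime_two_mul hq hqd hb
  have hxy' : (x : R) * q + y * (2 * b) = 1 := by exact_mod_cast congrArg (Int.cast (R := R)) hxy
  refine ⟨x * q + y * (b + s), ?_, y * (b - s), ?_, by linear_combination hxy'⟩
  · exact Ideal.add_mem _ (Ideal.mul_mem_left _ _ (Ideal.subset_span (by simp)))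
      (Ideal.mul_mem_left _ _ (Ideal.subset_span (by simp)))
  · exact Ideal.mul_mem_left _ _ (Ideal.subset_span (by simp))

lemma isCoprime_of_mem {I J : Ideal R} {q q' : ℕ} (hI : (q : R) ∈ I) (hJ : (q' : R) ∈ J)
    (hqq : q.Coprime q') : IsCoprime I J := by
  rw [Ideal.isCoprime_iff_exists]
  obtain ⟨x, y, hxy⟩ := Nat.isCoprime_iff_coprime.2 hqq
  have hxy' : (x : R) * q + y * q' = 1 := by exact_mod_cast congrArg (Int.cast (R := R)) hxy
  exact ⟨x * q, I.mul_mem_left _ hI, y * q', J.mul_mem_left _ hJ, hxy'⟩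

lemma absNorm_primeAbove (h : IsImagQuad R d s σ) {q : ℕ} {b : ℤ} (hq : q.Prime)
    (hqd : ¬ q ∣ 6 * d) (hb : (q : ℤ) ∣ b ^ 2 + d) :
    Ideal.absNorm (primeAbove s q b) = q := by
  have h2 := congrArg Ideal.absNorm (h.primeAbove_mul_map hq hqd hb)
  rw [map_mul, absNorm_map, Ideal.absNorm_span_natCast, h.finrank, ← pow_two] at h2
  exact Nat.pow_left_injective two_ne_zero h2

lemma cubeSol_of_norm {u v : ℤ} {a : ℕ} (ha : 1 < a) (hodd : Odd a)
    (huv : 4 * (a : ℤ) ^ 3 = u ^ 2 + d * v ^ 2)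
    (hp : ∀ p : ℕ, p.Prime → p ≠ 2 → p ∣ a → (p : ℤ) ∣ u → (p : ℤ) ∣ v → False) :
    CubeSol 1 1 d a ∨ CubeSol 4 1 d a := by
  have ha3 : 1 < (a : ℤ) ^ 3 := by
    have : (1 : ℤ) < a := by exact_mod_cast ha
    exact one_lt_pow₀ this (by norm_num)
  have key : ∀ p : ℕ, p.Prime → p ≠ 2 → (p : ℤ) ∣ u → (p : ℤ) ∣ v → False := by
    intro p hpp hp2 h1 h2
    have h3 : (p : ℤ) ∣ 4 * (a : ℤ) ^ 3 := by
      rw [huv]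
      exact dvd_add (h1.pow two_ne_zero) ((h2.pow two_ne_zero).mul_left _)
    have h4 : p ∣ 4 * a ^ 3 := by exact_mod_cast h3
    refine hp p hpp hp2 ?_ h1 h2
    rcases (Nat.Prime.dvd_mul hpp).1 h4 with h5 | h5
    · exact absurd ((Nat.prime_dvd_prime_iff_eq hpp Nat.prime_two).1
        (hpp.dvd_of_dvd_pow (n := 2) (by simpa using h5))) hp2
    · exact hpp.dvd_of_dvd_pow h5
  have hv0 : ∀ u v κ : ℤ, 1 ≤ κ → κ * (a : ℤ) ^ 3 = u ^ 2 + d * v ^ 2 → IsCoprime u v → v ≠ 0 := by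
    rintro u v κ hκ h1 h2 rfl
    have h3 : IsUnit u := isCoprime_zero_right.1 h2
    have h4 : u ^ 2 = 1 := by rcases Int.isUnit_iff.1 h3 with h | h <;> rw [h] <;> norm_num
    rw [h4] at h1
    nlinarith
  by_cases h2 : (2 : ℤ) ∣ u ∧ (2 : ℤ) ∣ v
  · obtain ⟨⟨u₁, rfl⟩, ⟨v₁, rfl⟩⟩ := h2
    have e : 1 * (a : ℤ) ^ 3 = u₁ ^ 2 + d * v₁ ^ 2 := by linarith
    have hc : IsCoprime u₁ v₁ := by
      refine Int.isCoprime_iff_gcd_eq_one.2 (Nat.coprime_of_dvd fun p hpp h1 h2 => ?_)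
      have h1' : (p : ℤ) ∣ u₁ := Int.natCast_dvd.2 h1
      have h2' : (p : ℤ) ∣ v₁ := Int.natCast_dvd.2 h2
      by_cases hp2 : p = 2
      · subst hp2
        have h3 : ((2 : ℕ) : ℤ) ∣ (a : ℤ) ^ 3 := by
          rw [← one_mul ((a : ℤ) ^ 3), e]
          exact dvd_add (h1'.pow two_ne_zero) ((h2'.pow two_ne_zero).mul_left _)
        have h4 : 2 ∣ a ^ 3 := by exact_mod_cast h3
        have := Nat.prime_two.dvd_of_dvd_pow h4
        rw [← Nat.not_even_iff_odd] at hodd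
        exact hodd (even_iff_two_dvd.2 this)
      · exact key p hpp hp2 (h1'.mul_left _) (h2'.mul_left _)
    refine Or.inl ⟨u₁, v₁, hv0 _ _ 1 le_rfl e hc, hc, by linarith, ?_⟩
    nlinarith [sq_nonneg u₁]
  · have hc : IsCoprime u v := by
      refine Int.isCoprime_iff_gcd_eq_one.2 (Nat.coprime_of_dvd fun p hpp h1 h3 => ?_)
      have h1' : (p : ℤ) ∣ u := Int.natCast_dvd.2 h1
      have h2' : (p : ℤ) ∣ v := Int.natCast_dvd.2 h3
      by_cases hp2 : p = 2
      · subst hp2; exact h2 ⟨h1', h2'⟩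
      · exact key p hpp hp2 h1' h2'
    refine Or.inr ⟨u, v, hv0 _ _ 4 (by norm_num) huv hc, hc, by linarith, ?_⟩
    nlinarith [sq_nonneg u]

lemma cubeSol_of_mk0_eq (h : IsImagQuad R d s σ) {q q' : ℕ} {b b' : ℤ} (hq : q.Prime)
    (hqd : ¬ q ∣ 6 * d) (hb : (q : ℤ) ∣ b ^ 2 + d) (hq' : q'.Prime)
    (hqd' : ¬ q' ∣ 6 * d) (hb' : (q' : ℤ) ∣ b' ^ 2 + d) (hne : q ≠ q')
    (h0 : primeAbove s q b ∈ nonZeroDivisors (Ideal R))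
    (h0' : primeAbove s q' b' ∈ nonZeroDivisors (Ideal R))
    (heq : ClassGroup.mk0 ⟨_, h0⟩ ^ 3 = ClassGroup.mk0 ⟨_, h0'⟩ ^ 3) :
    CubeSol 1 1 d (q * q') ∨ CubeSol 4 1 d (q * q') := by
  set I := primeAbove s q b with hI
  set I' := primeAbove s q' b' with hI'
  have hIm := h.primeAbove_mul_map hq hqd hb
  have hIm' := h.primeAbove_mul_map hq' hqd' hb'
  have hN := h.absNorm_primeAbove hq hqd hb
  have hN' := h.absNorm_primeAbove hq' hqd' hb'
  have hcop := h.isCoprime_primeAbove_map hq hqd hb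
  have hcop' := h.isCoprime_primeAbove_map hq' hqd' hb'
  rw [← hI] at hIm hN hcop
  rw [← hI'] at hIm' hN' hcop'
  have hIbar : I.map (σ : R →+* R) = Ideal.span {(q : R), (b : R) - s} := h.map_primeAbove q b
  have hIbar' : I'.map (σ : R →+* R) = Ideal.span {(q' : R), (b' : R) - s} := h.map_primeAbove q' b'
  set J := I.map (σ : R →+* R) with hJ
  set J' := I'.map (σ : R →+* R) with hJ'
  have mI : (q : R) ∈ I := Ideal.subset_span (by simp)
  have mI' : (q' : R) ∈ I' := Ideal.subset_span (by simp)
  have mJ : (q : R) ∈ J := by rw [hIbar]; exact Ideal.subset_span (by simp)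
  have mJ' : (q' : R) ∈ J' := by rw [hIbar']; exact Ideal.subset_span (by simp)
  have hqq : q.Coprime q' := (Nat.coprime_primes hq hq').2 hne
  have hJ0' : J' ∈ nonZeroDivisors (Ideal R) := by
    rw [mem_nonZeroDivisors_iff_ne_zero]
    intro h0
    rw [h0, Ideal.zero_eq_bot, Ideal.mem_bot] at mJ'
    exact hq'.ne_zero (by exact_mod_cast mJ')
  have hmk : ClassGroup.mk0 (⟨I, h0⟩ ^ 3 * ⟨J', hJ0'⟩ ^ 3) = 1 := by
    rw [map_mul, map_pow, map_pow, heq, ← mul_pow, ← map_mul]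
    have : (⟨I', h0'⟩ * ⟨J', hJ0'⟩ : nonZeroDivisors (Ideal R)) =
        ⟨Ideal.span {(q' : R)}, by rw [← hIm']; exact mul_mem h0' hJ0'⟩ := Subtype.ext hIm'
    rw [this, (ClassGroup.mk0_eq_one_iff _).2 ⟨⟨(q' : R), rfl⟩⟩, one_pow]
  obtain ⟨⟨γ, hγ⟩⟩ := (ClassGroup.mk0_eq_one_iff _).1 hmk
  have hγ : I ^ 3 * J' ^ 3 = Ideal.span {γ} := hγ
  obtain ⟨u, v, huv⟩ := h.rep γ
  obtain ⟨m, hm, hm4⟩ := h.norm_eq huv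
  have hNJ' : Ideal.absNorm J' = q' := by rw [hJ', absNorm_map, hN']
  have hm3 : m.natAbs = (q * q') ^ 3 := by
    rw [← h.absNorm_span hm, ← hγ, map_mul, map_pow, map_pow, hN, hNJ', mul_pow]
  have hm0 : 0 ≤ m := by
    have : 0 ≤ 4 * m := by rw [hm4]; positivity
    omega
  have hm3' : m = ((q * q' : ℕ) : ℤ) ^ 3 := by
    rw [← Int.natAbs_of_nonneg hm0, hm3]; push_cast; ring
  have hq2 : ∀ q : ℕ, q.Prime → ¬ q ∣ 6 * d → Odd q := fun q hq hqd => by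
    refine hq.odd_of_ne_two ?_
    rintro rfl
    exact hqd ⟨3 * d, by ring⟩
  refine cubeSol_of_norm (u := u) (v := v) ?_ ((hq2 q hq hqd).mul (hq2 q' hq' hqd')) ?_ ?_
  · have := hq.two_le
    have := hq'.two_le
    nlinarith
  · rw [← hm3', hm4]
  · intro p hp hp2 hpa hpu hpv
    have hpγ : ((p : ℤ) : R) ∣ γ :=
      dvd_of_odd huv (by exact_mod_cast hp.odd_of_ne_two hp2) hpu hpv
    rw [Int.cast_natCast] at hpγ
    have hle : ∀ K : Ideal R, (p : R) ∈ K → I ^ 3 * J' ^ 3 ≤ K := fun K hK => by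
      rw [hγ, Ideal.span_singleton_le_iff_mem]
      exact K.mem_of_dvd hpγ hK
    have htop : ∀ K : Ideal R, IsCoprime (I ^ 3 * J' ^ 3) K → (p : R) ∈ K → K = ⊤ := by
      intro K hK hpK
      have := Ideal.isCoprime_iff_sup_eq.1 hK
      rwa [sup_eq_right.2 (hle K hpK)] at this
    rcases (Nat.Prime.dvd_mul hp).1 hpa with h5 | h5
    · obtain rfl := (Nat.prime_dvd_prime_iff_eq hp hq).1 h5
      have := htop J ((hcop.pow_left).mul_left (isCoprime_of_mem mJ' mJ hqq.symm).pow_left) mJ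
      have h6 : Ideal.absNorm J = p := by rw [hJ, absNorm_map, hN]
      rw [this, Ideal.absNorm_top] at h6
      exact hp.one_lt.ne h6
    · obtain rfl := (Nat.prime_dvd_prime_iff_eq hp hq').1 h5
      have := htop I' ((isCoprime_of_mem mI mI' hqq).pow_left.mul_left hcop'.symm.pow_left) mI'
      rw [this, Ideal.absNorm_top] at hN'
      exact hp.one_lt.ne hN'

open Classical in
lemma card_torsion_mul_sq_le_card_filter (h : IsImagQuad R d s σ) [Finite (ClassGroup R)]
    (Q : Finset ℕ)
    (hQ : ∀ q ∈ Q, q.Prime ∧ ¬ q ∣ 6 * d ∧ ∃ b : ℤ, (q : ℤ) ∣ b ^ 2 + d) :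
    Nat.card {c : ClassGroup R // c ^ 3 = 1} * Q.card ^ 2 ≤ Nat.card (ClassGroup R) *
      (Q.card + (Q.offDiag.filter
        (fun x => CubeSol 1 1 d (x.1 * x.2) ∨ CubeSol 4 1 d (x.1 * x.2))).card) := by
  have hch : ∀ q : Q, ∃ b : ℤ, ((q : ℕ) : ℤ) ∣ b ^ 2 + d := fun q => (hQ q q.2).2.2
  choose b hb using hch
  have h0 : ∀ q : Q, primeAbove s q (b q) ∈ nonZeroDivisors (Ideal R) := fun q => by
    rw [mem_nonZeroDivisors_iff_ne_zero]
    intro h0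
    have : ((q : ℕ) : R) ∈ primeAbove s q (b q) := Ideal.subset_span (by simp)
    rw [h0, Ideal.zero_eq_bot, Ideal.mem_bot] at this
    exact (hQ q q.2).1.ne_zero (by exact_mod_cast this)
  let f : ℕ → ClassGroup R := fun q =>
    if hq : q ∈ Q then ClassGroup.mk0 ⟨_, h0 ⟨q, hq⟩⟩ else 1
  refine (card_torsion_mul_sq_le 3 Q f).trans (Nat.mul_le_mul_left _ ?_)
  rw [← Finset.diag_card Q]
  refine (Finset.card_le_card ?_).trans (Finset.card_union_le _ _)
  rintro ⟨q, q'⟩ hx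
  simp only [Finset.mem_filter, Finset.mem_product] at hx
  obtain ⟨⟨hq, hq'⟩, he⟩ := hx
  rw [Finset.mem_union, Finset.mem_diag, Finset.mem_filter, Finset.mem_offDiag]
  by_cases hne : q = q'
  · exact Or.inl ⟨hq, hne⟩
  · refine Or.inr ⟨⟨hq, hq', hne⟩, ?_⟩
    simp only [f, hq, hq', dif_pos] at he
    exact h.cubeSol_of_mk0_eq (hQ q hq).1 (hQ q hq).2.1 (hb ⟨q, hq⟩) (hQ q' hq').1 (hQ q' hq').2.1
      (hb ⟨q', hq'⟩) hne _ _ he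

end IsImagQuad

open NumberField in
lemma exists_isImagQuad {K : Type*} [Field K] [NumberField K] {d : ℕ} (hd : Squarefree d)
    (h3 : 3 < d) (t : K) (ht : t ^ 2 = -(d : K)) (hK : Module.finrank ℚ K = 2)
    (hrep : ∀ x : K, ∃ a b : ℚ, x = a + b * t) (τ : K ≃+* K) (hτ : τ t = -t) :
    ∃ (s : 𝓞 K) (σ : 𝓞 K ≃+* 𝓞 K), IsImagQuad (𝓞 K) d s σ := by
  have hint : IsIntegral ℤ t := by
    refine IsIntegral.of_pow (n := 2) two_pos ?_
    rw [ht, ← Int.cast_natCast, ← Int.cast_neg]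
    exact isIntegral_algebraMap (R := ℤ) (x := -(d : ℤ))
  have hrat : ∀ a : ℚ, IsIntegral ℤ (a : K) → ∃ m : ℤ, a = m := fun a ha => by
    have h1 : IsIntegral ℤ a := by
      rw [← eq_ratCast (algebraMap ℚ K) a] at ha
      exact (isIntegral_algebraMap_iff (algebraMap ℚ K).injective).1 ha
    obtain ⟨m, hm⟩ := IsIntegrallyClosed.isIntegral_iff.1 h1
    exact ⟨m, by rw [← hm]; simp⟩
  let s : 𝓞 K := ⟨t, hint⟩
  refine ⟨s, RingOfIntegers.mapRingEquiv τ, hd, h3, ?_, ?_, ?_, ?_⟩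
  · apply RingOfIntegers.ext
    simp only [map_pow, map_neg, map_natCast]
    exact ht
  · apply RingOfIntegers.ext
    exact hτ
  · intro x
    obtain ⟨a, b, hab⟩ := hrep x
    have hτx : τ x = a - b * t := by rw [hab]; simp [hτ, sub_eq_add_neg]
    have hx : IsIntegral ℤ (x : K) := x.isIntegral_coe
    have hx' : IsIntegral ℤ (τ (x : K)) := hx.map (τ : K ≃+* K).toIntAlgEquiv
    obtain ⟨u, hu⟩ := hrat (2 * a) (by
      have := hx.add hx'
      rw [hτx, hab] at this
      have e : ((2 * a : ℚ) : K) = a + b * t + (a - b * t) := by push_cast; ring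
      rwa [e])
    have h4 : IsIntegral ℤ (((2 * b) ^ 2 * d : ℚ) : K) := by
      have := ((hx.sub hx').pow 2).neg
      rw [hτx, hab] at this
      have e : (((2 * b) ^ 2 * d : ℚ) : K) = -(a + b * t - (a - b * t)) ^ 2 := by
        push_cast
        linear_combination (4 * (b : K) ^ 2) * ht
      rwa [e]
    obtain ⟨w, hw⟩ := hrat _ h4
    obtain ⟨v, hv⟩ : ∃ v : ℤ, 2 * b = v := by
      set c := 2 * b with hc
      have hcd : c.den = 1 := by
        have h5 : (c.num : ℤ) ^ 2 * d = w * (c.den : ℤ) ^ 2 := by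
          have h6 : (c.num : ℚ) = c * c.den := (Rat.mul_den_eq_num c).symm
          have : ((c.num : ℚ)) ^ 2 * d = w * (c.den : ℚ) ^ 2 := by
            rw [h6, ← hw]; ring
          exact_mod_cast this
        have h7 : (c.den : ℤ) ^ 2 ∣ d := by
          have hco : IsCoprime ((c.den : ℤ) ^ 2) ((c.num : ℤ) ^ 2) := by
            refine IsCoprime.pow ?_
            rw [Int.isCoprime_iff_gcd_eq_one, Int.gcd_comm]
            simpa [Int.gcd] using c.reduced
          exact hco.dvd_of_dvd_mul_left ⟨w, by linarith⟩
        have h8 : c.den * c.den ∣ d := by rw [← pow_two]; exact_mod_cast h7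
        exact Nat.isUnit_iff.1 (hd _ h8)
      exact ⟨c.num, by rw [Rat.coe_int_num_of_den_eq_one hcd]⟩
    refine ⟨u, v, ?_⟩
    apply RingOfIntegers.ext
    have e1 : ((2 * a : ℚ) : K) = u := by rw [hu]; simp
    have e2 : ((2 * b : ℚ) : K) = v := by rw [hv]; simp
    push_cast at e1 e2
    simp only [map_mul, map_add, map_ofNat, map_intCast]
    change 2 * (x : K) = u + v * t
    rw [hab]
    linear_combination e1 + t * e2
  · rw [RingOfIntegers.rank, hK]

section Kneg

variable {d : ℕ}

lemma sqrt_mul_I_sq (d : ℕ) : ((Real.sqrt d : ℂ) * Complex.I) ^ 2 = -(d : ℂ) := by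
  rw [mul_pow, Complex.I_sq, ← Complex.ofReal_pow, Real.sq_sqrt (Nat.cast_nonneg d)]
  simp

lemma sqrt_mul_I_mem (d : ℕ) : (Real.sqrt d : ℂ) * Complex.I ∈ Kneg d :=
  IntermediateField.mem_adjoin_simple_self ℚ _

open Polynomial in
lemma minpoly_sqrt_mul_I (hd : 0 < d) :
    minpoly ℚ ((Real.sqrt d : ℂ) * Complex.I) = X ^ 2 + C (d : ℚ) := by
  symm
  refine minpoly.eq_of_irreducible_of_monic ?_ ?_ ?_
  · rw [Polynomial.irreducible_iff_roots_eq_zero_of_degree_le_three]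
    · rw [Multiset.eq_zero_iff_forall_notMem]
      intro a ha
      have := Polynomial.isRoot_of_mem_roots ha
      simp only [IsRoot.def, eval_add, eval_pow, eval_X, eval_C] at this
      have h0 : (0 : ℚ) < d := by exact_mod_cast hd
      nlinarith [sq_nonneg a]
    · rw [natDegree_X_pow_add_C]
    · rw [natDegree_X_pow_add_C]; norm_num
  · simp only [map_add, map_pow, aeval_X, aeval_C, sqrt_mul_I_sq]
    simp
  · exact monic_X_pow_add_C _ two_ne_zero

lemma isIntegral_sqrt_mul_I (d : ℕ) : IsIntegral ℚ ((Real.sqrt d : ℂ) * Complex.I) := by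
  refine IsIntegral.of_pow (n := 2) two_pos ?_
  rw [sqrt_mul_I_sq, ← map_natCast (algebraMap ℚ ℂ), ← map_neg]
  exact isIntegral_algebraMap

lemma finrank_Kneg (hd : 0 < d) : Module.finrank ℚ (Kneg d) = 2 := by
  rw [Kneg, IntermediateField.adjoin.finrank (isIntegral_sqrt_mul_I d), minpoly_sqrt_mul_I hd,
    Polynomial.natDegree_X_pow_add_C]

lemma numberField_Kneg (hd : 0 < d) : NumberField (Kneg d) where
  to_finiteDimensional := Module.finite_of_finrank_pos (by rw [finrank_Kneg hd]; norm_num)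

lemma exists_isImagQuad_Kneg [NumberField (Kneg d)] (hd : Squarefree d) (h3 : 3 < d) :
    ∃ (s : NumberField.RingOfIntegers (Kneg d))
      (σ : NumberField.RingOfIntegers (Kneg d) ≃+* NumberField.RingOfIntegers (Kneg d)),
      IsImagQuad (NumberField.RingOfIntegers (Kneg d)) d s σ := by
  set θ : ℂ := (Real.sqrt d : ℂ) * Complex.I with hθ
  have hrep : ∀ x ∈ Kneg d, ∃ a b : ℚ, x = a + b * θ := by
    intro x hx
    have hθ2 : θ ^ 2 = -(d : ℂ) := sqrt_mul_I_sq d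
    induction hx using IntermediateField.adjoin_induction with
    | mem x hx => exact ⟨0, 1, by rw [Set.mem_singleton_iff.1 hx]; simp [hθ]⟩
    | algebraMap x => exact ⟨x, 0, by simp⟩
    | add x y _ _ hx hy =>
      obtain ⟨a, b, rfl⟩ := hx
      obtain ⟨a', b', rfl⟩ := hy
      exact ⟨a + a', b + b', by push_cast; ring⟩
    | mul x y _ _ hx hy =>
      obtain ⟨a, b, rfl⟩ := hx
      obtain ⟨a', b', rfl⟩ := hy
      exact ⟨a * a' - d * b * b', a * b' + a' * b, by
        push_cast; linear_combination (b * b' : ℂ) * hθ2⟩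
    | inv x _ hx =>
      obtain ⟨a, b, rfl⟩ := hx
      by_cases h0 : a ^ 2 + d * b ^ 2 = 0
      · have hd' : (0 : ℚ) < d := by exact_mod_cast (by omega : 0 < d)
        have hb : b = 0 := by
          by_contra hb
          have : 0 < b ^ 2 := by positivity
          nlinarith [sq_nonneg a]
        subst hb
        have ha : a = 0 := by simpa using h0
        exact ⟨0, 0, by simp [ha]⟩
      · have h0' : (a : ℂ) ^ 2 + d * (b : ℂ) ^ 2 ≠ 0 := by exact_mod_cast h0
        refine ⟨a / (a ^ 2 + d * b ^ 2), -b / (a ^ 2 + d * b ^ 2), ?_⟩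
        apply inv_eq_of_mul_eq_one_right
        push_cast
        have e : ((a : ℂ) + b * θ) * (a - b * θ) = a ^ 2 + d * b ^ 2 := by
          linear_combination (-(b : ℂ) ^ 2) * hθ2
        rw [← div_self h0', ← e]
        ring
  have hconj : (starRingEnd ℂ) θ = -θ := by rw [hθ]; simp
  have hmem : ∀ x ∈ Kneg d, (starRingEnd ℂ) x ∈ Kneg d := by
    intro x hx
    obtain ⟨a, b, rfl⟩ := hrep x hx
    rw [map_add, map_mul, hconj]
    simp only [map_ratCast]
    exact add_mem (SubfieldClass.ratCast_mem _ _)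
      (mul_mem (SubfieldClass.ratCast_mem _ _) (neg_mem (sqrt_mul_I_mem d)))
  let τ : Kneg d ≃+* Kneg d :=
    { toFun := fun x => ⟨(starRingEnd ℂ) x, hmem x x.2⟩
      invFun := fun x => ⟨(starRingEnd ℂ) x, hmem x x.2⟩
      left_inv := fun x => Subtype.ext (by simp)
      right_inv := fun x => Subtype.ext (by simp)
      map_mul' := fun x y => Subtype.ext (by simp)
      map_add' := fun x y => Subtype.ext (by simp) }
  refine exists_isImagQuad hd h3 ⟨θ, sqrt_mul_I_mem d⟩ ?_ (finrank_Kneg (by omega)) ?_ τ ?_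
  · exact Subtype.ext (by simpa using sqrt_mul_I_sq d)
  · rintro ⟨x, hx⟩
    obtain ⟨a, b, rfl⟩ := hrep x hx
    exact ⟨a, b, Subtype.ext (by simp)⟩
  · exact Subtype.ext hconj

end Kneg

/-- One third of `±q - 1`, the sign being such that this is an integer. -/
def cubicExponent (q : ℕ) : ℤ := if q % 3 = 1 then ((q : ℤ) - 1) / 3 else -(((q : ℤ) + 1) / 3)

lemma three_mul_cubicExponent_of_one {q : ℕ} (h : q % 3 = 1) : 3 * cubicExponent q = q - 1 := by
  unfold cubicExponent; rw [if_pos h]; omega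

lemma three_mul_cubicExponent_of_two {q : ℕ} (h : q % 3 = 2) : 3 * cubicExponent q = -(q + 1) := by
  unfold cubicExponent; rw [if_neg (by omega)]; omega

lemma Nat.Prime.mod_three_eq {q : ℕ} (hq : q.Prime) (h3 : q ≠ 3) : q % 3 = 1 ∨ q % 3 = 2 := by
  have : ¬ 3 ∣ q := fun h => h3 ((Nat.prime_dvd_prime_iff_eq Nat.prime_three hq).1 h).symm
  omega

/-- The quotient of the Jacobi sums of a cubic character and of its inverse, raised to the
power `cubicExponent q` in characteristic `q`, is the value of the character at `q`. -/
lemma jacobiSum_div_zpow_cubicExponent {p q : ℕ} [Fact p.Prime] (hq : q.Prime) (hpq : p ≠ q)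
    (hq3 : q ≠ 3) {F : Type*} [Field F] [CharP F q] [IsAlgClosed F] {χ : MulChar (ZMod p) F}
    (hχ : orderOf χ = 3) :
    jacobiSum χ χ ≠ 0 ∧ jacobiSum χ⁻¹ χ⁻¹ ≠ 0 ∧
      (jacobiSum χ χ / jacobiSum χ⁻¹ χ⁻¹) ^ cubicExponent q = χ q := by
  have : Fact q.Prime := ⟨hq⟩
  have hp : p.Prime := Fact.out
  have hpF : (p : F) ≠ 0 := by
    rw [Ne, CharP.cast_eq_zero_iff F q, Nat.prime_dvd_prime_iff_eq hq hp]
    exact fun h => hpq h.symm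
  have : NeZero (p : F) := ⟨hpF⟩
  obtain ⟨ζ, hζ⟩ := HasEnoughRootsOfUnity.exists_primitiveRoot F p
  have hψ := AddChar.zmodChar_primitive_of_primitive_root p hζ
  set ψ := AddChar.zmodChar p ((IsPrimitiveRoot.iff_def ζ p).mp hζ).left with hψdef
  have hχ3 : χ ^ 3 = 1 := by rw [← hχ]; exact pow_orderOf_eq_one χ
  have hχ1 : χ ≠ 1 := by
    rintro rfl
    simp at hχ
  have hinv : χ ^ 2 = χ⁻¹ := by
    rw [eq_inv_iff_mul_eq_one, ← pow_succ, hχ3]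
  have hχ2 : χ⁻¹ ≠ 1 := by simpa using hχ1
  have hχχ : χ * χ = χ⁻¹ := by rw [← pow_two, hinv]
  have hii : χ⁻¹ * χ⁻¹ = χ := by rw [← hχχ, ← pow_two, ← pow_two, ← pow_mul, pow_succ, hχ3, one_mul]
  have hcard : (Fintype.card (ZMod p) : F) ≠ 0 := by rwa [ZMod.card]
  have hg0 : gaussSum χ ψ ≠ 0 := gaussSum_ne_zero_of_nontrivial hcard hχ1 hψ
  have hg0' : gaussSum χ⁻¹ ψ ≠ 0 := gaussSum_ne_zero_of_nontrivial hcard hχ2 hψ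
  have h1 := jacobiSum_mul_nontrivial (χ := χ) (φ := χ) (by rwa [hχχ]) ψ
  have h2 := jacobiSum_mul_nontrivial (χ := χ⁻¹) (φ := χ⁻¹) (by rwa [hii]) ψ
  rw [hχχ] at h1
  rw [hii] at h2
  set g := gaussSum χ ψ
  set g' := gaussSum χ⁻¹ ψ
  set J := jacobiSum χ χ
  set J' := jacobiSum χ⁻¹ χ⁻¹
  have hJ0 : J ≠ 0 := by rintro h; rw [h, mul_zero] at h1; exact mul_ne_zero hg0 hg0 h1.symm
  have hJ0' : J' ≠ 0 := by rintro h; rw [h, mul_zero] at h2; exact mul_ne_zero hg0' hg0' h2.symm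
  refine ⟨hJ0, hJ0', ?_⟩
  have hJJ : J / J' = (g / g') ^ (3 : ℤ) := by
    rw [show (3 : ℤ) = ((3 : ℕ) : ℤ) from rfl, zpow_natCast, div_pow, div_eq_div_iff hJ0' (pow_ne_zero _ hg0')]
    apply mul_left_cancel₀ hg0
    linear_combination (g * g' ^ 2) * h1 - g ^ 3 * h2
  have hqu : IsUnit (q : ZMod p) := by
    rw [ZMod.isUnit_iff_coprime]
    exact (Nat.coprime_primes hq hp).2 (fun h => hpq h.symm)
  have hχq : χ q ^ 3 = 1 := by
    rw [← MulChar.pow_apply' _ three_ne_zero, hχ3, MulChar.one_apply hqu]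
  have hχq0 : χ q ≠ 0 := by
    intro h; rw [h] at hχq; simp at hχq
  have hχi : χ⁻¹ (q : ZMod p) = (χ q)⁻¹ := MulChar.inv_apply_eq_inv' χ _
  have hsh : ∀ θ : MulChar (ZMod p) F, gaussSum θ (ψ ^ q) = θ⁻¹ q * gaussSum θ ψ := by
    intro θ
    have := gaussSum_mulShift_eq θ ψ hqu.unit
    rw [IsUnit.unit_spec] at this
    rw [← this, AddChar.pow_mulShift]
  have hfr : g ^ q = (χ ^ q)⁻¹ q * gaussSum (χ ^ q) ψ := by
    rw [gaussSum_frob, hsh]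
  have hfr' : g' ^ q = (χ⁻¹ ^ q)⁻¹ q * gaussSum (χ⁻¹ ^ q) ψ := by
    rw [gaussSum_frob, hsh]
  rw [hJJ, ← zpow_mul]
  have hr0 : g / g' ≠ 0 := div_ne_zero hg0 hg0'
  rcases hq.mod_three_eq hq3 with h | h
  · rw [three_mul_cubicExponent_of_one h, zpow_sub₀ hr0, zpow_natCast, zpow_one, div_pow]
    have e1 : χ ^ q = χ := by
      rw [← Nat.div_add_mod q 3, h, pow_add, pow_mul, hχ3, one_pow, one_mul, pow_one]
    rw [inv_pow, e1, inv_inv] at hfr'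
    rw [e1] at hfr
    rw [hfr, hfr', hχi]
    change (χ q)⁻¹ * g / (χ q * g') / (g / g') = _
    field_simp
    linear_combination (-1 : F) * hχq
  · rw [three_mul_cubicExponent_of_two h, zpow_neg, zpow_add₀ hr0, zpow_natCast, zpow_one, div_pow]
    have e1 : χ ^ q = χ⁻¹ := by
      rw [← Nat.div_add_mod q 3, h, pow_add, pow_mul, hχ3, one_pow, one_mul, hinv]
    rw [inv_pow, e1, inv_inv, inv_inv] at hfr'
    rw [e1, inv_inv] at hfr
    rw [hfr, hfr', hχi]
    change (χ q * g' / ((χ q)⁻¹ * g) * (g / g'))⁻¹ = _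
    field_simp
    linear_combination (-1 : F) * hχq
/-- The ring of Eisenstein integers. -/
abbrev Eisenstein := QuadraticAlgebra ℤ (-1) (-1)

namespace Eisenstein

open QuadraticAlgebra

lemma norm_eq (z : Eisenstein) : norm z = z.re ^ 2 - z.re * z.im + z.im ^ 2 := by
  rw [norm_def]; ring

lemma norm_eq_zero {z : Eisenstein} (h : norm z = 0) : z = 0 := by
  rw [norm_eq] at h
  have h1 : z.im = 0 := by nlinarith [sq_nonneg (2 * z.re - z.im), sq_nonneg z.im]
  have h2 : z.re = 0 := by rw [h1] at h; nlinarith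
  ext <;> simpa

lemma norm_nonneg (z : Eisenstein) : 0 ≤ norm z := by
  rw [norm_eq]; nlinarith [sq_nonneg (2 * z.re - z.im), sq_nonneg z.im]

instance : IsDomain Eisenstein := by
  have : NoZeroDivisors Eisenstein := ⟨by
    intro a b h
    have : norm a * norm b = 0 := by rw [← map_mul, h, QuadraticAlgebra.norm_zero]
    rcases mul_eq_zero.1 this with h | h
    · exact Or.inl (norm_eq_zero h)
    · exact Or.inr (norm_eq_zero h)⟩
  exact NoZeroDivisors.to_isDomain _

lemma omega_sq : (omega : Eisenstein) ^ 2 = -1 - omega := by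
  ext <;> simp [pow_two]

lemma isPrimitiveRoot_map {F : Type*} [Field F] (h3 : (3 : F) ≠ 0) (φ : Eisenstein →+* F) :
    IsPrimitiveRoot (φ omega) 3 := by
  have h : φ omega ^ 2 = -1 - φ omega := by rw [← map_pow, omega_sq]; simp
  have h1 : φ omega ≠ 1 := by
    intro h1; rw [h1] at h; apply h3; linear_combination h
  have h2 : φ omega ^ 3 = 1 := by linear_combination (φ omega - 1) * h
  exact IsPrimitiveRoot.iff_orderOf.2 (orderOf_eq_prime h2 h1)

lemma star_omega : star (omega : Eisenstein) = -1 - omega := by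
  ext <;> simp

lemma exists_hom (F : Type*) [Field F] [IsAlgClosed F] : ∃ _ : Eisenstein →+* F, True := by
  obtain ⟨u, hu⟩ := IsAlgClosed.exists_root (Polynomial.X ^ 2 + Polynomial.X + 1 : Polynomial F) (by
    rw [show (Polynomial.X ^ 2 + Polynomial.X + 1 : Polynomial F).degree = 2 by compute_degree!]
    exact two_ne_zero)
  rw [Polynomial.IsRoot] at hu
  simp at hu
  exact ⟨(lift ⟨u, by simp; linear_combination hu⟩ : Eisenstein →ₐ[ℤ] F).toRingHom, trivial⟩

lemma map_norm {F : Type*} [CommRing F] (φ : Eisenstein →+* F) (z : Eisenstein) :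
    ((QuadraticAlgebra.norm z : ℤ) : F) = φ z * φ (star z) := by
  rw [← map_mul, ← algebraMap_norm_eq_mul_star]; simp

lemma map_eq {F : Type*} [CommRing F] (φ : Eisenstein →+* F) (z : Eisenstein) :
    φ z = z.re + z.im * φ omega := by
  have : z = (z.re : Eisenstein) + (z.im : Eisenstein) * omega := by ext <;> simp
  conv_lhs => rw [this]
  simp

section Frobenius

variable {q : ℕ} {F : Type*} [Field F] [CharP F q] (φ : Eisenstein →+* F)

lemma map_pow_of_one (hq : q.Prime) (h : q % 3 = 1) (z : Eisenstein) : φ z ^ q = φ z := by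
  have : Fact q.Prime := ⟨hq⟩
  have h3 : φ omega ^ 3 = 1 := by
    have h : φ omega ^ 2 = -1 - φ omega := by rw [← map_pow, omega_sq]; simp
    linear_combination (φ omega - 1) * h
  have hω : φ omega ^ q = φ omega := by
    rw [← Nat.div_add_mod q 3, h, pow_add, pow_mul, h3, one_pow, one_mul, pow_one]
  rw [map_eq, ← frobenius_def, map_add, map_mul, map_intCast, map_intCast, frobenius_def, hω]

lemma map_pow_of_two (hq : q.Prime) (h : q % 3 = 2) (z : Eisenstein) :
    φ z ^ q = φ (star z) := by
  have : Fact q.Prime := ⟨hq⟩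
  have h2 : φ omega ^ 2 = -1 - φ omega := by rw [← map_pow, omega_sq]; simp
  have h3 : φ omega ^ 3 = 1 := by linear_combination (φ omega - 1) * h2
  have hω : φ omega ^ q = -1 - φ omega := by
    rw [← Nat.div_add_mod q 3, h, pow_add, pow_mul, h3, one_pow, one_mul, h2]
  rw [map_eq φ z, map_eq φ (star z), ← frobenius_def, map_add, map_mul, map_intCast, map_intCast,
    frobenius_def, hω]
  simp
  ring

lemma map_ne_zero_of_norm {z : Eisenstein} (h : ¬ (q : ℤ) ∣ QuadraticAlgebra.norm z) :
    φ z ≠ 0 ∧ φ (star z) ≠ 0 := by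
  rw [← CharP.intCast_eq_zero_iff F q, map_norm φ] at h
  exact mul_ne_zero_iff.1 h

lemma three_ne_zero_of_prime (hq : q.Prime) (h3 : q ≠ 3) : (3 : F) ≠ 0 := by
  intro h
  have : ((3 : ℕ) : F) = 0 := by exact_mod_cast h
  rw [CharP.cast_eq_zero_iff F q] at this
  exact h3 ((Nat.prime_dvd_prime_iff_eq hq Nat.prime_three).1 this)

lemma exists_log (hq : q.Prime) (h3 : q ≠ 3) {z : Eisenstein}
    (h : ¬ (q : ℤ) ∣ QuadraticAlgebra.norm z) :
    ∃ e : ZMod 3, (φ z / φ (star z)) ^ cubicExponent q = φ omega ^ e.val := by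
  obtain ⟨h0, h0'⟩ := map_ne_zero_of_norm φ h
  have hp := isPrimitiveRoot_map (three_ne_zero_of_prime hq h3) φ
  have key : ((φ z / φ (star z)) ^ cubicExponent q) ^ 3 = 1 := by
    rw [← zpow_natCast, ← zpow_mul, mul_comm]
    have hr : φ z / φ (star z) ≠ 0 := div_ne_zero h0 h0'
    rcases hq.mod_three_eq h3 with h | h
    · rw [Nat.cast_ofNat, three_mul_cubicExponent_of_one h, zpow_sub₀ hr, zpow_natCast, zpow_one,
        div_pow, map_pow_of_one φ hq h, map_pow_of_one φ hq h, div_self hr]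
    · rw [Nat.cast_ofNat, three_mul_cubicExponent_of_two h, zpow_neg, zpow_add₀ hr, zpow_natCast,
        zpow_one, div_pow, map_pow_of_two φ hq h, map_pow_of_two φ hq h, star_star]
      field_simp
  obtain ⟨i, hi, h⟩ := hp.eq_pow_of_pow_eq_one key
  refine ⟨(i : ZMod 3), ?_⟩
  rw [← h, ZMod.val_natCast, Nat.mod_eq_of_lt hi]

end Frobenius

lemma exists_primeSymbol (q : ℕ) : ∃ f : Eisenstein → ZMod 3, q.Prime → q ≠ 3 →
    ∃ (F : Type) (_ : Field F) (_ : CharP F q) (_ : IsAlgClosed F) (φ : Eisenstein →+* F),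
      ∀ z, ¬ (q : ℤ) ∣ QuadraticAlgebra.norm z →
        (φ z / φ (star z)) ^ cubicExponent q = φ omega ^ (f z).val := by
  by_cases hq : q.Prime
  swap
  · exact ⟨0, fun h => absurd h hq⟩
  by_cases h3 : q = 3
  · exact ⟨0, fun _ h => absurd h3 h⟩
  have : Fact q.Prime := ⟨hq⟩
  obtain ⟨φ, -⟩ := exists_hom (AlgebraicClosure (ZMod q))
  have : CharP (AlgebraicClosure (ZMod q)) q := charP_of_injective_algebraMap
      (algebraMap (ZMod q) (AlgebraicClosure (ZMod q))).injective q
  have := fun z => exists_log φ hq h3 (z := z)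
  choose! f hf using this
  exact ⟨f, fun _ _ => ⟨_, _, inferInstance, inferInstance, φ, hf⟩⟩

/-- The exponent of the cubic residue symbol of an Eisenstein integer (divided by its conjugate)
modulo a rational prime. -/
noncomputable def primeSymbol (q : ℕ) : Eisenstein → ZMod 3 := (exists_primeSymbol q).choose

lemma exists_map_eq_primeSymbol {q : ℕ} (hq : q.Prime) (h3 : q ≠ 3) :
    ∃ (F : Type) (_ : Field F) (_ : CharP F q) (_ : IsAlgClosed F) (φ : Eisenstein →+* F),
      ∀ z, ¬ (q : ℤ) ∣ QuadraticAlgebra.norm z →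
        (φ z / φ (star z)) ^ cubicExponent q = φ omega ^ (primeSymbol q z).val :=
  (exists_primeSymbol q).choose_spec hq h3

lemma _root_.IsPrimitiveRoot.zmod_pow_inj {F : Type*} [Field F] {w : F} (h : IsPrimitiveRoot w 3)
    {a b : ZMod 3} (hab : w ^ a.val = w ^ b.val) : a = b :=
  ZMod.val_injective 3 (h.pow_inj (ZMod.val_lt a) (ZMod.val_lt b) hab)

lemma _root_.IsPrimitiveRoot.zmod_pow_add {F : Type*} [Field F] {w : F} (h : IsPrimitiveRoot w 3)
    (a b : ZMod 3) : w ^ (a + b).val = w ^ a.val * w ^ b.val := by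
  rw [ZMod.val_add, ← pow_add]
  have := pow_mod_orderOf w (a.val + b.val)
  rwa [← h.eq_orderOf] at this

section primeSymbol

variable {q : ℕ}

lemma primeSymbol_mul (hq : q.Prime) (h3 : q ≠ 3) {x y : Eisenstein} (hx : ¬ (q : ℤ) ∣ QuadraticAlgebra.norm x)
    (hy : ¬ (q : ℤ) ∣ QuadraticAlgebra.norm y) :
    primeSymbol q (x * y) = primeSymbol q x + primeSymbol q y := by
  obtain ⟨F, _, _, _, φ, hφ⟩ := exists_map_eq_primeSymbol hq h3
  have hp := isPrimitiveRoot_map (three_ne_zero_of_prime hq h3) φ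
  apply hp.zmod_pow_inj
  rw [hp.zmod_pow_add, ← hφ _ hx, ← hφ _ hy, ← hφ, ← mul_zpow, star_mul', map_mul, map_mul,
    mul_div_mul_comm]
  rw [map_mul]
  exact fun h => (Int.Prime.dvd_mul' hq h).elim hx hy

lemma primeSymbol_congr (hq : q.Prime) (h3 : q ≠ 3) {x y : Eisenstein} (hx : ¬ (q : ℤ) ∣ QuadraticAlgebra.norm x)
    (hre : (x.re : ℤ) ≡ y.re [ZMOD q]) (him : x.im ≡ y.im [ZMOD q]) :
    primeSymbol q x = primeSymbol q y := by
  obtain ⟨F, _, _, _, φ, hφ⟩ := exists_map_eq_primeSymbol hq h3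
  have hp := isPrimitiveRoot_map (three_ne_zero_of_prime hq h3) φ
  rw [← CharP.intCast_eq_intCast F q] at hre him
  have e1 : φ x = φ y := by rw [map_eq φ x, map_eq φ y, hre, him]
  have e2 : φ (star x) = φ (star y) := by
    rw [map_eq φ (star x), map_eq φ (star y)]; simp [hre, him]
  apply hp.zmod_pow_inj
  rw [← hφ _ hx, ← hφ, e1, e2]
  rwa [← CharP.intCast_eq_zero_iff F q, map_norm φ, ← e1, ← e2, ← map_norm φ,
    CharP.intCast_eq_zero_iff F q]

lemma primeSymbol_star (hq : q.Prime) (h3 : q ≠ 3) {x : Eisenstein} (hx : ¬ (q : ℤ) ∣ QuadraticAlgebra.norm x) :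
    primeSymbol q (star x) = -primeSymbol q x := by
  obtain ⟨F, _, _, _, φ, hφ⟩ := exists_map_eq_primeSymbol hq h3
  have hp := isPrimitiveRoot_map (three_ne_zero_of_prime hq h3) φ
  obtain ⟨h0, h0'⟩ := map_ne_zero_of_norm φ hx
  rw [eq_neg_iff_add_eq_zero]
  apply hp.zmod_pow_inj
  rw [hp.zmod_pow_add, ← hφ _ hx, ← hφ _ (by rwa [QuadraticAlgebra.norm_star]), star_star, ← mul_zpow,
    div_mul_div_cancel₀ h0, div_self h0', one_zpow]
  simp

end primeSymbol

end Eisenstein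

namespace Eisenstein

open QuadraticAlgebra

/-- The exponent of the cubic residue symbol of an Eisenstein integer (divided by its conjugate)
modulo a natural number. -/
noncomputable def cubicSymbol (A : ℕ) (z : Eisenstein) : ZMod 3 :=
  (A.primeFactorsList.map (fun q => primeSymbol q z)).sum

@[simp] lemma cubicSymbol_one (z : Eisenstein) : cubicSymbol 1 z = 0 := by simp [cubicSymbol]

lemma cubicSymbol_prime {q : ℕ} (hq : q.Prime) (z : Eisenstein) :
    cubicSymbol q z = primeSymbol q z := by simp [cubicSymbol, Nat.primeFactorsList_prime hq]

lemma cubicSymbol_mul_left {A B : ℕ} (hA : A ≠ 0) (hB : B ≠ 0) (z : Eisenstein) :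
    cubicSymbol (A * B) z = cubicSymbol A z + cubicSymbol B z := by
  rw [cubicSymbol, ((Nat.perm_primeFactorsList_mul hA hB).map _).sum_eq, List.map_append,
    List.sum_append]
  rfl

lemma cubicSymbol_pow_left {A : ℕ} (hA : A ≠ 0) (n : ℕ) (z : Eisenstein) :
    cubicSymbol (A ^ n) z = n * cubicSymbol A z := by
  induction n with
  | zero => simp
  | succ n ih => rw [pow_succ, cubicSymbol_mul_left (pow_ne_zero _ hA) hA, ih]; push_cast; ring

lemma prime_of_mem {A : ℕ} {N : ℤ} (h : IsCoprime (A : ℤ) (3 * N)) {q : ℕ}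
    (hq : q ∈ A.primeFactorsList) : q.Prime ∧ q ≠ 3 ∧ ¬ (q : ℤ) ∣ N := by
  have hp := Nat.prime_of_mem_primeFactorsList hq
  have hd : (q : ℤ) ∣ A := Int.natCast_dvd_natCast.2 (Nat.dvd_of_mem_primeFactorsList hq)
  have key : ¬ (q : ℤ) ∣ 3 * N := fun h' => by
    have := Int.isUnit_iff_natAbs_eq.1 (h.isUnit_of_dvd' hd h')
    simp at this
    exact hp.one_lt.ne' this
  refine ⟨hp, ?_, fun h' => key (h'.mul_left _)⟩
  rintro rfl
  exact key (by simp)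

lemma cubicSymbol_mul {A : ℕ} {x y : Eisenstein}
    (hx : IsCoprime (A : ℤ) (3 * QuadraticAlgebra.norm x))
    (hy : IsCoprime (A : ℤ) (3 * QuadraticAlgebra.norm y)) :
    cubicSymbol A (x * y) = cubicSymbol A x + cubicSymbol A y := by
  rw [cubicSymbol, cubicSymbol, cubicSymbol, ← List.sum_map_add]
  congr 1
  refine List.map_congr_left fun q hq => ?_
  obtain ⟨h1, h2, h3⟩ := prime_of_mem hx hq
  obtain ⟨-, -, h4⟩ := prime_of_mem hy hq
  exact primeSymbol_mul h1 h2 h3 h4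

lemma cubicSymbol_congr {A : ℕ} {x y : Eisenstein}
    (hx : IsCoprime (A : ℤ) (3 * QuadraticAlgebra.norm x))
    (hre : x.re ≡ y.re [ZMOD A]) (him : x.im ≡ y.im [ZMOD A]) :
    cubicSymbol A x = cubicSymbol A y := by
  rw [cubicSymbol, cubicSymbol]
  congr 1
  refine List.map_congr_left fun q hq => ?_
  obtain ⟨h1, h2, h3⟩ := prime_of_mem hx hq
  have hd : (q : ℤ) ∣ A := Int.natCast_dvd_natCast.2 (Nat.dvd_of_mem_primeFactorsList hq)
  exact primeSymbol_congr h1 h2 h3 (hre.of_dvd hd) (him.of_dvd hd)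

lemma cubicSymbol_star {A : ℕ} {x : Eisenstein}
    (hx : IsCoprime (A : ℤ) (3 * QuadraticAlgebra.norm x)) :
    cubicSymbol A (star x) = -cubicSymbol A x := by
  rw [cubicSymbol, cubicSymbol, eq_neg_iff_add_eq_zero, ← List.sum_map_add]
  refine List.sum_eq_zero fun e he => ?_
  obtain ⟨q, hq, rfl⟩ := List.mem_map.1 he
  obtain ⟨h1, h2, h3⟩ := prime_of_mem hx hq
  rw [primeSymbol_star h1 h2 h3, neg_add_cancel]

lemma cubicSymbol_eq_zero_of_star_eq {A : ℕ} {x : Eisenstein}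
    (hx : IsCoprime (A : ℤ) (3 * QuadraticAlgebra.norm x)) (h : star x = x) :
    cubicSymbol A x = 0 := by
  have := cubicSymbol_star hx
  rw [h] at this
  revert this
  generalize cubicSymbol A x = e
  revert e; decide

lemma cubicSymbol_eq_zero_of_star_eq_neg {A : ℕ} {x : Eisenstein}
    (hx : IsCoprime (A : ℤ) (3 * QuadraticAlgebra.norm x)) (h : star x = -x) :
    cubicSymbol A x = 0 := by
  have h1 : cubicSymbol A (x * x) = 0 := by
    apply cubicSymbol_eq_zero_of_star_eq
    · rw [map_mul]
      have h3 : IsCoprime (A : ℤ) 3 := hx.of_mul_right_left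
      have h4 := hx.of_mul_right_right
      exact h3.mul_right (h4.mul_right h4)
    · rw [star_mul', h]; ring
  rw [cubicSymbol_mul hx hx] at h1
  revert h1
  generalize cubicSymbol A x = e
  revert e; decide

lemma cubicSymbol_intCast {A : ℕ} {n : ℤ} (h : IsCoprime (A : ℤ) (3 * n)) :
    cubicSymbol A (n : Eisenstein) = 0 := by
  apply cubicSymbol_eq_zero_of_star_eq
  · rw [norm_intCast]
    exact h.of_mul_right_left.mul_right (h.of_mul_right_right.pow_right)
  · ext <;> simp

/-- An Eisenstein integer congruent to `±1` modulo `3`. -/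
def IsPrimary (z : Eisenstein) : Prop := ¬ 3 ∣ z.re ∧ 3 ∣ z.im

lemma isPrimitiveRoot_omega : IsPrimitiveRoot (omega : Eisenstein) 3 := by
  refine IsPrimitiveRoot.iff_orderOf.2 (orderOf_eq_prime (by rw [pow_succ, omega_sq]; linear_combination (-1 : Eisenstein) * omega_sq) ?_)
  intro h
  have := congrArg im h
  simp at this

lemma exists_mulChar {p : ℕ} [Fact p.Prime] (h : p % 3 = 1) :
    ∃ χ : MulChar (ZMod p) Eisenstein, orderOf χ = 3 := by
  apply MulChar.exists_mulChar_orderOf (ZMod p) _ isPrimitiveRoot_omega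
  rw [ZMod.card]; omega

section MulChar

variable {p : ℕ} [Fact p.Prime] {χ : MulChar (ZMod p) Eisenstein}

lemma pow_apply_eq_one (hχ : orderOf χ = 3) (u : (ZMod p)ˣ) : χ u ^ 3 = 1 := by
  rw [← MulChar.pow_apply' _ three_ne_zero, ← hχ, pow_orderOf_eq_one, MulChar.one_apply u.isUnit]

lemma orderOf_ringHomComp (hχ : orderOf χ = 3) {F : Type*} [Field F] (h3 : (3 : F) ≠ 0) (φ : Eisenstein →+* F) :
    orderOf (χ.ringHomComp φ) = 3 := by
  apply orderOf_eq_prime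
  · ext u
    rw [MulChar.pow_apply_coe, MulChar.ringHomComp_apply, ← map_pow, pow_apply_eq_one hχ, map_one, MulChar.one_apply u.isUnit]
  · intro h
    have : χ = 1 := by
      ext1 u
      rw [MulChar.one_apply u.isUnit]
      obtain ⟨i, hi, h'⟩ := isPrimitiveRoot_omega.eq_pow_of_pow_eq_one (pow_apply_eq_one hχ u)
      have h1 : φ (χ u) = 1 := by
        rw [← MulChar.ringHomComp_apply, h, MulChar.one_apply u.isUnit]
      rw [← h', map_pow] at h1
      have := (isPrimitiveRoot_map h3 φ).dvd_of_pow_eq_one _ h1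
      rw [← h', Nat.eq_zero_of_dvd_of_lt this hi, pow_zero]
    rw [this] at hχ
    simp at hχ

lemma ringHomComp_star (hχ : orderOf χ = 3) : χ.ringHomComp (starRingEnd Eisenstein) = χ⁻¹ := by
  rw [eq_inv_iff_mul_eq_one]
  ext1 u
  rw [MulChar.mul_apply, MulChar.ringHomComp_apply, MulChar.one_apply u.isUnit]
  obtain ⟨i, hi, h'⟩ := isPrimitiveRoot_omega.eq_pow_of_pow_eq_one (pow_apply_eq_one hχ u)
  rw [← h', map_pow, ← mul_pow]
  have : (starRingEnd Eisenstein) omega * omega = 1 := by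
    change star omega * omega = _
    rw [star_omega]
    linear_combination (-1 : Eisenstein) * omega_sq
  rw [this, one_pow]

lemma star_jacobiSum (hχ : orderOf χ = 3) : star (jacobiSum χ χ) = jacobiSum χ⁻¹ χ⁻¹ := by
  rw [← ringHomComp_star hχ, jacobiSum_ringHomComp]; rfl

lemma map_star_jacobiSum (hχ : orderOf χ = 3) {F : Type*} [Field F] (φ : Eisenstein →+* F) :
    φ (star (jacobiSum χ χ)) = jacobiSum (χ.ringHomComp φ)⁻¹ (χ.ringHomComp φ)⁻¹ := by
  rw [star_jacobiSum hχ, ← jacobiSum_ringHomComp]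
  congr 1 <;> (rw [MulChar.ringHomComp_inv])

lemma norm_jacobiSum (hχ : orderOf χ = 3) : QuadraticAlgebra.norm (jacobiSum χ χ) = p := by
  obtain ⟨φ, -⟩ := exists_hom ℂ
  have h0 := orderOf_ringHomComp hχ (by norm_num) φ
  have h1 : χ.ringHomComp φ ≠ 1 := by intro h; rw [h] at h0; simp at h0
  have h2 : χ.ringHomComp φ * χ.ringHomComp φ ≠ 1 := by
    intro h
    rw [← pow_two] at h
    have := orderOf_dvd_of_pow_eq_one h
    rw [h0] at this; omega
  have key := jacobiSum_mul_jacobiSum_inv (F := ZMod p) (F' := ℂ) (by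
    rw [ringChar.eq ℂ 0, ZMod.ringChar_zmod_n]; exact (Fact.out : p.Prime).ne_zero.symm) h1 h1 h2
  rw [jacobiSum_ringHomComp, ← map_star_jacobiSum hχ, ← map_norm, ZMod.card] at key
  exact_mod_cast key

lemma isPrimary_jacobiSum (hχ : orderOf χ = 3) (h : p % 3 = 1) : IsPrimary (jacobiSum χ χ) := by
  have h3 : χ ^ 3 = 1 := by rw [← hχ]; exact pow_orderOf_eq_one χ
  obtain ⟨z, -, hz⟩ := exists_jacobiSum_eq_neg_one_add (by norm_num) h3 h3
    (by rw [ZMod.card]; omega) isPrimitiveRoot_omega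
  have : (omega - 1 : Eisenstein) ^ 2 = -3 * omega := by linear_combination omega_sq
  rw [hz, this]
  constructor
  · simp
  · simp

lemma primeSymbol_jacobiSum (hχ : orderOf χ = 3) {q : ℕ} (hq : q.Prime) (h3 : q ≠ 3) (hqp : q ≠ p) :
    (omega : Eisenstein) ^ (primeSymbol q (jacobiSum χ χ)).val = χ q := by
  have hp : p.Prime := Fact.out
  obtain ⟨F, _, _, _, φ, hφ⟩ := exists_map_eq_primeSymbol hq h3
  have hr := isPrimitiveRoot_map (three_ne_zero_of_prime hq h3) φ
  have hn : ¬ (q : ℤ) ∣ QuadraticAlgebra.norm (jacobiSum χ χ) := by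
    rw [norm_jacobiSum hχ, Int.natCast_dvd_natCast, Nat.prime_dvd_prime_iff_eq hq hp]
    exact hqp
  have h1 := (jacobiSum_div_zpow_cubicExponent hq hqp.symm h3
    (orderOf_ringHomComp hχ (three_ne_zero_of_prime hq h3) φ)).2.2
  rw [← map_star_jacobiSum hχ, jacobiSum_ringHomComp, hφ _ hn, MulChar.ringHomComp_apply] at h1
  have hu : IsUnit (q : ZMod p) := by
    rw [ZMod.isUnit_iff_coprime]
    exact (Nat.coprime_primes hq hp).2 hqp
  obtain ⟨i, hi, h'⟩ := isPrimitiveRoot_omega.eq_pow_of_pow_eq_one (pow_apply_eq_one hχ hu.unit)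
  rw [IsUnit.unit_spec] at h'
  rw [← h'] at h1 ⊢
  rw [map_pow] at h1
  rw [hr.pow_inj (ZMod.val_lt _) hi h1]

lemma cubicSymbol_jacobiSum (hχ : orderOf χ = 3) {A : ℕ} (hA0 : A ≠ 0) (hA : IsCoprime (A : ℤ) (3 * p)) :
    (omega : Eisenstein) ^ (cubicSymbol A (jacobiSum χ χ)).val = χ A := by
  induction A using Nat.recOnMul with
  | zero => exact absurd rfl hA0
  | one => simp
  | prime q hq =>
    rw [cubicSymbol_prime hq]
    have := prime_of_mem hA (q := q) (by simp [Nat.primeFactorsList_prime hq])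
    exact primeSymbol_jacobiSum hχ hq this.2.1 (fun h => this.2.2 (by rw [h]))
  | mul a b iha ihb =>
    rw [mul_ne_zero_iff] at hA0
    push_cast at hA
    have hzp : ∀ a b : ZMod 3, (omega : Eisenstein) ^ (a + b).val = omega ^ a.val * omega ^ b.val := by
      intro a b
      rw [ZMod.val_add, ← pow_add]
      have := pow_mod_orderOf (omega : Eisenstein) (a.val + b.val)
      rwa [← isPrimitiveRoot_omega.eq_orderOf] at this
    rw [cubicSymbol_mul_left hA0.1 hA0.2, hzp, iha hA0.1 hA.of_mul_left_left,
      ihb hA0.2 hA.of_mul_left_right, Nat.cast_mul, map_mul]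

end MulChar

/-- A primary Eisenstein integer whose norm is a prime congruent to `1` modulo `3`, and whose
symbol is periodic. -/
lemma exists_norm_eq_prime {p : ℕ} (hp : p.Prime) (h : p % 3 = 1) :
    ∃ J : Eisenstein, QuadraticAlgebra.norm J = p ∧ IsPrimary J ∧
      ∀ A A' : ℕ, A ≠ 0 → A' ≠ 0 → IsCoprime (A : ℤ) (3 * p) → IsCoprime (A' : ℤ) (3 * p) →
        (A : ℤ) ≡ A' [ZMOD p] → cubicSymbol A J = cubicSymbol A' J := by
  have : Fact p.Prime := ⟨hp⟩
  obtain ⟨χ, hχ⟩ := exists_mulChar h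
  refine ⟨_, norm_jacobiSum hχ, isPrimary_jacobiSum hχ h, fun A A' h1 h2 h3 h4 h5 => ?_⟩
  have e1 := cubicSymbol_jacobiSum hχ h1 h3
  have e2 := cubicSymbol_jacobiSum hχ h2 h4
  rw [← ZMod.intCast_eq_intCast_iff] at h5
  push_cast at h5
  rw [h5, ← e2] at e1
  exact ZMod.val_injective 3 (isPrimitiveRoot_omega.pow_inj (ZMod.val_lt _) (ZMod.val_lt _) e1)

lemma IsPrimary.mul {x y : Eisenstein} (hx : IsPrimary x) (hy : IsPrimary y) :
    IsPrimary (x * y) := by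
  obtain ⟨h1, a, h2⟩ := hx
  obtain ⟨h3, b, h4⟩ := hy
  constructor
  · rw [re_mul, h2, h4]
    intro h
    have : 3 ∣ x.re * y.re := by
      have e : x.re * y.re = (x.re * y.re + -1 * (3 * a) * (3 * b)) + 3 * (3 * a * b) := by ring
      rw [e]; exact dvd_add h ⟨_, rfl⟩
    exact (Int.prime_three.dvd_or_dvd this).elim h1 h3
  · rw [im_mul, h2, h4]
    exact ⟨x.re * b + a * y.re + -1 * (a * (3 * b)), by ring⟩

lemma IsPrimary.star {x : Eisenstein} (hx : IsPrimary x) : IsPrimary (star x) := by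
  obtain ⟨h1, h2⟩ := hx
  constructor
  · simp; omega
  · simpa using h2

lemma IsPrimary.of_intCast_mul {p : ℤ} (hp : ¬ 3 ∣ p) {x : Eisenstein}
    (h : IsPrimary ((p : Eisenstein) * x)) : IsPrimary x := by
  obtain ⟨h1, h2⟩ := h
  simp at h1 h2
  exact ⟨fun h => h1 (h.mul_left _), (Int.prime_three.dvd_or_dvd h2).resolve_left hp⟩

lemma prime_mod_three_of_dvd {p : ℕ} (hp : p.Prime) (h3 : p ≠ 3) {z : Eisenstein}
    (h : (p : ℤ) ∣ QuadraticAlgebra.norm z) (hz : ¬ ((p : ℤ) ∣ z.re ∧ (p : ℤ) ∣ z.im)) :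
    p % 3 = 1 := by
  have : Fact p.Prime := ⟨hp⟩
  have hpz := Nat.prime_iff_prime_int.1 hp
  rw [norm_eq] at h
  have him : ¬ (p : ℤ) ∣ z.im := by
    intro h'
    refine hz ⟨?_, h'⟩
    have : (p : ℤ) ∣ z.re ^ 2 := by
      have e : z.re ^ 2 = z.re ^ 2 - z.re * z.im + z.im ^ 2 + z.im * (z.re - z.im) := by ring
      rw [e]; exact dvd_add h (h'.mul_right _)
    exact hpz.dvd_of_dvd_pow this
  rw [← ZMod.intCast_zmod_eq_zero_iff_dvd] at h him
  push_cast at h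
  set w : ZMod p := -(z.re / z.im)
  have hw : w ^ 2 + w + 1 = 0 := by
    simp only [w]; field_simp; linear_combination h
  have h3' : (3 : ZMod p) ≠ 0 := by
    intro h
    have : ((3 : ℕ) : ZMod p) = 0 := by exact_mod_cast h
    rw [CharP.cast_eq_zero_iff (ZMod p) p] at this
    exact h3 ((Nat.prime_dvd_prime_iff_eq hp Nat.prime_three).1 this)
  have hw1 : w ≠ 1 := by
    intro h1; rw [h1] at hw; apply h3'; linear_combination hw
  have hord : orderOf w = 3 := orderOf_eq_prime (by linear_combination (w - 1) * hw) hw1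
  have hw0 : w ≠ 0 := by rintro h; rw [h] at hw; simp at hw
  have := orderOf_dvd_of_pow_eq_one (ZMod.pow_card_sub_one_eq_one hw0)
  rw [hord] at this
  have := hp.two_le
  omega

/-- Two non-rational elements of norm divisible by `p` are, up to conjugation, in the same prime
above `p`. -/
lemma exists_mul_eq_intCast_mul {p : ℕ} (hp : p.Prime) {x y : Eisenstein}
    (hx : (p : ℤ) ∣ QuadraticAlgebra.norm x) (hy : QuadraticAlgebra.norm y = p) :
    ∃ z : Eisenstein, x * y = ((p : ℤ) : Eisenstein) * z ∨ x * star y = ((p : ℤ) : Eisenstein) * z := by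
  have hpz := Nat.prime_iff_prime_int.1 hp
  have key : ∀ y : Eisenstein, QuadraticAlgebra.norm y = p → (p : ℤ) ∣ (x * y).im →
      ∃ z : Eisenstein, x * y = ((p : ℤ) : Eisenstein) * z := by
    intro y hy h
    have h1 : (p : ℤ) ∣ QuadraticAlgebra.norm (x * y) := by rw [map_mul, hy]; exact ⟨_, mul_comm _ _⟩
    rw [norm_eq] at h1
    have h2 : (p : ℤ) ∣ (x * y).re := by
      apply hpz.dvd_of_dvd_pow (n := 2)
      have e : (x * y).re ^ 2 = (x * y).re ^ 2 - (x * y).re * (x * y).im + (x * y).im ^ 2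
        + (x * y).im * ((x * y).re - (x * y).im) := by ring
      rw [e]; exact dvd_add h1 (h.mul_right _)
    obtain ⟨a, ha⟩ := h2
    obtain ⟨b, hb⟩ := h
    exact ⟨⟨a, b⟩, by ext <;> simp only [ha, hb] <;> simp⟩
  have h : (p : ℤ) ∣ (x * y).im * (x * star y).im := by
    obtain ⟨n, hn⟩ := hx
    have hn' := hn
    rw [norm_eq] at hn'
    have hy' := hy
    rw [norm_eq] at hy'
    simp
    refine ⟨x.im ^ 2 - y.im ^ 2 * n, ?_⟩
    linear_combination x.im ^ 2 * hy' - y.im ^ 2 * hn'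
  rcases hpz.dvd_or_dvd h with h | h
  · obtain ⟨z, hz⟩ := key y hy h; exact ⟨z, Or.inl hz⟩
  · obtain ⟨z, hz⟩ := key (star y) (by rwa [QuadraticAlgebra.norm_star]) h; exact ⟨z, Or.inr hz⟩

lemma IsPrimary.norm_not_dvd {z : Eisenstein} (h : IsPrimary z) :
    ¬ (3 : ℤ) ∣ QuadraticAlgebra.norm z := by
  obtain ⟨h1, a, h2⟩ := h
  rw [norm_eq, h2]
  intro h
  apply h1
  apply Int.prime_three.dvd_of_dvd_pow (n := 2)
  have e : z.re ^ 2 = z.re ^ 2 - z.re * (3 * a) + (3 * a) ^ 2 + 3 * (a * z.re - 3 * a ^ 2) := by ring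
  rw [e]; exact dvd_add h ⟨_, rfl⟩

/-- The cubic residue symbol of a primary Eisenstein integer `z` is periodic modulo the norm
of `z`. -/
theorem cubicSymbol_eq_of_modEq {z : Eisenstein} (hz : IsPrimary z) {A A' : ℕ} (hA0 : A ≠ 0)
    (hA0' : A' ≠ 0) (hA : IsCoprime (A : ℤ) (3 * QuadraticAlgebra.norm z))
    (hA' : IsCoprime (A' : ℤ) (3 * QuadraticAlgebra.norm z))
    (h : (A : ℤ) ≡ A' [ZMOD QuadraticAlgebra.norm z]) : cubicSymbol A z = cubicSymbol A' z := by
  obtain ⟨n, hn⟩ : ∃ n : ℕ, QuadraticAlgebra.norm z = n := ⟨_, (Int.toNat_of_nonneg (norm_nonneg z)).symm⟩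
  induction n using Nat.strong_induction_on generalizing z with
  | _ n ih =>
  have hn0 : n ≠ 0 := by
    rintro rfl
    exact hz.norm_not_dvd (by simp [hn])
  rcases Nat.lt_or_ge 1 n with h1 | h1
  swap
  · have h1 : n = 1 := by omega
    have him : z.im = 0 := by
      obtain ⟨a, ha⟩ := hz.2
      rw [norm_eq, h1] at hn
      push_cast at hn
      have : a = 0 := by
        rw [ha] at hn
        have : a ^ 2 < 1 := by nlinarith [sq_nonneg (2 * z.re - 3 * a)]
        nlinarith
      rw [ha, this]; rfl
    have hst : star z = z := by ext <;> simp [him]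
    rw [cubicSymbol_eq_zero_of_star_eq hA hst, cubicSymbol_eq_zero_of_star_eq hA' hst]
  obtain ⟨p, hp, m, hm⟩ := Nat.exists_prime_and_dvd h1.ne'
  have hpz := Nat.prime_iff_prime_int.1 hp
  have hpn : (p : ℤ) ∣ QuadraticAlgebra.norm z := by rw [hn]; exact_mod_cast Dvd.intro _ hm.symm
  have hp3 : p ≠ 3 := by rintro rfl; exact hz.norm_not_dvd hpn
  have hp3' : ¬ (3 : ℤ) ∣ p := by
    intro h
    have h : 3 ∣ p := by exact_mod_cast h
    exact hp3 ((Nat.prime_dvd_prime_iff_eq Nat.prime_three hp).1 h).symm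
  have step : ∀ x y : Eisenstein, z = x * y → QuadraticAlgebra.norm x ≠ 1 → IsPrimary y →
      (IsCoprime (A : ℤ) (3 * QuadraticAlgebra.norm x) → IsCoprime (A' : ℤ) (3 * QuadraticAlgebra.norm x) →
        (A : ℤ) ≡ A' [ZMOD QuadraticAlgebra.norm x] → cubicSymbol A x = cubicSymbol A' x) →
      cubicSymbol A z = cubicSymbol A' z := by
    intro x y hxy hx1 hy hx
    have hN : QuadraticAlgebra.norm z = QuadraticAlgebra.norm x * QuadraticAlgebra.norm y := by
      rw [hxy, map_mul]
    rw [hN] at hA hA' h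
    have e1 : IsCoprime (A : ℤ) (3 * QuadraticAlgebra.norm x) :=
      IsCoprime.of_isCoprime_of_dvd_right hA ⟨QuadraticAlgebra.norm y, by ring⟩
    have e2 : IsCoprime (A : ℤ) (3 * QuadraticAlgebra.norm y) :=
      IsCoprime.of_isCoprime_of_dvd_right hA ⟨QuadraticAlgebra.norm x, by ring⟩
    have e3 : IsCoprime (A' : ℤ) (3 * QuadraticAlgebra.norm x) :=
      hA'.of_isCoprime_of_dvd_right ⟨QuadraticAlgebra.norm y, by ring⟩
    have e4 : IsCoprime (A' : ℤ) (3 * QuadraticAlgebra.norm y) :=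
      hA'.of_isCoprime_of_dvd_right ⟨QuadraticAlgebra.norm x, by ring⟩
    have e5 := h.of_dvd ⟨QuadraticAlgebra.norm y, rfl⟩
    have e6 := h.of_dvd ⟨QuadraticAlgebra.norm x, mul_comm _ _⟩
    rw [hxy, cubicSymbol_mul e1 e2, cubicSymbol_mul e3 e4, hx e1 e3 e5]
    congr 1
    have hy0 := norm_nonneg y
    have hx0 := norm_nonneg x
    refine ih (QuadraticAlgebra.norm y).toNat ?_ hy e2 e4 e6 (Int.toNat_of_nonneg hy0).symm
    have : QuadraticAlgebra.norm y < n := by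
      rw [← hn, hN]
      have : QuadraticAlgebra.norm x * QuadraticAlgebra.norm y ≠ 0 := by rw [← hN, hn]; exact_mod_cast hn0
      have h5 : 0 < QuadraticAlgebra.norm y := lt_of_le_of_ne hy0 (right_ne_zero_of_mul this).symm
      have h6 : 0 < QuadraticAlgebra.norm x := lt_of_le_of_ne hx0 (left_ne_zero_of_mul this).symm
      have h7 : 2 ≤ QuadraticAlgebra.norm x := by omega
      nlinarith
    omega
  by_cases hdiv : (p : ℤ) ∣ z.re ∧ (p : ℤ) ∣ z.im
  · obtain ⟨⟨a, ha⟩, ⟨b, hb⟩⟩ := hdiv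
    have hz' : z = ((p : ℤ) : Eisenstein) * ⟨a, b⟩ := by ext <;> simp [ha, hb]
    refine step _ _ hz' ?_ ?_ ?_
    · rw [norm_intCast]
      intro h
      have h' : (p : ℤ) * p = 1 := by rw [← pow_two]; exact h
      have := hp.one_lt
      nlinarith
    · rw [hz'] at hz; exact hz.of_intCast_mul hp3'
    · intro h1 h2 _
      rw [norm_intCast] at h1 h2
      have hd : (3 * (p : ℤ)) ∣ 3 * p ^ 2 := ⟨p, by ring⟩
      rw [cubicSymbol_intCast (h1.of_isCoprime_of_dvd_right hd),
        cubicSymbol_intCast (h2.of_isCoprime_of_dvd_right hd)]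
  · have hp1 := prime_mod_three_of_dvd hp hp3 hpn hdiv
    obtain ⟨J, hJN, hJp, hJ⟩ := exists_norm_eq_prime hp hp1
    have hJ0 : ((p : ℤ) : Eisenstein) = J * star J := by
      rw [← algebraMap_norm_eq_mul_star, hJN]; simp
    have hJne : J ≠ 0 := by
      rintro rfl
      rw [QuadraticAlgebra.norm_zero] at hJN
      exact hp.ne_zero (by exact_mod_cast hJN.symm)
    have hp1' : (p : ℤ) ≠ 1 := by exact_mod_cast hp.one_lt.ne'
    obtain ⟨y, hy | hy⟩ := exists_mul_eq_intCast_mul hp hpn hJN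
    · refine step (star J) y ?_ ?_ ?_ ?_
      · apply mul_right_cancel₀ hJne
        rw [hy, hJ0]; ring
      · rw [QuadraticAlgebra.norm_star, hJN]; exact hp1'
      · have := hz.mul hJp
        rw [hy] at this
        exact this.of_intCast_mul hp3'
      · rw [QuadraticAlgebra.norm_star]
        intro e1 e2 e3
        rw [cubicSymbol_star e1, cubicSymbol_star e2]
        rw [hJN] at e1 e2 e3
        rw [hJ _ _ hA0 hA0' e1 e2 e3]
    · refine step J y ?_ ?_ ?_ ?_
      · have : star J ≠ 0 := by simpa using hJne
        apply mul_right_cancel₀ this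
        rw [hy, hJ0]; ring
      · rw [hJN]; exact hp1'
      · have := hz.mul hJp.star
        rw [hy] at this
        exact this.of_intCast_mul hp3'
      · rw [hJN]
        intro e1 e2 e3
        exact hJ _ _ hA0 hA0' e1 e2 e3

end Eisenstein

lemma Int.isCoprime_of_forall_prime {a b : ℤ}
    (h : ∀ p : ℕ, p.Prime → (p : ℤ) ∣ a → (p : ℤ) ∣ b → False) : IsCoprime a b := by
  rw [Int.isCoprime_iff_gcd_eq_one]
  by_contra hne
  obtain ⟨p, hp, hd⟩ := Nat.exists_prime_and_dvd hne
  have hd : (p : ℤ) ∣ (Int.gcd a b : ℤ) := Int.natCast_dvd_natCast.2 hd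
  exact h p hp (hd.trans (Int.gcd_dvd_left ..)) (hd.trans (Int.gcd_dvd_right ..))

lemma IsCoprime.not_prime_dvd {a b : ℤ} (h : IsCoprime a b) {p : ℕ} (hp : p.Prime)
    (ha : (p : ℤ) ∣ a) (hb : (p : ℤ) ∣ b) : False :=
  (Nat.prime_iff_prime_int.1 hp).not_isUnit (h.isUnit_of_dvd' ha hb)

lemma Nat.Prime.int_dvd_mul {p : ℕ} (hp : p.Prime) {a b : ℤ} :
    (p : ℤ) ∣ a * b ↔ (p : ℤ) ∣ a ∨ (p : ℤ) ∣ b := (Nat.prime_iff_prime_int.1 hp).dvd_mul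

lemma Nat.Prime.int_dvd_pow {p : ℕ} (hp : p.Prime) {a : ℤ} {n : ℕ} (h : (p : ℤ) ∣ a ^ n) :
    (p : ℤ) ∣ a := (Nat.prime_iff_prime_int.1 hp).dvd_of_dvd_pow h

namespace Eisenstein

open QuadraticAlgebra

/-- The Eisenstein integer `r + s √-3`. -/
def root3 (r s : ℤ) : Eisenstein := ⟨r + s, 2 * s⟩

lemma norm_root3 (r s : ℤ) : QuadraticAlgebra.norm (root3 r s) = r ^ 2 + 3 * s ^ 2 := by
  rw [norm_eq, root3]; ring

lemma root3_mul (r s r' s' : ℤ) :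
    root3 r s * root3 r' s' = root3 (r * r' - 3 * (s * s')) (r * s' + r' * s) := by
  ext <;> simp [root3] <;> ring

lemma star_root3 (r s : ℤ) : star (root3 r s) = root3 r (-s) := by
  ext <;> simp [root3]; ring

/-- The exponent of the cubic symbol of `(r + s √-3) / (r - s √-3)` modulo `A`. -/
noncomputable def rootSymbol (A : ℕ) (r s : ℤ) : ZMod 3 := cubicSymbol A (root3 r s)

@[simp] lemma rootSymbol_one (r s : ℤ) : rootSymbol 1 r s = 0 := cubicSymbol_one _

lemma rootSymbol_mul_left {A B : ℕ} (hA : A ≠ 0) (hB : B ≠ 0) (r s : ℤ) :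
    rootSymbol (A * B) r s = rootSymbol A r s + rootSymbol B r s := cubicSymbol_mul_left hA hB _

lemma rootSymbol_pow_left {A : ℕ} (hA : A ≠ 0) (n : ℕ) (r s : ℤ) :
    rootSymbol (A ^ n) r s = n * rootSymbol A r s := cubicSymbol_pow_left hA n _

variable {A : ℕ} {r s r' s' : ℤ}

lemma rootSymbol_mul (h : IsCoprime (A : ℤ) (3 * (r ^ 2 + 3 * s ^ 2)))
    (h' : IsCoprime (A : ℤ) (3 * (r' ^ 2 + 3 * s' ^ 2))) :
    rootSymbol A (r * r' - 3 * (s * s')) (r * s' + r' * s) = rootSymbol A r s + rootSymbol A r' s' := by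
  rw [rootSymbol, ← root3_mul, cubicSymbol_mul (by rwa [norm_root3]) (by rwa [norm_root3])]; rfl

lemma rootSymbol_congr (h : IsCoprime (A : ℤ) (3 * (r ^ 2 + 3 * s ^ 2)))
    (hr : r ≡ r' [ZMOD A]) (hs : s ≡ s' [ZMOD A]) : rootSymbol A r s = rootSymbol A r' s' :=
  cubicSymbol_congr (by rwa [norm_root3]) (hr.add hs) (hs.mul_left 2)

lemma rootSymbol_neg_right (h : IsCoprime (A : ℤ) (3 * (r ^ 2 + 3 * s ^ 2))) :
    rootSymbol A r (-s) = -rootSymbol A r s := by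
  rw [rootSymbol, ← star_root3, cubicSymbol_star (by rwa [norm_root3])]; rfl

lemma rootSymbol_zero_right (h : IsCoprime (A : ℤ) (3 * r)) : rootSymbol A r 0 = 0 := by
  have : root3 r 0 = (r : Eisenstein) := by ext <;> simp [root3]
  rw [rootSymbol, this, cubicSymbol_intCast h]

lemma rootSymbol_zero_left (h : IsCoprime (A : ℤ) (3 * s)) : rootSymbol A 0 s = 0 := by
  apply cubicSymbol_eq_zero_of_star_eq_neg
  · rw [norm_root3]
    have h1 := h.of_mul_right_left
    have h2 := h.of_mul_right_right.pow_right (n := 2)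
    have := h1.mul_right (h1.mul_right h2)
    convert this using 2; ring
  · rw [star_root3]; ext <;> simp [root3]

lemma rootSymbol_intCast_mul {g : ℤ} (h : IsCoprime (A : ℤ) (3 * (r ^ 2 + 3 * s ^ 2)))
    (hg : IsCoprime (A : ℤ) g) : rootSymbol A (g * r) (g * s) = rootSymbol A r s := by
  have h3 := h.of_mul_right_left
  have hg3 := h3.mul_right hg
  have := rootSymbol_mul (r := g) (s := 0) (r' := r) (s' := s) (A := A) (by
    have := h3.mul_right (hg.pow_right (n := 2)); simpa using this) h
  rw [rootSymbol_zero_right hg3, zero_add] at this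
  rw [← this]; congr 1 <;> ring

lemma rootSymbol_eq_of_modEq {A A' : ℕ} (hr : ¬ 3 ∣ r) (hs : 3 ∣ s) (hA0 : A ≠ 0) (hA0' : A' ≠ 0)
    (hA : IsCoprime (A : ℤ) (3 * (r ^ 2 + 3 * s ^ 2)))
    (hA' : IsCoprime (A' : ℤ) (3 * (r ^ 2 + 3 * s ^ 2)))
    (h : (A : ℤ) ≡ A' [ZMOD r ^ 2 + 3 * s ^ 2]) : rootSymbol A r s = rootSymbol A' r s := by
  rw [← norm_root3] at hA hA' h
  refine cubicSymbol_eq_of_modEq ⟨?_, ?_⟩ hA0 hA0' hA hA' h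
  · change ¬ 3 ∣ r + s; omega
  · change 3 ∣ 2 * s; omega

lemma _root_.ZMod.three_mul_eq_zero (a : ZMod 3) : 3 * a = 0 := by revert a; decide

/-- The symbol of a primary element whose norm occurs in a suitable ternary identity
vanishes. -/
lemma rootSymbol_eq_zero_of_identity {a n : ℕ} {κ d x m x₁ m₁ h y t r s G : ℤ} (ha : a ≠ 0)
    (hκ : κ = 1 ∨ κ = 4 ∧ ¬ 2 ∣ x ∧ ¬ 2 ∣ y) (hxy : x ^ 2 + d * y ^ 2 = κ * n ^ 3)
    (cxy : IsCoprime x y) (x3 : ¬ 3 ∣ x) (y27 : ¬ 27 ∣ y) (cn : IsCoprime (n : ℤ) (6 * d))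
    (can : IsCoprime (a : ℤ) n)
    (hm : m ^ 2 - 8748 * d * t ^ 2 = a) (cmt : IsCoprime m t) (m2 : ¬ 2 ∣ m) (m3 : ¬ 3 ∣ m)
    (hx : x = h * x₁) (hm₁ : m = h * m₁) (cxm : IsCoprime x₁ m₁)
    (hr : y * m₁ = G * r) (hs : 54 * x₁ * t = G * s) (crs : IsCoprime r s)
    (caL : IsCoprime (a : ℤ) (3 * (r ^ 2 + 3 * s ^ 2))) : rootSymbol a r s = 0 := by
  set L := r ^ 2 + 3 * s ^ 2 with hL
  have hx0 : x₁ ≠ 0 := by rintro rfl; apply x3; rw [hx]; simp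
  have hm0 : m₁ ≠ 0 := by rintro rfl; apply m3; rw [hm₁]; simp
  have hn0 : n ≠ 0 := by
    rintro rfl
    have := cn.not_prime_dvd Nat.prime_two (by simp) ⟨3 * d, by push_cast; ring⟩
    exact this
  have hh0 : h ≠ 0 := by rintro rfl; apply x3; rw [hx]; simp
  have hid : (a : ℤ) * x₁ ^ 2 = κ * m₁ ^ 2 * n ^ 3 - d * G ^ 2 * L := by
    have e1 : m₁ * x = m * x₁ := by rw [hx, hm₁]; ring
    have e2 : G ^ 2 * L = (y * m₁) ^ 2 + 3 * (54 * x₁ * t) ^ 2 := by rw [hr, hs, hL]; ring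
    linear_combination (-x₁ ^ 2) * hm + m₁ ^ 2 * hxy - (m₁ * x + m * x₁) * e1 + d * e2
  have x2 : κ = 4 → ¬ 2 ∣ x := fun h4 => by
    rcases hκ with h1 | h1
    · omega
    · exact h1.2.1
  have y2 : κ = 4 → ¬ 2 ∣ y := fun h4 => by
    rcases hκ with h1 | h1
    · omega
    · exact h1.2.2
  -- primality of the remaining data to `3`
  have hs3 : 3 ∣ s := by
    by_contra h3
    have h27 : (27 : ℤ) ∣ G := by
      have h1 : IsCoprime ((27 : ℤ)) s := by
        have : IsCoprime (3 : ℤ) s := (Int.prime_three.coprime_iff_not_dvd).2 h3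
        have := this.pow_left (m := 3); simpa using this
      exact h1.dvd_of_dvd_mul_right ⟨2 * x₁ * t, by rw [← hs]; ring⟩
    have h1 : IsCoprime ((27 : ℤ)) m₁ := by
      have : IsCoprime (3 : ℤ) m₁ := (Int.prime_three.coprime_iff_not_dvd).2
        (fun h => m3 (by rw [hm₁]; exact h.mul_left _))
      have := this.pow_left (m := 3); simpa using this
    exact y27 (h1.dvd_of_dvd_mul_right (by rw [hr]; exact h27.mul_right _))
  have hr3 : ¬ 3 ∣ r := fun h3 => crs.not_prime_dvd Nat.prime_three h3 hs3
  have hL3 : ¬ (3 : ℤ) ∣ L := by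
    intro h3
    apply hr3
    apply Int.prime_three.dvd_of_dvd_pow (n := 2)
    have : r ^ 2 = L - 3 * s ^ 2 := by rw [hL]; ring
    rw [this]; exact dvd_sub h3 ⟨_, rfl⟩
  have x13 : ¬ 3 ∣ x₁ := fun h => x3 (by rw [hx]; exact h.mul_left _)
  have m13 : ¬ 3 ∣ m₁ := fun h => m3 (by rw [hm₁]; exact h.mul_left _)
  have m12 : ¬ 2 ∣ m₁ := fun h => m2 (by rw [hm₁]; exact h.mul_left _)
  have hL2 : κ = 4 → ¬ (2 : ℤ) ∣ L ∧ 2 ∣ s := by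
    intro h4
    have hG : ¬ 2 ∣ G * r := by
      rw [← hr]
      intro h; exact (Int.prime_two.dvd_or_dvd h).elim (y2 h4) m12
    have hs2 : 2 ∣ s := by
      have : (2 : ℤ) ∣ G * s := ⟨27 * x₁ * t, by rw [← hs]; ring⟩
      exact (Int.prime_two.dvd_or_dvd this).resolve_left (fun h => hG (h.mul_right _))
    refine ⟨fun h => ?_, hs2⟩
    apply hG
    apply Dvd.dvd.mul_left
    apply Int.prime_two.dvd_of_dvd_pow (n := 2)
    have : r ^ 2 = L - s * (3 * s) := by rw [hL]; ring
    rw [this]; exact dvd_sub h (hs2.mul_right _)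
  have cop3 : ∀ {b : ℤ}, ¬ 3 ∣ b → IsCoprime b L → IsCoprime b (3 * L) := fun h h' =>
    ((Int.prime_three.coprime_iff_not_dvd).2 h).symm.mul_right h'
  have caL' : IsCoprime (a : ℤ) L := caL.of_mul_right_right
  have cκL : IsCoprime κ L := by
    rcases hκ with rfl | ⟨h4, -⟩
    · exact isCoprime_one_left
    · have := ((Int.prime_two.coprime_iff_not_dvd).2 (hL2 h4).1).pow_left (m := 2)
      rw [h4]; simpa using this
  have cxn : IsCoprime x₁ n := by
    refine Int.isCoprime_of_forall_prime fun p hp h1 h2 => ?_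
    have hpx : (p : ℤ) ∣ x := by rw [hx]; exact h1.mul_left _
    have : (p : ℤ) ∣ d * y ^ 2 := by
      have : d * y ^ 2 = n * (κ * n ^ 2) - x * x := by linear_combination hxy
      rw [this]; exact dvd_sub (h2.mul_right _) (hpx.mul_right _)
    rcases hp.int_dvd_mul.1 this with h | h
    · exact cn.not_prime_dvd hp h2 (h.mul_left _)
    · exact cxy.not_prime_dvd hp hpx (hp.int_dvd_pow h)
  have cxL : IsCoprime x₁ L := by
    refine Int.isCoprime_of_forall_prime fun p hp h1 h2 => ?_
    have : (p : ℤ) ∣ κ * (m₁ ^ 2 * n ^ 3) := by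
      have : κ * (m₁ ^ 2 * n ^ 3) = x₁ * (a * x₁) + L * (d * G ^ 2) := by linear_combination (-1 : ℤ) * hid
      rw [this]; exact dvd_add (h1.mul_right _) (h2.mul_right _)
    rcases hp.int_dvd_mul.1 this with h | h
    · exact cκL.not_prime_dvd hp h h2
    rcases hp.int_dvd_mul.1 h with h | h
    · exact cxm.not_prime_dvd hp h1 (hp.int_dvd_pow h)
    · exact cxn.not_prime_dvd hp h1 (hp.int_dvd_pow h)
  have hdvd : ∀ p : ℕ, p.Prime → (p : ℤ) ∣ L → (p : ℤ) ∣ m₁ * n → False := by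
    intro p hp h2 h1
    have : (p : ℤ) ∣ a * x₁ ^ 2 := by
      have : (a : ℤ) * x₁ ^ 2 = (m₁ * n) * (κ * m₁ * n ^ 2) - L * (d * G ^ 2) := by linear_combination hid
      rw [this]; exact dvd_sub (h1.mul_right _) (h2.mul_right _)
    rcases hp.int_dvd_mul.1 this with h | h
    · exact caL'.not_prime_dvd hp h h2
    · exact cxL.not_prime_dvd hp (hp.int_dvd_pow h) h2
  have cmL : IsCoprime m₁ L := Int.isCoprime_of_forall_prime fun p hp h1 h2 =>
    hdvd p hp h2 (h1.mul_right _)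
  have cnL : IsCoprime (n : ℤ) L := Int.isCoprime_of_forall_prime fun p hp h1 h2 =>
    hdvd p hp h2 (h1.mul_left _)
  have n3 : ¬ (3 : ℤ) ∣ n := fun h => cn.not_prime_dvd Nat.prime_three h ⟨2 * d, by push_cast; ring⟩
  -- vanishing of the symbols modulo `x₁`, `m₁` and `κ`
  have cxL3 := cop3 x13 cxL
  have cmL3 := cop3 m13 cmL
  have cnL3 := cop3 n3 cnL
  have tx : rootSymbol x₁.natAbs r s = 0 := by
    have cc : ∀ {z : ℤ}, IsCoprime x₁ z → IsCoprime ((x₁.natAbs : ℕ) : ℤ) z := fun h => by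
      rw [Int.natCast_natAbs]; exact (IsCoprime.abs_left_iff _ _).2 h
    have cxG : IsCoprime x₁ (G * r) := by
      rw [← hr]
      refine IsCoprime.mul_right ?_ cxm
      exact cxy.of_isCoprime_of_dvd_left ⟨h, by rw [hx]; ring⟩
    rw [← rootSymbol_intCast_mul (cc cxL3) (cc cxG.of_mul_right_left), rootSymbol_congr (r' := G * r) (s' := 0),
      rootSymbol_zero_right]
    · exact cc (((Int.prime_three.coprime_iff_not_dvd).2 x13).symm.mul_right cxG)
    · have h1 := cc cxG.of_mul_right_left
      have := (cc cxL3).of_mul_right_left.mul_right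
        ((cc cxL).mul_right (h1.mul_right h1))
      convert this using 2; rw [hL]; ring
    · rfl
    · rw [← hs, Int.modEq_zero_iff_dvd, Int.natCast_natAbs, abs_dvd]
      exact ⟨54 * t, by ring⟩
  have tm : rootSymbol m₁.natAbs r s = 0 := by
    have cc : ∀ {z : ℤ}, IsCoprime m₁ z → IsCoprime ((m₁.natAbs : ℕ) : ℤ) z := fun h => by
      rw [Int.natCast_natAbs]; exact (IsCoprime.abs_left_iff _ _).2 h
    have cmG : IsCoprime m₁ (G * s) := by
      rw [← hs]
      have e2 := ((Int.prime_two.coprime_iff_not_dvd).2 m12).symm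
      have e3 := (((Int.prime_three.coprime_iff_not_dvd).2 m13).symm).pow_right (n := 3)
      have e4 : IsCoprime m₁ t := cmt.of_isCoprime_of_dvd_left ⟨h, by rw [hm₁]; ring⟩
      rw [show (54 : ℤ) = 2 * 3 ^ 3 by norm_num]
      exact ((e2.mul_right e3).mul_right cxm.symm).mul_right e4
    rw [← rootSymbol_intCast_mul (cc cmL3) (cc cmG.of_mul_right_left), rootSymbol_congr (r' := 0) (s' := G * s),
      rootSymbol_zero_left]
    · exact cc (((Int.prime_three.coprime_iff_not_dvd).2 m13).symm.mul_right cmG)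
    · have h1 := cc cmG.of_mul_right_left
      have := (cc cmL3).of_mul_right_left.mul_right
        ((cc cmL).mul_right (h1.mul_right h1))
      convert this using 2; rw [hL]; ring
    · rw [← hr, Int.modEq_zero_iff_dvd, Int.natCast_natAbs, abs_dvd]
      exact ⟨y, by ring⟩
    · rfl
  obtain ⟨k, hk, hkc, tk⟩ : ∃ k : ℕ, (k : ℤ) = κ ∧ ¬ (3 : ℤ) ∣ κ ∧ rootSymbol k r s = 0 := by
    rcases hκ with rfl | ⟨h4, -⟩
    · exact ⟨1, by simp, by norm_num, rootSymbol_one _ _⟩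
    · refine ⟨2 ^ 2, by rw [h4]; norm_num, by rw [h4]; norm_num, ?_⟩
      obtain ⟨hL2, hs2⟩ := hL2 h4
      have c2 : IsCoprime ((2 : ℕ) : ℤ) (3 * L) := by
        push_cast
        exact (Int.prime_two.coprime_iff_not_dvd).2
          (fun h => (Int.prime_two.dvd_or_dvd h).elim (by norm_num) hL2)
      have hr2 : ¬ (2 : ℤ) ∣ r := by
        intro h; apply hL2; rw [hL]
        exact dvd_add (dvd_pow h two_ne_zero) ((dvd_pow hs2 two_ne_zero).mul_left _)
      rw [rootSymbol_pow_left two_ne_zero, rootSymbol_congr (r' := r) (s' := 0) c2 rfl,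
        rootSymbol_zero_right, mul_zero]
      · push_cast
        exact (Int.prime_two.coprime_iff_not_dvd).2
          (fun h => (Int.prime_two.dvd_or_dvd h).elim (by norm_num) hr2)
      · rw [Int.modEq_zero_iff_dvd]; exact_mod_cast hs2
  have hk0 : k ≠ 0 := by rintro rfl; apply hkc; rw [← hk]; simp
  have hxa : x₁.natAbs ≠ 0 := by simpa using hx0
  have hma : m₁.natAbs ≠ 0 := by simpa using hm0
  have key := rootSymbol_eq_of_modEq (A := a * x₁.natAbs ^ 2) (A' := k * m₁.natAbs ^ 2 * n ^ 3)
    hr3 hs3 (mul_ne_zero ha (pow_ne_zero _ hxa))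
    (mul_ne_zero (mul_ne_zero hk0 (pow_ne_zero _ hma)) (pow_ne_zero _ hn0))
    (by
      push_cast
      rw [sq_abs]
      exact caL.mul_left cxL3.pow_left)
    (by
      push_cast
      rw [sq_abs, hk]
      exact ((cop3 hkc cκL).mul_left cmL3.pow_left).mul_left cnL3.pow_left)
    (by
      push_cast
      rw [sq_abs, sq_abs, hk, hid, Int.modEq_comm, Int.modEq_iff_dvd]
      exact ⟨-(d * G ^ 2), by rw [hL]; ring⟩)
  rw [rootSymbol_mul_left ha (pow_ne_zero _ hxa), rootSymbol_pow_left hxa, tx,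
    rootSymbol_mul_left (mul_ne_zero hk0 (pow_ne_zero _ hma)) (pow_ne_zero _ hn0),
    rootSymbol_mul_left hk0 (pow_ne_zero _ hma), rootSymbol_pow_left hma, tm, tk,
    rootSymbol_pow_left hn0] at key
  rw [show ((3 : ℕ) : ZMod 3) = 3 from rfl, ZMod.three_mul_eq_zero] at key
  simpa using key

/-- The value at a fixed representation `x² + d y² = κ n³` of the symbol attached to a binary
quadratic form of discriminant proportional to `d` with first coefficients `A` and `B` depends only
on the proper equivalence class of the form. -/
theorem rootSymbol_eq_of_represents {A A' n : ℕ} {κ d x m y t B B' : ℤ} (hA0 : A ≠ 0) (hA0' : A' ≠ 0)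
    (hκ : κ = 1 ∨ κ = 4 ∧ ¬ 2 ∣ x ∧ ¬ 2 ∣ y) (hxy : x ^ 2 + d * y ^ 2 = κ * n ^ 3)
    (cxy : IsCoprime x y) (x3 : ¬ 3 ∣ x) (y27 : ¬ 27 ∣ y) (cn : IsCoprime (n : ℤ) (6 * d))
    (hA : IsCoprime (A : ℤ) (6 * d * n)) (hA' : IsCoprime (A' : ℤ) (6 * d * n))
    (hm : m ^ 2 - 8748 * d * t ^ 2 = A * A') (cmt : IsCoprime m t)
    (hB : B ^ 2 ≡ 8748 * d [ZMOD A]) (hB' : B' ^ 2 ≡ 8748 * d [ZMOD A'])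
    (hmB : m ≡ B * t [ZMOD A]) (hmB' : m ≡ -(B' * t) [ZMOD A']) :
    rootSymbol A (y * B) (54 * x) = rootSymbol A' (y * B') (54 * x) := by
  have hA1 := hA.of_mul_right_left
  have hA1' := hA'.of_mul_right_left
  have h6 : ∀ {p : ℕ}, p.Prime → (p : ℤ) ∣ 8748 → (p : ℤ) ∣ 6 := by
    intro p hp h
    rw [show (8748 : ℤ) = 2 ^ 2 * 3 ^ 7 by norm_num] at h
    rw [show (6 : ℤ) = 2 * 3 by norm_num, hp.int_dvd_mul]
    exact (hp.int_dvd_mul.1 h).imp hp.int_dvd_pow hp.int_dvd_pow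
  have cop : ∀ {C : ℕ} {b : ℤ}, IsCoprime (C : ℤ) (6 * d * n) → (b ^ 2 ≡ 8748 * d [ZMOD C]) →
      IsCoprime (C : ℤ) (3 * ((y * b) ^ 2 + 3 * (54 * x) ^ 2)) := by
    intro C b hC hb
    have h1 : IsCoprime (C : ℤ) (3 * (8748 * (κ * n ^ 3))) := by
      refine Int.isCoprime_of_forall_prime fun p hp h h' => ?_
      have h'' : (p : ℤ) ∣ 6 * d * n := by
        rcases hp.int_dvd_mul.1 h' with h' | h'
        · exact ((h'.trans (by norm_num : (3 : ℤ) ∣ 6)).mul_right _).mul_right _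
        rcases hp.int_dvd_mul.1 h' with h' | h'
        · exact ((h6 hp h').mul_right _).mul_right _
        rcases hp.int_dvd_mul.1 h' with h' | h'
        · rcases hκ with rfl | ⟨rfl, -⟩
          · exact (h'.trans (one_dvd _))
          · have : (p : ℤ) ∣ 2 := hp.int_dvd_pow (n := 2) (by simpa using h')
            exact ((this.trans (by norm_num : (2 : ℤ) ∣ 6)).mul_right _).mul_right _
        · exact (hp.int_dvd_pow h').mul_left _
      exact hC.not_prime_dvd hp h h''
    obtain ⟨k, hk⟩ := hb.dvd
    have : 3 * ((y * b) ^ 2 + 3 * (54 * x) ^ 2) = 3 * (8748 * (κ * n ^ 3)) + (C : ℤ) * (-(3 * y ^ 2 * k)) := by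
      linear_combination 26244 * hxy - 3 * y ^ 2 * hk
    rw [this]
    exact h1.add_mul_left_right _
  have copt : ∀ {C : ℕ}, IsCoprime (C : ℤ) (6 * d * n) → (C : ℤ) ∣ A * A' → IsCoprime (C : ℤ) t ∧ IsCoprime (C : ℤ) m := by
    intro C hC hd
    have hct : IsCoprime (C : ℤ) t := by
      refine Int.isCoprime_of_forall_prime fun p hp h1 h2 => ?_
      refine cmt.not_prime_dvd hp (hp.int_dvd_pow (n := 2) ?_) h2
      have : m ^ 2 = A * A' + t * (8748 * d * t) := by linear_combination hm
      rw [this]; exact dvd_add (h1.trans hd) (h2.mul_right _)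
    refine ⟨hct, Int.isCoprime_of_forall_prime fun p hp h1 h2 => ?_⟩
    have : (p : ℤ) ∣ 8748 * d * t ^ 2 := by
      have : 8748 * d * t ^ 2 = m * m - A * A' := by linear_combination (-1 : ℤ) * hm
      rw [this]; exact dvd_sub (h2.mul_right _) (h1.trans hd)
    rcases hp.int_dvd_mul.1 this with h | h
    · rcases hp.int_dvd_mul.1 h with h | h
      · exact hC.not_prime_dvd hp h1 (((h6 hp h).mul_right _).mul_right _)
      · exact hC.not_prime_dvd hp h1 ((h.mul_left _).mul_right _)
    · exact hct.not_prime_dvd hp h1 (hp.int_dvd_pow h)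
  obtain ⟨cAt, cAm⟩ := copt hA ⟨A', rfl⟩
  obtain ⟨cAt', cAm'⟩ := copt hA' ⟨A, mul_comm _ _⟩
  have cB := cop hA hB
  have cB' := cop hA' hB'
  -- transfer to the element `y m + 54 x t √-3`
  have cL : ∀ {C : ℕ} {b : ℤ}, IsCoprime (C : ℤ) t →
      IsCoprime (C : ℤ) (3 * ((y * b) ^ 2 + 3 * (54 * x) ^ 2)) → m ≡ b * t [ZMOD C] →
      IsCoprime (C : ℤ) (3 * ((y * m) ^ 2 + 3 * (54 * x * t) ^ 2)) := by
    intro C b h1 h2 h3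
    obtain ⟨k, hk⟩ := h3.symm.dvd
    have : 3 * ((y * m) ^ 2 + 3 * (54 * x * t) ^ 2) = t ^ 2 * (3 * ((y * b) ^ 2 + 3 * (54 * x) ^ 2)) + (C : ℤ) * (3 * y ^ 2 * k * (m + b * t)) := by
      linear_combination (3 * y ^ 2 * (m + b * t)) * hk
    rw [this]
    exact (h1.pow_right.mul_right h2).add_mul_left_right _
  have e1 : rootSymbol A (y * m) (54 * x * t) = rootSymbol A (y * B) (54 * x) := by
    rw [← rootSymbol_intCast_mul cB cAt]
    refine rootSymbol_congr (cL cAt cB hmB) ?_ (by rw [mul_comm])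
    have := hmB.mul_left y
    convert this using 1; ring
  have cB'' : IsCoprime (A' : ℤ) (3 * ((y * -B') ^ 2 + 3 * (54 * x) ^ 2)) := by
    convert cB' using 2; ring
  have hmB'' : m ≡ -B' * t [ZMOD A'] := by convert hmB' using 1; ring
  have e2 : rootSymbol A' (y * m) (54 * x * t) = - rootSymbol A' (y * B') (54 * x) := by
    have h1 : IsCoprime (A' : ℤ) (-t) := cAt'.neg_right
    have h3 := rootSymbol_intCast_mul (A := A') (r := y * B') (s := -(54 * x))
      (by convert cB' using 3; ring) h1
    rw [← rootSymbol_neg_right cB', ← h3]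
    refine rootSymbol_congr (cL cAt' cB'' hmB'') ?_ (by ring_nf; rfl)
    have := hmB''.mul_left y
    convert this using 1; ring
  have cAA : IsCoprime ((A * A' : ℕ) : ℤ) (3 * ((y * m) ^ 2 + 3 * (54 * x * t) ^ 2)) := by
    push_cast
    exact (cL cAt cB hmB).mul_left (cL cAt' cB'' hmB'')
  -- remove common factors
  have hp2 : ∀ {p : ℕ}, p.Prime → (p : ℤ) ∣ 6 → ¬ (p : ℤ) ∣ m := by
    intro p hp h6' h
    have : (p : ℤ) ∣ A * A' := by
      rw [← hm]
      refine dvd_sub (dvd_pow h two_ne_zero) ?_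
      exact ((h6'.trans (by norm_num : (6 : ℤ) ∣ 8748)).mul_right _).mul_right _
    rcases hp.int_dvd_mul.1 this with h | h
    · exact hA1.not_prime_dvd hp h (h6'.mul_right _)
    · exact hA1'.not_prime_dvd hp h (h6'.mul_right _)
  have m2 : ¬ 2 ∣ m := hp2 Nat.prime_two (by norm_num)
  have m3 : ¬ 3 ∣ m := hp2 Nat.prime_three (by norm_num)
  have hm0 : m ≠ 0 := by rintro rfl; simp at m2
  obtain ⟨h, x₁, m₁, cxm, hx, hm₁⟩ : ∃ h x₁ m₁ : ℤ, IsCoprime x₁ m₁ ∧ x = h * x₁ ∧ m = h * m₁ := by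
    obtain ⟨x₁, m₁, h1, h2, h3⟩ := Int.exists_gcd_one (Int.gcd_pos_of_ne_zero_right x hm0)
    exact ⟨_, x₁, m₁, Int.isCoprime_iff_gcd_eq_one.2 h1, h2.trans (mul_comm _ _), h3.trans (mul_comm _ _)⟩
  have hmm : y * m₁ ≠ 0 := by
    refine mul_ne_zero ?_ ?_
    · rintro rfl; simp at y27
    · rintro rfl; apply hm0; rw [hm₁]; simp
  obtain ⟨G, r, s, crs, hr, hs⟩ : ∃ G r s : ℤ, IsCoprime r s ∧ y * m₁ = G * r ∧ 54 * x₁ * t = G * s := by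
    obtain ⟨x₂, m₂, h1, h2, h3⟩ := Int.exists_gcd_one (Int.gcd_pos_of_ne_zero_right (54 * x₁ * t) hmm)
    exact ⟨_, m₂, x₂, (Int.isCoprime_iff_gcd_eq_one.2 h1).symm, h3.trans (mul_comm _ _),
      h2.trans (mul_comm _ _)⟩
  have er : y * m = (h * G) * r := by rw [hm₁, mul_assoc h, ← hr]; ring
  have es : 54 * x * t = (h * G) * s := by rw [hx, mul_assoc h, ← hs]; ring
  have hN : 3 * ((y * m) ^ 2 + 3 * (54 * x * t) ^ 2) = 3 * (r ^ 2 + 3 * s ^ 2) * ((h * G) ^ 2) := by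
    rw [er, es]; ring
  rw [hN] at cAA
  have caL := cAA.of_mul_right_left
  have caG : IsCoprime ((A * A' : ℕ) : ℤ) (h * G) :=
    cAA.of_mul_right_right.of_isCoprime_of_dvd_right (dvd_pow_self _ two_ne_zero)
  have key := rootSymbol_eq_zero_of_identity (a := A * A') (mul_ne_zero hA0 hA0') hκ hxy cxy x3 y27 cn
    (by push_cast; exact hA.of_mul_right_right.mul_left hA'.of_mul_right_right)
    (by rw [hm]; push_cast; rfl) cmt m2 m3 hx hm₁ cxm hr hs crs caL
  rw [← rootSymbol_intCast_mul caL caG, ← er, ← es, rootSymbol_mul_left hA0 hA0', e1, e2] at key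
  exact sub_eq_zero.1 (by rw [sub_eq_add_neg]; exact key)

end Eisenstein

open QuadraticAlgebra

namespace Eisenstein

section CubicRoots

variable {q : ℕ} {F : Type*} [Field F] [CharP F q] {N u v d b : ℤ}

lemma exists_int_root (hq : q.Prime) {x y : F} (hxy : x * y = N) (hu : x ^ 3 + y ^ 3 = u)
    (h : (x + y) ^ q = x + y) : ∃ r : ℤ, (r : F) = x + y ∧ (q : ℤ) ∣ r ^ 3 - 3 * N * r - u := by
  have : Fact q.Prime := ⟨hq⟩
  obtain ⟨r, hr⟩ := (mem_bot_iff_intCast q F).1 ((Subfield.mem_bot_iff_pow_eq_self F q).2 h)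
  refine ⟨r, hr, ?_⟩
  rw [← CharP.intCast_eq_zero_iff F q]
  push_cast
  rw [hr, ← hxy, ← hu]
  ring

lemma natCast_ne_zero_of_prime_ne {p : ℕ} (hq : q.Prime) (hp : p.Prime) (h : q ≠ p) : (p : F) ≠ 0 := by
  rw [Ne, CharP.cast_eq_zero_iff F q]
  exact fun h' => h ((Nat.prime_dvd_prime_iff_eq hq hp).1 h')

lemma intCast_pow_char (hq : q.Prime) (z : ℤ) : (z : F) ^ q = z := by
  have : Fact q.Prime := ⟨hq⟩
  exact map_intCast (frobenius F q) z

lemma exists_cube_root [IsAlgClosed F] {α β : F} (hN : (N : F) ≠ 0) (h : α * β = (N : F) ^ 3) :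
    ∃ x y : F, x ^ 3 = α ∧ y ^ 3 = β ∧ x * y = N := by
  obtain ⟨x, hx⟩ := IsAlgClosed.exists_pow_nat_eq α (n := 3) (by norm_num)
  have h0 : x ≠ 0 := by
    rintro rfl
    rw [← hx] at h
    exact pow_ne_zero 3 hN (by rw [← h]; ring)
  refine ⟨x, N / x, hx, ?_, by field_simp⟩
  rw [div_pow, ← h, ← hx]
  field_simp

/-- If the cubic symbol attached to `α = (u + v √-d) / 2` vanishes modulo a prime for which `3 d` is
a square, then the cubic resolvent of `α` has two distinct roots. -/
theorem exists_two_roots (hq : q.Prime) (h2 : q ≠ 2) (h3 : q ≠ 3) (hN : ¬ (q : ℤ) ∣ N)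
    (hd : ¬ (q : ℤ) ∣ d) (hv : ¬ (q : ℤ) ∣ v) (huv : u ^ 2 + d * v ^ 2 = 4 * N ^ 3)
    (hb : b ^ 2 ≡ 8748 * d [ZMOD q]) (hS : rootSymbol q (v * b) (54 * u) = 0) :
    ∃ r₁ r₂ : ℤ, (q : ℤ) ∣ r₁ ^ 3 - 3 * N * r₁ - u ∧ (q : ℤ) ∣ r₂ ^ 3 - 3 * N * r₂ - u ∧
      ¬ (q : ℤ) ∣ r₁ - r₂ := by
  have : Fact q.Prime := ⟨hq⟩
  obtain ⟨F, _, _, _, φ, hφ⟩ := exists_map_eq_primeSymbol hq h3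
  have t0 : (3 : F) ≠ 0 := three_ne_zero_of_prime hq h3
  have w0 : (2 : F) ≠ 0 := by exact_mod_cast natCast_ne_zero_of_prime_ne (F := F) hq Nat.prime_two h2
  rw [← CharP.intCast_eq_zero_iff F q] at hN hd hv
  rw [← CharP.intCast_eq_intCast F q] at hb
  push_cast at hb
  have huv' : (u : F) ^ 2 + d * v ^ 2 = 4 * (N : F) ^ 3 := by exact_mod_cast congrArg (Int.cast (R := F)) huv
  have hw2 : φ omega ^ 2 = -1 - φ omega := by rw [← map_pow, omega_sq]; simp
  set w := φ omega with hw
  set t : F := 1 + 2 * w with ht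
  have ht2 : t ^ 2 = -3 := by rw [ht]; linear_combination 4 * hw2
  have ht0 : t ≠ 0 := by rintro h; rw [h] at ht2; apply t0; linear_combination ht2
  have h54 : (54 : F) ≠ 0 := by
    rw [show (54 : F) = 2 * 3 ^ 3 by norm_num]; exact mul_ne_zero w0 (pow_ne_zero _ t0)
  set σ : F := b / (54 * t) with hσ
  have hbσ : (b : F) = 54 * t * σ := by rw [hσ]; field_simp
  have hσ2 : σ ^ 2 = -d := by
    have : (54 * t) ^ 2 * (σ ^ 2 + d) = 0 := by
      rw [hbσ] at hb; linear_combination hb + 54 ^ 2 * (d : F) * ht2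
    rcases mul_eq_zero.1 this with h | h
    · exact absurd h (pow_ne_zero _ (mul_ne_zero h54 ht0))
    · linear_combination h
  have hσ0 : σ ≠ 0 := by rintro h; rw [h] at hσ2; apply hd; linear_combination hσ2
  obtain ⟨x, y, hx, hy, hxy⟩ := exists_cube_root (α := (u + v * σ) / 2) (β := (u - v * σ) / 2) hN
    (by field_simp; linear_combination huv' - (v : F) ^ 2 * hσ2)
  have hx0 : x ≠ 0 := by rintro rfl; apply hN; rw [← hxy]; ring
  have hy0 : y ≠ 0 := by rintro rfl; apply hN; rw [← hxy]; ring
  have hsum : x ^ 3 + y ^ 3 = u := by rw [hx, hy]; field_simp; ring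
  have hdiff : x ^ 3 - y ^ 3 = v * σ := by rw [hx, hy]; field_simp; ring
  have hdiff0 : x ^ 3 ≠ y ^ 3 := by
    intro h; rw [h, sub_self] at hdiff; exact mul_ne_zero hv hσ0 hdiff.symm
  have hz : φ (root3 (v * b) (54 * u)) = 108 * t * x ^ 3 := by
    rw [map_eq φ, ← hw, hx, root3]; push_cast; rw [hbσ, ht]; field_simp; ring
  have hz' : φ (star (root3 (v * b) (54 * u))) = -(108 * t) * y ^ 3 := by
    rw [star_root3, map_eq φ, ← hw, hy, root3]; push_cast; rw [hbσ, ht]; field_simp; ring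
  have h108 : (108 * t : F) ≠ 0 := by
    rw [show (108 : F) = 2 * 54 by norm_num]; exact mul_ne_zero (mul_ne_zero w0 h54) ht0
  have key := hφ (root3 (v * b) (54 * u)) (by
    rw [← CharP.intCast_eq_zero_iff F q, map_norm φ, hz, hz']
    exact mul_ne_zero (mul_ne_zero h108 (pow_ne_zero _ hx0))
      (mul_ne_zero (neg_ne_zero.2 h108) (pow_ne_zero _ hy0)))
  rw [← cubicSymbol_prime hq] at key
  rw [rootSymbol] at hS
  rw [hS, hz, hz', ZMod.val_zero, pow_zero] at key
  have hfix : ∀ e : F, e = 1 ∨ e = w → (e * x + e ^ 2 * y) ^ q = e * x + e ^ 2 * y := by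
    have hkey : (x / y) ^ (3 * cubicExponent q) = 1 := by
      have h1 : 108 * t * x ^ 3 / (-(108 * t) * y ^ 3) = -(x / y) ^ (3 : ℤ) := by
        rw [zpow_ofNat, neg_mul, div_neg, mul_div_mul_left _ _ h108, div_pow]
      rw [h1] at key
      have h2' : (-(x / y) ^ (3 : ℤ)) ^ cubicExponent q = ((x / y) ^ (3 : ℤ)) ^ cubicExponent q := by
        refine Even.neg_zpow ?_ _
        have ho := hq.eq_two_or_odd.resolve_left h2
        rcases hq.mod_three_eq h3 with h | h
        · have := three_mul_cubicExponent_of_one h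
          rw [Int.even_iff]; omega
        · have := three_mul_cubicExponent_of_two h
          rw [Int.even_iff]; omega
      rw [h2', ← zpow_mul] at key
      exact key
    have hac : x ^ q * y ^ q = x * y := by rw [← mul_pow, hxy, intCast_pow_char hq]
    have hbq := intCast_pow_char (F := F) hq b
    have h54q : (54 : F) ^ q = 54 := by simpa using intCast_pow_char (F := F) hq 54
    have h2q : (2 : F) ^ q = 2 := by simpa using intCast_pow_char (F := F) hq 2
    have h1q : (1 : F) ^ q = 1 := one_pow q
    have hx3 : (x ^ q) ^ 3 = (u + v * σ ^ q) / 2 := by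
      rw [← pow_mul, mul_comm, pow_mul, hx, div_pow, add_pow_char, mul_pow, intCast_pow_char hq,
        intCast_pow_char hq, h2q]
    rcases hq.mod_three_eq h3 with h | h
    · rw [three_mul_cubicExponent_of_one h, zpow_sub₀ (div_ne_zero hx0 hy0), zpow_natCast, zpow_one,
        div_eq_one_iff_eq (div_ne_zero hx0 hy0), div_pow, div_eq_div_iff (pow_ne_zero _ hy0) hy0] at hkey
      have hwq : w ^ q = w := map_pow_of_one φ hq h omega
      have hσq : σ ^ q = σ := by
        rw [hbσ, mul_pow, mul_pow, h54q, ht, add_pow_char, mul_pow, hwq, h1q, h2q, ← ht] at hbq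
        exact mul_left_cancel₀ (mul_ne_zero h54 ht0) hbq
      rw [hσq, ← hx] at hx3
      have h2a : (x ^ q) ^ 2 = x ^ 2 := mul_right_cancel₀ hy0 (by linear_combination x ^ q * hkey + x * hac)
      have hxq : x ^ q = x := mul_right_cancel₀ (pow_ne_zero 2 hx0) (by linear_combination hx3 - x ^ q * h2a)
      have hyq : y ^ q = y := by rw [hxq] at hac; exact mul_left_cancel₀ hx0 hac
      intro e he
      have heq : e ^ q = e := by rcases he with rfl | rfl <;> simp [hwq]
      rw [add_pow_char, mul_pow, mul_pow, hxq, hyq, ← pow_mul, mul_comm 2, pow_mul, heq]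
    · rw [three_mul_cubicExponent_of_two h, zpow_neg, inv_eq_one, zpow_add₀ (div_ne_zero hx0 hy0),
        zpow_natCast, zpow_one, div_pow, div_mul_div_comm,
        div_eq_one_iff_eq (mul_ne_zero (pow_ne_zero _ hy0) hy0)] at hkey
      have hwq : w ^ q = w ^ 2 := by rw [hw2, hw, map_pow_of_two φ hq h, star_omega]; simp
      have hσq : σ ^ q = -σ := by
        rw [hbσ, mul_pow, mul_pow, h54q, ht, add_pow_char, mul_pow, hwq, h1q, h2q] at hbq
        refine mul_left_cancel₀ (mul_ne_zero h54 ht0) ?_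
        rw [ht]
        linear_combination -hbq + 2 * 54 * σ ^ q * hw2
      rw [hσq, mul_neg, ← sub_eq_add_neg, ← hy] at hx3
      have h2a : (x ^ q) ^ 2 = y ^ 2 := mul_right_cancel₀ hx0 (by linear_combination x ^ q * hkey + y * hac)
      have hxq : x ^ q = y := mul_right_cancel₀ (pow_ne_zero 2 hy0) (by linear_combination hx3 - x ^ q * h2a)
      have hyq : y ^ q = x := by rw [hxq, mul_comm x] at hac; exact mul_left_cancel₀ hy0 hac
      intro e he
      rw [add_pow_char, mul_pow, mul_pow, hxq, hyq, ← pow_mul, mul_comm 2, pow_mul]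
      rcases he with rfl | rfl
      · simp [add_comm]
      · rw [hwq]
        linear_combination (w ^ 2 * x - w * x) * hw2
  have hw3 : w ^ 3 = 1 := by linear_combination (w - 1) * hw2
  obtain ⟨r₁, h1, h1'⟩ := exists_int_root (N := N) (u := u) hq hxy hsum (by simpa using hfix 1 (Or.inl rfl))
  obtain ⟨r₂, h2, h2'⟩ := exists_int_root (N := N) (u := u) (x := w * x) (y := w ^ 2 * y) hq
    (by rw [← hxy]; linear_combination x * y * hw3)
    (by rw [← hsum]; linear_combination (x ^ 3 + y ^ 3 * (w ^ 3 + 1)) * hw3) (hfix w (Or.inr rfl))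
  refine ⟨r₁, r₂, h1', h2', ?_⟩
  rw [← CharP.intCast_eq_zero_iff F q, Int.cast_sub, h1, h2]
  intro h
  have hp := isPrimitiveRoot_map t0 φ
  have : (1 - w) * (x - w ^ 2 * y) = 0 := by linear_combination h + (w * y - y) * hw2
  have h1w : 1 - w ≠ 0 := sub_ne_zero.2 (hp.ne_one (by norm_num)).symm
  have hx' := (mul_eq_zero.1 this).resolve_left h1w
  apply hdiff0
  linear_combination (x ^ 2 + x * w ^ 2 * y + w ^ 4 * y ^ 2) * hx' + y ^ 3 * (w ^ 3 + 1) * hw3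

/-- The cubic resolvent of `(u + v √-d) / 2` has a root modulo every prime for which `3 d` is not
a square. -/
theorem exists_one_root (hq : q.Prime) (h2 : q ≠ 2) (h3 : q ≠ 3) (hN : ¬ (q : ℤ) ∣ N)
    (huv : u ^ 2 + d * v ^ 2 = 4 * N ^ 3) (hb : ∀ b : ℤ, ¬ b ^ 2 ≡ 8748 * d [ZMOD q]) :
    ∃ r : ℤ, (q : ℤ) ∣ r ^ 3 - 3 * N * r - u := by
  have : Fact q.Prime := ⟨hq⟩
  obtain ⟨F, _, _, _⟩ : ∃ (F : Type) (_ : Field F) (_ : CharP F q), IsAlgClosed F :=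
    ⟨AlgebraicClosure (ZMod q), inferInstance, charP_of_injective_algebraMap
      (algebraMap (ZMod q) (AlgebraicClosure (ZMod q))).injective q, inferInstance⟩
  obtain ⟨φ, -⟩ := exists_hom F
  have t0 : (3 : F) ≠ 0 := three_ne_zero_of_prime hq h3
  have w0 : (2 : F) ≠ 0 := by exact_mod_cast natCast_ne_zero_of_prime_ne (F := F) hq Nat.prime_two h2
  rw [← CharP.intCast_eq_zero_iff F q] at hN
  have huv' : (u : F) ^ 2 + d * v ^ 2 = 4 * (N : F) ^ 3 := by exact_mod_cast congrArg (Int.cast (R := F)) huv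
  have hw2 : φ omega ^ 2 = -1 - φ omega := by rw [← map_pow, omega_sq]; simp
  set w := φ omega with hw
  have hw3 : w ^ 3 = 1 := by linear_combination (w - 1) * hw2
  have hp : IsPrimitiveRoot w 3 := isPrimitiveRoot_map t0 φ
  set t : F := 1 + 2 * w with ht
  have ht2 : t ^ 2 = -3 := by rw [ht]; linear_combination 4 * hw2
  have ht0 : t ≠ 0 := by rintro h; rw [h] at ht2; apply t0; linear_combination ht2
  have h54 : (54 : F) ≠ 0 := by
    rw [show (54 : F) = 2 * 3 ^ 3 by norm_num]; exact mul_ne_zero w0 (pow_ne_zero _ t0)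
  obtain ⟨σ, hσ2⟩ := IsAlgClosed.exists_pow_nat_eq (-d : F) (n := 2) (by norm_num)
  have h54q : (54 : F) ^ q = 54 := by simpa using intCast_pow_char (F := F) hq 54
  have h2q : (2 : F) ^ q = 2 := by simpa using intCast_pow_char (F := F) hq 2
  have hbq : (54 * t * σ) ^ q ≠ 54 * t * σ := by
    intro h
    obtain ⟨b, hb'⟩ := (mem_bot_iff_intCast q F).1 ((Subfield.mem_bot_iff_pow_eq_self F q).2 h)
    apply hb b
    rw [← CharP.intCast_eq_intCast F q]
    push_cast
    rw [hb', mul_pow, mul_pow, ht2, hσ2]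
    ring
  have hσq2 : (σ ^ q) ^ 2 = σ ^ 2 := by
    rw [← pow_mul, mul_comm, pow_mul, hσ2]
    have := intCast_pow_char (F := F) hq (-d)
    simpa using this
  have ht' : t ^ q = 1 + 2 * w ^ q := by rw [ht, add_pow_char, mul_pow, h2q, one_pow]
  rw [mul_pow, mul_pow, h54q, ht'] at hbq
  obtain ⟨x, y, hx, hy, hxy⟩ := exists_cube_root (α := (u + v * σ) / 2) (β := (u - v * σ) / 2) hN
    (by field_simp; linear_combination huv' - (v : F) ^ 2 * hσ2)
  have hx0 : x ≠ 0 := by rintro rfl; apply hN; rw [← hxy]; ring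
  have hy0 : y ≠ 0 := by rintro rfl; apply hN; rw [← hxy]; ring
  have hsum : x ^ 3 + y ^ 3 = u := by rw [hx, hy]; field_simp; ring
  have hac : x ^ q * y ^ q = x * y := by rw [← mul_pow, hxy, intCast_pow_char hq]
  have hx3 : (x ^ q) ^ 3 = (u + v * σ ^ q) / 2 := by
    rw [← pow_mul, mul_comm, pow_mul, hx, div_pow, add_pow_char, mul_pow, intCast_pow_char hq,
      intCast_pow_char hq, h2q]
  have hcube : ∀ {a b : F}, a ^ 3 = b ^ 3 → b ≠ 0 → ∃ i : ℕ, a = w ^ i * b := by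
    intro a b h hb0
    obtain ⟨i, -, hi⟩ := hp.eq_pow_of_pow_eq_one (ξ := a / b) (by
      rw [div_pow, h, div_self (pow_ne_zero _ hb0)])
    exact ⟨i, by rw [hi]; field_simp⟩
  have hw3i : ∀ i, (w ^ i) ^ 3 = 1 := fun i => by rw [← pow_mul, mul_comm, pow_mul, hw3, one_pow]
  have finish : ∀ e : F, e ^ 3 = 1 → (e * x + e ^ 2 * y) ^ q = e * x + e ^ 2 * y →
      ∃ r : ℤ, (q : ℤ) ∣ r ^ 3 - 3 * N * r - u := by
    intro e he h
    obtain ⟨r, -, hr⟩ := exists_int_root (N := N) (u := u) (x := e * x) (y := e ^ 2 * y) hq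
      (by rw [← hxy]; linear_combination x * y * he)
      (by rw [← hsum]; linear_combination (x ^ 3 + y ^ 3 * (e ^ 3 + 1)) * he) h
    exact ⟨r, hr⟩
  rcases hq.mod_three_eq h3 with h | h
  · have hwq : w ^ q = w := map_pow_of_one φ hq h omega
    have hσq : σ ^ q = -σ := (sq_eq_sq_iff_eq_or_eq_neg.1 hσq2).resolve_left fun h' =>
      hbq (by rw [hwq, h', ht])
    rw [hσq, mul_neg, ← sub_eq_add_neg, ← hy] at hx3
    obtain ⟨i, hi⟩ := hcube hx3 hy0
    have hyq : w ^ i * y ^ q = x := mul_right_cancel₀ hy0 (by rw [← hac, hi]; ring)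
    have heq : (w ^ i) ^ q = w ^ i := by rw [← pow_mul, mul_comm, pow_mul, hwq]
    refine finish (w ^ i) (hw3i i) ?_
    rw [add_pow_char, mul_pow, mul_pow, ← pow_mul (w ^ i), mul_comm 2, pow_mul, heq, hi]
    linear_combination w ^ i * hyq
  · have hwq : w ^ q = w ^ 2 := by rw [hw2, hw, map_pow_of_two φ hq h, star_omega]; simp
    have hσq : σ ^ q = σ := (sq_eq_sq_iff_eq_or_eq_neg.1 hσq2).resolve_right fun h' =>
      hbq (by rw [hwq, h', ht, hw2]; ring)
    rw [hσq, ← hx] at hx3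
    obtain ⟨i, hi⟩ := hcube hx3 hx0
    have hyq : w ^ i * y ^ q = y := mul_left_cancel₀ hx0 (by rw [← hac, hi]; ring)
    have hz3 := hw3i i
    have heq : ((w ^ i) ^ 2) ^ q = w ^ i := by
      have : (w ^ i) ^ q = (w ^ i) ^ 2 := by rw [← pow_mul, mul_comm, pow_mul, hwq, ← pow_mul, ← pow_mul, mul_comm]
      rw [← pow_mul, mul_comm, pow_mul, this]
      linear_combination w ^ i * hz3
    refine finish ((w ^ i) ^ 2) (by rw [← pow_mul, mul_comm 2, pow_mul, hw3i, one_pow]) ?_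
    rw [add_pow_char, mul_pow, mul_pow, heq, hi, ← pow_mul _ 2 q, mul_comm 2 q, pow_mul _ q, heq]
    linear_combination w ^ i * hyq - w ^ i * y * hz3

end CubicRoots

end Eisenstein

open NumberField Ideal in
/-- If every large rational prime has a prime ideal of degree one above it, then the primes with two
such ideals are sparse. -/
theorem NumberField.exists_sum_inv_le (K : Type*) [Field K] [NumberField K] {B : ℕ} {S : Set ℕ}
    {P Q : ℕ → Ideal (𝓞 K)} (hP : ∀ p, p.Prime → B < p → (P p).IsPrime ∧ absNorm (P p) = p)
    (hS : ∀ q ∈ S, q.Prime ∧ B < q) (hQ : ∀ q ∈ S, (Q q).IsPrime ∧ absNorm (Q q) = q ∧ Q q ≠ P q) :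
    ∃ C : ℝ, ∀ F : Finset ℕ, (∀ q ∈ F, q ∈ S) → ∑ q ∈ F, (1 / q : ℝ) ≤ C := by
  obtain ⟨κ, hκ⟩ : ∃ κ : ℝ, Filter.Tendsto (fun s : ℝ =>
      (Nat.card {I : Ideal (𝓞 K) // (absNorm I : ℝ) ≤ s} : ℝ) / s) Filter.atTop (nhds κ) :=
    ⟨_, NumberField.Ideal.tendsto_norm_le_div_atTop K⟩
  let J : ℕ → Ideal (𝓞 K) := fun m => (m.primeFactorsList.map P).prod
  have hm : ∀ j p : ℕ, p ∈ (B.factorial * j + 1).primeFactorsList → p.Prime ∧ B < p := by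
    intro j p h
    have hp := Nat.prime_of_mem_primeFactorsList h
    refine ⟨hp, ?_⟩
    by_contra! hle
    have h1 := (Nat.dvd_factorial hp.pos hle).mul_right j
    exact hp.not_dvd_one ((Nat.dvd_add_right h1).1 (Nat.dvd_of_mem_primeFactorsList h))
  have hJ : ∀ j, absNorm (J (B.factorial * j + 1)) = B.factorial * j + 1 := by
    intro j
    simp only [J]
    rw [map_list_prod, List.map_map]
    have e := Nat.prod_primeFactorsList (n := B.factorial * j + 1) (by omega)
    conv_rhs => rw [← e, ← List.map_id (Nat.primeFactorsList _)]
    congr 1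
    exact List.map_congr_left fun p hp => (hP p (hm j p hp).1 (hm j p hp).2).2
  have hne : ∀ {I : Ideal (𝓞 K)} {q : ℕ}, q.Prime → absNorm I = q → I ≠ ⊥ := by
    rintro I q hq h rfl
    rw [absNorm_bot] at h
    exact hq.ne_zero h.symm
  have hmax : ∀ {I I' : Ideal (𝓞 K)}, I.IsPrime → I ≠ ⊥ → I'.IsPrime → I' ≠ ⊥ → I ∣ I' → I = I' := by
    intro I I' h1 h2 h3 h4 h
    exact ((h3.isMaximal h4).eq_of_le h1.ne_top (Ideal.dvd_iff_le.1 h)).symm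
  have hinj : ∀ q ∈ S, ∀ q' ∈ S, ∀ j j' : ℕ,
      Q q * J (B.factorial * j + 1) = Q q' * J (B.factorial * j' + 1) → q = q' ∧
      B.factorial * j + 1 = B.factorial * j' + 1 := by
    intro q hq q' hq' j j' h
    obtain ⟨h1, h2, h3⟩ := hQ q hq
    obtain ⟨h1', h2', -⟩ := hQ q' hq'
    have hqp := (hS q hq).1
    have h0 := hne hqp h2
    have h0' := hne (hS q' hq').1 h2'
    have hprime := Ideal.prime_of_isPrime h0 h1
    have hqq : q = q' := by
      rcases hprime.dvd_or_dvd (Dvd.intro _ h) with hd | hd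
      · rw [← h2, hmax h1 h0 h1' h0' hd, h2']
      · obtain ⟨I, hI, hd⟩ := hprime.dvd_prod_iff.1 hd
        obtain ⟨p, hp, rfl⟩ := List.mem_map.1 hI
        obtain ⟨hp1, hp2⟩ := hm j' p hp
        obtain ⟨hP1, hP2⟩ := hP p hp1 hp2
        have e := hmax h1 h0 hP1 (hne hp1 hP2) hd
        have : q = p := by rw [← h2, e, hP2]
        rw [← this] at e
        exact absurd e h3
    refine ⟨hqq, ?_⟩
    have := congrArg absNorm h
    rw [map_mul, map_mul, hJ, hJ, h2, h2', ← hqq] at this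
    exact Nat.eq_of_mul_eq_mul_left hqp.pos this
  refine ⟨B.factorial * (κ + 1), fun F hF => ?_⟩
  have hev := hκ.eventually (gt_mem_nhds (lt_add_one κ))
  have hD : 0 < (∏ q ∈ F, q) * B.factorial :=
    Nat.mul_pos (Finset.prod_pos fun q hq => (hS q (hF q hq)).1.pos) B.factorial_pos
  obtain ⟨M, hM0, hM⟩ : ∃ M : ℕ, 0 < M ∧
      (Nat.card {I : Ideal (𝓞 K) // (absNorm I : ℝ) ≤ ((M * ((∏ q ∈ F, q) * B.factorial) : ℕ) : ℝ)} : ℝ) /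
        ((M * ((∏ q ∈ F, q) * B.factorial) : ℕ) : ℝ) < κ + 1 := by
    obtain ⟨s₀, hs⟩ := Filter.eventually_atTop.1 hev
    obtain ⟨M, hM⟩ := exists_nat_ge s₀
    refine ⟨M + 1, M.succ_pos, hs _ (hM.trans ?_)⟩
    exact_mod_cast (Nat.le_succ M).trans (Nat.le_mul_of_pos_right _ hD)
  set s := M * ((∏ q ∈ F, q) * B.factorial) with hs
  have hs0 : 0 < s := Nat.mul_pos hM0 hD
  have hdvd : ∀ q ∈ F, q * B.factorial ∣ s := fun q hq =>
    (Nat.mul_dvd_mul_right (Finset.dvd_prod_of_mem _ hq) _).mul_left _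
  have hcount : ∑ q ∈ F, s / (q * B.factorial) ≤ Nat.card {I : Ideal (𝓞 K) // (absNorm I : ℝ) ≤ (s : ℝ)} := by
    have hfin : {I : Ideal (𝓞 K) | absNorm I ≤ s}.Finite := Ideal.finite_setOfPred_absNorm_le s
    have e : Nat.card {I : Ideal (𝓞 K) // (absNorm I : ℝ) ≤ (s : ℝ)} = hfin.toFinset.card := by
      rw [← Set.ncard_eq_toFinset_card _ hfin, ← Nat.card_coe_set_eq]
      exact Nat.card_congr (Equiv.subtypeEquivRight fun I => by simp)
    have e2 : ∑ q ∈ F, s / (q * B.factorial) = (F.sigma fun q => Finset.range (s / (q * B.factorial))).card := by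
      simp
    rw [e, e2]
    refine Finset.card_le_card_of_injOn (fun x => Q x.1 * J (B.factorial * x.2 + 1)) ?_ ?_
    · rintro ⟨q, j⟩ hx
      simp only [Finset.coe_sigma, Set.mem_sigma_iff, Finset.mem_coe, Finset.mem_range] at hx
      simp only [Finset.mem_coe, Set.Finite.mem_toFinset, Set.mem_ofPred_eq, map_mul, hJ]
      rw [(hQ q (hF q hx.1)).2.1]
      calc q * (B.factorial * j + 1) ≤ q * (B.factorial * (j + 1)) := by
            gcongr; rw [mul_add, mul_one]; have := B.factorial_pos; omega
        _ = (q * B.factorial) * (j + 1) := by ring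
        _ ≤ (q * B.factorial) * (s / (q * B.factorial)) := by gcongr; exact hx.2
        _ ≤ s := Nat.mul_div_le _ _
    · rintro ⟨q, j⟩ hx ⟨q', j'⟩ hx' h
      simp only [Finset.coe_sigma, Set.mem_sigma_iff, Finset.mem_coe, Finset.mem_range] at hx hx'
      obtain ⟨rfl, h2⟩ := hinj q (hF q hx.1) q' (hF q' hx'.1) j j' h
      have := Nat.eq_of_mul_eq_mul_left B.factorial_pos (Nat.add_right_cancel h2)
      rw [this]
  have hsR : (0 : ℝ) < s := by exact_mod_cast hs0
  have hB : (0 : ℝ) < B.factorial := by exact_mod_cast B.factorial_pos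
  have h1 : ∑ q ∈ F, (s : ℝ) / (q * B.factorial) ≤ (κ + 1) * s := by
    rw [div_lt_iff₀ hsR] at hM
    refine le_trans (le_of_eq ?_) ((Nat.cast_le (α := ℝ).2 hcount).trans hM.le)
    push_cast
    refine Finset.sum_congr rfl fun q hq => ?_
    rw [Nat.cast_div (hdvd q hq)]
    · push_cast; rfl
    · push_cast
      exact mul_ne_zero (by exact_mod_cast (hS q (hF q hq)).1.ne_zero) hB.ne'
  have h2 : ∑ q ∈ F, (s : ℝ) / (q * B.factorial) = (s / B.factorial) * ∑ q ∈ F, (1 / q : ℝ) := by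
    rw [Finset.mul_sum]
    refine Finset.sum_congr rfl fun q _ => ?_
    rw [div_mul_div_comm, mul_one, mul_comm (B.factorial : ℝ)]
  rw [h2, div_mul_eq_mul_div, div_le_iff₀ hB] at h1
  refine le_of_mul_le_mul_left (h1.trans (le_of_eq (by ring))) hsR

open ArithmeticFunction ArithmeticFunction.vonMangoldt LSeries in
/-- The reciprocals of the primes in a reduced residue class have a divergent sum. -/
theorem Nat.Prime.not_summable_one_div_residue {m : ℕ} [NeZero m] {a : ZMod m} (ha : IsUnit a) :
    ¬ Summable (fun n : ℕ => if n.Prime ∧ (n : ZMod m) = a then (1 / n : ℝ) else 0) := by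
  intro H
  set g : ℕ → ℝ := fun n => if n.Prime ∧ (n : ZMod m) = a then (1 / n : ℝ) else 0 with hg
  have g0 : ∀ n, 0 ≤ g n := fun n => by simp only [hg]; split_ifs <;> positivity
  have hs : ∀ h : ℝ, 0 ≤ h → Summable fun n : ℕ => g n * (n : ℝ) ^ (-h) := by
    intro h hh
    refine H.of_nonneg_of_le (fun n => mul_nonneg (g0 n) (by positivity)) fun n => ?_
    by_cases hn : n.Prime ∧ (n : ZMod m) = a
    · exact mul_le_of_le_one_right (g0 n)
        (Real.rpow_le_one_of_one_le_of_nonpos (by exact_mod_cast hn.1.one_le) (by linarith))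
    · simp [hg, hn]
  obtain ⟨C, hC⟩ := LSeries_residueClass_lower_bound ha
  set N : ℕ → ℝ := fun n => (if n.Prime then 0 else residueClass a n) / n with hN
  have sN : Summable N := summable_residueClass_non_primes_div a
  have hsum : ∀ x : ℝ, 1 < x → Summable fun n : ℕ => residueClass a n / (n : ℝ) ^ x := by
    intro x hx
    exact summable_real_of_abscissaOfAbsConv_lt <|
      (abscissaOfAbsConv_residueClass_le_one a).trans_lt <| mod_cast hx
  set c : ℝ := (m.totient : ℝ)⁻¹ with hc
  have c0 : 0 < c := inv_pos.2 (by exact_mod_cast m.totient.pos_of_neZero)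
  have key : ∀ h : ℝ, 0 < h → h ≤ 1 / 2 →
      ∑' n : ℕ, g n * (n : ℝ) ^ (-(2 * h)) + (c / 2 - h * (C + ∑' n, N n)) ≤
        ∑' n : ℕ, g n * (n : ℝ) ^ (-h) := by
    intro h h0 h1
    have b := hC (x := 1 + 2 * h) ⟨by linarith, by linarith⟩
    have e1 : c / (1 + 2 * h - 1) * h = c / 2 := by field_simp; ring
    have t : ∑' n : ℕ, (g n * (n : ℝ) ^ (-(2 * h)) +
        h * (residueClass a n / (n : ℝ) ^ (1 + 2 * h) - N n)) ≤ ∑' n : ℕ, g n * (n : ℝ) ^ (-h) := by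
      refine Summable.tsum_le_tsum (fun n => ?_) ((hs _ (by linarith)).add
        (((hsum _ (by linarith)).sub sN).mul_left h)) (hs h h0.le)
      by_cases hp : n.Prime
      · have n0 : (0 : ℝ) < n := by exact_mod_cast hp.pos
        by_cases hn : (n : ZMod m) = a
        · have e : residueClass a n = Real.log n := by
            simp [hn, vonMangoldt_apply_prime hp]
          simp only [hg, hN, hp, hn, e, and_self, if_true, zero_div, sub_zero]
          have e2 : (n : ℝ) ^ (-h) = (n : ℝ) ^ (-(2 * h)) * (n : ℝ) ^ h := by
            rw [← Real.rpow_add n0]; ring_nf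
          have e3 : Real.log n / (n : ℝ) ^ (1 + 2 * h) = 1 / n * ((n : ℝ) ^ (-(2 * h)) * Real.log n) := by
            rw [Real.rpow_add n0, Real.rpow_one, Real.rpow_neg n0.le]; field_simp
          have e4 : h * Real.log n + 1 ≤ (n : ℝ) ^ h := by
            rw [Real.rpow_def_of_pos n0, mul_comm]; exact Real.add_one_le_exp _
          have e5 : 0 ≤ 1 / (n : ℝ) * (n : ℝ) ^ (-(2 * h)) := by positivity
          rw [e2, e3]
          nlinarith [mul_le_mul_of_nonneg_left e4 e5]
        · simp [hg, hN, hp, hn]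
      · have e : residueClass a n / (n : ℝ) ^ (1 + 2 * h) ≤ residueClass a n / n := by
          rcases Nat.eq_zero_or_pos n with rfl | hn
          · simp
          have n1 : (1 : ℝ) ≤ n := by exact_mod_cast hn
          refine div_le_div_of_nonneg_left (residueClass_nonneg a n) (by linarith) ?_
          calc (n : ℝ) = (n : ℝ) ^ (1 : ℝ) := (Real.rpow_one _).symm
            _ ≤ _ := Real.rpow_le_rpow_of_exponent_le n1 (by linarith)
        simp only [hg, hN, hp, false_and, if_false, zero_mul, zero_add]
        nlinarith
    rw [Summable.tsum_add (hs _ (by linarith)) (((hsum _ (by linarith)).sub sN).mul_left h), tsum_mul_left,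
      Summable.tsum_sub (hsum _ (by linarith)) sN] at t
    nlinarith
  set D := C + ∑' n, N n with hD
  obtain ⟨h₀, h1, h2, h3⟩ : ∃ h₀ : ℝ, 0 < h₀ ∧ h₀ ≤ 1 / 2 ∧ h₀ * |D| ≤ c / 4 := by
    refine ⟨min (1 / 2) (c / (4 * (|D| + 1))), lt_min (by norm_num) (by positivity), min_le_left _ _, ?_⟩
    have : c / (4 * (|D| + 1)) * (|D| + 1) = c / 4 := by field_simp
    have h5 := min_le_right (1 / 2) (c / (4 * (|D| + 1)))
    have h6 : 0 ≤ c / (4 * (|D| + 1)) := by positivity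
    nlinarith [abs_nonneg D]
  have ind : ∀ k : ℕ, k * (c / 4) ≤ ∑' n : ℕ, g n * (n : ℝ) ^ (-(h₀ / 2 ^ k)) := by
    intro k
    induction k with
    | zero => simp only [Nat.cast_zero, zero_mul]; exact tsum_nonneg fun n => mul_nonneg (g0 n) (by positivity)
    | succ k ih =>
      have p2 : (1 : ℝ) ≤ 2 ^ (k + 1) := one_le_pow₀ (by norm_num)
      have hle : h₀ / 2 ^ (k + 1) ≤ h₀ := _root_.div_le_self h1.le p2
      have := key (h₀ / 2 ^ (k + 1)) (by positivity) (hle.trans h2)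
      rw [show 2 * (h₀ / 2 ^ (k + 1)) = h₀ / 2 ^ k by rw [pow_succ]; field_simp] at this
      have h7 : h₀ / 2 ^ (k + 1) * D ≤ c / 4 := by
        refine le_trans (mul_le_mul_of_nonneg_left (le_abs_self D) (by positivity)) (le_trans ?_ h3)
        exact mul_le_mul_of_nonneg_right hle (abs_nonneg D)
      push_cast
      linarith
  obtain ⟨k, hk⟩ := exists_nat_gt ((∑' n, g n) / (c / 4))
  rw [div_lt_iff₀ (by positivity)] at hk
  refine absurd (ind k) (not_le.2 (lt_of_le_of_lt ?_ hk))
  refine Summable.tsum_le_tsum (fun n => ?_) (hs _ (by positivity)) H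
  by_cases hn : n.Prime ∧ (n : ZMod m) = a
  · exact mul_le_of_le_one_right (g0 n)
      (Real.rpow_le_one_of_one_le_of_nonpos (by exact_mod_cast hn.1.one_le) (by
        have : 0 ≤ h₀ / 2 ^ k := by positivity
        linarith))
  · simp [hg, hn]

open NumberField RingOfIntegers in
/-- An algebraic integer generating the field has a nonzero exponent. -/
theorem NumberField.exponent_ne_zero {K : Type*} [Field K] [NumberField K] (θ : 𝓞 K)
    (B : PowerBasis ℚ K) (hB : B.gen = (θ : K)) : exponent θ ≠ 0 := by
  have hint : IsIntegral ℤ B.gen := hB ▸ θ.isIntegral_coe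
  have hd : IsIntegral ℤ (Algebra.discr ℚ B.basis) := Algebra.discr_isIntegral ℚ fun i => by
    rw [B.basis_eq_pow]; exact hint.pow _
  obtain ⟨n, hn⟩ := IsIntegrallyClosed.isIntegral_iff.1 hd
  have n0 : n ≠ 0 := by
    rintro rfl
    exact Algebra.discr_not_zero_of_basis ℚ B.basis (by rw [← hn, map_zero])
  have hmem : ∀ m : ℤ, n ∣ m → (m : 𝓞 K) ∈ conductor ℤ θ := by
    rintro m ⟨j, rfl⟩
    refine mem_conductor_iff.2 fun b => ?_
    have h1 := Algebra.discr_mul_isIntegral_mem_adjoin (K := ℚ) (R := ℤ) (B := B) hint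
      (z := ((j : 𝓞 K) * b : 𝓞 K)) (isIntegral_coe _)
    rw [hB, ← hn] at h1
    let φ : 𝓞 K →ₐ[ℤ] K := (algebraMap (𝓞 K) K).toIntAlgHom
    have h2 : Algebra.adjoin ℤ {(θ : K)} = (Algebra.adjoin ℤ {θ}).map φ := by
      rw [AlgHom.map_adjoin, Set.image_singleton]; rfl
    rw [h2] at h1
    obtain ⟨y, hy, e⟩ := h1
    have : y = ((n * j : ℤ) : 𝓞 K) * b := by
      apply RingOfIntegers.coe_injective
      refine Eq.trans e ?_
      rw [Algebra.smul_def]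
      simp [mul_assoc]
    exact this ▸ hy
  rw [exponent_eq_sInf]
  have hne : {d : ℕ | 0 < d ∧ (d : 𝓞 K) ∈ conductor ℤ θ}.Nonempty :=
    ⟨n.natAbs, Int.natAbs_pos.2 n0, by
      have := hmem n.natAbs (Int.dvd_natAbs.2 dvd_rfl)
      rwa [Int.cast_natCast] at this⟩
  exact (Nat.sInf_mem hne).1.ne'

open NumberField RingOfIntegers Polynomial Ideal in
/-- The simple factors of the minimal polynomial modulo `p` give prime ideals of degree one. -/
theorem NumberField.exists_ideal_of_isRoot {K : Type*} [Field K] [NumberField K] (θ : 𝓞 K) {p : ℕ}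
    [Fact p.Prime] (hp : ¬ p ∣ exponent θ) : ∃ I : ZMod p → Ideal (𝓞 K), ∀ r,
      ((minpoly ℤ θ).map (Int.castRingHom (ZMod p))).IsRoot r → (I r).IsPrime ∧ absNorm (I r) = p ∧
      ∀ r', ((minpoly ℤ θ).map (Int.castRingHom (ZMod p))).IsRoot r' → I r = I r' → r = r' := by
  classical
  have h0 : (minpoly ℤ θ).map (Int.castRingHom (ZMod p)) ≠ 0 :=
    map_monic_ne_zero (minpoly.monic θ.isIntegral)
  have hmem : ∀ r, ((minpoly ℤ θ).map (Int.castRingHom (ZMod p))).IsRoot r →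
      X - C r ∈ monicFactorsMod θ p := fun r hr => by
    rw [Multiset.mem_toFinset, Polynomial.mem_normalizedFactors_iff h0]
    exact ⟨irreducible_X_sub_C r, monic_X_sub_C r, dvd_iff_isRoot.2 hr⟩
  refine ⟨fun r => if h : X - C r ∈ monicFactorsMod θ p then
    ((NumberField.Ideal.primesOverSpanEquivMonicFactorsMod hp).symm ⟨_, h⟩ : Ideal (𝓞 K)) else ⊥, fun r hr => ?_⟩
  simp only [hmem r hr, dif_pos]
  set J := (NumberField.Ideal.primesOverSpanEquivMonicFactorsMod hp).symm ⟨_, hmem r hr⟩ with hJ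
  have i1 : J.1.IsPrime := J.2.1
  have i2 : J.1.LiesOver (span {(p : ℤ)}) := J.2.2
  refine ⟨i1, ?_, fun r' hr' e => ?_⟩
  · rw [← natAbs_pow_inertiaDeg (p : ℤ) J.1, hJ,
      NumberField.Ideal.inertiaDeg_primesOverSpanEquivMonicFactorsMod_symm_apply' hp (hmem r hr)]
    simp
  · rw [dif_pos (hmem r' hr')] at e
    have := congrArg Subtype.val ((Equiv.injective _) (Subtype.ext e))
    simpa using this

open NumberField RingOfIntegers Polynomial Ideal in
/-- A monic irreducible polynomial cannot have a root modulo every large prime, with two distinct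
roots modulo every large prime that is `1` modulo `m`. -/
theorem Polynomial.exists_prime_not_two_roots {f : ℤ[X]} (hf : f.Monic) (hirr : Irreducible f) {m : ℕ}
    (hm : m ≠ 0) (B : ℕ) : ∃ q : ℕ, q.Prime ∧ B < q ∧ ((∀ r : ℤ, ¬ (q : ℤ) ∣ f.eval r) ∨
      (q ≡ 1 [MOD m] ∧ ∀ r₁ r₂ : ℤ, (q : ℤ) ∣ f.eval r₁ → (q : ℤ) ∣ f.eval r₂ → (q : ℤ) ∣ r₁ - r₂)) := by
  by_contra! hcon
  have hirrQ : Irreducible (f.map (algebraMap ℤ ℚ)) :=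
    (Polynomial.Monic.irreducible_iff_irreducible_map_fraction_map hf).1 hirr
  have : Fact (Irreducible (f.map (algebraMap ℤ ℚ))) := ⟨hirrQ⟩
  let K := AdjoinRoot (f.map (algebraMap ℤ ℚ))
  let pb : PowerBasis ℚ K := AdjoinRoot.powerBasis hirrQ.ne_zero
  have : NumberField K := { to_charZero := inferInstance, to_finiteDimensional := pb.finite }
  have hroot : aeval (AdjoinRoot.root (f.map (algebraMap ℤ ℚ)) : K) f = 0 := by
    rw [← aeval_map_algebraMap ℚ]
    exact AdjoinRoot.eval₂_root _
  let θ : 𝓞 K := ⟨AdjoinRoot.root (f.map (algebraMap ℤ ℚ)), f, hf, hroot⟩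
  have hθ : aeval θ f = 0 := by
    apply RingOfIntegers.coe_injective
    have := aeval_algebraMap_apply K θ f
    rw [map_zero]
    exact this.symm.trans hroot
  have hmin : minpoly ℤ θ = f := by
    have hd := minpoly.isIntegrallyClosed_dvd θ.isIntegral hθ
    exact eq_of_monic_of_associated (minpoly.monic θ.isIntegral) hf
      ((hirr.dvd_iff.1 hd).resolve_left (minpoly.not_isUnit ℤ θ)).symm
  have he : exponent θ ≠ 0 := NumberField.exponent_ne_zero θ pb (AdjoinRoot.powerBasis_gen hirrQ.ne_zero)
  have hlarge : ∀ q : ℕ, max B (exponent θ) < q → ¬ q ∣ exponent θ := fun q hq h =>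
    absurd (Nat.le_of_dvd (Nat.pos_of_ne_zero he) h) (not_le.2 ((le_max_right _ _).trans_lt hq))
  have hroots : ∀ (q : ℕ) (r : ℤ), (q : ℤ) ∣ f.eval r →
      ((minpoly ℤ θ).map (Int.castRingHom (ZMod q))).IsRoot (r : ZMod q) := by
    intro q r h
    rw [hmin, IsRoot.def, eval_intCast_map, eq_intCast, Int.cast_id]
    exact (ZMod.intCast_zmod_eq_zero_iff_dvd _ _).2 h
  have h1 : ∀ q : ℕ, ∃ P Q : Ideal (𝓞 K), q.Prime → max B (exponent θ) < q →
      (P.IsPrime ∧ absNorm P = q) ∧ (q ≡ 1 [MOD m] → Q.IsPrime ∧ absNorm Q = q ∧ Q ≠ P) := by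
    intro q
    by_cases hq : q.Prime ∧ max B (exponent θ) < q
    · obtain ⟨hp, hB⟩ := hq
      have : Fact q.Prime := ⟨hp⟩
      obtain ⟨I, hI⟩ := NumberField.exists_ideal_of_isRoot θ (hlarge q hB)
      obtain ⟨⟨r, hr⟩, h2⟩ := hcon q hp ((le_max_left _ _).trans_lt hB)
      by_cases hq1 : q ≡ 1 [MOD m]
      · obtain ⟨r₁, r₂, e1, e2, e3⟩ := h2 hq1
        obtain ⟨a1, a2, -⟩ := hI _ (hroots q r₁ e1)
        obtain ⟨b1, b2, b3⟩ := hI _ (hroots q r₂ e2)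
        refine ⟨I r₁, I r₂, fun _ _ => ⟨⟨a1, a2⟩, fun _ => ⟨b1, b2, fun e => e3 ?_⟩⟩⟩
        have := b3 _ (hroots q r₁ e1) e
        exact (ZMod.intCast_eq_intCast_iff_dvd_sub _ _ _).1 this
      · obtain ⟨a1, a2, -⟩ := hI _ (hroots q r hr)
        exact ⟨I r, ⊥, fun _ _ => ⟨⟨a1, a2⟩, fun h => absurd h hq1⟩⟩
    · exact ⟨⊥, ⊥, fun a b => absurd ⟨a, b⟩ hq⟩
  choose P Q hPQ using h1
  obtain ⟨C, hC⟩ := NumberField.exists_sum_inv_le K (B := max B (exponent θ))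
    (S := {q | (q.Prime ∧ max B (exponent θ) < q) ∧ q ≡ 1 [MOD m]}) (P := P) (Q := Q)
    (fun p hp hB => (hPQ p hp hB).1) (fun q hq => hq.1) (fun q hq => (hPQ q hq.1.1 hq.1.2).2 hq.2)
  have : NeZero m := ⟨hm⟩
  refine Nat.Prime.not_summable_one_div_residue (m := m) isUnit_one ?_
  refine summable_of_sum_le (c := C + ∑ q ∈ Finset.range (max B (exponent θ) + 1), (1 / q : ℝ))
    (fun n => by dsimp only [Pi.zero_apply]; split_ifs <;> positivity) fun F => ?_
  rw [← Finset.sum_filter_add_sum_filter_not F (fun q => (q.Prime ∧ max B (exponent θ) < q) ∧ q ≡ 1 [MOD m])]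
  have hmod : ∀ q : ℕ, (q : ZMod m) = 1 ↔ q ≡ 1 [MOD m] := fun q => by
    rw [← Nat.cast_one, ZMod.natCast_eq_natCast_iff]
  refine add_le_add (le_trans (le_of_eq (Finset.sum_congr rfl fun q hq => ?_))
    (hC (F.filter _) fun q hq => (Finset.mem_filter.1 hq).2)) ?_
  · obtain ⟨-, h2, h3⟩ := Finset.mem_filter.1 hq
    rw [if_pos ⟨h2.1, (hmod q).2 h3⟩]
  · rw [← Finset.sum_filter]
    refine Finset.sum_le_sum_of_subset_of_nonneg (fun q hq => ?_) fun q _ _ => by positivity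
    simp only [Finset.mem_filter, hmod] at hq
    rw [Finset.mem_range, Nat.lt_succ_iff]
    by_contra! h
    exact hq.1.2 ⟨⟨hq.2.1, h⟩, hq.2.2⟩

/-- An integral root of `X³ - 3NX - u` exhibits `4(u + v√-d)` as a cube. -/
theorem exists_cube_of_root {d : ℕ} (hd : Squarefree d) {u v N t : ℤ} (huv : u ^ 2 + d * v ^ 2 = 4 * N ^ 3)
    (ht : t ^ 3 - 3 * N * t - u = 0) :
    ∃ t w : ℤ, t ^ 3 - 3 * d * t * w ^ 2 = 4 * u ∧ 3 * t ^ 2 * w - d * w ^ 3 = 4 * v := by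
  have d0 : (d : ℤ) ≠ 0 := by exact_mod_cast hd.ne_zero
  obtain rfl : u = t ^ 3 - 3 * N * t := by linear_combination -ht
  rcases eq_or_ne (t ^ 2 - N) 0 with h | h
  · obtain rfl : N = t ^ 2 := by linear_combination -h
    have : v = 0 := by
      have : (d : ℤ) * v ^ 2 = 0 := by linear_combination huv
      simpa using (mul_eq_zero.1 this).resolve_left d0
    exact ⟨-2 * t, 0, by ring, by rw [this]; ring⟩
  · have key : (d : ℤ) * v ^ 2 = (t ^ 2 - N) ^ 2 * (4 * N - t ^ 2) := by linear_combination huv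
    obtain ⟨m, n, h1, h2, h3⟩ := Int.exists_gcd_one (Int.gcd_pos_of_ne_zero_left v h)
    set g : ℤ := (Int.gcd (t ^ 2 - N) v : ℤ) with hg
    have g0 : g ≠ 0 := by
      intro h0
      rw [h0, mul_zero] at h2
      exact h h2
    have h4 : (d : ℤ) * n ^ 2 = m ^ 2 * (4 * N - t ^ 2) := by
      apply mul_left_cancel₀ (pow_ne_zero 2 g0)
      rw [h2, h3] at key
      linear_combination key
    have h5 : m * m ∣ (d : ℤ) := by
      have : IsCoprime (m * m) (n ^ 2) := by
        rw [← pow_two]; exact (Int.isCoprime_iff_gcd_eq_one.2 h1).pow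
      exact this.dvd_of_dvd_mul_right ⟨4 * N - t ^ 2, by rw [h4]; ring⟩
    have h6 : m ^ 2 = 1 := by
      have := (Int.squarefree_natCast.2 hd) m h5
      rcases Int.isUnit_iff.1 this with rfl | rfl <;> norm_num
    refine ⟨t, n * m, ?_, ?_⟩
    · linear_combination (-3 * t * m ^ 2) * h4 - 3 * t * (4 * N - t ^ 2) * (m ^ 2 + 1) * h6
    · linear_combination (-n * m ^ 3) * h4 + 4 * (n * m) * h2 - 4 * h3 + 4 * n * g * h6 -
        n * m * (4 * N - t ^ 2) * (m ^ 2 + 1) * h6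

namespace Eisenstein

open Polynomial in
/-- The symbols attached to `u + v√-d` detect whether `4(u + v√-d)` is a cube. -/
theorem exists_rootSymbol_ne_zero {d : ℕ} (hd : Squarefree d) {u v N : ℤ} (hN : N ≠ 0)
    (huv : u ^ 2 + d * v ^ 2 = 4 * N ^ 3)
    (hcube : ∀ t w : ℤ, ¬ (t ^ 3 - 3 * d * t * w ^ 2 = 4 * u ∧ 3 * t ^ 2 * w - d * w ^ 3 = 4 * v)) (B : ℕ) :
    ∃ q : ℕ, q.Prime ∧ B < q ∧ ∃ b : ℤ, b ^ 2 ≡ 8748 * d [ZMOD q] ∧ rootSymbol q (v * b) (54 * u) ≠ 0 := by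
  have d0 := hd.ne_zero
  have hroot : ∀ t : ℤ, t ^ 3 - 3 * N * t - u ≠ 0 := fun t ht => by
    obtain ⟨t, w, h⟩ := exists_cube_of_root hd huv ht
    exact hcube t w h
  have v0 : v ≠ 0 := by
    rintro rfl
    have h1 : u ^ 2 = 4 * N ^ 3 := by linear_combination huv
    have h2 : N ∣ u := by
      have h : N ^ 2 ∣ u ^ 2 := ⟨4 * N, by rw [h1]; ring⟩
      exact (Int.pow_dvd_pow_iff two_ne_zero).1 h
    obtain ⟨j, rfl⟩ := h2
    have h3 : j ^ 2 = 4 * N := by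
      apply mul_left_cancel₀ (pow_ne_zero 2 hN); linear_combination h1
    obtain ⟨i, rfl⟩ : (2 : ℤ) ∣ j := by
      have : (2 : ℤ) ∣ j ^ 2 := ⟨2 * N, by rw [h3]; ring⟩
      exact Int.prime_two.dvd_of_dvd_pow this
    obtain rfl : N = i ^ 2 := by linarith
    exact hroot (-i) (by ring)
  set f : ℤ[X] := X ^ 3 - C (3 * N) * X - C u with hf
  have hev : ∀ r, f.eval r = r ^ 3 - 3 * N * r - u := fun r => by simp [hf]
  have hdeg : f.natDegree = 3 := by rw [hf]; compute_degree!
  have hmon : f.Monic := by rw [hf]; monicity!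
  have hirr : Irreducible f := by
    rw [Polynomial.Monic.irreducible_iff_roots_eq_zero_of_degree_le_three hmon (by omega) (by omega)]
    refine Multiset.eq_zero_of_forall_notMem fun r hr => hroot r ?_
    rw [← hev]; exact (mem_roots'.1 hr).2
  obtain ⟨q, hq, hB, h⟩ := Polynomial.exists_prime_not_two_roots hmon hirr (m := 12 * d) (by omega)
    (B + 3 + d + v.natAbs + N.natAbs)
  have large : ∀ a : ℤ, a ≠ 0 → a.natAbs < q → ¬ (q : ℤ) ∣ a := fun a ha h h' =>
    absurd (Nat.le_of_dvd (Int.natAbs_pos.2 ha) (Int.natCast_dvd.1 h')) (not_le.2 h)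
  have hqd := large d (by exact_mod_cast d0) (by rw [Int.natAbs_natCast]; omega)
  refine ⟨q, hq, by omega, ?_⟩
  by_contra! hcon
  simp only [hev] at h
  by_cases hb : ∃ b : ℤ, b ^ 2 ≡ 8748 * d [ZMOD q]
  · obtain ⟨b, hb⟩ := hb
    obtain ⟨r₁, r₂, e1, e2, e3⟩ := exists_two_roots hq (by omega) (by omega) (large N hN (by omega)) hqd
      (large v v0 (by omega)) huv hb (hcon b hb)
    rcases h with h | h
    · exact h _ e1
    · exact e3 (h.2 _ _ e1 e2)
  · push Not at hb
    obtain ⟨r, hr⟩ := exists_one_root hq (by omega) (by omega) (large N hN (by omega)) huv hb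
    rcases h with h | ⟨h, -⟩
    · exact h r hr
    · have : Fact q.Prime := ⟨hq⟩
      have hodd : Odd q := hq.odd_of_ne_two (by omega)
      have h3d : ((((3 * d : ℕ) : ℤ)) : ZMod q) ≠ 0 := by
        rw [Ne, ZMod.intCast_zmod_eq_zero_iff_dvd]
        push_cast
        exact fun h => ((Nat.prime_iff_prime_int.1 hq).dvd_or_dvd h).elim (large 3 (by norm_num) (by omega)) hqd
      have hJ : jacobiSym (3 * d : ℕ) q = 1 := by
        rw [jacobiSym.mod_right _ hodd, show 4 * ((3 * d : ℕ) : ℤ).natAbs = 12 * d by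
          rw [Int.natAbs_natCast]; ring, h, Nat.mod_eq_of_lt (by omega), jacobiSym.one_right]
      rw [← jacobiSym.legendreSym.to_jacobiSym, legendreSym.eq_one_iff q h3d] at hJ
      obtain ⟨c, hc⟩ := hJ
      obtain ⟨c, rfl⟩ := ZMod.intCast_surjective c
      refine hb (54 * c) ((ZMod.intCast_eq_intCast_iff _ _ _).1 ?_)
      push_cast at hc ⊢
      linear_combination (-2916 : ZMod q) * hc

end Eisenstein

namespace Eisenstein

lemma isCoprime_rootSymbol {a : ℕ} {d x y m b : ℤ} (hm : x ^ 2 + d * y ^ 2 = m)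
    (ha : IsCoprime (a : ℤ) (6 * m)) (hb : b ^ 2 ≡ 8748 * d [ZMOD a]) :
    IsCoprime (a : ℤ) (3 * ((y * b) ^ 2 + 3 * (54 * x) ^ 2)) := by
  have h6 : IsCoprime (a : ℤ) 6 := ha.of_mul_right_left
  have hm' := ha.of_mul_right_right
  have h3 : IsCoprime (a : ℤ) 3 := h6.of_isCoprime_of_dvd_right (by norm_num)
  have h7 : IsCoprime (a : ℤ) 8748 :=
    (h6.pow_right (n := 7)).of_isCoprime_of_dvd_right (by norm_num)
  refine h3.mul_right ?_
  obtain ⟨k, hk⟩ := hb.symm.dvd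
  have : (y * b) ^ 2 + 3 * (54 * x) ^ 2 = 8748 * m + a * (k * y ^ 2) := by
    linear_combination y ^ 2 * hk + 8748 * hm
  rw [this]
  exact (h7.mul_right hm').add_mul_left_right _

/-- The symbol of a quotient is the difference of the symbols. -/
lemma rootSymbol_sub {a : ℕ} {d x y m x' y' m' b c : ℤ} (hm : x ^ 2 + d * y ^ 2 = m)
    (hm' : x' ^ 2 + d * y' ^ 2 = m') (ha : IsCoprime (a : ℤ) (6 * (m * m'))) (hc : IsCoprime (a : ℤ) c)
    (hb : b ^ 2 ≡ 8748 * d [ZMOD a]) :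
    rootSymbol a (c * (y * x' - x * y') * b) (54 * (c * (x * x' + d * (y * y')))) =
      rootSymbol a (y * b) (54 * x) - rootSymbol a (y' * b) (54 * x') := by
  have h6 : IsCoprime (a : ℤ) 6 := ha.of_mul_right_left
  have h54 : IsCoprime (a : ℤ) 54 :=
    (h6.pow_right (n := 3)).of_isCoprime_of_dvd_right (by norm_num)
  have h3 : IsCoprime (a : ℤ) 3 := h6.of_isCoprime_of_dvd_right (by norm_num)
  have c1 := isCoprime_rootSymbol hm
    (h6.mul_right ha.of_mul_right_right.of_mul_right_left) hb
  have c2 := isCoprime_rootSymbol hm' (h6.mul_right ha.of_mul_right_right.of_mul_right_right) hb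
  have c0 := isCoprime_rootSymbol (d := d) (x := x * x' + d * (y * y')) (y := y * x' - x * y')
    (m := m * m') (by rw [← hm, ← hm']; ring) ha hb
  have c2' : IsCoprime (a : ℤ) (3 * ((-(y' * b)) ^ 2 + 3 * (54 * x') ^ 2)) := by rwa [neg_sq]
  have hneg : rootSymbol a (-(y' * b)) (54 * x') = -rootSymbol a (y' * b) (54 * x') := by
    rw [← rootSymbol_neg_right c2]
    have := rootSymbol_intCast_mul (A := a) (r := y' * b) (s := -(54 * x')) (g := -1)
      (by rwa [neg_sq]) isCoprime_one_right.neg_right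
    rw [← this]; congr 1 <;> ring
  have hprod := rootSymbol_mul c1 c2'
  have c01 : IsCoprime (a : ℤ) (3 * ((0 : ℤ) ^ 2 + 3 * 1 ^ 2)) := by
    norm_num; exact (h3.pow_right (n := 2)).of_isCoprime_of_dvd_right (by norm_num)
  have hroot := rootSymbol_mul c01 c0
  rw [rootSymbol_zero_left (by simpa using h3), zero_add] at hroot
  rw [sub_eq_add_neg (rootSymbol _ _ _), ← hneg, ← hprod]
  have e1 := rootSymbol_intCast_mul c0 hc
  rw [show c * (y * x' - x * y') * b = c * ((y * x' - x * y') * b) by ring,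
    show 54 * (c * (x * x' + d * (y * y'))) = c * (54 * (x * x' + d * (y * y'))) by ring, e1, ← hroot]
  obtain ⟨k, hk⟩ := hb.symm.dvd
  have c3 : IsCoprime (a : ℤ) (3 * ((0 * ((y * x' - x * y') * b) - 3 * (1 * (54 * (x * x' + d * (y * y'))))) ^ 2
      + 3 * (0 * (54 * (x * x' + d * (y * y'))) + (y * x' - x * y') * b * 1) ^ 2)) := by
    have := h3.mul_right c0
    convert this using 1; ring
  rw [← rootSymbol_intCast_mul c3 h54]
  refine rootSymbol_congr ?_ ?_ ?_
  · have := ((h54.pow_right (n := 2)).mul_right (h3.mul_right c0))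
    convert this using 1; ring
  · refine (Int.modEq_iff_dvd.2 ⟨-(y * y') * k, ?_⟩)
    linear_combination (-(y * y')) * hk
  · exact congrArg (· % (a : ℤ)) (by ring)

/-- The vectors of symbols of a family `x i + y i √-d` that are attained by moduli with large prime
factors. -/
def symbolVectors {ι : Type*} (d : ℤ) (x y : ι → ℤ) : Set (ι → ZMod 3) :=
  {f | ∀ B : ℕ, ∃ a : ℕ, a ≠ 0 ∧ (∀ p : ℕ, p.Prime → p ∣ a → B < p) ∧ ∃ b : ℤ,
    b ^ 2 ≡ 8748 * d [ZMOD a] ∧ ∀ i, rootSymbol a (y i * b) (54 * x i) = f i}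

lemma isCoprime_of_forall_prime_lt {a : ℕ} {z : ℤ} (ha : ∀ p : ℕ, p.Prime → p ∣ a → z.natAbs < p)
    (hz : z ≠ 0) : IsCoprime (a : ℤ) z := by
  refine Int.isCoprime_of_forall_prime fun p hp h1 h2 => ?_
  exact absurd (Nat.le_of_dvd (Int.natAbs_pos.2 hz) (Int.natCast_dvd.1 h2))
    (not_le.2 (ha p hp (Int.natCast_dvd_natCast.1 h1)))

section

variable {ι : Type*} {d : ℤ} {x y m : ι → ℤ}

lemma zero_mem_symbolVectors : 0 ∈ symbolVectors d x y := fun B =>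
  ⟨1, one_ne_zero, fun p hp h => absurd h hp.not_dvd_one, 0, by
    simpa using Int.modEq_one, fun i => by simp⟩

lemma add_mem_symbolVectors [Finite ι] (hm : ∀ i, x i ^ 2 + d * y i ^ 2 = m i) (h0 : ∀ i, m i ≠ 0) {f g : ι → ZMod 3}
    (hf : f ∈ symbolVectors d x y) (hg : g ∈ symbolVectors d x y) : f + g ∈ symbolVectors d x y := by
  intro B
  have := Fintype.ofFinite ι
  set M := B + ∑ i, (6 * m i).natAbs with hM
  have hMi : ∀ i, (6 * m i).natAbs ≤ M := fun i =>
    (Finset.single_le_sum (f := fun i => (6 * m i).natAbs) (fun _ _ => Nat.zero_le _)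
      (Finset.mem_univ i)).trans (Nat.le_add_left _ _)
  obtain ⟨a, a0, ha, b, hb, hfa⟩ := hf M
  obtain ⟨a', a0', ha', b', hb', hga⟩ := hg (M + a)
  have hcop : a.Coprime a' := Nat.coprime_of_dvd fun p hp h1 h2 =>
    absurd (Nat.le_of_dvd (Nat.pos_of_ne_zero a0) h1) (by have := ha' p hp h2; omega)
  have hcop' : IsCoprime (a : ℤ) a' := Nat.isCoprime_iff_coprime.2 hcop
  obtain ⟨c, hc, hc'⟩ : ∃ c : ℤ, c ≡ b [ZMOD a] ∧ c ≡ b' [ZMOD a'] := by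
    obtain ⟨u, v, huv⟩ := hcop'
    refine ⟨b' * (u * a) + b * (v * a'), Int.modEq_iff_dvd.2 ⟨u * (b - b'), ?_⟩,
      Int.modEq_iff_dvd.2 ⟨v * (b' - b), ?_⟩⟩
    · linear_combination (-b) * huv
    · linear_combination (-b') * huv
  have hca := (hc.pow 2).trans hb
  have hca' := (hc'.pow 2).trans hb'
  refine ⟨a * a', mul_ne_zero a0 a0', fun p hp h => ?_, c, ?_, fun i => ?_⟩
  · rcases (hp.dvd_mul).1 h with h | h
    · have := ha p hp h; omega
    · have := ha' p hp h; omega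
  · push_cast
    exact (Int.modEq_and_modEq_iff_modEq_mul (by simpa using hcop)).1 ⟨hca, hca'⟩
  · rw [rootSymbol_mul_left a0 a0', Pi.add_apply, ← hfa i, ← hga i]
    have n0 : 6 * m i ≠ 0 := mul_ne_zero (by norm_num) (h0 i)
    have k1 := isCoprime_rootSymbol (hm i) (isCoprime_of_forall_prime_lt
      (fun p hp h => (hMi i).trans_lt (ha p hp h)) n0) hca
    have k2 := isCoprime_rootSymbol (hm i) (isCoprime_of_forall_prime_lt
      (fun p hp h => (hMi i).trans_lt ((Nat.le_add_right _ _).trans_lt (ha' p hp h))) n0) hca'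
    rw [rootSymbol_congr k1 (hc.mul_left _) rfl, rootSymbol_congr k2 (hc'.mul_left _) rfl]

end

lemma exists_mem_symbolVectors_ne {ι : Type*} [Finite ι] {d : ℕ} (hd : Squarefree d) {x y m : ι → ℤ}
    (hm : ∀ i, x i ^ 2 + d * y i ^ 2 = m i) (h0 : ∀ i, m i ≠ 0) {i j : ι} {c N : ℤ} (hc : c ≠ 0)
    (hN : N ≠ 0) (hcN : c ^ 2 * (m i * m j) = 4 * N ^ 3)
    (hcube : ∀ t w : ℤ, ¬ (t ^ 3 - 3 * d * t * w ^ 2 = 4 * (c * (x i * x j + d * (y i * y j))) ∧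
      3 * t ^ 2 * w - d * w ^ 3 = 4 * (c * (y i * x j - x i * y j)))) :
    ∃ f ∈ symbolVectors (d : ℤ) x y, f i ≠ f j := by
  have := Fintype.ofFinite (ι → ZMod 3)
  by_contra! hcon
  have hB : ∀ f : ι → ZMod 3, ∃ B : ℕ, f i ≠ f j → ∀ a : ℕ, a ≠ 0 → (∀ p : ℕ, p.Prime → p ∣ a → B < p) →
      ∀ b : ℤ, b ^ 2 ≡ 8748 * d [ZMOD a] → ∃ i, rootSymbol a (y i * b) (54 * x i) ≠ f i := by
    intro f
    by_cases hf : f ∈ symbolVectors (d : ℤ) x y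
    · exact ⟨0, fun h => absurd (hcon f hf) h⟩
    · simp only [symbolVectors, Set.mem_ofPred_eq] at hf
      push Not at hf
      obtain ⟨B, hB⟩ := hf
      exact ⟨B, fun _ => hB⟩
  choose B hB using hB
  have key := exists_rootSymbol_ne_zero hd (u := c * (x i * x j + d * (y i * y j)))
    (v := c * (y i * x j - x i * y j)) hN (by rw [← hcN, ← hm i, ← hm j]; ring) hcube
    (∑ f, B f + (6 * (m i * m j)).natAbs + c.natAbs)
  obtain ⟨q, hq, hqB, b, hb, hne⟩ := key
  have hp : ∀ n : ℕ, n < q → ∀ p : ℕ, p.Prime → p ∣ q → n < p := fun n hn p hp h => by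
    rwa [(Nat.prime_dvd_prime_iff_eq hp hq).1 h]
  rw [rootSymbol_sub (hm i) (hm j) (isCoprime_of_forall_prime_lt (hp _ (by omega))
    (mul_ne_zero (by norm_num) (mul_ne_zero (h0 i) (h0 j))))
    (isCoprime_of_forall_prime_lt (hp _ (by omega)) hc) hb] at hne
  set f : ι → ZMod 3 := fun i => rootSymbol q (y i * b) (54 * x i) with hf
  have hfB : B f ≤ ∑ f, B f := Finset.single_le_sum (f := B) (fun _ _ => Nat.zero_le _) (Finset.mem_univ f)
  obtain ⟨k, hk⟩ := hB f (sub_ne_zero.1 hne) q hq.ne_zero (hp _ (by omega)) b hb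
  exact hk rfl

/-- A family `x i + y i √-d` whose members are independent modulo cubes has at least as many vectors of
symbols as members. -/
theorem card_le_card_symbolVectors {ι : Type*} [Finite ι] {d : ℕ} (hd : Squarefree d) {x y m : ι → ℤ}
    (hm : ∀ i, x i ^ 2 + d * y i ^ 2 = m i) (h0 : ∀ i, m i ≠ 0)
    (hsep : ∀ i j, i ≠ j → ∃ c N : ℤ, c ≠ 0 ∧ N ≠ 0 ∧ c ^ 2 * (m i * m j) = 4 * N ^ 3 ∧
      ∀ t w : ℤ, ¬ (t ^ 3 - 3 * d * t * w ^ 2 = 4 * (c * (x i * x j + d * (y i * y j))) ∧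
      3 * t ^ 2 * w - d * w ^ 3 = 4 * (c * (y i * x j - x i * y j)))) :
    Nat.card ι ≤ (symbolVectors (d : ℤ) x y).ncard := by
  let V : Submodule (ZMod 3) (ι → ZMod 3) :=
    { carrier := symbolVectors d x y
      zero_mem' := zero_mem_symbolVectors
      add_mem' := fun hf hg => add_mem_symbolVectors hm h0 hf hg
      smul_mem' := fun c f hf => by
        have : c • f = c.val • f := by
          rw [← Nat.cast_smul_eq_nsmul (ZMod 3), ZMod.natCast_zmod_val]
        rw [this]
        generalize c.val = n
        induction n with
        | zero => rw [zero_smul]; exact zero_mem_symbolVectors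
        | succ n ih => rw [succ_nsmul]; exact add_mem_symbolVectors hm h0 ih hf }
  have : Fact (Nat.Prime 3) := ⟨Nat.prime_three⟩
  have hinj : Function.Injective (fun i : ι => ((LinearMap.proj i).comp V.subtype : Module.Dual (ZMod 3) V)) := by
    intro i j hij
    by_contra hne
    obtain ⟨c, N, hc, hN, h1, h2⟩ := hsep i j hne
    obtain ⟨f, hf, hfne⟩ := exists_mem_symbolVectors_ne hd hm h0 hc hN h1 h2
    exact hfne (LinearMap.congr_fun hij ⟨f, hf⟩)
  have hfin : Finite (Module.Dual (ZMod 3) V) := Module.finite_of_finite (ZMod 3)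
  refine (Nat.card_le_card_of_injective _ hinj).trans (le_of_eq ?_)
  have e : Nat.card (Module.Dual (ZMod 3) V) = Nat.card V := by
    rw [Module.natCard_eq_pow_finrank (K := ZMod 3), Module.natCard_eq_pow_finrank (K := ZMod 3) (V := V),
      Subspace.dual_finrank_eq]
  exact e

/-- Pairwise coprime moduli for finitely many vectors of symbols. -/
theorem exists_pairwise_coprime_moduli {ι : Type*} {d : ℤ} {x y : ι → ℤ} (W : Finset (ι → ZMod 3))
    (hW : ∀ f ∈ W, f ∈ symbolVectors d x y) (M : ℕ) : ∃ (a : (ι → ZMod 3) → ℕ) (b : (ι → ZMod 3) → ℤ),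
      (∀ f ∈ W, a f ≠ 0 ∧ (∀ p : ℕ, p.Prime → p ∣ a f → M < p) ∧ b f ^ 2 ≡ 8748 * d [ZMOD a f] ∧
        ∀ i, rootSymbol (a f) (y i * b f) (54 * x i) = f i) ∧
      ∀ f ∈ W, ∀ g ∈ W, f ≠ g → (a f).Coprime (a g) := by
  classical
  induction W using Finset.induction_on with
  | empty => exact ⟨fun _ => 0, fun _ => 0, by simp, by simp⟩
  | insert f W hf ih =>
    obtain ⟨a, b, h1, h2⟩ := ih fun g hg => hW g (Finset.mem_insert_of_mem hg)
    obtain ⟨a', a0, ha, b', hb, hr⟩ := hW f (Finset.mem_insert_self f W) (M + ∑ g ∈ W, a g)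
    have hc : ∀ g ∈ W, (a g).Coprime a' := fun g hg => Nat.coprime_of_dvd fun p hp p1 p2 =>
      absurd (Nat.le_of_dvd (Nat.pos_of_ne_zero (h1 g hg).1) p1) (by
        have := ha p hp p2
        have := Finset.single_le_sum (f := a) (fun _ _ => Nat.zero_le _) hg
        omega)
    have hne : ∀ g ∈ W, g ≠ f := fun g hg h => hf (h ▸ hg)
    refine ⟨Function.update a f a', Function.update b f b', fun g hg => ?_, fun g hg k hk hgk => ?_⟩
    · rcases Finset.mem_insert.1 hg with rfl | hg
      · simp only [Function.update_self]
        exact ⟨a0, fun p hp h => by have := ha p hp h; omega, hb, hr⟩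
      · rw [Function.update_of_ne (hne g hg), Function.update_of_ne (hne g hg)]
        exact h1 g hg
    · rcases Finset.mem_insert.1 hg with rfl | hg
      · rcases Finset.mem_insert.1 hk with rfl | hk
        · exact absurd rfl hgk
        · rw [Function.update_self, Function.update_of_ne (hne k hk)]; exact (hc k hk).symm
      · rcases Finset.mem_insert.1 hk with h | hk
        · rw [h, Function.update_self, Function.update_of_ne (hne g ‹_›)]; exact hc g ‹_›
        · rw [Function.update_of_ne (hne g hg), Function.update_of_ne (hne k hk)]
          exact h2 g hg k hk hgk

end Eisenstein

namespace IsImagQuad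

set_option linter.unusedSectionVars false

variable {R : Type*} [CommRing R] [IsDedekindDomain R] [CharZero R] [Module.Free ℤ R]
  [Module.Finite ℤ R] {d : ℕ} {s : R} {σ : R ≃+* R}

/-- Every ideal class contains an ideal coprime to a given nonzero integer. -/
lemma _root_.ClassGroup.exists_mk0_eq_isCoprime {R : Type*} [CommRing R] [IsDedekindDomain R]
    (c : ClassGroup R) {J : Ideal R} (hJ : J ≠ 0) :
    ∃ I : Ideal R, ∃ hI : I ∈ nonZeroDivisors (Ideal R), ClassGroup.mk0 ⟨I, hI⟩ = c ∧
      IsCoprime I J := by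
  obtain ⟨⟨K, hK⟩, hKc⟩ := ClassGroup.mk0_surjective c⁻¹
  have hK0 : K ≠ 0 := mem_nonZeroDivisors_iff_ne_zero.1 hK
  obtain ⟨a, ha⟩ := IsDedekindDomain.exists_sup_span_eq (I := K * J * J) (J := K)
    ((mul_assoc K J J).trans_le Ideal.mul_le_left) (mul_ne_zero (mul_ne_zero hK0 hJ) hJ)
  by_cases ha0 : a = 0
  · have h1 : J = ⊤ := by
      rw [ha0, Ideal.span_singleton_eq_bot.2 rfl, sup_bot_eq, mul_assoc] at ha
      have h2 : K * (J * J) = K * 1 := by rw [ha, mul_one]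
      have := mul_left_cancel₀ hK0 h2
      rw [Ideal.one_eq_top] at this
      exact top_le_iff.1 (this.symm.trans_le Ideal.mul_le_left)
    obtain ⟨⟨I, hI⟩, hIc⟩ := ClassGroup.mk0_surjective c
    exact ⟨I, hI, hIc, by rw [h1, ← Ideal.one_eq_top]; exact isCoprime_one_right⟩
  · have haK : a ∈ K := by
      rw [← ha]; exact Ideal.mem_sup_right (Ideal.mem_span_singleton_self a)
    obtain ⟨I, hI⟩ := Ideal.dvd_iff_le.2 ((Ideal.span_singleton_le_iff_mem K).2 haK)
    have haspan : Ideal.span {a} ≠ 0 := by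
      rw [Ne, Ideal.zero_eq_bot, Ideal.span_singleton_eq_bot]; exact ha0
    have hI0 : I ∈ nonZeroDivisors (Ideal R) := by
      rw [mem_nonZeroDivisors_iff_ne_zero]
      rintro rfl
      rw [mul_zero] at hI
      exact haspan hI
    refine ⟨I, hI0, ?_, ?_⟩
    · have h1 : ClassGroup.mk0 ⟨K, hK⟩ * ClassGroup.mk0 ⟨I, hI0⟩ = 1 := by
        rw [← map_mul]
        have : (⟨K, hK⟩ * ⟨I, hI0⟩ : nonZeroDivisors (Ideal R)) =
            ⟨Ideal.span {a}, mem_nonZeroDivisors_iff_ne_zero.2 haspan⟩ := Subtype.ext hI.symm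
        rw [this, ClassGroup.mk0_eq_one_iff]
        exact ⟨⟨a, rfl⟩⟩
      rw [hKc, inv_mul_eq_one] at h1
      exact h1.symm
    · have h1 : K * (J * J ⊔ I) = K * 1 := by
        rw [← Ideal.add_eq_sup, mul_add, ← mul_assoc, ← hI, Ideal.add_eq_sup, ha, mul_one]
      have h2 := mul_left_cancel₀ hK0 h1
      rw [Ideal.isCoprime_iff_sup_eq, ← top_le_iff, ← Ideal.one_eq_top, ← h2, sup_comm]
      exact sup_le_sup_left Ideal.mul_le_left _

lemma isCoprime_absNorm (h : IsImagQuad R d s σ) {I : Ideal R} {M : ℤ}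
    (hIM : IsCoprime I (Ideal.span {(M : R)})) : IsCoprime (Ideal.absNorm I : ℤ) M := by
  rw [Ideal.isCoprime_iff_exists] at hIM
  obtain ⟨a, haI, t, ht, hat⟩ := hIM
  obtain ⟨t, rfl⟩ := Ideal.mem_span_singleton.1 ht
  obtain ⟨u, v, huv⟩ := h.rep a
  obtain ⟨m, hm, -⟩ := h.norm_eq huv
  have h1 : M ∣ 1 - m := by
    apply h.int_dvd
    have h2 : σ a + M * σ t = 1 := by
      have := congrArg σ hat
      simpa using this
    refine ⟨t + σ t - M * (t * σ t), ?_⟩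
    push_cast
    rw [← hm]
    linear_combination (-σ a) * hat - (1 - M * t) * h2
  have h3 : (Ideal.absNorm I : ℤ) ∣ m := by
    rw [Int.natCast_dvd, ← h.absNorm_span hm]
    exact map_dvd Ideal.absNorm (Ideal.dvd_iff_le.2 ((Ideal.span_singleton_le_iff_mem I).2 haI))
  obtain ⟨k, hk⟩ := h1
  obtain ⟨l, hl⟩ := h3
  exact ⟨l, k, by linear_combination -hl - hk⟩

/-- A pair of integers with prescribed residues modulo `27` whose associated norm is coprime to
a given integer. -/
lemma _root_.Int.exists_isCoprime_sq_add_mul_sq {p q d M : ℤ} (hM : M ≠ 0)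
    (h3 : IsCoprime (p ^ 2 + d * q ^ 2) 3) :
    ∃ P Q : ℤ, P ≡ p [ZMOD 27] ∧ Q ≡ q [ZMOD 27] ∧ IsCoprime (P ^ 2 + d * Q ^ 2) M := by
  have hpr : Prime (3 : ℤ) := Int.prime_three
  obtain ⟨M', hM', h3M⟩ :=
    (Int.finiteMultiplicity_iff.2 ⟨by decide, hM⟩ : FiniteMultiplicity 3 M).exists_eq_pow_mul_and_not_dvd
  have hc : IsCoprime (27 : ℤ) M' := by
    rw [show (27 : ℤ) = 3 ^ 3 by norm_num]
    exact ((Prime.coprime_iff_not_dvd hpr).2 h3M).pow_left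
  obtain ⟨a, b, hab⟩ := hc
  have hPQ : (1 + b * M' * (p - 1)) ^ 2 + d * (b * M' * q) ^ 2 =
      1 + M' * (2 * b * (p - 1) + M' * (b * (p - 1)) ^ 2 + d * (M' * (b * q) ^ 2)) := by ring
  have hP : (1 + b * M' * (p - 1)) ^ 2 + d * (b * M' * q) ^ 2 =
      p ^ 2 + d * q ^ 2 + 3 * (9 * a * (-2 * p * (p - 1) - 2 * d * q ^ 2) +
        243 * a ^ 2 * ((p - 1) ^ 2 + d * q ^ 2)) := by
    rw [show b * M' = 1 - a * 27 by linear_combination hab]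
    ring
  refine ⟨1 + b * M' * (p - 1), b * M' * q, ?_, ?_, ?_⟩
  · exact (Int.modEq_iff_dvd.2 ⟨a * (p - 1), by linear_combination (1 - p) * hab⟩)
  · exact (Int.modEq_iff_dvd.2 ⟨a * q, by linear_combination (-q) * hab⟩)
  · rw [hM']
    refine IsCoprime.mul_right ?_ ?_
    · rw [hP]
      exact h3.add_mul_left_left _ |>.pow_right
    · rw [hPQ]
      exact isCoprime_one_left.add_mul_left_left _

/-- A cube root of a principal ideal coprime to `M`, with a generator `(u + v √-d) / 2` of the cube
satisfying `P u v`. -/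
def CubeRep (s : R) (c : ClassGroup R) (M : ℤ) (P : ℤ → ℤ → Prop) (I : Ideal R) : Prop :=
  ∃ hI : I ∈ nonZeroDivisors (Ideal R), ClassGroup.mk0 ⟨I, hI⟩ = c ∧
    IsCoprime I (Ideal.span {(M : R)}) ∧
    ∃ α : R, ∃ u v : ℤ, I ^ 3 = Ideal.span {α} ∧ 2 * α = u + v * s ∧ P u v

lemma CubeRep.norm_eq (h : IsImagQuad R d s σ) {I : Ideal R} {α : R} {u v : ℤ}
    (hα : I ^ 3 = Ideal.span {α}) (huv : 2 * α = u + v * s) :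
    u ^ 2 + d * v ^ 2 = 4 * (Ideal.absNorm I : ℤ) ^ 3 := by
  obtain ⟨m, hm, hm4⟩ := h.norm_eq huv
  have h1 : m.natAbs = Ideal.absNorm I ^ 3 := by
    rw [← h.absNorm_span hm, ← hα, map_pow]
  have h2 : 0 ≤ m := by
    have : 0 ≤ 4 * m := by rw [hm4]; positivity
    omega
  rw [← hm4, ← Int.natAbs_of_nonneg h2, h1]
  push_cast; rfl

/-- Multiplying by `p + q √-d`, up to a multiple of `27`. -/
lemma CubeRep.mul (h : IsImagQuad R d s σ) {c : ClassGroup R} {M : ℤ} (hM : M ≠ 0)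
    {P P' : ℤ → ℤ → Prop} {I : Ideal R} (hI : CubeRep s c M P I) {p q : ℤ}
    (hpq : IsCoprime (p ^ 2 + d * q ^ 2) 3)
    (hP : ∀ u v u' v', P u v → (∃ n : ℕ, u ^ 2 + d * v ^ 2 = 4 * (n : ℤ) ^ 3 ∧ IsCoprime (n : ℤ) M) →
      u' ≡ u * (p ^ 3 - 3 * d * p * q ^ 2) - d * v * (3 * p ^ 2 * q - d * q ^ 3) [ZMOD 27] →
      v' ≡ u * (3 * p ^ 2 * q - d * q ^ 3) + v * (p ^ 3 - 3 * d * p * q ^ 2) [ZMOD 27] → P' u' v') :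
    ∃ I', CubeRep s c M P' I' := by
  obtain ⟨hI0, hIc, hIM, α, u, v, hα, huv, hPuv⟩ := hI
  obtain ⟨x, y, hx, hy, hxy⟩ := Int.exists_isCoprime_sq_add_mul_sq hM hpq
  set γ : R := x + y * s with hγ
  have hγγ : γ * (x - y * s) = ((x ^ 2 + d * y ^ 2 : ℤ) : R) := by
    rw [hγ]; push_cast; linear_combination (-(y : R) ^ 2) * h.sq
  have hγM : IsCoprime γ (M : R) :=
    IsCoprime.of_isCoprime_of_dvd_left (hxy.map (Int.castRingHom R)) ⟨_, hγγ.symm⟩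
  have hγ0 : Ideal.span {γ} ∈ nonZeroDivisors (Ideal R) := by
    rw [mem_nonZeroDivisors_iff_ne_zero, Ne, Ideal.zero_eq_bot, Ideal.span_singleton_eq_bot]
    intro h0
    rw [h0, zero_mul] at hγγ
    have h1 : x ^ 2 + d * y ^ 2 = 0 := by exact_mod_cast hγγ.symm
    have h2 := hpq
    have h3 : (27 : ℤ) ∣ (p ^ 2 + d * q ^ 2) - (x ^ 2 + d * y ^ 2) :=
      Int.modEq_iff_dvd.1 ((hx.pow 2).add ((hy.pow 2).mul_left _))
    rw [h1, sub_zero] at h3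
    exact absurd (IsCoprime.isUnit_of_dvd' h2 (dvd_trans ⟨9, rfl⟩ h3) dvd_rfl) (by decide)
  refine ⟨Ideal.span {γ} * I, mul_mem hγ0 hI0, ?_, ?_, γ ^ 3 * α,
    u * (x ^ 3 - 3 * d * x * y ^ 2) - d * v * (3 * x ^ 2 * y - d * y ^ 3),
    u * (3 * x ^ 2 * y - d * y ^ 3) + v * (x ^ 3 - 3 * d * x * y ^ 2), ?_, ?_, ?_⟩
  · have : (⟨Ideal.span {γ} * I, mul_mem hγ0 hI0⟩ : nonZeroDivisors (Ideal R)) =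
      ⟨Ideal.span {γ}, hγ0⟩ * ⟨I, hI0⟩ := rfl
    rw [this, map_mul, (ClassGroup.mk0_eq_one_iff _).2 ⟨⟨γ, rfl⟩⟩, one_mul, hIc]
  · exact IsCoprime.mul_left ((Ideal.isCoprime_span_singleton_iff _ _).2 hγM) hIM
  · rw [mul_pow, hα, Ideal.span_singleton_pow, Ideal.span_singleton_mul_span_singleton]
  · have hs3 : s ^ 3 = -(d * s) := by linear_combination s * h.sq
    have hγ3 : γ ^ 3 = (x ^ 3 - 3 * d * x * y ^ 2) + (3 * x ^ 2 * y - d * y ^ 3) * s := by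
      rw [hγ]; linear_combination (3 * x * y ^ 2 : R) * h.sq + (y : R) ^ 3 * hs3
    rw [mul_left_comm, huv, hγ3]
    push_cast
    linear_combination ((v : R) * (3 * x ^ 2 * y - d * y ^ 3)) * h.sq
  · refine hP u v _ _ hPuv ⟨Ideal.absNorm I, CubeRep.norm_eq h hα huv, h.isCoprime_absNorm hIM⟩ ?_ ?_
    · gcongr
    · gcongr

lemma exists_cubeRep (h : IsImagQuad R d s σ) {c : ClassGroup R} (hc : c ^ 3 = 1) {M : ℤ}
    (hM : M ≠ 0) (h3M : 3 ∣ M) :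
    ∃ I, CubeRep s c M (fun u v => ¬ 3 ∣ u ∧ ¬ 27 ∣ v) I := by
  have hp3 : Prime (3 : ℤ) := Int.prime_three
  have hn : ∀ n : ℕ, IsCoprime (n : ℤ) M → ¬ (3 : ℤ) ∣ 4 * (n : ℤ) ^ 3 := by
    intro n hnM h3
    have h4 : (3 : ℤ) ∣ n := by
      rcases hp3.dvd_or_dvd h3 with h | h
      · omega
      · exact hp3.dvd_of_dvd_pow h
    exact hp3.not_isUnit (hnM.isUnit_of_dvd' h4 h3M)
  have hMspan : Ideal.span {(M : R)} ≠ 0 := by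
    rw [Ne, Ideal.zero_eq_bot, Ideal.span_singleton_eq_bot]; exact_mod_cast hM
  have hI0 : ∃ I, CubeRep s c M (fun _ _ => True) I := by
    obtain ⟨I, hI, hIc, hIM⟩ := ClassGroup.exists_mk0_eq_isCoprime c hMspan
    have h1 : ClassGroup.mk0 (⟨I, hI⟩ ^ 3) = 1 := by rw [map_pow, hIc, hc]
    obtain ⟨⟨α, hα⟩⟩ := (ClassGroup.mk0_eq_one_iff _).1 h1
    obtain ⟨u, v, huv⟩ := h.rep α
    exact ⟨I, hI, hIc, hIM, α, u, v, hα, huv, trivial⟩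
  have hI1 : ∃ I, CubeRep s c M (fun u _ => ¬ 3 ∣ u) I := by
    obtain ⟨I, hI⟩ := hI0
    by_cases hu : CubeRep s c M (fun u _ => ¬ 3 ∣ u) I
    · exact ⟨I, hu⟩
    have hI' : CubeRep s c M (fun u _ => 3 ∣ u) I := by
      obtain ⟨hI0, hIc, hIM, α, u, v, hα, huv, -⟩ := hI
      refine ⟨hI0, hIc, hIM, α, u, v, hα, huv, ?_⟩
      by_contra h3
      exact hu ⟨hI0, hIc, hIM, α, u, v, hα, huv, h3⟩
    have hd3 : ¬ (3 : ℤ) ∣ d := by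
      intro hd
      obtain ⟨hI0, hIc, hIM, α, u, v, hα, huv, hu3⟩ := hI'
      refine hn _ (h.isCoprime_absNorm hIM) ?_
      rw [← CubeRep.norm_eq h hα huv]
      exact dvd_add (dvd_pow hu3 two_ne_zero) (hd.mul_right _)
    refine CubeRep.mul h hM hI' (p := 0) (q := 1) ?_ ?_
    · simpa using ((Prime.coprime_iff_not_dvd hp3).2 hd3).symm
    · rintro u v u' v' hu ⟨n, hn4, hnM⟩ hu' - h3
      have h4 : (3 : ℤ) ∣ d * v * d := by
        have h6 := dvd_trans (⟨9, rfl⟩ : (3 : ℤ) ∣ 27) (Int.modEq_iff_dvd.1 hu')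
        obtain ⟨k, hk⟩ := dvd_add h6 h3
        exact ⟨k, by linear_combination hk⟩
      have hv : (3 : ℤ) ∣ v := by
        rcases hp3.dvd_or_dvd h4 with h | h
        · exact (hp3.dvd_or_dvd h).resolve_left hd3
        · exact absurd h hd3
      refine hn n hnM ?_
      rw [← hn4]
      exact dvd_add (dvd_pow hu two_ne_zero) (dvd_mul_of_dvd_right (dvd_pow hv two_ne_zero) _)
  obtain ⟨I, hI⟩ := hI1
  by_cases hv : CubeRep s c M (fun u v => ¬ 3 ∣ u ∧ ¬ 27 ∣ v) I
  · exact ⟨I, hv⟩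
  have hI' : CubeRep s c M (fun u v => ¬ 3 ∣ u ∧ 27 ∣ v) I := by
    obtain ⟨hI0, hIc, hIM, α, u, v, hα, huv, hu⟩ := hI
    refine ⟨hI0, hIc, hIM, α, u, v, hα, huv, hu, ?_⟩
    by_contra h3
    exact hv ⟨hI0, hIc, hIM, α, u, v, hα, huv, hu, h3⟩
  refine CubeRep.mul h hM hI' (p := 1) (q := 3) ?_ ?_
  · exact ⟨1, -(3 * d), by ring⟩
  · rintro u v u' v' ⟨hu, w, rfl⟩ - hu' hv'
    obtain ⟨a, ha⟩ := Int.modEq_iff_dvd.1 hu'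
    obtain ⟨b, hb⟩ := Int.modEq_iff_dvd.1 hv'
    refine ⟨fun ⟨k, hk⟩ => hu ⟨k + 9 * d * u + 9 * a + d * w * 27 * (3 - 9 * d), by
      linear_combination ha + hk⟩, fun ⟨k, hk⟩ => hu ?_⟩
    have h9 : 27 * (k + b + d * u - w * (1 - 27 * d)) = 9 * u := by
      linear_combination -hb - hk
    exact ⟨k + b + d * u - w * (1 - 27 * d), by linarith⟩

lemma exists_coords (h : IsImagQuad R d s σ) {c : ClassGroup R} (hc : c ^ 3 = 1) {M : ℤ}
    (hM : M ≠ 0) (h6M : (6 * d : ℤ) ∣ M) :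
    ∃ I : Ideal R, ∃ hI : I ∈ nonZeroDivisors (Ideal R), ∃ α : R, ∃ e x y : ℤ,
      ClassGroup.mk0 ⟨I, hI⟩ = c ∧ I ^ 3 = Ideal.span {α} ∧ e * α = x + y * s ∧
      (e = 1 ∨ e = 2 ∧ ¬ 2 ∣ x ∧ ¬ 2 ∣ y) ∧ x ^ 2 + d * y ^ 2 = e ^ 2 * (Ideal.absNorm I : ℤ) ^ 3 ∧
      IsCoprime x y ∧ ¬ 3 ∣ x ∧ ¬ 27 ∣ y ∧ IsCoprime (Ideal.absNorm I : ℤ) M := by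
  set P : ℤ → ℤ → Prop := fun u v => ¬ 3 ∣ u ∧ ¬ 27 ∣ v with hPdef
  have hex : ∃ n : ℕ, ∃ I, CubeRep s c M P I ∧ Ideal.absNorm I = n := by
    obtain ⟨I, hI⟩ := h.exists_cubeRep hc hM (dvd_trans ⟨2 * d, by ring⟩ h6M)
    exact ⟨_, I, hI, rfl⟩
  classical
  obtain ⟨I, hI, hIn⟩ := Nat.find_spec hex
  have hmin : ∀ I', CubeRep s c M P I' → Ideal.absNorm I ≤ Ideal.absNorm I' := fun I' hI' => by
    rw [hIn]; exact Nat.find_min' hex ⟨I', hI', rfl⟩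
  obtain ⟨hI0, hIc, hIM, α, u, v, hα, huv, hu3, hv27⟩ := hI
  have hIne : I ≠ ⊥ := mem_nonZeroDivisors_iff_ne_zero.1 hI0
  have hnM := h.isCoprime_absNorm hIM
  have hN := CubeRep.norm_eq h hα huv
  have hprim : ∀ p : ℕ, p.Prime → ¬ I ≤ Ideal.span {(p : R)} := by
    intro p hp hle
    obtain ⟨I', hI'⟩ := Ideal.dvd_iff_le.2 hle
    have hp0 : (p : R) ≠ 0 := by exact_mod_cast hp.ne_zero
    have hpspan : Ideal.span {(p : R)} ≠ 0 := by
      rw [Ne, Ideal.zero_eq_bot, Ideal.span_singleton_eq_bot]; exact hp0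
    have hI'ne : I' ≠ 0 := by rintro rfl; rw [mul_zero] at hI'; exact hIne hI'
    have hI'0 : I' ∈ nonZeroDivisors (Ideal R) := mem_nonZeroDivisors_iff_ne_zero.2 hI'ne
    have hc' : ClassGroup.mk0 ⟨I', hI'0⟩ = c := by
      rw [← hIc]
      have : (⟨I, hI0⟩ : nonZeroDivisors (Ideal R)) =
          ⟨Ideal.span {(p : R)}, mem_nonZeroDivisors_iff_ne_zero.2 hpspan⟩ * ⟨I', hI'0⟩ :=
        Subtype.ext hI'
      rw [this, map_mul, (ClassGroup.mk0_eq_one_iff _).2 ⟨⟨(p : R), rfl⟩⟩, one_mul]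
    have h1 : ClassGroup.mk0 (⟨I', hI'0⟩ ^ 3) = 1 := by rw [map_pow, hc', hc]
    obtain ⟨⟨β, hβ⟩⟩ := (ClassGroup.mk0_eq_one_iff _).1 h1
    replace hβ : I' ^ 3 = Ideal.span {β} := hβ
    have h2 : Ideal.span {α} = Ideal.span {(p : R) ^ 3 * β} := by
      rw [← hα, hI', mul_pow, hβ, Ideal.span_singleton_pow, Ideal.span_singleton_mul_span_singleton]
    obtain ⟨ε, hε⟩ := Ideal.span_singleton_eq_span_singleton.1 h2
    set α' : R := β * ((ε⁻¹ : Rˣ) : R) with hα'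
    have h3 : α = (p : R) ^ 3 * α' := by
      rw [hα', ← mul_assoc, ← hε, Units.mul_inv_cancel_right]
    obtain ⟨u', v', huv'⟩ := h.rep α'
    have h4 : (u : R) + v * s = ((p ^ 3 * u' : ℤ) : R) + ((p ^ 3 * v' : ℤ) : R) * s := by
      rw [← huv, h3]; push_cast; linear_combination (p : R) ^ 3 * huv'
    obtain ⟨rfl, rfl⟩ := h.inj h4
    have hle := hmin I' ⟨hI'0, hc', ?_, α', u', v', ?_, huv', ?_, ?_⟩
    · rw [hI', map_mul, Ideal.absNorm_span_natCast, h.finrank] at hle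
      have hpos : 0 < Ideal.absNorm I' :=
        Nat.pos_of_ne_zero (fun h0 => hI'ne (Ideal.absNorm_eq_zero_iff.1 h0))
      have h4 : 2 ^ 2 ≤ p ^ 2 := Nat.pow_le_pow_left hp.two_le 2
      have := Nat.mul_le_mul_right (Ideal.absNorm I') h4
      omega
    · rw [hI'] at hIM
      exact hIM.of_mul_left_right
    · rw [hβ, hα', Ideal.span_singleton_mul_right_unit (Units.isUnit _)]
    · exact fun h => hu3 (h.mul_left _)
    · exact fun h => hv27 (h.mul_left _)
  have hodd : ∀ p : ℤ, Prime p → ¬ p ∣ 2 → p ∣ u → p ∣ v → False := by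
    intro p hp hp2 hpu hpv
    have hpodd : Odd p := by
      rcases Int.even_or_odd p with h | h
      · obtain ⟨k, hk⟩ := h
        have h2 : p = 2 * k := by omega
        have := (hp.irreducible.isUnit_or_isUnit h2).resolve_left (by decide)
        exact absurd (h2 ▸ (this.mul_right_dvd.2 dvd_rfl) : p ∣ 2) hp2
      · exact h
    obtain ⟨a, g, r, z, hz, hg, -, -, -, -, hIz⟩ := h.exists_params hIne hprim
    have hzI : z ∈ I := by rw [hIz]; exact Ideal.subset_span (by simp)
    have hz3 : (p : R) ∣ z ^ 3 := by
      have h1 : z ^ 3 ∈ Ideal.span {α} := by rw [← hα]; exact Ideal.pow_mem_pow hzI 3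
      exact (dvd_of_odd huv hpodd hpu hpv).trans (Ideal.mem_span_singleton.1 h1)
    obtain ⟨w, hw⟩ := hz3
    obtain ⟨k, l, hkl⟩ := h.rep w
    have h16 : ((2 * (r ^ 3 - 3 * r * g ^ 2 * d) : ℤ) : R) +
        ((2 * (3 * r ^ 2 * g - d * g ^ 3) : ℤ) : R) * s =
        ((p * (8 * k) : ℤ) : R) + ((p * (8 * l) : ℤ) : R) * s := by
      have h8 : (2 * z) ^ 3 = 8 * (p * w) := by rw [mul_pow, hw]; norm_num
      rw [hz] at h8
      push_cast
      linear_combination (2 : R) * h8 + 8 * (p : R) * hkl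
        - 2 * (3 * (r : R) * g ^ 2 + g ^ 3 * s) * h.sq
    obtain ⟨h5, h6⟩ := h.inj h16
    have h2p : ∀ w : ℤ, p ∣ 2 * w → p ∣ w := fun w hw => (hp.dvd_or_dvd hw).resolve_left hp2
    have hgp : ∀ w : ℤ, p ∣ g * w → p ∣ w := by
      rcases hg with rfl | rfl
      · simp
      · exact fun w hw => h2p w (by simpa using hw)
    have h7 : p ∣ (r : ℤ) * (r ^ 2 - 3 * g ^ 2 * d) :=
      h2p _ ⟨8 * k, by linear_combination h5⟩
    have h8 : p ∣ 3 * (r : ℤ) ^ 2 - d * g ^ 2 :=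
      hgp _ (h2p _ ⟨8 * l, by linear_combination h6⟩)
    have hpd : p ∣ d := by
      rcases hp.dvd_or_dvd h7 with h9 | h9
      · refine hgp _ (hgp _ ?_)
        obtain ⟨m, hm⟩ := dvd_sub (dvd_mul_of_dvd_right (dvd_pow h9 two_ne_zero) 3) h8
        exact ⟨m, by linear_combination hm⟩
      · refine hgp _ (hgp _ (h2p _ (h2p _ (h2p _ ?_))))
        obtain ⟨m, hm⟩ := dvd_sub h8 (dvd_mul_of_dvd_right h9 3)
        exact ⟨m, by linear_combination hm⟩
    have hpn : p ∣ 4 * (Ideal.absNorm I : ℤ) ^ 3 := by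
      rw [← hN]; exact dvd_add (dvd_pow hpu two_ne_zero) (hpd.mul_right _)
    have hpn' : p ∣ (Ideal.absNorm I : ℤ) := by
      rcases hp.dvd_or_dvd hpn with h | h
      · rw [show (4 : ℤ) = 2 ^ 2 by norm_num] at h
        exact absurd (hp.dvd_of_dvd_pow h) hp2
      · exact hp.dvd_of_dvd_pow h
    exact hp.not_isUnit (hnM.isUnit_of_dvd' hpn' ((hpd.mul_left 6).trans h6M))
  have hdvd2 : ∀ p : ℕ, p.Prime → (p : ℤ) ∣ 2 → (2 : ℤ) ∣ p := fun p hp hp2 =>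
    ((Nat.prime_iff_prime_int.1 hp).associated_of_dvd Int.prime_two hp2).symm.dvd
  have hn2 : ¬ (2 : ℤ) ∣ Ideal.absNorm I := fun h2 =>
    Int.prime_two.not_isUnit (hnM.isUnit_of_dvd' h2 (dvd_trans ⟨3 * d, by ring⟩ h6M))
  have hpar : 2 ∣ u ∧ 2 ∣ v ∨ ¬ 2 ∣ u ∧ ¬ 2 ∣ v := by
    rcases Int.even_or_odd' u with ⟨k, rfl | rfl⟩ <;> rcases Int.even_or_odd' v with ⟨l, rfl | rfl⟩
    · left; omega
    · exfalso
      have h4 : (2 * 2 : ℤ) ∣ d := ⟨(Ideal.absNorm I : ℤ) ^ 3 - k ^ 2 - d * (l ^ 2 + l), by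
        linear_combination hN⟩
      have h5 : 2 * 2 ∣ d := by exact_mod_cast h4
      exact absurd (h.squarefree 2 h5) (by decide)
    · exfalso
      have : 2 * (2 * (Ideal.absNorm I : ℤ) ^ 3 - 2 * d * l ^ 2 - 2 * k ^ 2 - 2 * k) = 1 := by
        linear_combination -hN
      omega
    · right; omega
  rcases hpar with ⟨⟨x, rfl⟩, ⟨y, rfl⟩⟩ | ⟨hu2, hv2⟩
  · refine ⟨I, hI0, α, 1, x, y, hIc, hα, ?_, Or.inl rfl, by linarith, ?_, fun h => hu3 (h.mul_left _),
      fun h => hv27 (h.mul_left _), hnM⟩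
    · refine mul_left_cancel₀ two_ne_zero ?_
      push_cast at huv ⊢
      linear_combination huv
    · refine Int.isCoprime_of_forall_prime fun p hp hpx hpy => ?_
      by_cases hp2 : (p : ℤ) ∣ 2
      · have h2p : (2 : ℤ) ∣ p := hdvd2 p hp hp2
        obtain ⟨k, rfl⟩ := h2p.trans hpx
        obtain ⟨l, rfl⟩ := h2p.trans hpy
        refine hn2 (Int.prime_two.dvd_of_dvd_pow (n := 3) ⟨2 * (k ^ 2 + d * l ^ 2), ?_⟩)
        linarith
      · exact hodd p (Nat.prime_iff_prime_int.1 hp) hp2 (hpx.mul_left 2) (hpy.mul_left 2)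
  · refine ⟨I, hI0, α, 2, u, v, hIc, hα, by exact_mod_cast huv, Or.inr ⟨rfl, hu2, hv2⟩,
      by linarith, ?_, hu3, hv27, hnM⟩
    refine Int.isCoprime_of_forall_prime fun p hp hpx hpy => ?_
    by_cases hp2 : (p : ℤ) ∣ 2
    · exact hu2 ((hdvd2 p hp hp2).trans hpx)
    · exact hodd p (Nat.prime_iff_prime_int.1 hp) hp2 hpx hpy

end IsImagQuad

lemma Ideal.eq_of_pow_eq_pow {R : Type*} [CommRing R] [IsDedekindDomain R] {I J : Ideal R} {n : ℕ}
    (hn : n ≠ 0) (h : I ^ n = J ^ n) : I = J :=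
  dvd_antisymm ((UniqueFactorizationMonoid.pow_dvd_pow_iff_dvd hn).1 h.dvd)
    ((UniqueFactorizationMonoid.pow_dvd_pow_iff_dvd hn).1 h.symm.dvd)

namespace IsImagQuad

set_option linter.unusedSectionVars false

variable {R : Type*} [CommRing R] [IsDedekindDomain R] [CharZero R] [Module.Free ℤ R]
  [Module.Finite ℤ R] {d : ℕ} {s : R} {σ : R ≃+* R}

lemma mk0_eq_of_cube (h : IsImagQuad R d s σ) {I I' : Ideal R} (hI : I ∈ nonZeroDivisors (Ideal R))
    (hI' : I' ∈ nonZeroDivisors (Ideal R)) {α α' : R} {e e' x y x' y' n' : ℤ}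
    (hα : I ^ 3 = Ideal.span {α}) (hα' : I' ^ 3 = Ideal.span {α'}) (hxy : e * α = x + y * s)
    (hxy' : e' * α' = x' + y' * s) (he' : e' ≠ 0) (hn0 : n' ≠ 0)
    (hn' : x' ^ 2 + d * y' ^ 2 = e' ^ 2 * n' ^ 3) {c t w : ℤ} (hc : c * (e * e') = 16)
    (h1 : t ^ 3 - 3 * d * t * w ^ 2 = 4 * (c * (x * x' + d * (y * y'))))
    (h2 : 3 * t ^ 2 * w - d * w ^ 3 = 4 * (c * (y * x' - x * y'))) :
    ClassGroup.mk0 ⟨I, hI⟩ = ClassGroup.mk0 ⟨I', hI'⟩ := by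
  set J := I'.map (σ : R →+* R) with hJ
  have hbar : e' * σ α' = x' - y' * s := by
    have := congrArg σ hxy'
    simp only [map_mul, map_add, map_intCast, h.conj] at this
    rw [this]; ring
  have hJ3 : J ^ 3 = Ideal.span {σ α'} := by
    rw [hJ, ← Ideal.map_pow, hα', Ideal.map_span, Set.image_singleton]; rfl
  have hnorm : α' * σ α' = (n' : R) ^ 3 := by
    have h0 : (e' : R) ^ 2 ≠ 0 := by exact_mod_cast pow_ne_zero 2 he'
    refine mul_left_cancel₀ h0 ?_
    have h3 : (x' : R) ^ 2 + d * y' ^ 2 = e' ^ 2 * n' ^ 3 := by exact_mod_cast hn'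
    linear_combination e' * σ α' * hxy' + (x' + y' * s) * hbar - (y' : R) ^ 2 * h.sq + h3
  have hIJ : I' * J = Ideal.span {(n' : R)} := by
    refine Ideal.eq_of_pow_eq_pow three_ne_zero ?_
    rw [mul_pow, hα', hJ3, Ideal.span_singleton_mul_span_singleton, hnorm, Ideal.span_singleton_pow]
  have hn0' : Ideal.span {(n' : R)} ∈ nonZeroDivisors (Ideal R) := by
    rw [mem_nonZeroDivisors_iff_ne_zero, Ne, Ideal.zero_eq_bot, Ideal.span_singleton_eq_bot]
    exact_mod_cast hn0
  have hJ0 : J ∈ nonZeroDivisors (Ideal R) := by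
    rw [← hIJ] at hn0'
    exact (mul_mem_nonZeroDivisors.1 hn0').2
  have h4 : Ideal.span {(4 : R)} ∈ nonZeroDivisors (Ideal R) := by
    rw [mem_nonZeroDivisors_iff_ne_zero, Ne, Ideal.zero_eq_bot, Ideal.span_singleton_eq_bot]
    norm_num
  have h64 : (t + w * s) ^ 3 = 4 ^ 3 * (α * σ α') := by
    have h1' : (t : R) ^ 3 - 3 * d * t * w ^ 2 = 4 * (c * (x * x' + d * (y * y'))) := by
      exact_mod_cast h1
    have h2' : 3 * (t : R) ^ 2 * w - d * w ^ 3 = 4 * (c * (y * x' - x * y')) := by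
      exact_mod_cast h2
    have hc' : (c : R) * (e * e') = 16 := by exact_mod_cast hc
    linear_combination h1' + s * h2' + (3 * t * w ^ 2 + w ^ 3 * s : R) * h.sq
      - 4 * c * e' * σ α' * hxy - 4 * c * (x + y * s) * hbar + 4 * α * σ α' * hc'
      + 4 * c * y * y' * h.sq
  have hspan : Ideal.span {(t + w * s : R)} = Ideal.span {(4 : R)} * (I * J) := by
    refine Ideal.eq_of_pow_eq_pow three_ne_zero ?_
    rw [Ideal.span_singleton_pow, h64, mul_pow, mul_pow, hα, hJ3, Ideal.span_singleton_pow,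
      Ideal.span_singleton_mul_span_singleton, Ideal.span_singleton_mul_span_singleton]
  have m1 : ClassGroup.mk0 ⟨I, hI⟩ * ClassGroup.mk0 ⟨J, hJ0⟩ = 1 := by
    have h5 : ClassGroup.mk0 (⟨_, h4⟩ * (⟨I, hI⟩ * ⟨J, hJ0⟩)) = 1 :=
      (ClassGroup.mk0_eq_one_iff _).2 ⟨⟨_, hspan.symm⟩⟩
    rwa [map_mul, map_mul, (ClassGroup.mk0_eq_one_iff (I := Ideal.span {(4 : R)}) h4).2 ⟨⟨4, rfl⟩⟩,
      one_mul] at h5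
  have m2 : ClassGroup.mk0 ⟨I', hI'⟩ * ClassGroup.mk0 ⟨J, hJ0⟩ = 1 := by
    rw [← map_mul]
    exact (ClassGroup.mk0_eq_one_iff _).2 ⟨⟨_, hIJ⟩⟩
  exact mul_right_cancel (m1.trans m2.symm)

/-- Coordinates of generators of the cubes of ideals representing the `3`-torsion classes, for
which the cubic symbols separate enough. -/
lemma exists_torsion_coords (h : IsImagQuad R d s σ) [Finite (ClassGroup R)] {M : ℕ} (hM : M ≠ 0)
    (h6M : 6 * d ∣ M) : ∃ (e x y : {c : ClassGroup R // c ^ 3 = 1} → ℤ)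
      (n : {c : ClassGroup R // c ^ 3 = 1} → ℕ),
      (∀ c, (e c = 1 ∨ e c = 2 ∧ ¬ 2 ∣ x c ∧ ¬ 2 ∣ y c) ∧
        x c ^ 2 + d * y c ^ 2 = e c ^ 2 * (n c : ℤ) ^ 3 ∧ IsCoprime (x c) (y c) ∧ ¬ 3 ∣ x c ∧
        ¬ 27 ∣ y c ∧ IsCoprime (n c : ℤ) M ∧ n c ≠ 0) ∧
      Nat.card {c : ClassGroup R // c ^ 3 = 1} ≤ (Eisenstein.symbolVectors (d : ℤ) x y).ncard := by
  have hM' : (M : ℤ) ≠ 0 := by exact_mod_cast hM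
  have hd' : (6 * d : ℤ) ∣ (M : ℤ) := by exact_mod_cast h6M
  have hex := fun c : {c : ClassGroup R // c ^ 3 = 1} => h.exists_coords c.2 hM' hd'
  choose I hI α e x y hmk hα hxy he hN hco hx3 hy27 hn using hex
  have hn0 : ∀ c, Ideal.absNorm (I c) ≠ 0 := fun c h0 =>
    mem_nonZeroDivisors_iff_ne_zero.1 (hI c) (Ideal.absNorm_eq_zero_iff.1 h0)
  have he0 : ∀ c, e c ≠ 0 := fun c => by rcases he c with h | ⟨h, -⟩ <;> omega
  refine ⟨e, x, y, fun c => Ideal.absNorm (I c), fun c => ⟨he c, hN c, hco c, hx3 c, hy27 c, hn c,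
    hn0 c⟩, Eisenstein.card_le_card_symbolVectors h.squarefree hN (fun c => ?_)
    fun c c' hcc => ?_⟩
  · have := he0 c
    have : (Ideal.absNorm (I c) : ℤ) ≠ 0 := by exact_mod_cast hn0 c
    positivity
  · have hsc : ∃ k : ℤ, k ≠ 0 ∧ k * (e c * e c') = 16 := by
      rcases he c with h | ⟨h, -⟩ <;> rcases he c' with h' | ⟨h', -⟩ <;> rw [h, h']
      exacts [⟨16, by norm_num⟩, ⟨8, by norm_num⟩, ⟨8, by norm_num⟩, ⟨4, by norm_num⟩]
    obtain ⟨k, hk0, hk⟩ := hsc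
    refine ⟨k, 4 * (Ideal.absNorm (I c) * Ideal.absNorm (I c')), hk0, ?_, ?_, fun t w htw => hcc ?_⟩
    · have := hn0 c
      have := hn0 c'
      positivity
    · linear_combination (k * (e c * e c') + 16) * (Ideal.absNorm (I c) : ℤ) ^ 3 *
        (Ideal.absNorm (I c') : ℤ) ^ 3 * hk
    · have := h.mk0_eq_of_cube (hI c) (hI c') (hα c) (hα c') (hxy c) (hxy c') (he0 c')
        (by exact_mod_cast hn0 c') (hN c') hk htw.1 htw.2
      rw [hmk, hmk] at this
      exact Subtype.ext this

end IsImagQuad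

/-- A reduced form `c X² + 2 r X Y + e Y²` of discriminant `4 E` representing `A` by the vector
`(p₁, p₂)`, compatibly with the square root `B` of `E` modulo `A`, and at scale `2 ^ k`. -/
structure ReducedRep (E A B c r : ℤ) (k : ℕ) (e p₁ p₂ : ℤ) : Prop where
  disc : r ^ 2 - c * e = E
  val : c * p₁ ^ 2 + 2 * r * p₁ * p₂ + e * p₂ ^ 2 = A
  dvd_fst : A ∣ c * p₁ + (r + B) * p₂
  dvd_snd : A ∣ (r - B) * p₁ + e * p₂
  le_abs : 2 ^ k * √(A : ℝ) ≤ |c * p₁ + (r - √(E : ℝ)) * p₂|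
  abs_le : |c * p₁ + (r - √(E : ℝ)) * p₂| ≤ 2 ^ (k + 1) * √(A : ℝ)

theorem exists_reducedRep {E A B : ℤ} (hE : 0 < E) (hsq : ¬ IsSquare E) (hA : 0 < A)
    (hAB : A ∣ B ^ 2 - E) : ∃ c r : ℤ, ∃ k : ℕ, c ≠ 0 ∧ c ^ 2 ≤ 9 * E ∧ 0 ≤ r ∧ r < |c| ∧
      4 ^ k ≤ 9 * E ∧ ∃ e p₁ p₂, ReducedRep E A B c r k e p₁ p₂ := by
  obtain ⟨C, hC⟩ := hAB
  have hAR : (0 : ℝ) < A := by exact_mod_cast hA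
  have hER : (1 : ℝ) ≤ E := by exact_mod_cast hE
  set S : ℝ := √(E : ℝ) with hS
  have hS2 : S ^ 2 = E := Real.sq_sqrt (by linarith)
  have hS1 : 1 ≤ S := Real.one_le_sqrt.2 hER
  set T : ℝ := √(A : ℝ) with hT
  have hT2 : T ^ 2 = A := Real.sq_sqrt hAR.le
  have hT1 : 1 ≤ T := Real.one_le_sqrt.2 (by exact_mod_cast hA)
  obtain ⟨q, hq, hqn⟩ := Real.exists_rat_abs_sub_le_and_den_le ((S - B) / A) (n := ⌊T⌋₊)
    (Nat.floor_pos.2 hT1)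
  set X : ℤ := q.num with hX
  set Y : ℤ := (q.den : ℤ) with hY
  have hY0 : 0 < Y := by rw [hY]; exact_mod_cast q.den_pos
  have hYR : (0 : ℝ) < Y := by exact_mod_cast hY0
  have hYT : (Y : ℝ) ≤ T := by
    refine le_trans ?_ (Nat.floor_le (by linarith : 0 ≤ T))
    rw [hY]; exact_mod_cast hqn
  -- the two conjugates
  set φ : ℝ := A * X + B * Y - S * Y with hφ
  set θ : ℝ := A * X + B * Y + S * Y with hθ
  have hφle : |φ| * T ≤ A := by
    have hqXY : (q : ℝ) * Y = X := by
      rw [hX, hY]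
      have := q.mul_den_eq_num
      exact_mod_cast this
    have h1 : φ = -(A * Y * ((S - B) / A - q)) := by
      rw [hφ, ← hqXY]; field_simp; ring
    rw [h1, abs_neg, abs_mul, abs_of_pos (mul_pos hAR hYR)]
    have h2 : T ≤ (⌊T⌋₊ : ℝ) + 1 := (Nat.lt_floor_add_one T).le
    have hden : (q.den : ℝ) = Y := by rw [hY]; simp
    rw [hden] at hq
    calc (A : ℝ) * Y * |(S - B) / A - q| * T
        ≤ A * Y * (1 / ((⌊T⌋₊ + 1) * Y)) * (⌊T⌋₊ + 1) := by gcongr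
      _ = A := by field_simp
  have hφT : |φ| ≤ T := by
    rw [← hT2, pow_two] at hφle
    exact le_of_mul_le_mul_right hφle (by linarith)
  have hθle : |θ| ≤ 3 * S * T := by
    have h1 : θ = φ + 2 * S * Y := by rw [hθ, hφ]; ring
    calc |θ| ≤ |φ| + |2 * S * Y| := by rw [h1]; exact abs_add_le _ _
      _ ≤ T + 2 * S * T := by
        rw [abs_of_nonneg (by positivity : (0 : ℝ) ≤ 2 * S * Y)]; gcongr
      _ ≤ 3 * S * T := by nlinarith
  have hcop : IsCoprime X Y := by
    rw [hX, hY, Int.isCoprime_iff_gcd_eq_one]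
    simpa [Int.gcd] using q.reduced
  obtain ⟨a, b, hab⟩ := hcop
  set c : ℤ := A * X ^ 2 + 2 * B * X * Y + C * Y ^ 2 with hc
  have hcA : A * c = (A * X + B * Y) ^ 2 - E * Y ^ 2 := by
    rw [hc]; linear_combination (-Y ^ 2) * hC
  have hθφ : θ * φ = A * c := by
    have : (A : ℝ) * c = (A * X + B * Y) ^ 2 - E * Y ^ 2 := by exact_mod_cast hcA
    rw [this, hθ, hφ]
    linear_combination (-(Y : ℝ) ^ 2) * hS2
  have hc0 : c ≠ 0 := by
    intro h0
    rw [h0, mul_zero] at hcA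
    have h1 : Y ^ 2 ∣ (A * X + B * Y) ^ 2 := ⟨E, by linear_combination -hcA⟩
    obtain ⟨w, hw⟩ := (Int.pow_dvd_pow_iff two_ne_zero).1 h1
    apply hsq
    refine ⟨w, ?_⟩
    rw [hw] at hcA
    have h2 : Y ^ 2 * E = Y ^ 2 * (w * w) := by linear_combination hcA
    exact mul_left_cancel₀ (pow_ne_zero 2 hY0.ne') h2
  have hcR : (1 : ℝ) ≤ |(c : ℝ)| := by exact_mod_cast Int.one_le_abs hc0
  have habs : |θ| * |φ| = A * |(c : ℝ)| := by
    rw [← abs_mul, hθφ, abs_mul, abs_of_pos hAR]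
  have hcS : |(c : ℝ)| ≤ 3 * S := by
    have h1 : (A : ℝ) * |(c : ℝ)| ≤ A * (3 * S) := by
      rw [← habs, ← hT2]
      calc |θ| * |φ| ≤ (3 * S * T) * T := by gcongr
        _ = _ := by ring
    exact le_of_mul_le_mul_left h1 hAR
  have hθT : T ≤ |θ| := by
    have h1 : T * T ≤ |θ| * T := by
      calc T * T = A := by rw [← hT2]; ring
        _ ≤ A * |(c : ℝ)| := le_mul_of_one_le_right hAR.le hcR
        _ = |θ| * |φ| := habs.symm
        _ ≤ |θ| * T := by gcongr
    exact le_of_mul_le_mul_right h1 (by linarith)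
  obtain ⟨k, hk1, hk2⟩ := exists_nat_pow_near (x := |θ| / T) (y := 2)
    ((one_le_div (by linarith)).2 hθT) (by norm_num)
  rw [le_div_iff₀ (by linarith)] at hk1
  rw [div_lt_iff₀ (by linarith)] at hk2
  set r₀ : ℤ := A * X * (-b) + B * (X * a + -b * Y) + C * Y * a with hr₀
  set t : ℤ := -(r₀ / c) with ht
  have hr : r₀ + t * c = r₀ % c := by
    rw [ht]; linear_combination -(Int.mul_ediv_add_emod r₀ c)
  set X₂ : ℤ := -b + t * X with hX₂
  set Y₂ : ℤ := a + t * Y with hY₂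
  have hdet : X * Y₂ - X₂ * Y = 1 := by rw [hX₂, hY₂]; linear_combination hab
  set r : ℤ := A * X * X₂ + B * (X * Y₂ + X₂ * Y) + C * Y * Y₂ with hrdef
  have hr' : r = r₀ % c := by rw [← hr, hrdef, hr₀, hX₂, hY₂, hc]; ring
  refine ⟨c, r, k, hc0, ?_, ?_, ?_, ?_, A * X₂ ^ 2 + 2 * B * X₂ * Y₂ + C * Y₂ ^ 2, Y₂, -Y, ?_, ?_,
    ?_, ?_, ?_, ?_⟩
  · have : ((c : ℝ)) ^ 2 ≤ 9 * E := by
      rw [← sq_abs, ← hS2]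
      calc |(c : ℝ)| ^ 2 ≤ (3 * S) ^ 2 := by gcongr
        _ = _ := by ring
    exact_mod_cast this
  · rw [hr']; exact Int.emod_nonneg _ hc0
  · rw [hr']; exact Int.emod_lt_abs _ hc0
  · have h1 : (2 : ℝ) ^ k ≤ 3 * S := le_of_mul_le_mul_right (hk1.trans hθle) (by linarith)
    have h2 : (4 : ℝ) ^ k ≤ 9 * E := by
      rw [← hS2, show (4 : ℝ) = 2 ^ 2 by norm_num, pow_right_comm]
      calc ((2 : ℝ) ^ k) ^ 2 ≤ (3 * S) ^ 2 := by gcongr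
        _ = _ := by ring
    exact_mod_cast h2
  · rw [hrdef, hc]
    linear_combination (X * Y₂ - X₂ * Y + 1) * (B ^ 2 - A * C) * hdet + hC
  · rw [hrdef, hc]
    linear_combination A * (X * Y₂ - X₂ * Y + 1) * hdet
  · exact ⟨X, by rw [hrdef, hc]; linear_combination (A * X + B * Y) * hdet⟩
  · exact ⟨X₂, by rw [hrdef]; linear_combination (A * X₂ + B * Y₂) * hdet⟩
  all_goals
    have h1 : (c : ℝ) * Y₂ + (r - S) * ((-Y : ℤ) : ℝ) = θ := by
      have h2 : c * Y₂ - r * Y = A * X + B * Y := by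
        rw [hrdef, hc]; linear_combination (A * X + B * Y) * hdet
      have h3 : (c : ℝ) * Y₂ - r * Y = A * X + B * Y := by exact_mod_cast h2
      rw [hθ]; push_cast; linear_combination h3
    rw [h1]
  · exact hk1
  · exact hk2.le

/-- The relation between two values `A`, `A'` of the same reduced form at the same scale. -/
structure Collision (E A B A' B' u v : ℤ) : Prop where
  eq : u ^ 2 - E * v ^ 2 = A * A'
  dvd_sub : A ∣ u - B * v
  dvd_add : A' ∣ u + B' * v
  le : E * v ^ 2 ≤ 4 * (A * A')

theorem ReducedRep.exists_collision {E A B A' B' c r e p₁ p₂ e' p₁' p₂' : ℤ} {k : ℕ}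
    (h : ReducedRep E A B c r k e p₁ p₂) (h' : ReducedRep E A' B' c r k e' p₁' p₂')
    (hc : c ≠ 0) (hE : 0 < E) (hA : 0 < A) (hA' : 0 < A') :
    ∃ u v, Collision E A B A' B' u v := by
  obtain rfl : e = e' := mul_left_cancel₀ hc (by linear_combination h'.disc - h.disc)
  refine ⟨c * p₁ * p₁' + r * (p₁ * p₂' + p₂ * p₁') + e * p₂ * p₂', p₁ * p₂' - p₂ * p₁', ?_, ?_, ?_, ?_⟩
  · rw [← h.val, ← h'.val, ← h.disc]; ring
  · obtain ⟨x, hx⟩ := h.dvd_fst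
    obtain ⟨y, hy⟩ := h.dvd_snd
    exact ⟨p₁' * x + p₂' * y, by linear_combination p₁' * hx + p₂' * hy⟩
  · obtain ⟨x, hx⟩ := h'.dvd_fst
    obtain ⟨y, hy⟩ := h'.dvd_snd
    exact ⟨p₁ * x + p₂ * y, by linear_combination p₁ * hx + p₂ * hy⟩
  · have hER : (0 : ℝ) < E := by exact_mod_cast hE
    have hAR : (0 : ℝ) < A := by exact_mod_cast hA
    have hAR' : (0 : ℝ) < A' := by exact_mod_cast hA'
    have l1 := h.le_abs
    have l2 := h.abs_le
    have l1' := h'.le_abs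
    have l2' := h'.abs_le
    set S : ℝ := √(E : ℝ) with hS
    have hS2 : S ^ 2 = E := Real.sq_sqrt hER.le
    have hS0 : 0 < S := Real.sqrt_pos.2 hER
    set T : ℝ := √(A : ℝ) with hT
    have hT2 : T ^ 2 = A := Real.sq_sqrt hAR.le
    have hT0 : 0 < T := Real.sqrt_pos.2 hAR
    set T' : ℝ := √(A' : ℝ) with hT'
    have hT2' : T' ^ 2 = A' := Real.sq_sqrt hAR'.le
    have hT0' : 0 < T' := Real.sqrt_pos.2 hAR'
    have hd : (r : ℝ) ^ 2 - c * e = E := by exact_mod_cast h.disc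
    have hv : (c : ℝ) * p₁ ^ 2 + 2 * r * p₁ * p₂ + e * p₂ ^ 2 = A := by exact_mod_cast h.val
    have hv' : (c : ℝ) * p₁' ^ 2 + 2 * r * p₁' * p₂' + e * p₂' ^ 2 = A' := by exact_mod_cast h'.val
    set θ : ℝ := c * p₁ + (r - S) * p₂ with hθ
    set θ' : ℝ := c * p₁' + (r - S) * p₂' with hθ'
    set φ : ℝ := c * p₁ + (r + S) * p₂ with hφ
    set φ' : ℝ := c * p₁' + (r + S) * p₂' with hφ'
    have hn : |θ| * |φ| = |(c : ℝ)| * T ^ 2 := by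
      rw [← abs_mul, hT2, ← abs_of_pos hAR, ← abs_mul]
      congr 1
      rw [hθ, hφ]
      linear_combination (c : ℝ) * hv - (p₂ : ℝ) ^ 2 * hS2 + (p₂ : ℝ) ^ 2 * hd
    have hn' : |θ'| * |φ'| = |(c : ℝ)| * T' ^ 2 := by
      rw [← abs_mul, hT2', ← abs_of_pos hAR', ← abs_mul]
      congr 1
      rw [hθ', hφ']
      linear_combination (c : ℝ) * hv' - (p₂' : ℝ) ^ 2 * hS2 + (p₂' : ℝ) ^ 2 * hd
    have h2k : (0 : ℝ) < 2 ^ k := by positivity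
    have key : ∀ a b f t t' : ℝ, 0 < t → 0 < t' → 2 ^ k * t' ≤ b → 0 ≤ a → a ≤ 2 ^ (k + 1) * t →
        b * f = |(c : ℝ)| * t' ^ 2 → 0 ≤ f → a * f ≤ 2 * |(c : ℝ)| * (t * t') := by
      intro a b f t t' ht ht' hb ha0 ha hbf hf
      have h1 : 2 ^ k * f ≤ |(c : ℝ)| * t' := by
        refine le_of_mul_le_mul_right ?_ ht'
        calc 2 ^ k * f * t' = (2 ^ k * t') * f := by ring
          _ ≤ b * f := by gcongr
          _ = _ := by rw [hbf]; ring
      calc a * f ≤ 2 ^ (k + 1) * t * f := by gcongr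
        _ = 2 * t * (2 ^ k * f) := by ring
        _ ≤ 2 * t * (|(c : ℝ)| * t') := by gcongr
        _ = _ := by ring
    have k1 := key |θ| |θ'| |φ'| T T' hT0 hT0' l1' (abs_nonneg _) l2 hn' (abs_nonneg _)
    have k2 := key |θ'| |θ| |φ| T' T hT0' hT0 l1 (abs_nonneg _) l2' hn (abs_nonneg _)
    set v : ℤ := p₁ * p₂' - p₂ * p₁' with hvdef
    have hdiff : θ * φ' - θ' * φ = c * (2 * S * v) := by
      rw [hθ, hθ', hφ, hφ', hvdef]; push_cast; ring
    have hcR : 0 < |(c : ℝ)| := abs_pos.2 (by exact_mod_cast hc)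
    have h3 : |(c : ℝ)| * (2 * S * |(v : ℝ)|) ≤ |(c : ℝ)| * (4 * (T * T')) := by
      calc |(c : ℝ)| * (2 * S * |(v : ℝ)|) = |θ * φ' - θ' * φ| := by
            rw [hdiff, abs_mul, abs_mul, abs_of_pos (by positivity : 0 < 2 * S)]
        _ ≤ |θ * φ'| + |θ' * φ| := abs_sub _ _
        _ = |θ| * |φ'| + |θ'| * |φ| := by rw [abs_mul, abs_mul]
        _ ≤ 2 * |(c : ℝ)| * (T * T') + 2 * |(c : ℝ)| * (T' * T) := add_le_add k1 k2
        _ = _ := by ring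
    have h4 : S * |(v : ℝ)| ≤ 2 * (T * T') := by
      have := le_of_mul_le_mul_left h3 hcR
      linarith
    have h5 : (E : ℝ) * v ^ 2 ≤ 4 * (A * A') := by
      rw [← hS2, ← hT2, ← hT2', ← sq_abs (v : ℝ), ← mul_pow]
      calc (S * |(v : ℝ)|) ^ 2 ≤ (2 * (T * T')) ^ 2 := by gcongr
        _ = _ := by ring
    exact_mod_cast h5

namespace Collision

variable {E A B A' B' u v : ℤ}

lemma isCoprime (h : Collision E A B A' B' u v) (hA : A ≠ 0) (hA' : A' ≠ 0)
    (hB : B ^ 2 ≡ E [ZMOD A]) (hB' : B' ^ 2 ≡ E [ZMOD A']) (hAA : IsCoprime A A') :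
    IsCoprime u v := by
  refine Int.isCoprime_of_forall_prime fun p hp hu hv => ?_
  have hp' := Nat.prime_iff_prime_int.1 hp
  obtain ⟨C, hC⟩ := Int.modEq_iff_dvd.1 hB
  obtain ⟨C', hC'⟩ := Int.modEq_iff_dvd.1 hB'
  obtain ⟨x, hx⟩ := h.dvd_sub
  obtain ⟨y, hy⟩ := h.dvd_add
  have h1 : A' = x * (u + B * v) - C * v ^ 2 := by
    refine mul_left_cancel₀ hA ?_
    linear_combination -h.eq + (u + B * v) * hx - v ^ 2 * hC
  have h2 : A = y * (u - B' * v) - C' * v ^ 2 := by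
    refine mul_left_cancel₀ hA' ?_
    linear_combination -h.eq + (u - B' * v) * hy - v ^ 2 * hC'
  refine hp'.not_isUnit (hAA.isUnit_of_dvd' ?_ ?_)
  · rw [h2]
    exact _root_.dvd_sub ((_root_.dvd_sub hu (hv.mul_left _)).mul_left _) ((dvd_pow hv two_ne_zero).mul_left _)
  · rw [h1]
    exact _root_.dvd_sub ((_root_.dvd_add hu (hv.mul_left _)).mul_left _) ((dvd_pow hv two_ne_zero).mul_left _)

/-- A common factor of the two values can be removed when the square roots agree modulo it. -/
lemma exists_of_mul {g : ℤ} (h : Collision E (g * A) B (g * A') B' u v) (hg0 : g ≠ 0)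
    (hg : IsCoprime g (2 * E)) (hB : B ^ 2 ≡ E [ZMOD g]) (hBB : B ≡ B' [ZMOD g]) :
    ∃ u v, Collision E A B A' B' u v := by
  obtain ⟨x, hx⟩ := h.dvd_sub
  obtain ⟨y, hy⟩ := h.dvd_add
  obtain ⟨z, hz⟩ := Int.modEq_iff_dvd.1 hBB
  obtain ⟨w, hw⟩ := Int.modEq_iff_dvd.1 hB
  have hgB : IsCoprime g (2 * B) := by
    have h1 : IsCoprime g (B ^ 2) := by
      have := hg.of_mul_right_right.add_mul_left_right (-w)
      rwa [show E + g * -w = B ^ 2 by linear_combination hw] at this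
    exact hg.of_mul_right_left.mul_right ((IsCoprime.pow_right_iff two_pos).1 h1)
  obtain ⟨v₁, rfl⟩ : g ∣ v := hgB.dvd_of_dvd_mul_left ⟨A' * y - A * x - z * v, by
    linear_combination hy - hx - v * hz⟩
  obtain ⟨u₁, rfl⟩ : g ∣ u := ⟨A * x + B * v₁, by linear_combination hx⟩
  refine ⟨u₁, v₁, ?_, ⟨x, ?_⟩, ⟨y, ?_⟩, ?_⟩
  · refine mul_left_cancel₀ (pow_ne_zero 2 hg0) ?_
    linear_combination h.eq
  · refine mul_left_cancel₀ hg0 ?_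
    linear_combination hx
  · refine mul_left_cancel₀ hg0 ?_
    linear_combination hy
  · have hpos : 0 < g ^ 2 := by positivity
    refine le_of_mul_le_mul_left ?_ hpos
    linarith [h.le]

end Collision

/-- Hensel lifting of square roots from `p` to `p ^ 3`. -/
lemma Int.exists_sq_modEq_pow_three {p E b : ℤ} (hp : IsCoprime p (2 * b))
    (hb : b ^ 2 ≡ E [ZMOD p]) : ∃ β : ℤ, β ^ 2 ≡ E [ZMOD p ^ 3] := by
  obtain ⟨x, y, hxy⟩ := hp
  obtain ⟨w, hw⟩ := Int.modEq_iff_dvd.1 hb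
  -- `y` inverts `2 b` modulo `p`
  set t := w * y with ht
  set b₂ := b + p * t with hb₂
  obtain ⟨w₂, hw₂⟩ : p ^ 2 ∣ E - b₂ ^ 2 := ⟨w * x - t ^ 2, by
    rw [hb₂]; linear_combination hw - p * w * hxy + 2 * p * b * ht⟩
  refine ⟨b₂ + p ^ 2 * (w₂ * y), (Int.modEq_iff_dvd.2 ⟨w₂ * x - 2 * t * w₂ * y - p * (w₂ * y) ^ 2, ?_⟩)⟩
  rw [hb₂] at hw₂ ⊢
  linear_combination hw₂ - p ^ 2 * w₂ * hxy

namespace Eisenstein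

/-- Integers `x`, `y`, `e`, `n` describing a form class of order dividing three: `x² + d y² = e² n³`,
with local conditions. -/
structure CubeRep (d e x y : ℤ) (n : ℕ) : Prop where
  unit : e = 1 ∨ e = 2 ∧ ¬ 2 ∣ x ∧ ¬ 2 ∣ y
  eq : x ^ 2 + d * y ^ 2 = e ^ 2 * (n : ℤ) ^ 3
  coprime : IsCoprime x y
  three : ¬ 3 ∣ x
  cube : ¬ 27 ∣ y
  coprime_six : IsCoprime (n : ℤ) (6 * d)

variable {d e x y : ℤ} {n : ℕ}

lemma rootSymbol_eq_of_collision (h : CubeRep d e x y n) {A A' : ℕ} {B B' u v : ℤ} (hA0 : A ≠ 0)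
    (hA0' : A' ≠ 0) (hc : Collision (8748 * d) A B A' B' u v) (hA : IsCoprime (A : ℤ) (6 * d * n))
    (hA' : IsCoprime (A' : ℤ) (6 * d * n)) (hAA : IsCoprime (A : ℤ) A')
    (hB : B ^ 2 ≡ 8748 * d [ZMOD A]) (hB' : B' ^ 2 ≡ 8748 * d [ZMOD A']) :
    rootSymbol A (y * B) (54 * x) = rootSymbol A' (y * B') (54 * x) := by
  refine rootSymbol_eq_of_represents (κ := e ^ 2) hA0 hA0' ?_ h.eq h.coprime h.three h.cube
    h.coprime_six hA hA' hc.eq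
    (hc.isCoprime (by exact_mod_cast hA0) (by exact_mod_cast hA0') hB hB' hAA) hB hB'
    (Int.modEq_iff_dvd.2 ?_) (Int.modEq_iff_dvd.2 ?_)
  · exact h.unit.imp (fun h => by rw [h]; rfl) (fun h => ⟨by rw [h.1]; rfl, h.2⟩)
  · obtain ⟨k, hk⟩ := hc.dvd_sub
    exact ⟨-k, by linear_combination -hk⟩
  · obtain ⟨k, hk⟩ := hc.dvd_add
    exact ⟨-k, by linear_combination -hk⟩

lemma rootSymbol_mul_cube_left (h : CubeRep d e x y n) {a q : ℕ} {b B : ℤ} (ha0 : a ≠ 0)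
    (hq0 : q ≠ 0) (ha : IsCoprime (a : ℤ) (6 * d * n)) (hb : b ^ 2 ≡ 8748 * d [ZMOD a])
    (hB : B ≡ b [ZMOD a]) :
    rootSymbol (a * q ^ 3) (y * B) (54 * x) = rootSymbol a (y * b) (54 * x) := by
  have h6 : IsCoprime (a : ℤ) 6 := ha.of_mul_right_left.of_mul_right_left
  have he : IsCoprime (a : ℤ) (e ^ 2) := by
    refine (h6.of_isCoprime_of_dvd_right ?_).pow_right
    rcases h.unit with h | ⟨h, -⟩ <;> rw [h] <;> norm_num
  have hm : IsCoprime (a : ℤ) (6 * (e ^ 2 * (n : ℤ) ^ 3)) :=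
    h6.mul_right (he.mul_right ha.of_mul_right_right.pow_right)
  rw [rootSymbol_mul_left ha0 (pow_ne_zero _ hq0), rootSymbol_pow_left hq0,
    show ((3 : ℕ) : ZMod 3) = 0 from rfl, zero_mul, add_zero]
  exact rootSymbol_congr (isCoprime_rootSymbol h.eq hm ((hB.pow 2).trans hb)) (hB.mul_left y) rfl

end Eisenstein

lemma Int.exists_modEq_and_modEq {a b : ℤ} (h : IsCoprime a b) (r s : ℤ) :
    ∃ z, z ≡ r [ZMOD a] ∧ z ≡ s [ZMOD b] := by
  obtain ⟨u, v, huv⟩ := h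
  exact ⟨s * (u * a) + r * (v * b), Int.modEq_iff_dvd.2 ⟨(r - s) * u, by linear_combination -r * huv⟩,
    Int.modEq_iff_dvd.2 ⟨(s - r) * v, by linear_combination -s * huv⟩⟩

open Classical in
/-- The possible first two coefficients and scales of reduced forms of discriminant `4 E`. -/
noncomputable def reducedLabels (E : ℤ) : Finset (ℤ × ℤ × ℕ) :=
  (Finset.Icc (-(9 * E)) (9 * E) ×ˢ Finset.Icc 0 (9 * E) ×ˢ Finset.range ((9 * E).toNat + 1)).filter
    (fun z => z.1 ≠ 0 ∧ z.1 ^ 2 ≤ 9 * E ∧ z.2.1 < |z.1| ∧ 4 ^ z.2.2 ≤ 9 * E ∧ z.1 ∣ z.2.1 ^ 2 - E)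

lemma exists_reducedRep_mem_reducedLabels {E A B : ℤ} (hE : 0 < E) (hsq : ¬ IsSquare E) (hA : 0 < A)
    (hAB : B ^ 2 ≡ E [ZMOD A]) :
    ∃ z ∈ reducedLabels E, ∃ e p₁ p₂, ReducedRep E A B z.1 z.2.1 z.2.2 e p₁ p₂ := by
  obtain ⟨c, r, k, hc, hcE, hr, hrc, hk, e, p₁, p₂, h⟩ := exists_reducedRep hE hsq hA hAB.symm.dvd
  refine ⟨(c, r, k), ?_, e, p₁, p₂, h⟩
  have h1 : |c| ≤ 9 * E := by
    rw [← sq_abs] at hcE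
    have := abs_pos.2 hc
    nlinarith
  have h2 : (k : ℤ) ≤ 9 * E := by
    have : (k : ℤ) < 4 ^ k := by exact_mod_cast k.lt_pow_self (by norm_num : 1 < 4)
    omega
  simp only [reducedLabels, Finset.mem_filter, Finset.mem_product, Finset.mem_Icc, Finset.mem_range]
  refine ⟨⟨abs_le.1 h1, ⟨hr, by omega⟩, by omega⟩, hc, hcE, hrc, hk, e, ?_⟩
  linear_combination h.disc

namespace Eisenstein

lemma exists_sq_modEq_cube {d q : ℕ} (hq : q.Prime) (hqd : ¬ q ∣ 6 * d)
    (hb : ∃ b : ℤ, (q : ℤ) ∣ b ^ 2 - 3 * d) : ∃ β : ℤ, β ^ 2 ≡ 8748 * d [ZMOD (q : ℤ) ^ 3] := by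
  obtain ⟨b, k, hk⟩ := hb
  have hp := Nat.prime_iff_prime_int.1 hq
  have h6d : ¬ (q : ℤ) ∣ 6 * d := by exact_mod_cast hqd
  refine Int.exists_sq_modEq_pow_three (b := 54 * b) ?_
    (Int.modEq_iff_dvd.2 ⟨-2916 * k, by linear_combination (-2916) * hk⟩)
  rw [hp.coprime_iff_not_dvd]
  intro h
  have h6 : (q : ℤ) ∣ 6 ∨ (q : ℤ) ∣ b := by
    rw [show 2 * (54 * b) = 6 * (6 * 3 * b) by ring] at h
    rcases hp.dvd_or_dvd h with h | h
    · exact Or.inl h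
    rcases hp.dvd_or_dvd h with h | h
    · rcases hp.dvd_or_dvd h with h | h
      · exact Or.inl h
      · exact Or.inl (h.trans ⟨2, rfl⟩)
    · exact Or.inr h
  rcases h6 with h | ⟨w, rfl⟩
  · exact h6d (h.mul_right _)
  · exact h6d ⟨2 * (q * w ^ 2 - k), by linear_combination (-2) * hk⟩

lemma cubeSol_of_collision {d q q' : ℕ} {B B' u v : ℤ} (hd : 0 < d) (hq : q.Prime) (hq' : q'.Prime)
    (hqq : q ≠ q') (hB : B ^ 2 ≡ 8748 * d [ZMOD (q : ℤ) ^ 3])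
    (hB' : B' ^ 2 ≡ 8748 * d [ZMOD (q' : ℤ) ^ 3])
    (h : Collision (8748 * d) ((q : ℤ) ^ 3) B ((q' : ℤ) ^ 3) B' u v) :
    CubeSol 1 (-8748) d (q * q') := by
  have hc : IsCoprime ((q : ℤ) ^ 3) ((q' : ℤ) ^ 3) :=
    (Nat.isCoprime_iff_coprime.2 ((Nat.coprime_primes hq hq').2 hqq)).pow
  have huv := h.isCoprime (pow_ne_zero _ (by exact_mod_cast hq.ne_zero))
    (pow_ne_zero _ (by exact_mod_cast hq'.ne_zero)) hB hB' hc
  refine ⟨u, v, ?_, huv, by push_cast; linear_combination -h.eq, ?_⟩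
  · rintro rfl
    have h1 := h.eq
    have hu : IsUnit u := isCoprime_zero_right.1 huv
    rw [Int.isUnit_iff] at hu
    have hu2 : u ^ 2 = 1 := by rcases hu with rfl | rfl <;> rfl
    rw [hu2] at h1
    have : (q : ℤ) ∣ 1 := ⟨q ^ 2 * q' ^ 3, by linear_combination h1⟩
    exact (Nat.prime_iff_prime_int.1 hq).not_isUnit (isUnit_of_dvd_one this)
  · have h1 := h.le
    have h2 : 0 ≤ v ^ 2 * d := by positivity
    push_cast
    nlinarith

open Classical in
theorem card_mul_sq_le_card_reducedLabels_mul {ι : Type*} [Finite ι] {d : ℕ} (hd : 0 < d)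
    (hsq : ¬ IsSquare (8748 * d : ℤ)) {e x y : ι → ℤ} {n : ι → ℕ} (hn0 : ∀ i, n i ≠ 0)
    (hrep : ∀ i, CubeRep d (e i) (x i) (y i) (n i)) (Q : Finset ℕ)
    (hQ : ∀ q ∈ Q, q.Prime ∧ ¬ q ∣ 6 * d ∧ ∃ b : ℤ, (q : ℤ) ∣ b ^ 2 - 3 * d)
    (hnQ : ∀ i, ∀ q ∈ Q, IsCoprime (q : ℤ) (n i)) (W : Finset (ι → ZMod 3))
    (hW : ∀ f ∈ W, f ∈ symbolVectors (d : ℤ) x y) :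
    W.card * Q.card ^ 2 ≤ (reducedLabels (8748 * d)).card * (Q.card +
      (Q.offDiag.filter (fun z => CubeSol 1 (-8748) d (z.1 * z.2))).card) := by
  rcases W.eq_empty_or_nonempty with rfl | hW0
  · simp
  have := Fintype.ofFinite ι
  have hE : (0 : ℤ) < 8748 * d := by positivity
  set M := 6 * d * (∏ q ∈ Q, q) * ∏ i, n i with hM
  have hM0 : M ≠ 0 := mul_ne_zero (mul_ne_zero (by omega)
    (Finset.prod_ne_zero_iff.2 fun q hq => (hQ q hq).1.ne_zero)) (Finset.prod_ne_zero_iff.2 fun i _ => hn0 i)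
  obtain ⟨a, b, hab, hcop⟩ := exists_pairwise_coprime_moduli W hW M
  have hac : ∀ f ∈ W, ∀ z : ℕ, z ∣ M → IsCoprime (a f : ℤ) z := fun f hf z hz =>
    isCoprime_of_forall_prime_lt
      (fun p hp hpa => (Nat.le_of_dvd (Nat.pos_of_ne_zero hM0) hz).trans_lt ((hab f hf).2.1 p hp hpa))
      (by exact_mod_cast ne_zero_of_dvd_ne_zero hM0 hz)
  have han : ∀ f ∈ W, ∀ i, IsCoprime (a f : ℤ) (6 * d * n i) := by
    intro f hf i
    have h1 : 6 * d * n i ∣ M := mul_dvd_mul (Dvd.intro _ rfl) (Finset.dvd_prod_of_mem n (Finset.mem_univ i))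
    exact_mod_cast hac f hf _ h1
  have haq : ∀ f ∈ W, ∀ q ∈ Q, IsCoprime (a f : ℤ) ((q : ℤ) ^ 3) := fun f hf q hq =>
    (hac f hf q (((Finset.dvd_prod_of_mem _ hq).mul_left _).mul_right _)).pow_right
  have hq6 : ∀ q ∈ Q, IsCoprime (q : ℤ) (6 * d) := by
    intro q hq
    rw [(Nat.prime_iff_prime_int.1 (hQ q hq).1).coprime_iff_not_dvd]
    exact_mod_cast (hQ q hq).2.1
  have hqn : ∀ q ∈ Q, ∀ i, IsCoprime ((q : ℤ) ^ 3) (6 * d * n i) := fun q hq i =>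
    ((hq6 q hq).mul_right (hnQ i q hq)).pow_left
  have hE6 : ∀ {z : ℤ}, IsCoprime z (6 * d) → IsCoprime z (2 * (8748 * d)) := by
    intro z hz
    have h6 := hz.of_mul_right_left
    have h7 : IsCoprime z (6 ^ 7 * d) := h6.pow_right.mul_right hz.of_mul_right_right
    exact h7.of_isCoprime_of_dvd_right ⟨16, by ring⟩
  choose! β hβ using fun q (hq : q ∈ Q) => exists_sq_modEq_cube (hQ q hq).1 (hQ q hq).2.1 (hQ q hq).2.2
  have hlabel : ∀ z : (ι → ZMod 3) × ℕ, z ∈ W ×ˢ Q → ∃ B : ℤ, ∃ l ∈ reducedLabels (8748 * d),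
      (B ≡ b z.1 [ZMOD a z.1] ∧ B ≡ β z.2 [ZMOD (z.2 : ℤ) ^ 3]) ∧ ∃ e p₁ p₂,
        ReducedRep (8748 * d) (a z.1 * (z.2 : ℤ) ^ 3) B l.1 l.2.1 l.2.2 e p₁ p₂ := by
    rintro ⟨f, q⟩ hz
    obtain ⟨hf, hq⟩ := Finset.mem_product.1 hz
    obtain ⟨B, h1, h2⟩ := Int.exists_modEq_and_modEq (haq f hf q hq) (b f) (β q)
    have hB : B ^ 2 ≡ 8748 * d [ZMOD a f * (q : ℤ) ^ 3] :=
      (Int.modEq_and_modEq_iff_modEq_mul (Int.isCoprime_iff_gcd_eq_one.1 (haq f hf q hq))).1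
        ⟨(h1.pow 2).trans (hab f hf).2.2.1, (h2.pow 2).trans (hβ q hq)⟩
    obtain ⟨l, hl, h⟩ := exists_reducedRep_mem_reducedLabels hE hsq (mul_pos
      (by exact_mod_cast Nat.pos_of_ne_zero (hab f hf).1)
      (pow_pos (by exact_mod_cast (hQ q hq).1.pos) 3)) hB
    exact ⟨B, l, hl, ⟨h1, h2⟩, h⟩
  choose! B l hl hB hred using hlabel
  have hBa : ∀ z ∈ W ×ˢ Q, B z ^ 2 ≡ 8748 * d [ZMOD a z.1] := fun z hz =>
    ((hB z hz).1.pow 2).trans (hab _ (Finset.mem_product.1 hz).1).2.2.1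
  have hBq : ∀ z ∈ W ×ˢ Q, B z ^ 2 ≡ 8748 * d [ZMOD (z.2 : ℤ) ^ 3] := fun z hz =>
    ((hB z hz).2.pow 2).trans (hβ _ (Finset.mem_product.1 hz).2)
  have ha0 : ∀ f ∈ W, (a f : ℤ) ≠ 0 := fun f hf => by exact_mod_cast (hab f hf).1
  have hq0 : ∀ q ∈ Q, q ≠ 0 := fun q hq => (hQ q hq).1.ne_zero
  have hq0' : ∀ q ∈ Q, (q : ℤ) ^ 3 ≠ 0 := fun q hq => pow_ne_zero _ (by exact_mod_cast hq0 q hq)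
  -- the form of `f` recovers `f`
  have hval : ∀ z ∈ W ×ˢ Q, ∀ q, q ≠ 0 → ∀ i,
      rootSymbol (a z.1 * q ^ 3) (y i * B z) (54 * x i) = z.1 i := fun z hz q hq i => by
    have hf := (Finset.mem_product.1 hz).1
    rw [rootSymbol_mul_cube_left (hrep i) (hab _ hf).1 hq (han _ hf i) (hab _ hf).2.2.1 (hB z hz).1,
      (hab _ hf).2.2.2]
  have hpair : ∀ z ∈ W ×ˢ Q, ∀ z' ∈ W ×ˢ Q, l z = l z' →
      z.1 = z'.1 ∧ (z.2 ≠ z'.2 → CubeSol 1 (-8748) d (z.2 * z'.2)) := by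
    intro z hz z' hz' hll
    obtain ⟨hf, hq⟩ := Finset.mem_product.1 hz
    obtain ⟨hf', hq'⟩ := Finset.mem_product.1 hz'
    have hpos : ∀ w ∈ W ×ˢ Q, (0 : ℤ) < a w.1 * (w.2 : ℤ) ^ 3 := fun w hw => by
      have hw' := Finset.mem_product.1 hw
      exact mul_pos (lt_of_le_of_ne (by positivity) (ha0 _ hw'.1).symm)
        (lt_of_le_of_ne (by positivity) (hq0' _ hw'.2).symm)
    obtain ⟨_, _, _, h1⟩ := hred z hz
    obtain ⟨_, _, _, h2⟩ := hred z' hz'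
    rw [← hll] at h2
    have hl0 : (l z).1 ≠ 0 := by
      have := hl z hz
      simp only [reducedLabels, Finset.mem_filter] at this
      exact this.2.1
    obtain ⟨u, v, hc⟩ := h1.exists_collision h2 hl0 hE (hpos z hz) (hpos z' hz')
    by_cases hff : z.1 = z'.1
    · refine ⟨hff, fun hqq => ?_⟩
      rw [← hff] at hc
      obtain ⟨u, v, hc⟩ := hc.exists_of_mul (ha0 _ hf) (hE6 (by
        exact_mod_cast hac _ hf (6 * d) ((Dvd.intro _ rfl : 6 * d ∣ _).mul_right _))) (hBa z hz) ((hB z hz).1.trans (hff ▸ (hB z' hz').1.symm))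
      exact cubeSol_of_collision hd (hQ _ hq).1 (hQ _ hq').1 hqq (hBq z hz) (hBq z' hz') hc
    · have haa : IsCoprime (a z.1 : ℤ) (a z'.1) :=
        Nat.isCoprime_iff_coprime.2 (hcop _ hf _ hf' hff)
      refine absurd (funext fun i => ?_) hff
      by_cases hqq : z.2 = z'.2
      · rw [← hqq, mul_comm (a z.1 : ℤ), mul_comm (a z'.1 : ℤ)] at hc
        obtain ⟨u, v, hc⟩ := hc.exists_of_mul (hq0' _ hq) (hE6 (hq6 _ hq).pow_left) (hBq z hz)
          ((hB z hz).2.trans (hqq ▸ (hB z' hz').2.symm))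
        have := rootSymbol_eq_of_collision (hrep i) (hab _ hf).1 (hab _ hf').1 hc (han _ hf i)
          (han _ hf' i) haa (hBa z hz) (hBa z' hz')
        have e1 := hval z hz 1 one_ne_zero i
        have e2 := hval z' hz' 1 one_ne_zero i
        rw [one_pow, mul_one] at e1 e2
        rw [← e1, ← e2, this]
      · rw [← hval z hz z.2 (hq0 _ hq) i, ← hval z' hz' z'.2 (hq0 _ hq') i]
        have hqq' : IsCoprime ((z.2 : ℤ) ^ 3) ((z'.2 : ℤ) ^ 3) :=
          (Nat.isCoprime_iff_coprime.2 ((Nat.coprime_primes (hQ _ hq).1 (hQ _ hq').1).2 hqq)).pow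
        have hB2 : ∀ w ∈ W ×ˢ Q, B w ^ 2 ≡ 8748 * d [ZMOD (a w.1 * (w.2 : ℤ) ^ 3)] := fun w hw =>
          (Int.modEq_and_modEq_iff_modEq_mul (Int.isCoprime_iff_gcd_eq_one.1
            (haq _ (Finset.mem_product.1 hw).1 _ (Finset.mem_product.1 hw).2))).1 ⟨hBa w hw, hBq w hw⟩
        refine rootSymbol_eq_of_collision (hrep i) (mul_ne_zero (hab _ hf).1 (pow_ne_zero _ (hq0 _ hq)))
          (mul_ne_zero (hab _ hf').1 (pow_ne_zero _ (hq0 _ hq'))) (u := u) (v := v) ?_ ?_ ?_ ?_ ?_ ?_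
          <;> push_cast
        · exact hc
        · exact (han _ hf i).mul_left (hqn _ hq i)
        · exact (han _ hf' i).mul_left (hqn _ hq' i)
        · exact (haa.mul_right (haq _ hf _ hq')).mul_left ((haq _ hf' _ hq).symm.mul_right hqq')
        · exact hB2 z hz
        · exact hB2 z' hz'
  have hcard := sq_card_le_card_mul (W ×ˢ Q) (reducedLabels (8748 * d)) l hl
  set S := Q.offDiag.filter (fun z => CubeSol 1 (-8748) d (z.1 * z.2)) with hS
  have hle : (((W ×ˢ Q) ×ˢ (W ×ˢ Q)).filter (fun z => l z.1 = l z.2)).card ≤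
      (W ×ˢ (Q.diag ∪ S)).card := by
    refine Finset.card_le_card_of_injOn (fun z => (z.1.1, (z.1.2, z.2.2))) ?_ ?_
    · intro z hz
      obtain ⟨hz, hll⟩ := Finset.mem_filter.1 hz
      obtain ⟨hz1, hz2⟩ := Finset.mem_product.1 hz
      have hq1 := (Finset.mem_product.1 hz1).2
      have hq2 := (Finset.mem_product.1 hz2).2
      refine Finset.mem_coe.2 (Finset.mem_product.2 ⟨(Finset.mem_product.1 hz1).1, Finset.mem_union.2 ?_⟩)
      by_cases hqq : z.1.2 = z.2.2
      · exact Or.inl (Finset.mem_diag.2 ⟨hq1, hqq⟩)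
      · exact Or.inr (Finset.mem_filter.2 ⟨Finset.mem_offDiag.2 ⟨hq1, hq2, hqq⟩,
          (hpair _ hz1 _ hz2 hll).2 hqq⟩)
    · intro z hz w hw hzw
      have key : ∀ z ∈ ((W ×ˢ Q) ×ˢ (W ×ˢ Q)).filter (fun z => l z.1 = l z.2), z.1.1 = z.2.1 := by
        intro z hz
        obtain ⟨hz, hll⟩ := Finset.mem_filter.1 hz
        obtain ⟨hz1, hz2⟩ := Finset.mem_product.1 hz
        exact (hpair _ hz1 _ hz2 hll).1
      have h1 := key z hz
      have h2 := key w hw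
      simp only [Prod.mk.injEq] at hzw
      exact Prod.ext (Prod.ext hzw.1 hzw.2.1) (Prod.ext (by rw [← h1, ← h2, hzw.1]) hzw.2.2)
  have hS2 : (W ×ˢ (Q.diag ∪ S)).card ≤ W.card * (Q.card + S.card) := by
    rw [Finset.card_product]
    refine Nat.mul_le_mul_left _ ((Finset.card_union_le _ _).trans ?_)
    rw [Finset.diag_card]
  refine le_of_mul_le_mul_left ?_ (Finset.card_pos.2 hW0)
  calc W.card * (W.card * Q.card ^ 2) = (W ×ˢ Q).card ^ 2 := by rw [Finset.card_product]; ring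
    _ ≤ _ := hcard
    _ ≤ (reducedLabels (8748 * d)).card * (W.card * (Q.card + S.card)) :=
      Nat.mul_le_mul_left _ (hle.trans hS2)
    _ = _ := by ring

end Eisenstein

lemma Int.card_le_two_mul_card_divisors {D : ℤ} (hD : D ≠ 0) (s : Finset ℤ) (hs : ∀ c ∈ s, c ∣ D) :
    s.card ≤ 2 * D.natAbs.divisors.card := by
  classical
  have h : s ⊆ D.natAbs.divisors.image (fun m : ℕ => (m : ℤ)) ∪
      D.natAbs.divisors.image (fun m : ℕ => -(m : ℤ)) := by
    intro c hc
    have h1 : c.natAbs ∈ D.natAbs.divisors :=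
      Nat.mem_divisors.2 ⟨Int.natAbs_dvd_natAbs.2 (hs c hc), Int.natAbs_ne_zero.2 hD⟩
    rw [Finset.mem_union, Finset.mem_image, Finset.mem_image]
    exact (Int.natAbs_eq c).imp (fun h => ⟨_, h1, h.symm⟩) (fun h => ⟨_, h1, h.symm⟩)
  refine (Finset.card_le_card h).trans ((Finset.card_union_le _ _).trans ?_)
  rw [two_mul]
  exact add_le_add Finset.card_image_le Finset.card_image_le

theorem exists_card_reducedLabels_le {ε : ℝ} (hε : 0 < ε) : ∃ C : ℝ, 0 < C ∧ ∀ E : ℕ,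
    ¬ IsSquare (E : ℤ) → ((reducedLabels E).card : ℝ) ≤ C * (9 * E : ℝ) ^ (1 / 2 + ε) := by
  classical
  obtain ⟨C, hC1, hC⟩ := exists_card_divisors_le (half_pos hε)
  have hC0 : 0 < C := by linarith
  refine ⟨4 * C ^ 2, by positivity, fun E hsq => ?_⟩
  have hE0 : E ≠ 0 := by rintro rfl; exact hsq ⟨0, rfl⟩
  set N := 9 * E with hN
  have hN0 : N ≠ 0 := by omega
  set m := Nat.sqrt N with hm
  set L := Nat.log 4 N with hL
  set t := ⌊C * (N : ℝ) ^ (ε / 2)⌋₊ with ht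
  have hτ : ∀ k, k ≠ 0 → k ≤ N → k.divisors.card ≤ t := fun k hk hkN =>
    Nat.le_floor ((hC k hk).trans (by gcongr))
  have hmem : ∀ z ∈ reducedLabels E, z.2 ∈ Finset.Icc (0 : ℤ) m ×ˢ Finset.range (L + 1) ∧
      z.1 ∣ z.2.1 ^ 2 - E ∧ (z.2.1 ^ 2 - E).natAbs ≤ N := by
    intro z hz
    simp only [reducedLabels, Finset.mem_filter, Finset.mem_product, Finset.mem_Icc] at hz
    obtain ⟨⟨-, ⟨hr0, -⟩, -⟩, -, hcE, hrc, hk, hdvd⟩ := hz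
    have hr2 : z.2.1 ^ 2 ≤ N := by
      rw [← sq_abs] at hcE
      rw [hN]; push_cast; nlinarith
    refine ⟨Finset.mem_product.2 ⟨Finset.mem_Icc.2 ⟨hr0, ?_⟩, Finset.mem_range.2 ?_⟩, hdvd, ?_⟩
    · lift z.2.1 to ℕ using hr0 with r
      exact_mod_cast Nat.le_sqrt'.2 (by exact_mod_cast hr2)
    · exact Nat.lt_succ_of_le (Nat.le_log_of_pow_le (by norm_num) (by rw [hN]; exact_mod_cast hk))
    · have : (0 : ℤ) ≤ z.2.1 ^ 2 := by positivity
      omega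
  have h1 : (reducedLabels E).card ≤ 2 * t * ((reducedLabels E).image Prod.snd).card := by
    refine Finset.card_le_mul_card_image _ _ fun y hy => ?_
    obtain ⟨w, hw, rfl⟩ := Finset.mem_image.1 hy
    have hD : w.2.1 ^ 2 - (E : ℤ) ≠ 0 := fun h => hsq ⟨w.2.1, by linear_combination -h⟩
    have h2 : ((reducedLabels E).filter (fun z => z.2 = w.2)).card ≤
        (((reducedLabels E).filter (fun z => z.2 = w.2)).image Prod.fst).card := by
      rw [Finset.card_image_of_injOn]
      intro z hz z' hz' h
      exact Prod.ext h ((Finset.mem_filter.1 hz).2.trans (Finset.mem_filter.1 hz').2.symm)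
    refine h2.trans ((Int.card_le_two_mul_card_divisors hD _ ?_).trans
      (Nat.mul_le_mul_left _ (hτ _ (Int.natAbs_ne_zero.2 hD) (hmem w hw).2.2)))
    intro c hc
    obtain ⟨z, hz, rfl⟩ := Finset.mem_image.1 hc
    obtain ⟨hz, hzw⟩ := Finset.mem_filter.1 hz
    rw [← hzw]
    exact (hmem z hz).2.1
  have h3 : ((reducedLabels E).image Prod.snd).card ≤ (m + 1) * (L + 1) := by
    have : (reducedLabels E).image Prod.snd ⊆ Finset.Icc (0 : ℤ) m ×ˢ Finset.range (L + 1) := by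
      intro y hy
      obtain ⟨w, hw, rfl⟩ := Finset.mem_image.1 hy
      exact (hmem w hw).1
    refine (Finset.card_le_card this).trans (le_of_eq ?_)
    rw [Finset.card_product, Int.card_Icc, Finset.card_range]
    congr 1
  have hNR : (0 : ℝ) < N := by exact_mod_cast Nat.pos_of_ne_zero hN0
  have hm1 : ((m + 1 : ℕ) : ℝ) ≤ 2 * √(N : ℝ) := by
    have h4 : 1 ≤ m := Nat.le_sqrt'.2 (by omega)
    have h5 : (m : ℝ) ≤ √(N : ℝ) := Real.le_sqrt_of_sq_le (by exact_mod_cast Nat.sqrt_le' N)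
    have h6 : (1 : ℝ) ≤ m := by exact_mod_cast h4
    push_cast; linarith
  have ht1 : (t : ℝ) ≤ C * (N : ℝ) ^ (ε / 2) := Nat.floor_le (by positivity)
  have hL1 : ((L + 1 : ℕ) : ℝ) ≤ C * (N : ℝ) ^ (ε / 2) := by
    refine le_trans ?_ ht1
    have h7 := hτ (4 ^ L) (by positivity) (Nat.pow_log_le_self 4 hN0)
    rw [show 4 ^ L = 2 ^ (2 * L) by rw [pow_mul]; norm_num, Nat.divisors_prime_pow Nat.prime_two,
      Finset.card_map, Finset.card_range] at h7
    exact_mod_cast (by omega : L + 1 ≤ t)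
  calc ((reducedLabels E).card : ℝ) ≤ ((2 * t * ((m + 1) * (L + 1)) : ℕ) : ℝ) := by
        exact_mod_cast h1.trans (Nat.mul_le_mul_left _ h3)
    _ = 2 * t * (((m + 1 : ℕ) : ℝ) * ((L + 1 : ℕ) : ℝ)) := by push_cast; ring
    _ ≤ 2 * (C * (N : ℝ) ^ (ε / 2)) * (2 * √(N : ℝ) * (C * (N : ℝ) ^ (ε / 2))) := by gcongr
    _ = 4 * C ^ 2 * (N : ℝ) ^ (1 / 2 + ε) := by
        rw [show 1 / 2 + ε = 1 / 2 + ε / 2 + ε / 2 by ring, Real.rpow_add hNR, Real.rpow_add hNR,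
          Real.sqrt_eq_rpow]
        ring
    _ = _ := by rw [hN]; push_cast; rfl

lemma not_isSquare_mul_of_squarefree {d : ℕ} (hd : Squarefree d) (h3 : 3 < d) :
    ¬ IsSquare (((8748 * d : ℕ) : ℤ)) := by
  rintro ⟨z, hz⟩
  have h54 : (54 : ℤ) ∣ z := (Int.pow_dvd_pow_iff (n := 2) two_ne_zero).1 ⟨3 * d, by push_cast at hz; linear_combination -hz⟩
  obtain ⟨w, rfl⟩ := h54
  have hw : (3 * d : ℤ) = w ^ 2 := by push_cast at hz; linarith
  have h3w : (3 : ℤ) ∣ w := Int.prime_three.dvd_of_dvd_pow ⟨d, hw.symm⟩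
  obtain ⟨t, rfl⟩ := h3w
  have hd' : (d : ℤ) = 3 * t ^ 2 := by linarith
  have ht : IsUnit t.natAbs := hd _ (by zify; exact ⟨3, by rw [hd', ← sq, sq_abs]; ring⟩)
  rw [Nat.isUnit_iff] at ht
  have : t ^ 2 = 1 := by rw [← Int.natAbs_sq, ht]; rfl
  omega

namespace IsImagQuad

set_option linter.unusedSectionVars false

open Classical in
theorem exists_card_torsion_mul_sq_le {ε : ℝ} (hε : 0 < ε) : ∃ C : ℝ, 0 < C ∧
    ∀ {R : Type} [CommRing R] [IsDedekindDomain R] [CharZero R] [Module.Free ℤ R]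
      [Module.Finite ℤ R] [Finite (ClassGroup R)] {d : ℕ} {s : R} {σ : R ≃+* R},
      IsImagQuad R d s σ → ∀ Q : Finset ℕ,
      (∀ q ∈ Q, q.Prime ∧ ¬ q ∣ 6 * d ∧ ∃ b : ℤ, (q : ℤ) ∣ b ^ 2 - 3 * d) →
      (Nat.card {c : ClassGroup R // c ^ 3 = 1} : ℝ) * (Q.card : ℝ) ^ 2 ≤ C * (d : ℝ) ^ (1 / 2 + ε) *
        (Q.card + (Q.offDiag.filter (fun x => CubeSol 1 (-8748) d (x.1 * x.2))).card) := by
  obtain ⟨C, hC0, hC⟩ := exists_card_reducedLabels_le hε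
  refine ⟨C * 78732 ^ (1 / 2 + ε), by positivity, ?_⟩
  intro R _ _ _ _ _ _ d s σ h Q hQ
  have hd0 : 0 < d := by have := h.three_lt; omega
  have hsq := not_isSquare_mul_of_squarefree h.squarefree h.three_lt
  have hP0 : ∏ q ∈ Q, q ≠ 0 := Finset.prod_ne_zero_iff.2 fun q hq => (hQ q hq).1.ne_zero
  obtain ⟨e, x, y, n, hrep, hcard⟩ := h.exists_torsion_coords (M := 6 * d * ∏ q ∈ Q, q)
    (mul_ne_zero (by omega) hP0) (Dvd.intro _ rfl)
  set W := (Set.toFinite (Eisenstein.symbolVectors (d : ℤ) x y)).toFinset with hW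
  have hWcard : Nat.card {c : ClassGroup R // c ^ 3 = 1} ≤ W.card := by
    rwa [Set.ncard_eq_toFinset_card _ (Set.toFinite _)] at hcard
  have hcop : ∀ i, ∀ z : ℕ, z ∣ 6 * d * ∏ q ∈ Q, q → IsCoprime (n i : ℤ) z := fun i z hz =>
    (hrep i).2.2.2.2.2.1.of_isCoprime_of_dvd_right (by exact_mod_cast hz)
  have key := Eisenstein.card_mul_sq_le_card_reducedLabels_mul hd0 (by exact_mod_cast hsq)
    (e := e) (x := x) (y := y) (n := n) (fun i => (hrep i).2.2.2.2.2.2) (fun i => by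
      obtain ⟨h1, h2, h3, h4, h5, h6, h7⟩ := hrep i
      exact ⟨h1, h2, h3, h4, h5, by exact_mod_cast hcop i (6 * d) (Dvd.intro _ rfl)⟩) Q hQ
    (fun i q hq => (hcop i q ((Finset.dvd_prod_of_mem _ hq).mul_left _)).symm) W
    (fun f hf => (Set.Finite.mem_toFinset _).1 hf)
  set S := Q.offDiag.filter (fun x => CubeSol 1 (-8748) d (x.1 * x.2)) with hS
  have hlab := hC (8748 * d) hsq
  push_cast at hlab
  calc (Nat.card {c : ClassGroup R // c ^ 3 = 1} : ℝ) * (Q.card : ℝ) ^ 2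
      ≤ (W.card : ℝ) * (Q.card : ℝ) ^ 2 := by gcongr
    _ ≤ ((reducedLabels (8748 * d)).card : ℝ) * (Q.card + S.card) := by exact_mod_cast key
    _ ≤ C * (9 * (8748 * d) : ℝ) ^ (1 / 2 + ε) * (Q.card + S.card) := by gcongr
    _ = _ := by
      rw [show (9 * (8748 * d) : ℝ) = 78732 * d by ring, Real.mul_rpow (by norm_num) (by positivity)]
      ring

end IsImagQuad

open Classical in
theorem exists_hneg_three_mul_sq_le {ε : ℝ} (hε : 0 < ε) : ∃ C : ℝ, 0 < C ∧ ∀ d P : ℕ, Squarefree d →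
    3 < d → 2 ≤ P → P ≤ d →
      (hneg 3 d : ℝ) * P ^ 2 ≤ C * (d : ℝ) ^ (1 / 2 + ε) * (P + solCount d (P ^ 2)) := by
  refine exists_mul_sq_le_solCount (h := fun d => (hneg 3 d : ℝ)) (fun d => Nat.cast_nonneg _)
    (fun ε hε => ?_) (fun ε hε => ?_) (fun ε hε => ?_) hε
  · obtain ⟨C, hC, H⟩ := exists_card_classGroup_le hε
    refine ⟨C, hC, fun d hd h3 => ?_⟩
    have := numberField_Kneg (d := d) (by omega)
    obtain ⟨s, σ, h⟩ := exists_isImagQuad_Kneg hd h3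
    refine le_trans ?_ (H h)
    exact_mod_cast Nat.card_le_card_of_injective _ Subtype.val_injective
  · obtain ⟨C, hC, H⟩ := exists_card_classGroup_le hε
    refine ⟨C, hC, fun d Q hd h3 hQ => ?_⟩
    have := numberField_Kneg (d := d) (by omega)
    obtain ⟨s, σ, h⟩ := exists_isImagQuad_Kneg hd h3
    have key := h.card_torsion_mul_sq_le_card_filter Q
      (fun q hq => ⟨(hQ q hq).1, (hQ q hq).2.1, (hQ q hq).2.2.2⟩)
    have key' : (hneg 3 d : ℝ) * (Q.card : ℝ) ^ 2 ≤
        Nat.card (ClassGroup (NumberField.RingOfIntegers (Kneg d))) * (Q.card + (Q.offDiag.filter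
          (fun x => CubeSol 1 1 d (x.1 * x.2) ∨ CubeSol 4 1 d (x.1 * x.2))).card) := by
      exact_mod_cast key
    exact key'.trans (by gcongr; exact H h)
  · obtain ⟨C, hC, H⟩ := IsImagQuad.exists_card_torsion_mul_sq_le hε
    refine ⟨C, hC, fun d Q hd h3 hQ => ?_⟩
    have := numberField_Kneg (d := d) (by omega)
    obtain ⟨s, σ, h⟩ := exists_isImagQuad_Kneg hd h3
    exact H h Q (fun q hq => ⟨(hQ q hq).1, (hQ q hq).2.1, (hQ q hq).2.2.2⟩)

/-- For every real `k ≥ 4` and every `ε > 0` there is `C = C(k, ε)` such that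
for all `X ≥ 2`,
`∑_{0 < d < X, d squarefree} h_3(-d)^k ≤ C · X^((2k+3)/6 + ε)`. -/
theorem kth_moment_h3_bound_high (k : ℝ) (hk : 4 ≤ k) (ε : ℝ) (hε : 0 < ε) :
    ∃ C : ℝ, 0 < C ∧ ∀ X : ℝ, 2 ≤ X →
      ∑ d ∈ (Finset.range (⌈X⌉₊ + 1)).filter
          (fun d : ℕ => Squarefree d ∧ 0 < d ∧ (d : ℝ) < X),
        (hneg 3 d : ℝ) ^ k
      ≤ C * X ^ ((2 * k + 3) / 6 + ε) := by
  have key := exists_moment_le (h := fun d => (hneg 3 d : ℝ)) (fun d => Nat.cast_nonneg _)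
    (fun ε hε => exists_hneg_three_mul_sq_le hε) hk hε
  convert key
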